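/- Quantitative free subgroup theorem (Theorem 1.1(ii)): For all real P0, r0, δ > 0 there exists a positive integer N, depending only on P0, r0 and δ, with the following property. Let (X,σ) be any δ-hyperbolic GCB-space which is P0-packed at scale r0, and let a, b be σ-isometries of X such that the subgroup ⟨a,b⟩ generated by a and b is discrete, non-elementary and torsion-free. Then there exists an element w of ⟨a,b⟩ expressible as a product of at most N elements of {a, a⁻¹, b, b⁻¹}, such that the group homomorphism from the free group on two generators to the isometry group of X sending the two generators to a^N and w respectively is injective (i.e. the subgroup generated by a^N and w is free of rank 2). -/

import Mathlib

open Metric Filter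

/-- Four-points condition for `δ`-hyperbolicity. -/
def IsDeltaHyperbolic (X : Type*) [MetricSpace X] (δ : ℝ) : Prop :=
  ∀ x y z w : X,
    dist x y + dist z w ≤ max (dist x z + dist y w) (dist x w + dist y z) + 2 * δ

/-- `X` is `P₀`-packed at scale `r₀`: any subset of a closed ball of radius `3r₀` whose
points are pairwise at distance `> 2r₀` has cardinality at most `P₀`. -/
def IsPacked (X : Type*) [MetricSpace X] (P₀ r₀ : ℝ) : Prop :=
  ∀ x : X, ∀ S : Finset X, (↑S ⊆ closedBall x (3 * r₀)) →
    (∀ a ∈ S, ∀ b ∈ S, a ≠ b → 2 * r₀ < dist a b) → (S.card : ℝ) ≤ P₀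

/-- A geodesically complete, convex, consistent, reversible geodesic bicombing on `X`.
Together with completeness of `X` this is the notion of GCB-space. -/
structure IsGCB {X : Type*} [MetricSpace X] (σ : X → X → ℝ → X) : Prop where
  source : ∀ x y : X, σ x y 0 = x
  target : ∀ x y : X, σ x y 1 = y
  geodesic : ∀ x y : X, ∀ t ∈ Set.Icc (0:ℝ) 1, ∀ t' ∈ Set.Icc (0:ℝ) 1,
    dist (σ x y t) (σ x y t') = |t - t'| * dist x y
  convex : ∀ x y x' y' : X,
    ConvexOn ℝ (Set.Icc (0:ℝ) 1) fun t => dist (σ x y t) (σ x' y' t)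
  consistent : ∀ x y : X, ∀ s t l : ℝ, 0 ≤ s → s ≤ t → t ≤ 1 → l ∈ Set.Icc (0:ℝ) 1 →
    σ (σ x y s) (σ x y t) l = σ x y ((1 - l) * s + l * t)
  reversible : ∀ x y : X, ∀ t ∈ Set.Icc (0:ℝ) 1, σ x y t = σ y x (1 - t)
  geodComplete : ∀ x y : X, ∃ γ : ℝ → X, Isometry γ ∧
    (∀ s t : ℝ, s ≤ t → ∀ l ∈ Set.Icc (0:ℝ) 1, σ (γ s) (γ t) l = γ (s + l * (t - s))) ∧
    (∀ t ∈ Set.Icc (0:ℝ) 1, σ x y t = γ (t * dist x y))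

/-- `g` is a `σ`-isometry: a surjective isometry preserving the bicombing `σ`. -/
def IsSigmaIsometry {X : Type*} [MetricSpace X] (σ : X → X → ℝ → X) (g : X ≃ᵢ X) : Prop :=
  ∀ x y : X, ∀ t ∈ Set.Icc (0:ℝ) 1, g (σ x y t) = σ (g x) (g y) t

/-- A group of isometries is discrete if for every `x` and `R` only finitely many of its
elements displace `x` at most `R`. -/
def IsDiscreteSubgroup {X : Type*} [MetricSpace X] (Γ : Subgroup (X ≃ᵢ X)) : Prop :=
  ∀ x : X, ∀ R : ℝ, {g : X ≃ᵢ X | g ∈ Γ ∧ dist x (g x) ≤ R}.Finite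

/-- A group is virtually nilpotent if it has a nilpotent subgroup of finite index. -/
def IsVirtuallyNilpotent (G : Type*) [Group G] : Prop :=
  ∃ H : Subgroup G, H.FiniteIndex ∧ Group.IsNilpotent H

/-- `Γ` is non-elementary: it contains two elements generating a subgroup that is not
virtually nilpotent. -/
def IsNonElementary {X : Type*} [MetricSpace X] (Γ : Subgroup (X ≃ᵢ X)) : Prop :=
  ∃ a b : X ≃ᵢ X, a ∈ Γ ∧ b ∈ Γ ∧
    ¬ IsVirtuallyNilpotent ↥(Subgroup.closure ({a, b} : Set (X ≃ᵢ X)))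

/-- An isometry is non-elliptic if its orbits are unbounded. -/
def IsNonElliptic {X : Type*} [MetricSpace X] (g : X ≃ᵢ X) : Prop :=
  ∀ x : X, ¬ Bornology.IsBounded (Set.range fun n : ℤ => (g ^ n) x)

/-- The `r`-almost stabilizer `Γ_r(x)`, generated by the elements of `Γ` displacing `x`
at most `r`. -/
def almostStabilizer {X : Type*} [MetricSpace X] (Γ : Subgroup (X ≃ᵢ X)) (r : ℝ) (x : X) :
    Subgroup (X ≃ᵢ X) :=
  Subgroup.closure {g : X ≃ᵢ X | g ∈ Γ ∧ dist x (g x) ≤ r}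

/-- The nilpotence radius of `Γ` at `x`. -/
noncomputable def nilrad {X : Type*} [MetricSpace X] (Γ : Subgroup (X ≃ᵢ X)) (x : X) : ℝ :=
  sSup {r : ℝ | 0 ≤ r ∧ IsVirtuallyNilpotent ↥(almostStabilizer Γ r x)}

/-- The Margulis domain `M_ε(g)`. -/
def margulisDomain {X : Type*} [MetricSpace X] (g : X ≃ᵢ X) (ε : ℝ) : Set X :=
  {x : X | dist x (g x) ≤ ε}

/-- The generalized Margulis domain `ℳ_ε(g) = ⋃_{i ≠ 0} M_ε(gⁱ)`. -/
def genMargulisDomain {X : Type*} [MetricSpace X] (g : X ≃ᵢ X) (ε : ℝ) : Set X :=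
  ⋃ i ∈ {i : ℤ | i ≠ 0}, margulisDomain (g ^ i) ε

/-- `f` parameterizes a geodesic segment from `x` to `y` on `[0, dist x y]`. -/
def IsGeodesicFrom {X : Type*} [MetricSpace X] (f : ℝ → X) (x y : X) : Prop :=
  f 0 = x ∧ f (dist x y) = y ∧
    ∀ s ∈ Set.Icc 0 (dist x y), ∀ t ∈ Set.Icc 0 (dist x y), dist (f s) (f t) = |s - t|

/-- `X` is a geodesic space. -/
def IsGeodesicSpace (X : Type*) [MetricSpace X] : Prop :=
  ∀ x y : X, ∃ f : ℝ → X, IsGeodesicFrom f x y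

/-- `C` is `lam`-quasiconvex: any two of its points are joined by a geodesic contained in
the closed `lam`-neighbourhood of `C`. -/
def IsQuasiconvex {X : Type*} [MetricSpace X] (lam : ℝ) (C : Set X) : Prop :=
  ∀ x ∈ C, ∀ y ∈ C, ∃ f : ℝ → X, IsGeodesicFrom f x y ∧
    ∀ t ∈ Set.Icc 0 (dist x y), infDist (f t) C ≤ lam

/-- `C` is a convex subset: any two of its points are joined by a geodesic inside `C`. -/
def IsConvexSubset {X : Type*} [MetricSpace X] (C : Set X) : Prop :=
  ∀ x ∈ C, ∀ y ∈ C, ∃ f : ℝ → X, IsGeodesicFrom f x y ∧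
    ∀ t ∈ Set.Icc 0 (dist x y), f t ∈ C

/-- Arc-length concatenation of three paths, of respective lengths `d₁`, `d₂` and the rest. -/
noncomputable def concatPath {X : Type*} (d₁ d₂ : ℝ) (f₁ f₂ f₃ : ℝ → X) : ℝ → X :=
  fun t => if t ≤ d₁ then f₁ t else if t ≤ d₁ + d₂ then f₂ (t - d₁) else f₃ (t - d₁ - d₂)

section GroupBasics
open scoped Classical Pointwise commutatorElement

lemma IsVirtuallyNilpotent.of_injective {G G' : Type*} [Group G] [Group G'] (f : G →* G')
    (hf : Function.Injective f) (h : IsVirtuallyNilpotent G') : IsVirtuallyNilpotent G := by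
  obtain ⟨H, hH, hn⟩ := h
  have hfi : (H.comap f).FiniteIndex := ⟨by
    rw [Subgroup.index_comap]; exact (inferInstance : (H.subgroupOf f.range).FiniteIndex).index_ne_zero⟩
  refine ⟨H.comap f, hfi, ?_⟩
  let φ : H.comap f →* H := (f.comp (H.comap f).subtype).codRestrict H fun x => x.2
  refine Subgroup.isNilpotent_of_ker_le_center φ ?_
  have : φ.ker = ⊥ := by
    rw [MonoidHom.ker_eq_bot_iff]
    intro x y hxy
    exact Subtype.ext (hf (congrArg Subtype.val hxy))
  rw [this]; exact bot_le

lemma IsVirtuallyNilpotent.of_finiteIndex {G : Type*} [Group G] (H : Subgroup G)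
    [hi : H.FiniteIndex] (h : IsVirtuallyNilpotent H) : IsVirtuallyNilpotent G := by
  obtain ⟨K, hK, hn⟩ := h
  refine ⟨K.map H.subtype, ⟨?_⟩, ?_⟩
  · have := K.index_map H.subtype
    rw [this]
    simp [hK.index_ne_zero, hi.index_ne_zero]
  · exact Group.nilpotent_of_surjective (H.subtype.subgroupMap K)
      (H.subtype.subgroupMap_surjective K)

lemma IsVirtuallyNilpotent.mono {G : Type*} [Group G] {H K : Subgroup G} (hHK : H ≤ K)
    (h : IsVirtuallyNilpotent K) : IsVirtuallyNilpotent H :=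
  h.of_injective (Subgroup.inclusion hHK) (Subgroup.inclusion_injective hHK)

lemma IsVirtuallyNilpotent.of_finite (G : Type*) [Group G] [Finite G] :
    IsVirtuallyNilpotent G :=
  ⟨⊥, inferInstance, inferInstance⟩

lemma IsVirtuallyNilpotent.of_ker_le_center {G G' : Type*} [Group G] [Group G'] (f : G →* G')
    (hf : f.ker ≤ Subgroup.center G) (h : IsVirtuallyNilpotent G') : IsVirtuallyNilpotent G := by
  obtain ⟨H, hH, hn⟩ := h
  have hfi : (H.comap f).FiniteIndex := ⟨by
    rw [Subgroup.index_comap]; exact (inferInstance : (H.subgroupOf f.range).FiniteIndex).index_ne_zero⟩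
  refine ⟨H.comap f, hfi, ?_⟩
  let φ : H.comap f →* H := (f.comp (H.comap f).subtype).codRestrict H fun x => x.2
  refine Subgroup.isNilpotent_of_ker_le_center φ ?_
  intro x hx
  have hx' : (x : G) ∈ Subgroup.center G := hf (congrArg Subtype.val hx)
  rw [Subgroup.mem_center_iff] at hx' ⊢
  intro g
  exact Subtype.ext (hx' g)

/-- Left-normed iterated commutators of elements of `Y`. -/
def leftCommutators {G : Type*} [Group G] (Y : Set G) : ℕ → Set G
  | 0 => Y
  | n + 1 => {z | ∃ x ∈ leftCommutators Y n, ∃ y ∈ Y, ⁅x, y⁆ = z}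

lemma leftCommutators_image {G G' : Type*} [Group G] [Group G'] (f : G →* G') (Y : Set G) (n : ℕ) :
    leftCommutators (f '' Y) n = f '' leftCommutators Y n := by
  induction n with
  | zero => rfl
  | succ n ih =>
    ext z
    simp only [leftCommutators, ih, Set.mem_image, Set.mem_ofPred_eq]
    constructor
    · rintro ⟨_, ⟨x, hx, rfl⟩, _, ⟨y, hy, rfl⟩, rfl⟩
      exact ⟨_, ⟨x, hx, y, hy, rfl⟩, map_commutatorElement f x y⟩
    · rintro ⟨_, ⟨x, hx, y, hy, rfl⟩, rfl⟩
      exact ⟨_, ⟨x, hx, rfl⟩, _, ⟨y, hy, rfl⟩, (map_commutatorElement f x y).symm⟩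

lemma leftCommutators_finite {G : Type*} [Group G] {Y : Set G} (hY : Y.Finite) (n : ℕ) :
    (leftCommutators Y n).Finite := by
  induction n with
  | zero => exact hY
  | succ n ih =>
    refine ((ih.prod hY).image fun p => ⁅p.1, p.2⁆).subset ?_
    rintro z ⟨x, hx, y, hy, rfl⟩
    exact ⟨(x, y), ⟨hx, hy⟩, rfl⟩

lemma leftCommutators_subset_lowerCentralSeries {G : Type*} [Group G] (Y : Set G) (n : ℕ) :
    leftCommutators Y n ⊆ (⊤ : Subgroup G).lowerCentralSeries n := by
  induction n with
  | zero => intro x _; trivial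
  | succ n ih =>
    rintro z ⟨x, hx, y, hy, rfl⟩
    exact Subgroup.commutator_mem_commutator (ih hx) (Subgroup.mem_top y)

lemma exists_leftCommutators_trivial {G : Type*} [Group G] [h : Group.IsNilpotent G] (Y : Set G) :
    ∃ n, leftCommutators Y n ⊆ {1} := by
  obtain ⟨n, hn⟩ := Subgroup.nilpotent_iff_lowerCentralSeries.1 h
  refine ⟨n, fun x hx => ?_⟩
  have := leftCommutators_subset_lowerCentralSeries Y n hx
  rw [hn] at this
  simpa using this

lemma isNilpotent_of_leftCommutators {G : Type*} [Group G] (Y : Set G)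
    (hY : Subgroup.closure Y = ⊤) (n : ℕ) (h : leftCommutators Y n ⊆ {1}) :
    Group.IsNilpotent G := by
  induction n generalizing G with
  | zero =>
    have : Subsingleton G := by
      have hb : Subgroup.closure Y = ⊥ := (Subgroup.closure_eq_bot_iff).2 h
      rw [hY] at hb
      exact Subgroup.subsingleton_iff.1 (subsingleton_of_bot_eq_top hb.symm)
    infer_instance
  | succ n ih =>
    apply Group.of_quotient_center_nilpotent
    refine ih (QuotientGroup.mk' (Subgroup.center G) '' Y) ?_ ?_
    · rw [← MonoidHom.map_closure, hY, ← MonoidHom.range_eq_map, MonoidHom.range_eq_top]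
      exact QuotientGroup.mk'_surjective _
    · rw [leftCommutators_image]
      rintro _ ⟨x, hx, rfl⟩
      simp only [QuotientGroup.mk'_apply, Set.mem_singleton_iff, QuotientGroup.eq_one_iff]
      have hc : Subgroup.closure Y ≤ Subgroup.centralizer {x} := by
        rw [Subgroup.closure_le]
        intro y hy
        have : ⁅x, y⁆ = 1 := h ⟨x, hx, y, hy, rfl⟩
        rw [commutatorElement_eq_one_iff_mul_comm] at this
        exact Subgroup.mem_centralizer_singleton_iff.2 this.symm
      rw [hY] at hc
      rw [Subgroup.mem_center_iff]
      intro g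
      exact Subgroup.mem_centralizer_singleton_iff.1 (hc (Subgroup.mem_top g))

/-- Every finite subset has growth at most polynomial of degree `d`. -/
def GrowthLE (G : Type*) [Group G] (d : ℕ) : Prop :=
  ∀ T : Finset G, ∃ C : ℕ, ∀ n : ℕ, (T ^ n).card ≤ C * (n + 1) ^ d

lemma GrowthLE.of_injective {G G' : Type*} [Group G] [Group G'] {d : ℕ} (f : G →* G')
    (hf : Function.Injective f) (h : GrowthLE G' d) : GrowthLE G d := by
  intro T
  obtain ⟨C, hC⟩ := h (T.image f)
  refine ⟨C, fun n => ?_⟩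
  rw [← Finset.card_image_of_injective _ hf, Finset.image_pow f T n]
  exact hC n

lemma exists_finset_image_eq {G G' : Type*} {f : G → G'}
    (hf : Function.Surjective f) (T : Finset G') : ∃ S : Finset G, S.image f = T := by
  refine ⟨T.image (Function.surjInv hf), ?_⟩
  rw [Finset.image_image]
  simp [Function.comp_def, Function.surjInv_eq hf]

/-- A finite symmetric generating set containing `1`. -/
structure IsSymmGen {G : Type*} [Group G] (S : Finset G) : Prop where
  one_mem : 1 ∈ S
  inv_mem : ∀ x ∈ S, x⁻¹ ∈ S
  closure_eq : Subgroup.closure (S : Set G) = ⊤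

lemma exists_isSymmGen (G : Type*) [Group G] [h : Group.FG G] : ∃ S : Finset G, IsSymmGen S := by
  obtain ⟨T, hT⟩ := Group.fg_def.1 h
  refine ⟨insert 1 (T ∪ T⁻¹), by simp, ?_, ?_⟩
  · intro x hx
    simp only [Finset.mem_insert, Finset.mem_union, Finset.mem_inv'] at hx ⊢
    simp only [inv_eq_one, inv_inv]
    tauto
  · rw [eq_top_iff, ← hT]
    apply Subgroup.closure_mono
    intro x hx
    simp only [Finset.coe_insert, Finset.coe_union]
    exact Or.inr (Or.inl hx)

lemma exists_mem_pow_of_mem_closure {G : Type*} [Group G] {S : Finset G}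
    (hinv : ∀ x ∈ S, x⁻¹ ∈ S) {g : G} (hg : g ∈ Subgroup.closure (S : Set G)) :
    ∃ n, g ∈ S ^ n := by
  induction hg using Subgroup.closure_induction with
  | mem x hx => exact ⟨1, by simpa using hx⟩
  | one => exact ⟨0, by simp⟩
  | mul x y _ _ hx hy =>
    obtain ⟨n, hn⟩ := hx
    obtain ⟨m, hm⟩ := hy
    exact ⟨n + m, by rw [pow_add]; exact Finset.mul_mem_mul hn hm⟩
  | inv x _ hx =>
    obtain ⟨n, hn⟩ := hx
    refine ⟨n, ?_⟩
    have hS : S⁻¹ = S := by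
      ext x; rw [Finset.mem_inv']
      exact ⟨fun h => by simpa using hinv _ h, hinv x⟩
    rw [← hS, inv_pow, Finset.mem_inv', inv_inv]
    exact hn

lemma IsSymmGen.exists_mem_pow {G : Type*} [Group G] {S : Finset G} (hS : IsSymmGen S) (g : G) :
    ∃ n, g ∈ S ^ n :=
  exists_mem_pow_of_mem_closure hS.inv_mem (hS.closure_eq ▸ Subgroup.mem_top g)

lemma IsSymmGen.exists_subset_pow {G : Type*} [Group G] {S : Finset G} (hS : IsSymmGen S)
    (T : Finset G) : ∃ m, T ⊆ S ^ m := by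
  choose f hf using hS.exists_mem_pow
  refine ⟨T.sup f, fun x hx => ?_⟩
  exact Finset.pow_subset_pow_right hS.one_mem (Finset.le_sup hx) (hf x)

lemma GrowthLE.of_isSymmGen {G : Type*} [Group G] {S : Finset G} (hS : IsSymmGen S) {C d : ℕ}
    (h : ∀ n, (S ^ n).card ≤ C * (n + 1) ^ d) : GrowthLE G d := by
  intro T
  obtain ⟨m, hm⟩ := hS.exists_subset_pow T
  refine ⟨C * (m + 1) ^ d, fun n => ?_⟩
  calc (T ^ n).card ≤ ((S ^ m) ^ n).card := Finset.card_le_card (Finset.pow_subset_pow_left hm)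
    _ = (S ^ (m * n)).card := by rw [pow_mul]
    _ ≤ C * (m * n + 1) ^ d := h _
    _ ≤ C * ((m + 1) * (n + 1)) ^ d := by gcongr; nlinarith
    _ = _ := by rw [mul_pow, mul_assoc]

lemma GrowthLE.of_two_pow {G : Type*} [Group G] {S : Finset G} (hS : IsSymmGen S) {s K : ℕ}
    (h : ∀ k, (S ^ 2 ^ k).card ≤ s * 2 ^ (K * k)) : GrowthLE G K := by
  refine GrowthLE.of_isSymmGen hS (C := s * 2 ^ K) fun n => ?_
  have h1 : n + 1 ≤ 2 ^ (Nat.log 2 (n + 1) + 1) := (Nat.lt_pow_succ_log_self one_lt_two _).le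
  have h2 : 2 ^ Nat.log 2 (n + 1) ≤ n + 1 := Nat.pow_log_le_self 2 (by lia)
  calc (S ^ n).card ≤ (S ^ 2 ^ (Nat.log 2 (n + 1) + 1)).card :=
        Finset.card_le_card (Finset.pow_subset_pow_right hS.one_mem (by lia))
    _ ≤ s * 2 ^ (K * (Nat.log 2 (n + 1) + 1)) := h _
    _ = s * 2 ^ K * (2 ^ Nat.log 2 (n + 1)) ^ K := by rw [← pow_mul]; ring
    _ ≤ _ := by gcongr

lemma GrowthLE.finite_of_zero {G : Type*} [Group G] [Group.FG G] (h : GrowthLE G 0) :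
    Finite G := by
  obtain ⟨S, hS⟩ := exists_isSymmGen G
  obtain ⟨C, hC⟩ := h S
  by_contra hf
  rw [not_finite_iff_infinite] at hf
  obtain ⟨T, hT⟩ := Infinite.exists_subset_card_eq G (C + 1)
  obtain ⟨m, hm⟩ := hS.exists_subset_pow T
  have := Finset.card_le_card hm
  have := hC m
  simp at this
  lia

/-- Quotient by a normal infinite cyclic subgroup decreases the degree of growth. -/
lemma GrowthLE.quotient_of_infinite_order {G Q : Type*} [Group G] [Group Q] {d : ℕ}
    (f : G →* Q) (hf : Function.Surjective f) (z : G) (hz : f z = 1) (hzo : ¬ IsOfFinOrder z)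
    (h : GrowthLE G (d + 1)) : GrowthLE Q d := by
  intro T
  obtain ⟨S, rfl⟩ := exists_finset_image_eq hf T
  obtain ⟨C, hC⟩ := h (S ∪ {1, z})
  refine ⟨C * 2 ^ (d + 1), fun n => ?_⟩
  rw [← Finset.image_pow f S n]
  set B := (S ^ n).image f
  have hB : ∀ b ∈ B, ∃ x ∈ S ^ n, f x = b := fun b hb => by simpa [B] using hb
  choose! r hr hfr using hB
  have key : (B ×ˢ Finset.range (n + 1)).card ≤ ((S ∪ {1, z}) ^ (2 * n)).card := by
    refine Finset.card_le_card_of_injOn (fun p => r p.1 * z ^ p.2) ?_ ?_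
    · rintro ⟨b, j⟩ hp
      simp only [Finset.coe_product, Set.mem_prod, Finset.mem_coe, Finset.mem_range] at hp
      rw [two_mul, pow_add]
      refine Finset.mul_mem_mul (Finset.pow_subset_pow_left Finset.subset_union_left (hr b hp.1)) ?_
      refine Finset.pow_subset_pow_right (m := j) (by simp) (by lia) ?_
      exact Finset.pow_mem_pow (by simp)
    · rintro ⟨b, j⟩ hp ⟨b', j'⟩ hp' heq
      simp only [Finset.coe_product, Set.mem_prod, Finset.mem_coe, Finset.mem_range] at hp hp' heq
      have hb : b = b' := by
        have := congrArg f heq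
        simpa [hz, hfr b hp.1, hfr b' hp'.1] using this
      subst hb
      have : z ^ j = z ^ j' := mul_left_cancel heq
      rw [(injective_pow_iff_not_isOfFinOrder.2 hzo) this]
  rw [Finset.card_product, Finset.card_range] at key
  have h3 := key.trans (hC (2 * n))
  have h4 : C * (2 * n + 1) ^ (d + 1) ≤ C * 2 ^ (d + 1) * (n + 1) ^ d * (n + 1) := by
    calc C * (2 * n + 1) ^ (d + 1) ≤ C * (2 * (n + 1)) ^ (d + 1) := by gcongr; lia
      _ = _ := by rw [mul_pow]; ring
  exact Nat.le_of_mul_le_mul_right (h3.trans h4) (Nat.succ_pos n)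

/-- The kernel of a homomorphism onto `ℤ` has a smaller degree of growth. -/
lemma GrowthLE.ker_of_infinite_order {G Q : Type*} [Group G] [Group Q] {d : ℕ}
    (f : G →* Q) (t : G) (ht : ¬ IsOfFinOrder (f t))
    (h : GrowthLE G (d + 1)) : GrowthLE f.ker d := by
  intro T
  obtain ⟨C, hC⟩ := h (T.image f.ker.subtype ∪ {1, t})
  refine ⟨C * 2 ^ (d + 1), fun n => ?_⟩
  set S := T.image f.ker.subtype
  have key : ((T ^ n) ×ˢ Finset.range (n + 1)).card ≤ ((S ∪ {1, t}) ^ (2 * n)).card := by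
    refine Finset.card_le_card_of_injOn (fun p => (p.1 : G) * t ^ p.2) ?_ ?_
    · rintro ⟨b, j⟩ hp
      simp only [Finset.coe_product, Set.mem_prod, Finset.mem_coe, Finset.mem_range] at hp
      rw [two_mul, pow_add]
      refine Finset.mul_mem_mul (Finset.pow_subset_pow_left Finset.subset_union_left ?_) ?_
      · simp only [S]
        rw [← Finset.image_pow]
        exact Finset.mem_image_of_mem _ hp.1
      refine Finset.pow_subset_pow_right (m := j) (by simp) (by lia) ?_
      exact Finset.pow_mem_pow (by simp)
    · rintro ⟨b, j⟩ hp ⟨b', j'⟩ hp' heq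
      have hb : j = j' := by
        have := congrArg f heq
        have h1 : f b = 1 := b.2
        have h2 : f b' = 1 := b'.2
        simp only [map_mul, h1, h2, one_mul, map_pow] at this
        exact injective_pow_iff_not_isOfFinOrder.2 ht this
      subst hb
      have : (b : G) = b' := mul_right_cancel heq
      rw [Subtype.ext this]
  rw [Finset.card_product, Finset.card_range] at key
  have h3 := key.trans (hC (2 * n))
  have h4 : C * (2 * n + 1) ^ (d + 1) ≤ C * 2 ^ (d + 1) * (n + 1) ^ d * (n + 1) := by
    calc C * (2 * n + 1) ^ (d + 1) ≤ C * (2 * (n + 1)) ^ (d + 1) := by gcongr; lia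
      _ = _ := by rw [mul_pow]; ring
  refine Nat.le_of_mul_le_mul_right (le_trans (le_of_eq ?_) (h3.trans h4)) (Nat.succ_pos n)
  congr!

end GroupBasics

section HarmonicExistence
open scoped Classical Pointwise Topology
open Filter

/-- Limit along an ultrafilter of a real sequence. -/
noncomputable def ulim {α : Type*} (ω : Ultrafilter α) (u : α → ℝ) : ℝ := limUnder (ω : Filter α) u

lemma tendsto_ulim {α : Type*} (ω : Ultrafilter α) (u : α → ℝ) (C : ℝ) (h : ∀ᶠ n in ω, |u n| ≤ C) :
    Tendsto u ω (𝓝 (ulim ω u)) := by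
  refine tendsto_nhds_limUnder ?_
  obtain ⟨x, -, hx⟩ := (isCompact_Icc (a := -C) (b := C)).ultrafilter_le_nhds (ω.map u) (by
    rw [le_principal_iff, Ultrafilter.coe_map, mem_map]
    filter_upwards [h] with n hn using abs_le.1 hn)
  exact ⟨x, hx⟩

/-- The average of a function on a finite type. -/
noncomputable def avg {ι : Type*} [Fintype ι] (F : ι → ℝ) : ℝ := (Fintype.card ι : ℝ)⁻¹ * ∑ i, F i

section avg
variable {ι κ : Type*} [Fintype ι] [Fintype κ]

lemma avg_const [Nonempty ι] (c : ℝ) : avg (fun _ : ι => c) = c := by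
  simp [avg]

lemma avg_add (F F' : ι → ℝ) : avg (fun i => F i + F' i) = avg F + avg F' := by
  simp [avg, Finset.sum_add_distrib, mul_add]

lemma avg_sub (F F' : ι → ℝ) : avg (fun i => F i - F' i) = avg F - avg F' := by
  simp [avg, Finset.sum_sub_distrib, mul_sub]

lemma avg_mul_left (c : ℝ) (F : ι → ℝ) : avg (fun i => c * F i) = c * avg F := by
  simp only [avg, ← Finset.mul_sum]; ring

lemma avg_mul_right (c : ℝ) (F : ι → ℝ) : avg (fun i => F i * c) = avg F * c := by
  simp only [avg, ← Finset.sum_mul]; ring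

lemma avg_sum {α : Type*} (B : Finset α) (F : α → ι → ℝ) :
    avg (fun i => ∑ b ∈ B, F b i) = ∑ b ∈ B, avg (F b) := by
  simp only [avg]
  rw [Finset.sum_comm, Finset.mul_sum]

lemma avg_mono {F F' : ι → ℝ} (h : ∀ i, F i ≤ F' i) : avg F ≤ avg F' := by
  unfold avg; gcongr; exact h _

lemma avg_nonneg {F : ι → ℝ} (h : ∀ i, 0 ≤ F i) : 0 ≤ avg F :=
  mul_nonneg (by positivity) (Finset.sum_nonneg fun i _ => h i)

lemma le_card_mul_avg {F : ι → ℝ} (h : ∀ i, 0 ≤ F i) (i : ι) : F i ≤ Fintype.card ι * avg F := by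
  have : Nonempty ι := ⟨i⟩
  have : (Fintype.card ι : ℝ) ≠ 0 := by simp
  rw [avg, mul_inv_cancel_left₀ this]
  exact Finset.single_le_sum (fun i _ => h i) (Finset.mem_univ i)

lemma exists_avg_le [Nonempty ι] (F : ι → ℝ) : ∃ i, avg F ≤ F i := by
  by_contra! h
  have h2 : ∑ i, F i < ∑ _i : ι, avg F := Finset.sum_lt_sum_of_nonempty Finset.univ_nonempty
    fun i _ => h i
  simp only [avg, Finset.sum_const, Finset.card_univ, nsmul_eq_mul] at h2
  have : (Fintype.card ι : ℝ) ≠ 0 := by simp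
  rw [mul_inv_cancel_left₀ this] at h2
  exact lt_irrefl _ h2

lemma avg_prod (F : ι × κ → ℝ) : avg F = avg fun i => avg fun k => F (i, k) := by
  simp only [avg, Fintype.card_prod, Fintype.sum_prod_type, Nat.cast_mul, mul_inv, Finset.mul_sum]
  simp [mul_assoc]

lemma avg_comm (F : ι → κ → ℝ) : (avg fun i => avg fun k => F i k) =
    avg fun k => avg fun i => F i k := by
  simp only [avg, Finset.mul_sum]
  rw [Finset.sum_comm]
  simp [mul_left_comm]

lemma avg_equiv (e : ι ≃ κ) (F : κ → ℝ) : avg (fun i => F (e i)) = avg F := by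
  simp only [avg, Fintype.card_congr e, e.sum_comp]

lemma eq_of_avg_eq_of_le {F : ι → ℝ} {c : ℝ} (h : ∀ i, F i ≤ c) (ha : avg F = c) (i : ι) :
    F i = c := by
  have : Nonempty ι := ⟨i⟩
  have h1 : avg (fun i => c - F i) = 0 := by rw [avg_sub, avg_const, ha, sub_self]
  have := le_card_mul_avg (F := fun i => c - F i) (fun i => sub_nonneg.2 (h i)) i
  rw [h1, mul_zero] at this
  linarith [h i]

lemma tendsto_avg {α : Type*} {l : Filter α} {F : α → ι → ℝ} {G : ι → ℝ}
    (h : ∀ i, Tendsto (fun a => F a i) l (𝓝 (G i))) :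
    Tendsto (fun a => avg (F a)) l (𝓝 (avg G)) :=
  (tendsto_finsetSum _ fun i _ => h i).const_mul _

end avg

/-- The Markov operator of right multiplication by a uniformly chosen element of a family. -/
noncomputable def markov {G ι : Type*} [Group G] [Fintype ι] (s : ι → G) (f : G → ℝ) : G → ℝ :=
  fun x => avg fun i => f (x * s i)

/-- The family of products of two elements of `S`. -/
def pairMul {G : Type*} [Group G] (S : Finset G) : ↥S × ↥S → G := fun p => p.1 * p.2

lemma IsSymmGen.induction {G : Type*} [Group G] {S : Finset G} (hS : IsSymmGen S) {p : G → Prop}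
    (h1 : p 1) (hmul : ∀ x, p x → ∀ s ∈ S, p (x * s)) (x : G) : p x := by
  obtain ⟨n, hn⟩ := hS.exists_mem_pow x
  induction n generalizing x with
  | zero => simp at hn; rwa [hn]
  | succ n ih =>
    rw [pow_succ] at hn
    obtain ⟨y, hy, s, hs, rfl⟩ := Finset.mem_mul.1 hn
    exact hmul _ (ih y hy) s hs

lemma IsSymmGen.eq_const {G : Type*} [Group G] {S : Finset G} (hS : IsSymmGen S) {f : G → ℝ}
    (hf : ∀ x, ∀ s ∈ S, f (x * s) = f x) (x : G) : f x = f 1 := by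
  refine hS.induction (p := fun x => f x = f 1) rfl (fun x hx s hs => ?_) x
  rw [hf x s hs, hx]

section ReturnProb
variable {G : Type*} [Group G] (S : Finset G)

/-- The `j`-step transition function of the walk driven by the uniform measure on `S`. -/
noncomputable def heat (j : ℕ) : G → ℝ := (markov (fun i : ↥S => (i : G)))^[j] (Pi.single 1 1)

lemma heat_zero (x : G) : heat S 0 x = if x = 1 then 1 else 0 := by
  simp [heat, Pi.single_apply]

lemma heat_succ (j : ℕ) (x : G) : heat S (j + 1) x = avg fun i : ↥S => heat S j (x * i) := by
  simp only [heat, Function.iterate_succ_apply']; rfl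

variable {S}

/-- Inversion on a symmetric finite set. -/
def IsSymmGen.invEquiv (hS : IsSymmGen S) : ↥S ≃ ↥S where
  toFun i := ⟨(i : G)⁻¹, hS.inv_mem _ i.2⟩
  invFun i := ⟨(i : G)⁻¹, hS.inv_mem _ i.2⟩
  left_inv i := by simp
  right_inv i := by simp

lemma heat_succ' (hS : IsSymmGen S) (j : ℕ) (x : G) :
    heat S (j + 1) x = avg fun i : ↥S => heat S j ((i : G)⁻¹ * x) := by
  induction j generalizing x with
  | zero =>
    rw [heat_succ, ← avg_equiv hS.invEquiv]
    congr 1; ext i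
    simp only [heat_zero, IsSymmGen.invEquiv, Equiv.coe_fn_mk, mul_inv_eq_one, inv_mul_eq_one,
      eq_comm]
  | succ j ih =>
    rw [heat_succ]
    simp only [ih]
    rw [avg_comm]
    congr 1; ext k
    rw [← ih, heat_succ]; simp only [mul_assoc]

/-- Vectors in a Hilbert space whose Gram matrix is given by the transition function. -/
noncomputable def heatVec (S : Finset G) : ℕ → G → lp (fun _ : G => ℝ) 2
  | 0, x => lp.single 2 x 1
  | j + 1, x => (Fintype.card ↥S : ℝ)⁻¹ • ∑ i : ↥S, heatVec S j (x * i)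

lemma inner_heatVec (hS : IsSymmGen S) (i j : ℕ) (x y : G) :
    inner ℝ (heatVec S i x) (heatVec S j y) = heat S (i + j) (x⁻¹ * y) := by
  induction i generalizing x with
  | zero =>
    induction j generalizing y with
    | zero =>
      rw [heat_zero]
      simp only [heatVec, lp.inner_single_left, inv_mul_eq_one]
      by_cases h : x = y
      · subst h; simp
      · simp [h]
    | succ j ih =>
      simp only [heatVec] at ih ⊢
      rw [inner_smul_right, inner_sum, ← Nat.add_assoc, heat_succ]
      simp only [ih, mul_assoc]; rfl
  | succ i ih =>
    rw [heatVec, real_inner_smul_left, sum_inner]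
    simp only [ih]
    rw [show i + 1 + j = i + j + 1 by ring, heat_succ' hS]
    simp only [mul_inv_rev, mul_assoc]; rfl

lemma heat_nonneg (j : ℕ) (x : G) : 0 ≤ heat S j x := by
  induction j generalizing x with
  | zero => rw [heat_zero]; split_ifs <;> simp
  | succ j ih => rw [heat_succ]; exact avg_nonneg fun i => ih _

lemma IsSymmGen.nonempty (hS : IsSymmGen S) : Nonempty ↥S := ⟨⟨1, hS.one_mem⟩⟩

lemma sum_heat (hS : IsSymmGen S) (j : ℕ) (B : Finset G) (hB : S ^ j ⊆ B) :
    ∑ x ∈ B, heat S j x = 1 := by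
  have := hS.nonempty
  induction j generalizing B with
  | zero =>
    simp only [heat_zero]
    rw [Finset.sum_ite_eq', if_pos (hB (by simp))]
  | succ j ih =>
    simp only [heat_succ]
    rw [← avg_sum, ← avg_const (ι := ↥S) 1]
    congr 1; ext i
    rw [← ih (B.image (· * (i : G)))]
    · rw [Finset.sum_image (fun a _ b _ h => mul_right_cancel h)]
    · intro y hy
      refine Finset.mem_image.2 ⟨y * (i : G)⁻¹, hB ?_, by simp⟩
      rw [pow_succ]
      exact Finset.mul_mem_mul hy (hS.inv_mem _ i.2)

lemma sum_heat_le (hS : IsSymmGen S) (j : ℕ) (B : Finset G) : ∑ x ∈ B, heat S j x ≤ 1 := by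
  rw [← sum_heat hS j (B ∪ S ^ j) Finset.subset_union_right]
  exact Finset.sum_le_sum_of_subset_of_nonneg Finset.subset_union_left
    fun x _ _ => heat_nonneg j x

lemma heat_two_mul_one (hS : IsSymmGen S) (j : ℕ) (x : G) :
    heat S (2 * j) 1 = ‖heatVec S j x‖ ^ 2 := by
  rw [← real_inner_self_eq_norm_sq, inner_heatVec hS, two_mul, inv_mul_cancel]

lemma one_le_card_mul_heat (hS : IsSymmGen S) (j : ℕ) :
    1 ≤ ((S ^ j).card : ℝ) * heat S (2 * j) 1 := by
  have h1 := sum_heat hS j (S ^ j) subset_rfl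
  have h2 := sq_sum_le_card_mul_sum_sq (s := S ^ j) (f := heat S j)
  rw [h1, one_pow] at h2
  refine h2.trans (mul_le_mul_of_nonneg_left ?_ (by positivity))
  have hv : Orthonormal ℝ (heatVec S 0) := by
    rw [orthonormal_iff_ite]
    intro i k
    rw [inner_heatVec hS, heat_zero, inv_mul_eq_one]
  have := hv.sum_inner_products_le (s := S ^ j) (heatVec S j 1)
  rw [← heat_two_mul_one hS] at this
  refine le_trans (Finset.sum_le_sum fun x _ => ?_) this
  have h3 : heat S j x = inner ℝ (heatVec S 0 x) (heatVec S j 1) := by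
    rw [real_inner_comm, inner_heatVec hS]; simp
  rw [h3, Real.norm_eq_abs, sq_abs]

end ReturnProb
end HarmonicExistence

section HarmonicExistence
open scoped Classical Pointwise Topology
open Filter

variable {G : Type*} [Group G] {S : Finset G}

/-- The decrement of the even return probabilities. -/
noncomputable def heatDrop (S : Finset G) (j : ℕ) : ℝ := heat S (2 * j) 1 - heat S (2 * (j + 1)) 1

lemma norm_heatVec_sub_sq (hS : IsSymmGen S) (j : ℕ) (x y : G) :
    ‖heatVec S j x - heatVec S j y‖ ^ 2 = 2 * (heat S (2 * j) 1 - heat S (2 * j) (x⁻¹ * y)) := by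
  rw [norm_sub_sq_real, ← heat_two_mul_one hS, ← heat_two_mul_one hS, inner_heatVec hS, two_mul j]
  ring

lemma norm_heatVec_step_sq (hS : IsSymmGen S) (j : ℕ) (x : G) :
    ‖heatVec S (j + 2) x - heatVec S j x‖ ^ 2 = heatDrop S j - heatDrop S (j + 1) := by
  rw [norm_sub_sq_real, ← heat_two_mul_one hS, ← heat_two_mul_one hS, inner_heatVec hS, heatDrop,
    heatDrop, inv_mul_cancel, show j + 2 + j = 2 * (j + 1) by ring,
    show j + 2 = j + 1 + 1 by ring]
  ring

lemma heat_two_mul_le (hS : IsSymmGen S) (j : ℕ) (x : G) : heat S (2 * j) x ≤ heat S (2 * j) 1 := by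
  have := norm_heatVec_sub_sq hS j 1 x
  rw [inv_one, one_mul] at this
  nlinarith [sq_nonneg ‖heatVec S j 1 - heatVec S j x‖]

lemma heat_add_two (j : ℕ) (x : G) :
    heat S (j + 2) x = avg fun i => heat S j (x * pairMul S i) := by
  simp only [avg_prod, pairMul]
  rw [heat_succ]
  simp only [heat_succ, mul_assoc]

lemma heatDrop_eq_avg (hS : IsSymmGen S) (j : ℕ) :
    heatDrop S j = avg fun i => (heat S (2 * j) 1 - heat S (2 * j) (pairMul S i)) := by
  have := hS.nonempty
  rw [avg_sub, avg_const, heatDrop, mul_add, mul_one, heat_add_two]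
  simp

lemma heatDrop_nonneg (hS : IsSymmGen S) (j : ℕ) : 0 ≤ heatDrop S j := by
  rw [heatDrop_eq_avg hS]
  exact avg_nonneg fun i => sub_nonneg.2 (heat_two_mul_le hS j _)

lemma heatDrop_antitone (hS : IsSymmGen S) : Antitone (heatDrop S) :=
  antitone_nat_of_succ_le fun j => by
    have := norm_heatVec_step_sq hS j 1
    nlinarith [sq_nonneg ‖heatVec S (j + 2) 1 - heatVec S j 1‖]

lemma sum_heatDrop (j n : ℕ) :
    ∑ k ∈ Finset.range n, heatDrop S (j + k) = heat S (2 * j) 1 - heat S (2 * (j + n)) 1 := by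
  simp only [heatDrop]
  exact Finset.sum_range_sub' (fun k => heat S (2 * (j + k)) 1) n

lemma tendsto_heatDrop (hS : IsSymmGen S) : Tendsto (heatDrop S) atTop (𝓝 0) := by
  refine squeeze_zero (heatDrop_nonneg hS) (fun n => ?_) tendsto_one_div_add_atTop_nhds_zero_nat
  rw [le_div_iff₀ (by positivity)]
  have h1 : ∑ k ∈ Finset.range (n + 1), heatDrop S n ≤
      ∑ k ∈ Finset.range (n + 1), heatDrop S (0 + k) :=
    Finset.sum_le_sum fun k hk => heatDrop_antitone hS (by simp at hk; lia)
  rw [sum_heatDrop] at h1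
  simp only [Finset.sum_const, Finset.card_range, nsmul_eq_mul, mul_zero, heat_zero, if_true] at h1
  have := heat_nonneg (S := S) (2 * (0 + (n + 1))) 1
  push_cast at h1
  linarith

lemma abs_heat_step_le (hS : IsSymmGen S) (j : ℕ) (x : G) :
    |heat S (2 * j + 2) x - heat S (2 * j) x| ≤ Real.sqrt (heatDrop S j) := by
  have h1 : heat S (2 * j + 2) x - heat S (2 * j) x =
      inner ℝ (heatVec S (j + 2) 1 - heatVec S j 1) (heatVec S j x) := by
    rw [inner_sub_left, inner_heatVec hS, inner_heatVec hS, inv_one, one_mul, two_mul]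
    ring_nf
  rw [h1]
  refine (abs_real_inner_le_norm _ _).trans ?_
  have h2 : ‖heatVec S j x‖ ≤ 1 := by
    rw [← sq_le_one_iff₀ (norm_nonneg _), ← heat_two_mul_one hS]
    simpa using sum_heat_le hS (2 * j) {1}
  have h3 : ‖heatVec S (j + 2) 1 - heatVec S j 1‖ ≤ Real.sqrt (heatDrop S j) := by
    refine Real.le_sqrt_of_sq_le ?_
    rw [norm_heatVec_step_sq hS]
    linarith [heatDrop_nonneg hS (j + 1)]
  calc _ ≤ Real.sqrt (heatDrop S j) * 1 := by gcongr
    _ = _ := mul_one _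

lemma heat_lt_of_infinite [Infinite G] (hS : IsSymmGen S) {η : ℝ} (hη : 0 < η) :
    ∃ j, heat S (2 * j) 1 < η := by
  by_contra! hq
  let ω : Ultrafilter ℕ := hyperfilter ℕ
  have hω : (ω : Filter ℕ) ≤ atTop := by
    rw [← Nat.cofinite_eq_atTop]; exact hyperfilter_le_cofinite
  set h : G → ℝ := fun x => ulim ω fun j => heat S (2 * j) x
  have hb : ∀ j x, |heat S j x| ≤ 1 := fun j x => by
    rw [abs_of_nonneg (heat_nonneg _ _)]; simpa using sum_heat_le hS j {x}
  have hlim : ∀ x, Tendsto (fun j => heat S (2 * j) x) ω (𝓝 (h x)) := fun x =>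
    tendsto_ulim ω _ 1 (Eventually.of_forall fun j => hb _ x)
  have hle : ∀ x, h x ≤ h 1 := fun x =>
    le_of_tendsto_of_tendsto' (hlim x) (hlim 1) fun j => heat_two_mul_le hS j x
  have hharm : ∀ x, avg (fun i => h (x * pairMul S i)) = h x := fun x => by
    have h1 : Tendsto (fun j => heat S (2 * j + 2) x) ω
        (𝓝 (avg fun i => h (x * pairMul S i))) := by
      simp only [heat_add_two]
      exact tendsto_avg fun i => hlim _
    have h2 : Tendsto (fun j => heat S (2 * j + 2) x - heat S (2 * j) x) ω (𝓝 0) := by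
      rw [tendsto_zero_iff_abs_tendsto_zero]
      refine squeeze_zero (fun _ => abs_nonneg _) (fun j => abs_heat_step_le hS j x) ?_
      have := (tendsto_heatDrop hS).sqrt
      rw [Real.sqrt_zero] at this
      exact this.mono_left hω
    have h3 := h1.sub (hlim x)
    linarith [tendsto_nhds_unique h3 h2]
  have hconst : ∀ x, h x = h 1 := by
    refine hS.induction rfl fun x hx s hs => ?_
    have := eq_of_avg_eq_of_le (fun i => (hle (x * pairMul S i)).trans hx.ge) (hharm x)
      (⟨s, hs⟩, ⟨1, hS.one_mem⟩)
    simpa [pairMul, hx] using this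
  have hh1 : η ≤ h 1 := ge_of_tendsto' (hlim 1) hq
  obtain ⟨n, hn⟩ := exists_nat_gt (1 / η)
  obtain ⟨B, hB⟩ := Infinite.exists_subset_card_eq G n
  have h4 : ∑ x ∈ B, h x ≤ 1 :=
    le_of_tendsto' (tendsto_finsetSum B fun x _ => hlim x) fun j => sum_heat_le hS _ B
  simp only [hconst, Finset.sum_const, hB, nsmul_eq_mul] at h4
  rw [div_lt_iff₀ hη] at hn
  nlinarith [(Nat.cast_nonneg n : (0 : ℝ) ≤ n)]

lemma exists_heatDrop_slow [Infinite G] (hS : IsSymmGen S) {d : ℕ} (hG : GrowthLE G d) {ε : ℝ}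
    (hε : 0 < ε) (hε1 : ε < 1) :
    ∃ j, 0 < heatDrop S j ∧ heatDrop S j - heatDrop S (j + 1) ≤ ε * heatDrop S j := by
  by_contra! hcon
  set r := 1 - ε
  have hr0 : 0 < r := by simp only [r]; linarith
  have hr1 : r < 1 := by simp only [r]; linarith
  have hstep : ∀ j, heatDrop S (j + 1) ≤ r * heatDrop S j := fun j => by
    rcases (heatDrop_nonneg hS j).eq_or_lt with h | h
    · have := heatDrop_antitone hS (Nat.le_succ j)
      rw [← h] at this ⊢
      simpa using this
    · have := hcon j h
      simp only [r]; linarith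
  have hpow : ∀ j, heatDrop S j ≤ r ^ j * heatDrop S 0 := fun j => by
    induction j with
    | zero => simp
    | succ j ih =>
      refine (hstep j).trans ?_
      rw [pow_succ', mul_assoc]
      gcongr
  have hc0 : heatDrop S 0 ≤ 1 := by
    simp only [heatDrop, mul_zero, heat_zero, if_true]
    linarith [heat_nonneg (S := S) (2 * (0 + 1)) 1]
  have hq : ∀ j, heat S (2 * j) 1 ≤ r ^ j / ε := fun j => by
    refine le_of_forall_pos_le_add fun η hη => ?_
    obtain ⟨n, hn⟩ := heat_lt_of_infinite hS hη
    have hanti : heat S (2 * (j + n)) 1 ≤ heat S (2 * n) 1 := by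
      have h1 := sum_heatDrop (S := S) n j
      have h2 : 0 ≤ ∑ k ∈ Finset.range j, heatDrop S (n + k) :=
        Finset.sum_nonneg fun k _ => heatDrop_nonneg hS _
      rw [add_comm j n]; linarith
    have h1 := sum_heatDrop (S := S) j n
    have h2 : ∑ k ∈ Finset.range n, heatDrop S (j + k) ≤ r ^ j * (1 / ε) := by
      calc _ ≤ ∑ k ∈ Finset.range n, r ^ j * r ^ k := by
            refine Finset.sum_le_sum fun k _ => (hpow _).trans ?_
            rw [pow_add]
            exact mul_le_of_le_one_right (by positivity) hc0
        _ = r ^ j * ∑ k ∈ Finset.range n, r ^ k := by rw [Finset.mul_sum]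
        _ ≤ r ^ j * (1 / ε) := by
            gcongr
            have := (summable_geometric_of_lt_one hr0.le hr1).sum_le_tsum (Finset.range n)
              (fun k _ => by positivity)
            rw [tsum_geometric_of_lt_one hr0.le hr1] at this
            simpa [r] using this
    rw [mul_one_div] at h2
    linarith
  obtain ⟨C, hC⟩ := hG S
  have hbig : ∀ j : ℕ, ε ≤ (C * 2 ^ d) * ((j : ℝ) ^ d * r ^ j) + C * r ^ j := fun j => by
    have h1 := one_le_card_mul_heat hS j
    have h2 : ((S ^ j).card : ℝ) ≤ C * ((j : ℝ) + 1) ^ d := by exact_mod_cast hC j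
    have h3 : ((j : ℝ) + 1) ^ d ≤ 2 ^ d * (j : ℝ) ^ d + 1 := by
      rcases Nat.eq_zero_or_pos j with rfl | hj
      · simp
      · have : (1 : ℝ) ≤ j := by exact_mod_cast hj
        rw [← mul_pow]
        have : ((j : ℝ) + 1) ^ d ≤ (2 * j) ^ d := by gcongr; linarith
        linarith
    have h4 : 1 ≤ (C * (2 ^ d * (j : ℝ) ^ d + 1)) * (r ^ j / ε) := by
      refine h1.trans (mul_le_mul (h2.trans ?_) (hq j) (heat_nonneg _ _) (by positivity))
      gcongr
    rw [mul_div_assoc', le_div_iff₀ hε] at h4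
    linarith
  have hlim : Tendsto (fun j : ℕ => (C * 2 ^ d) * ((j : ℝ) ^ d * r ^ j) + C * r ^ j) atTop
      (𝓝 ((C * 2 ^ d) * 0 + C * 0)) := by
    have hr : |r| < 1 := by rw [abs_of_pos hr0]; exact hr1
    exact ((tendsto_pow_const_mul_const_pow_of_abs_lt_one d hr).const_mul _).add
      ((tendsto_pow_atTop_nhds_zero_of_abs_lt_one hr).const_mul _)
  have := ge_of_tendsto' hlim hbig
  simp at this
  linarith

/-- An approximately harmonic Lipschitz function. -/
lemma exists_almost_harmonic [Infinite G] (hS : IsSymmGen S) {d : ℕ} (hG : GrowthLE G d) {ε : ℝ}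
    (hε : 0 < ε) (hε1 : ε < 1) :
    ∃ u : G → ℝ, u 1 = 0 ∧ (∃ i, 2 ≤ u (pairMul S i)) ∧
      (∀ x i, |u (x * pairMul S i) - u x| ≤ 2 * Fintype.card (↥S × ↥S)) ∧
      ∀ x, |markov (pairMul S) u x - u x| ≤ Real.sqrt (2 * Fintype.card (↥S × ↥S) * ε) := by
  have hne := hS.nonempty
  obtain ⟨j, hc, hslow⟩ := exists_heatDrop_slow hS hG hε hε1
  set c := heatDrop S j
  set N : ℝ := ((Fintype.card (↥S × ↥S) : ℕ) : ℝ)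
  set D : G → ℝ := fun x => heat S (2 * j) 1 - heat S (2 * j) x
  have hD0 : ∀ x, 0 ≤ D x := fun x => sub_nonneg.2 (heat_two_mul_le hS j x)
  have hDc : c = avg fun i => D (pairMul S i) := heatDrop_eq_avg hS j
  have hDN : ∀ i, D (pairMul S i) ≤ N * c := fun i => by
    rw [hDc]; exact le_card_mul_avg (fun i => hD0 (pairMul S i)) i
  obtain ⟨i₀, hi₀⟩ := exists_avg_le fun i => D (pairMul S i)
  rw [← hDc] at hi₀
  set s := pairMul S i₀
  set w := heatVec S j s - heatVec S j 1
  have hw : ‖w‖ ≤ Real.sqrt (2 * (N * c)) := by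
    refine Real.le_sqrt_of_sq_le ?_
    rw [norm_sub_rev, norm_heatVec_sub_sq hS, inv_one, one_mul]
    exact mul_le_mul_of_nonneg_left (hDN i₀) zero_le_two
  set u : G → ℝ := fun x => inner ℝ (heatVec S j x - heatVec S j 1) w / c
  have hu : ∀ x, u x = inner ℝ (heatVec S j x - heatVec S j 1) w / c := fun _ => rfl
  refine ⟨u, by simp [hu], ⟨i₀, ?_⟩, fun x i => ?_, fun x => ?_⟩
  · rw [hu, real_inner_self_eq_norm_sq, le_div_iff₀ hc, norm_sub_rev, norm_heatVec_sub_sq hS]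
    simp only [inv_one, one_mul]
    have : c ≤ heat S (2 * j) 1 - heat S (2 * j) s := hi₀
    linarith
  · rw [hu, hu, ← sub_div, ← inner_sub_left, sub_sub_sub_cancel_right, abs_div, abs_of_pos hc,
      div_le_iff₀ hc]
    refine (abs_real_inner_le_norm _ _).trans ?_
    have h1 : ‖heatVec S j (x * pairMul S i) - heatVec S j x‖ ≤ Real.sqrt (2 * (N * c)) := by
      refine Real.le_sqrt_of_sq_le ?_
      rw [norm_sub_rev, norm_heatVec_sub_sq hS, inv_mul_cancel_left]
      exact mul_le_mul_of_nonneg_left (hDN i) zero_le_two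
    calc _ ≤ Real.sqrt (2 * (N * c)) * Real.sqrt (2 * (N * c)) := by gcongr
      _ = 2 * N * c := by rw [Real.mul_self_sqrt (by positivity)]; ring
  · have h1 : markov (pairMul S) u x - u x =
        inner ℝ (heatVec S (j + 2) x - heatVec S j x) w / c := by
      have h2 : markov (pairMul S) u x = inner ℝ (heatVec S (j + 2) x - heatVec S j 1) w / c := by
        rw [markov]
        simp only [hu, div_eq_mul_inv]
        rw [avg_mul_right]
        congr 1
        simp only [inner_sub_left]
        rw [avg_sub, avg_const]
        congr 1
        simp only [w, inner_sub_right, inner_heatVec hS]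
        rw [avg_sub]
        have h3 : ∀ y, (avg fun i => heat S (j + j) ((x * pairMul S i)⁻¹ * y)) =
            heat S (j + 2 + j) (x⁻¹ * y) := fun y => by
          rw [show j + 2 + j = j + j + 1 + 1 by ring, heat_succ' hS, avg_prod]
          simp only [heat_succ' hS (j + j), pairMul, mul_inv_rev, mul_assoc]
        rw [h3, h3]
      rw [h2, hu, ← sub_div, ← inner_sub_left, sub_sub_sub_cancel_right]
    rw [h1, abs_div, abs_of_pos hc, div_le_iff₀ hc]
    refine (abs_real_inner_le_norm _ _).trans ?_
    have h3 : ‖heatVec S (j + 2) x - heatVec S j x‖ ≤ Real.sqrt (ε * c) := by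
      refine Real.le_sqrt_of_sq_le ?_
      rwa [norm_heatVec_step_sq hS]
    calc _ ≤ Real.sqrt (ε * c) * Real.sqrt (2 * (N * c)) := by gcongr
      _ = Real.sqrt (2 * N * ε * c ^ 2) := by rw [← Real.sqrt_mul (by positivity)]; ring_nf
      _ = _ := by rw [Real.sqrt_mul (by positivity), Real.sqrt_sq hc.le]

/-- Existence of a nonzero Lipschitz harmonic function on an infinite group of polynomial growth. -/
theorem exists_lipschitz_harmonic [Infinite G] (hS : IsSymmGen S) {d : ℕ} (hG : GrowthLE G d) :
    ∃ u : G → ℝ, u ≠ 0 ∧ u 1 = 0 ∧ (∀ x, markov (pairMul S) u x = u x) ∧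
      ∃ L : ℝ, ∀ x i, |u (x * pairMul S i) - u x| ≤ L := by
  have hne := hS.nonempty
  set N : ℝ := ((Fintype.card (↥S × ↥S) : ℕ) : ℝ)
  let e : ℕ → ℝ := fun n => 1 / ((n : ℝ) + 2)
  have he : Tendsto e atTop (𝓝 0) := by
    have := (tendsto_add_atTop_iff_nat 1).2 (tendsto_one_div_add_atTop_nhds_zero_nat (𝕜 := ℝ))
    refine this.congr fun n => ?_
    simp only [e]; push_cast; ring
  have hex := fun n : ℕ => exists_almost_harmonic hS hG (ε := e n) (by positivity)
    (by simp only [e]; rw [div_lt_one (by positivity)]; linarith [(Nat.cast_nonneg n : (0:ℝ) ≤ n)])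
  choose u hu1 hu2 huL huh using hex
  let ω : Ultrafilter ℕ := hyperfilter ℕ
  have hω : (ω : Filter ℕ) ≤ atTop := by
    rw [← Nat.cofinite_eq_atTop]; exact hyperfilter_le_cofinite
  have hb : ∀ x, ∃ C, ∀ n, |u n x| ≤ C := by
    refine hS.induction ⟨0, fun n => by simp [hu1]⟩ ?_
    rintro x ⟨C, hC⟩ s hs
    refine ⟨C + 2 * N, fun n => ?_⟩
    have h1 := huL n x (⟨s, hs⟩, ⟨1, hS.one_mem⟩)
    simp only [pairMul, mul_one] at h1
    calc |u n (x * s)| = |u n x + (u n (x * s) - u n x)| := by ring_nf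
      _ ≤ _ := (abs_add_le _ _).trans (add_le_add (hC n) h1)
  set v : G → ℝ := fun x => ulim ω fun n => u n x
  have hlim : ∀ x, Tendsto (fun n => u n x) ω (𝓝 (v x)) := fun x => by
    obtain ⟨C, hC⟩ := hb x
    exact tendsto_ulim ω _ C (Eventually.of_forall hC)
  refine ⟨v, ?_, ?_, fun x => ?_, 2 * N, fun x i => ?_⟩
  · intro h0
    have h1 : Tendsto (fun n => ∑ i, u n (pairMul S i) ^ 2) ω
        (𝓝 (∑ i, v (pairMul S i) ^ 2)) :=
      tendsto_finsetSum _ fun i _ => (hlim _).pow 2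
    have h2 := ge_of_tendsto' h1 (b := 4) fun n => by
      obtain ⟨i, hi⟩ := hu2 n
      have := Finset.single_le_sum (f := fun i => u n (pairMul S i) ^ 2)
        (fun i _ => sq_nonneg _) (Finset.mem_univ i)
      refine le_trans ?_ this
      nlinarith
    simp [h0] at h2
    linarith
  · refine tendsto_nhds_unique (hlim 1) ?_
    simp [hu1]
  · have h1 : Tendsto (fun n => markov (pairMul S) (u n) x - u n x) ω
        (𝓝 (markov (pairMul S) v x - v x)) := (tendsto_avg fun i => hlim _).sub (hlim x)
    have h2 : Tendsto (fun n => markov (pairMul S) (u n) x - u n x) ω (𝓝 0) := by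
      rw [tendsto_zero_iff_abs_tendsto_zero]
      refine squeeze_zero (fun _ => abs_nonneg _) (fun n => huh n x) ?_
      have := ((he.mono_left hω).const_mul (2 * N)).sqrt
      rwa [mul_zero, Real.sqrt_zero] at this
    linarith [tendsto_nhds_unique h1 h2]
  · exact le_of_tendsto' ((hlim _).sub (hlim x)).abs fun n => huL n x i

end HarmonicExistence

section WalkEntropy
open scoped Classical Pointwise Topology
open Filter

variable {G ι : Type*} [Group G] [Fintype ι] (s : ι → G)

/-- Expectation of `f` at time `n` for the random walk with steps `s`. -/
noncomputable def walkExp (n : ℕ) (f : G → ℝ) : ℝ := (markov s)^[n] f 1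

/-- Law at time `n` of the random walk with steps `s`. -/
noncomputable def walkLaw (n : ℕ) (x : G) : ℝ := walkExp s n (Pi.single x 1)

lemma markov_left (f : G → ℝ) (g : G) :
    markov s (fun x => f (g * x)) = fun x => markov s f (g * x) := by
  ext x; simp only [markov, mul_assoc]

lemma markov_iterate_left (n : ℕ) (f : G → ℝ) (g : G) :
    (markov s)^[n] (fun x => f (g * x)) = fun x => (markov s)^[n] f (g * x) := by
  induction n with
  | zero => rfl
  | succ n ih => simp only [Function.iterate_succ_apply', ih, markov_left]

lemma walkExp_zero (f : G → ℝ) : walkExp s 0 f = f 1 := rfl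

lemma walkExp_succ (n : ℕ) (f : G → ℝ) : walkExp s (n + 1) f = walkExp s n (markov s f) := rfl

lemma walkExp_succ' (n : ℕ) (f : G → ℝ) :
    walkExp s (n + 1) f = avg fun i => walkExp s n fun x => f (s i * x) := by
  simp only [walkExp, Function.iterate_succ_apply', markov_iterate_left, mul_one]
  simp only [markov, one_mul]

lemma walkLaw_zero (x : G) : walkLaw s 0 x = if x = 1 then 1 else 0 := by
  simp [walkLaw, walkExp_zero, Pi.single_apply, eq_comm]

lemma walkLaw_succ (n : ℕ) (x : G) :
    walkLaw s (n + 1) x = avg fun i => walkLaw s n ((s i)⁻¹ * x) := by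
  rw [walkLaw, walkExp_succ']
  congr 1; ext i
  rw [walkLaw]
  congr 1; ext y
  simp only [Pi.single_apply, eq_inv_mul_iff_mul_eq]

/-- The set of steps of the walk. -/
noncomputable def stepSet : Finset G := Finset.univ.image s

lemma inv_smul_image_subset {n : ℕ} {B : Finset G} (hB : stepSet s ^ (n + 1) ⊆ B) (i : ι) :
    stepSet s ^ n ⊆ B.image ((s i)⁻¹ * ·) := by
  intro y hy
  refine Finset.mem_image.2 ⟨s i * y, hB ?_, by simp⟩
  rw [pow_succ']
  exact Finset.mul_mem_mul (Finset.mem_image_of_mem _ (Finset.mem_univ i)) hy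

lemma sum_image_inv_mul (B : Finset G) (g : G) (F : G → ℝ) :
    ∑ x ∈ B, F (g⁻¹ * x) = ∑ y ∈ B.image (g⁻¹ * ·), F y := by
  rw [Finset.sum_image (fun a _ b _ h => mul_left_cancel h)]

lemma walkExp_eq_sum (n : ℕ) (f : G → ℝ) {B : Finset G} (hB : stepSet s ^ n ⊆ B) :
    walkExp s n f = ∑ x ∈ B, walkLaw s n x * f x := by
  induction n generalizing f B with
  | zero =>
    simp only [walkLaw_zero, walkExp_zero, ite_mul, one_mul, zero_mul]
    rw [Finset.sum_ite_eq', if_pos (hB (by simp))]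
  | succ n ih =>
    rw [walkExp_succ']
    simp only [walkLaw_succ, ← avg_mul_right]
    rw [← avg_sum]
    congr 1; ext i
    rw [ih _ (inv_smul_image_subset s hB i), ← sum_image_inv_mul]
    simp

lemma walkExp_mul_left_eq_sum (n : ℕ) (f : G → ℝ) {B : Finset G} (hB : stepSet s ^ (n + 1) ⊆ B)
    (i : ι) :
    walkExp s n (fun x => f (s i * x)) = ∑ x ∈ B, walkLaw s n ((s i)⁻¹ * x) * f x := by
  rw [walkExp_eq_sum s n _ (inv_smul_image_subset s hB i), ← sum_image_inv_mul]
  simp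

lemma markov_mono {f f' : G → ℝ} (h : ∀ x, f x ≤ f' x) (x : G) : markov s f x ≤ markov s f' x :=
  avg_mono fun _ => h _

lemma walkExp_mono (n : ℕ) {f f' : G → ℝ} (h : ∀ x, f x ≤ f' x) :
    walkExp s n f ≤ walkExp s n f' := by
  induction n generalizing f f' with
  | zero => exact h 1
  | succ n ih => exact ih (markov_mono s h)

lemma walkExp_add (n : ℕ) (f f' : G → ℝ) :
    walkExp s n (fun x => f x + f' x) = walkExp s n f + walkExp s n f' := by
  simp only [walkExp_eq_sum s n _ subset_rfl, mul_add, Finset.sum_add_distrib]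

lemma walkExp_const_mul (n : ℕ) (c : ℝ) (f : G → ℝ) :
    walkExp s n (fun x => c * f x) = c * walkExp s n f := by
  simp only [walkExp_eq_sum s n _ subset_rfl, Finset.mul_sum, mul_left_comm]

lemma walkExp_const [Nonempty ι] (n : ℕ) (c : ℝ) : walkExp s n (fun _ => c) = c := by
  induction n with
  | zero => rfl
  | succ n ih =>
    rw [walkExp_succ]
    convert ih using 2
    ext x; simp [markov, avg_const]

lemma walkExp_sum {α : Type*} (n : ℕ) (A : Finset α) (F : α → G → ℝ) :
    walkExp s n (fun x => ∑ a ∈ A, F a x) = ∑ a ∈ A, walkExp s n (F a) := by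
  simp only [walkExp_eq_sum s n _ subset_rfl, Finset.mul_sum]
  rw [Finset.sum_comm]

lemma walkExp_nonneg (n : ℕ) {f : G → ℝ} (h : ∀ x, 0 ≤ f x) : 0 ≤ walkExp s n f := by
  have := walkExp_mono s n (f := fun _ => 0 * 0) (f' := f) (by simpa using h)
  rwa [walkExp_const_mul, zero_mul] at this

lemma walkLaw_nonneg (n : ℕ) (x : G) : 0 ≤ walkLaw s n x :=
  walkExp_nonneg s n fun y => by rw [Pi.single_apply]; split_ifs <;> simp

lemma sum_walkLaw [Nonempty ι] (n : ℕ) {B : Finset G} (hB : stepSet s ^ n ⊆ B) :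
    ∑ x ∈ B, walkLaw s n x = 1 := by
  have := walkExp_eq_sum s n (fun _ => 1) hB
  rw [walkExp_const] at this
  simpa using this.symm

lemma walkExp_mul_left_le (n : ℕ) {f : G → ℝ} (h : ∀ x, 0 ≤ f x) (i : ι) :
    walkExp s n (fun x => f (s i * x)) ≤ Fintype.card ι * walkExp s (n + 1) f := by
  rw [walkExp_succ']
  exact le_card_mul_avg (F := fun i => walkExp s n fun x => f (s i * x))
    (fun i => walkExp_nonneg s n fun x => h _) i

lemma sq_sum_sub_mul_le {α : Type*} (B : Finset α) (p q F : α → ℝ) (hp : ∀ x, 0 ≤ p x)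
    (hq : ∀ x, 0 ≤ q x) :
    (∑ x ∈ B, (p x - q x) * F x) ^ 2 ≤ (∑ x ∈ B, (√(p x) - √(q x)) ^ 2) *
      (2 * (∑ x ∈ B, p x * F x ^ 2 + ∑ x ∈ B, q x * F x ^ 2)) := by
  have h1 := Finset.sum_mul_sq_le_sq_mul_sq B (fun x => √(p x) - √(q x))
    (fun x => (√(p x) + √(q x)) * F x)
  have h2 : ∀ x, (√(p x) - √(q x)) * ((√(p x) + √(q x)) * F x) = (p x - q x) * F x := fun x => by
    have e1 := Real.sq_sqrt (hp x)
    have e2 := Real.sq_sqrt (hq x)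
    calc _ = (√(p x) ^ 2 - √(q x) ^ 2) * F x := by ring
      _ = _ := by rw [e1, e2]
  simp only [h2] at h1
  refine h1.trans ?_
  refine mul_le_mul_of_nonneg_left ?_ (Finset.sum_nonneg fun x _ => sq_nonneg _)
  rw [← Finset.sum_add_distrib, Finset.mul_sum]
  refine Finset.sum_le_sum fun x _ => ?_
  have e1 := Real.sq_sqrt (hp x)
  have e2 := Real.sq_sqrt (hq x)
  have : (√(p x) + √(q x)) ^ 2 ≤ 2 * (p x + q x) := by nlinarith [sq_nonneg (√(p x) - √(q x))]
  calc _ = (√(p x) + √(q x)) ^ 2 * F x ^ 2 := by ring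
    _ ≤ 2 * (p x + q x) * F x ^ 2 := by gcongr
    _ = _ := by ring

/-- Entropy of the law of the walk at time `n`. -/
noncomputable def walkEntropy (n : ℕ) : ℝ := ∑ x ∈ stepSet s ^ n, Real.negMulLog (walkLaw s n x)

lemma walkLaw_eq_zero [Nonempty ι] (n : ℕ) {x : G} (hx : x ∉ stepSet s ^ n) :
    walkLaw s n x = 0 := by
  have h1 := sum_walkLaw s n (B := insert x (stepSet s ^ n)) (Finset.subset_insert _ _)
  rw [Finset.sum_insert hx, sum_walkLaw s n subset_rfl] at h1
  linarith

lemma walkEntropy_eq_sum [Nonempty ι] (n : ℕ) {B : Finset G} (hB : stepSet s ^ n ⊆ B) :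
    walkEntropy s n = ∑ x ∈ B, Real.negMulLog (walkLaw s n x) := by
  refine Finset.sum_subset hB fun x _ hx => ?_
  rw [walkLaw_eq_zero s n hx, Real.negMulLog_zero]

lemma walkEntropy_le [Nonempty ι] (n : ℕ) {c : ℝ} (h : ((stepSet s ^ n).card : ℝ) ≤ c) :
    walkEntropy s n ≤ Real.log c := by
  have hpos : 0 < (stepSet s ^ n).card := by
    rw [Finset.card_pos, Finset.nonempty_iff_ne_empty]
    intro h0
    have := sum_walkLaw s n (subset_refl _)
    rw [h0] at this; simp at this
  have hpos' : (0:ℝ) < (stepSet s ^ n).card := by exact_mod_cast hpos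
  refine le_trans ?_ (Real.log_le_log hpos' h)
  set M : ℝ := (((stepSet s ^ n).card : ℕ) : ℝ)
  have key : ∀ x, Real.negMulLog (walkLaw s n x) ≤ walkLaw s n x * Real.log M + (1 / M - walkLaw s n x) := by
    intro x
    set p := walkLaw s n x
    have hp : 0 ≤ p := walkLaw_nonneg s n x
    rcases hp.eq_or_lt with h0 | h0
    · rw [← h0]; simp; positivity
    have h1 := Real.log_le_sub_one_of_pos (x := 1 / (p * M)) (by positivity)
    rw [one_div, Real.log_inv, Real.log_mul h0.ne' hpos'.ne'] at h1
    have h2 := mul_le_mul_of_nonneg_left h1 hp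
    have h3 : p * ((p * M)⁻¹ - 1) = 1 / M - p := by field_simp
    rw [h3] at h2
    rw [Real.negMulLog]
    linarith
  calc walkEntropy s n ≤ ∑ x ∈ stepSet s ^ n, (walkLaw s n x * Real.log M + (1 / M - walkLaw s n x)) :=
        Finset.sum_le_sum fun x _ => key x
    _ = Real.log M := by
        rw [Finset.sum_add_distrib, ← Finset.sum_mul, Finset.sum_sub_distrib,
          sum_walkLaw s n subset_rfl, Finset.sum_const, nsmul_eq_mul]
        change _ + (M * _ - _) = _
        field_simp; ring

/-- Squared Hellinger distance between the laws of the walk started with a given step and of the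
walk. -/
noncomputable def walkHellinger (n : ℕ) (i : ι) : ℝ :=
  ∑ x ∈ stepSet s ^ (n + 1), (√(walkLaw s n ((s i)⁻¹ * x)) - √(walkLaw s (n + 1) x)) ^ 2

lemma sq_sqrt_sub_sqrt_add_le {a b : ℝ} (ha : 0 ≤ a) (hb : 0 ≤ b) (hab : b = 0 → a = 0) :
    (√a - √b) ^ 2 + (a - b) ≤ a * Real.log a - a * Real.log b := by
  rcases ha.eq_or_lt with h0 | h0
  · rw [← h0]; simp [Real.sq_sqrt hb]
  have hb' : 0 < b := lt_of_le_of_ne hb fun h => h0.ne' (hab h.symm)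
  have h1 := Real.log_le_sub_one_of_pos (x := √b / √a) (by positivity)
  rw [Real.log_div (by positivity) (by positivity), Real.log_sqrt hb, Real.log_sqrt ha] at h1
  have h2 := mul_le_mul_of_nonneg_left h1 (by positivity : 0 ≤ 2 * a)
  have h3 : 2 * a * (√b / √a - 1) = 2 * (√a * √b) - 2 * a := by
    have : √a ≠ 0 := by positivity
    have e : a = √a * √a := (Real.mul_self_sqrt ha).symm
    have : a * (√b / √a) = √a * √b := by
      calc a * (√b / √a) = √a * √a * (√b / √a) := by rw [← e]
        _ = _ := by field_simp
    linarith
  rw [h3] at h2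
  nlinarith [Real.sq_sqrt ha, Real.sq_sqrt hb]

lemma avg_walkHellinger_le [Nonempty ι] (n : ℕ) :
    avg (walkHellinger s n) ≤ walkEntropy s (n + 1) - walkEntropy s n := by
  set B := stepSet s ^ (n + 1)
  have h1 : ∀ i, ∑ x ∈ B, walkLaw s n ((s i)⁻¹ * x) = 1 := fun i => by
    have := walkExp_mul_left_eq_sum s n (fun _ => 1) (subset_refl B) i
    rw [walkExp_const] at this
    simpa using this.symm
  have h2 : ∀ i, ∑ x ∈ B, Real.negMulLog (walkLaw s n ((s i)⁻¹ * x)) = walkEntropy s n := fun i => by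
    rw [sum_image_inv_mul B (s i) fun y => Real.negMulLog (walkLaw s n y),
      walkEntropy_eq_sum s n (inv_smul_image_subset s subset_rfl i)]
  have h3 : walkEntropy s (n + 1) =
      avg fun i => ∑ x ∈ B, -(walkLaw s n ((s i)⁻¹ * x) * Real.log (walkLaw s (n + 1) x)) := by
    rw [avg_sum, walkEntropy]
    refine Finset.sum_congr rfl fun x _ => ?_
    simp only [← mul_neg]
    rw [avg_mul_right, ← walkLaw_succ, Real.negMulLog]; ring
  rw [h3, ← avg_const (ι := ι) (walkEntropy s n), ← avg_sub]
  refine avg_mono fun i => ?_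
  rw [← h2 i, ← Finset.sum_sub_distrib]
  have h4 : walkHellinger s n i = ∑ x ∈ B, ((√(walkLaw s n ((s i)⁻¹ * x)) - √(walkLaw s (n + 1) x)) ^ 2
      + (walkLaw s n ((s i)⁻¹ * x) - walkLaw s (n + 1) x)) := by
    rw [Finset.sum_add_distrib, Finset.sum_sub_distrib, h1, sum_walkLaw s _ subset_rfl]
    simp [walkHellinger, B]
  rw [h4]
  refine Finset.sum_le_sum fun x _ => ?_
  refine (sq_sqrt_sub_sqrt_add_le (walkLaw_nonneg s _ _) (walkLaw_nonneg s _ _) ?_).trans_eq ?_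
  · intro h0
    have := le_card_mul_avg (F := fun i => walkLaw s n ((s i)⁻¹ * x))
      (fun i => walkLaw_nonneg s _ _) i
    rw [← walkLaw_succ, h0, mul_zero] at this
    exact le_antisymm this (walkLaw_nonneg s _ _)
  · rw [Real.negMulLog]; ring

lemma frequently_walkEntropy_sub_le [Nonempty ι] {d : ℕ} (hG : GrowthLE G d) :
    ∃ᶠ n : ℕ in atTop, walkEntropy s (n + 1) - walkEntropy s n ≤ (d + 1) / ((n : ℝ) + 1) := by
  obtain ⟨C, hC⟩ := hG (stepSet s)
  intro hev
  obtain ⟨n₀, hn₀⟩ := eventually_atTop.1 hev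
  have h1 : ∀ k : ℕ, walkEntropy s n₀ + (d + 1) * (Real.log ((n₀ + k : ℕ) + 1) - Real.log (n₀ + 1)) ≤
      walkEntropy s (n₀ + k) := by
    intro k
    induction k with
    | zero => simp
    | succ k ih =>
      have h2 := hn₀ (n₀ + k) (by lia)
      rw [not_le] at h2
      have h3 : Real.log ((n₀ + (k + 1) : ℕ) + 1) - Real.log ((n₀ + k : ℕ) + 1) ≤
          1 / (((n₀ + k : ℕ) : ℝ) + 1) := by
        rw [← Real.log_div (by positivity) (by positivity)]
        refine (Real.log_le_sub_one_of_pos (by positivity)).trans_eq ?_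
        push_cast; field_simp; ring
      have h4 := mul_le_mul_of_nonneg_left h3 (by positivity : (0:ℝ) ≤ d + 1)
      rw [mul_one_div] at h4
      rw [← Nat.add_assoc] at h4 ⊢
      linarith
  have h2 : ∀ n : ℕ, walkEntropy s n ≤ Real.log (C + 1) + d * Real.log (n + 1) := by
    intro n
    have : ((stepSet s ^ n).card : ℝ) ≤ (C + 1) * (n + 1 : ℝ) ^ d := by
      have h5 : ((stepSet s ^ n).card : ℝ) ≤ C * (n + 1 : ℝ) ^ d := by exact_mod_cast hC n
      have : (0:ℝ) ≤ (n + 1 : ℝ) ^ d := by positivity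
      linarith
    refine (walkEntropy_le s n this).trans_eq ?_
    rw [Real.log_mul (by positivity) (by positivity), Real.log_pow]
  have h3 : Tendsto (fun k : ℕ => Real.log (((n₀ + k : ℕ) : ℝ) + 1)) atTop atTop := by
    refine Real.tendsto_log_atTop.comp (tendsto_atTop_add_const_right _ _ ?_)
    exact tendsto_natCast_atTop_atTop.comp (tendsto_atTop_mono (fun k => Nat.le_add_left k n₀) tendsto_id)
  obtain ⟨k, hk⟩ := (h3.eventually_gt_atTop
    (Real.log (C + 1) - walkEntropy s n₀ + (d + 1) * Real.log (n₀ + 1))).exists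
  have h4 := h1 k
  have h5 := h2 (n₀ + k)
  linarith

end WalkEntropy

section HarmonicSpace
open scoped Classical Pointwise Topology
open Filter

section Moments
variable {G ι : Type*} [Group G] [Fintype ι]

/-- Harmonic functions vanishing at the identity with increments bounded by `L`. -/
structure IsLipHarmonic (s : ι → G) (L : ℝ) (f : G → ℝ) : Prop where
  map_one : f 1 = 0
  harmonic : ∀ x, markov s f x = f x
  lipschitz : ∀ x i, |f (x * s i) - f x| ≤ L

variable {s : ι → G} {L : ℝ} {f : G → ℝ}

lemma IsLipHarmonic.nonneg [Nonempty ι] (h : IsLipHarmonic s L f) : 0 ≤ L :=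
  (abs_nonneg _).trans (h.lipschitz 1 (Classical.arbitrary ι))

/-- The action of `g` by translation, normalised to vanish at the identity. -/
def leftTranslate (g : G) (f : G → ℝ) : G → ℝ := fun x => f (g * x) - f g

lemma IsLipHarmonic.translate [Nonempty ι] (h : IsLipHarmonic s L f) (g : G) :
    IsLipHarmonic s L (leftTranslate g f) where
  map_one := by simp [leftTranslate]
  harmonic x := by
    have := h.harmonic (g * x)
    simp only [markov, leftTranslate, avg_sub, avg_const, ← mul_assoc] at this ⊢
    rw [this]
  lipschitz x i := by simpa [leftTranslate, mul_assoc] using h.lipschitz (g * x) i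

lemma IsLipHarmonic.walkExp_eq (h : ∀ x, markov s f x = f x) (n : ℕ) : walkExp s n f = f 1 := by
  induction n with
  | zero => rfl
  | succ n ih => rw [walkExp_succ, show markov s f = f from funext h, ih]

lemma markov_sq [Nonempty ι] (h : ∀ x, markov s f x = f x) (x : G) :
    markov s (fun y => f y ^ 2) x = f x ^ 2 + avg fun i => (f (x * s i) - f x) ^ 2 := by
  have h1 : (fun i => f (x * s i) ^ 2) = fun i => (f x ^ 2 + (f (x * s i) - f x) ^ 2) +
      2 * f x * (f (x * s i) - f x) := by ext i; ring
  have h2 := h x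
  simp only [markov] at h2 ⊢
  rw [h1, avg_add, avg_add, avg_mul_left, avg_sub, h2]
  simp [avg_const]

lemma IsLipHarmonic.walkExp_sq_le [Nonempty ι] (h : IsLipHarmonic s L f) (n : ℕ) :
    walkExp s n (fun x => f x ^ 2) ≤ n * L ^ 2 := by
  induction n with
  | zero => simp [walkExp_zero, h.map_one]
  | succ n ih =>
    rw [walkExp_succ]
    have : walkExp s n (markov s fun x => f x ^ 2) ≤ walkExp s n fun x => f x ^ 2 + L ^ 2 := by
      refine walkExp_mono s n fun x => ?_
      rw [markov_sq h.harmonic]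
      gcongr
      rw [← avg_const (ι := ι) (L ^ 2)]
      exact avg_mono fun i => sq_le_sq' (abs_le.1 (h.lipschitz x i)).1 (abs_le.1 (h.lipschitz x i)).2
    rw [walkExp_add, walkExp_const] at this
    push_cast; linarith

lemma IsLipHarmonic.walkExp_four_le [Nonempty ι] (h : IsLipHarmonic s L f) (n : ℕ) :
    walkExp s n (fun x => f x ^ 4) ≤ 8 * L ^ 4 * n ^ 2 := by
  have hL := h.nonneg
  induction n with
  | zero => simp [walkExp_zero, h.map_one]
  | succ n ih =>
    rw [walkExp_succ]
    have : walkExp s n (markov s fun x => f x ^ 4) ≤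
        walkExp s n fun x => (f x ^ 4 + (8 * L ^ 2) * f x ^ 2) + 3 * L ^ 4 := by
      refine walkExp_mono s n fun x => ?_
      have h1 : ∀ i, f (x * s i) ^ 4 ≤ (f x ^ 4 + ((8 * L ^ 2) * f x ^ 2 + 3 * L ^ 4)) +
          4 * f x ^ 3 * (f (x * s i) - f x) := by
        intro i
        set a := f x
        obtain ⟨e, he⟩ : ∃ e, f (x * s i) = a + e := ⟨f (x * s i) - a, by ring⟩
        have h2 := h.lipschitz x i
        rw [he] at h2 ⊢
        simp only [add_sub_cancel_left, a] at h2 ⊢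
        have h3 : e ^ 2 ≤ L ^ 2 := sq_le_sq' (abs_le.1 h2).1 (abs_le.1 h2).2
        have h4 : e ^ 4 ≤ L ^ 4 := by nlinarith [sq_nonneg e]
        have h5 : 2 * (f x * e) ≤ f x ^ 2 + e ^ 2 := by nlinarith [sq_nonneg (f x - e)]
        have h6 : 2 * (f x * e) * e ^ 2 ≤ (f x ^ 2 + e ^ 2) * e ^ 2 := by gcongr
        have h7 : f x ^ 2 * e ^ 2 ≤ f x ^ 2 * L ^ 2 := by gcongr
        nlinarith
      refine (avg_mono h1).trans_eq ?_
      have h2 := h.harmonic x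
      simp only [markov] at h2
      rw [avg_add, avg_mul_left, avg_sub, h2, avg_const, avg_const]; ring
    rw [walkExp_add, walkExp_add, walkExp_const_mul, walkExp_const] at this
    have h8 := mul_le_mul_of_nonneg_left (h.walkExp_sq_le n) (by positivity : 0 ≤ 8 * L ^ 2)
    have h9 : 0 ≤ L ^ 4 := by positivity
    have h10 : 0 ≤ L ^ 4 * n := by positivity
    push_cast
    nlinarith

lemma walkHellinger_nonneg (n : ℕ) (i : ι) : 0 ≤ walkHellinger s n i :=
  Finset.sum_nonneg fun _ _ => sq_nonneg _

lemma sq_walkExp_sub_le (n : ℕ) (F : G → ℝ) (i : ι) :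
    (walkExp s n (fun x => F (s i * x)) - walkExp s (n + 1) F) ^ 2 ≤
      walkHellinger s n i * (2 * (Fintype.card ι + 1) * walkExp s (n + 1) fun x => F x ^ 2) := by
  have h1 := sq_sum_sub_mul_le (stepSet s ^ (n + 1)) (fun x => walkLaw s n ((s i)⁻¹ * x))
    (walkLaw s (n + 1)) F (fun x => walkLaw_nonneg s _ _) (fun x => walkLaw_nonneg s _ _)
  simp only [sub_mul, Finset.sum_sub_distrib] at h1
  rw [← walkExp_mul_left_eq_sum s n F subset_rfl, ← walkExp_eq_sum s _ F subset_rfl,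
    ← walkExp_mul_left_eq_sum s n (fun x => F x ^ 2) subset_rfl,
    ← walkExp_eq_sum s _ (fun x => F x ^ 2) subset_rfl] at h1
  refine h1.trans (mul_le_mul_of_nonneg_left ?_ (walkHellinger_nonneg n i))
  have := walkExp_mul_left_le s n (f := fun x => F x ^ 2) (fun x => sq_nonneg _) i
  linarith

variable (ω : Ultrafilter ℕ)

/-- The asymptotic covariance of two functions along the walk. -/
noncomputable def covForm (s : ι → G) (f f' : G → ℝ) : ℝ :=
  ulim ω fun n => walkExp s (n + 1) (fun x => f x * f' x) / ((n : ℝ) + 1)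

lemma tendsto_covForm [Nonempty ι] {L' : ℝ} {f' : G → ℝ} (h : IsLipHarmonic s L f)
    (h' : IsLipHarmonic s L' f') :
    Tendsto (fun n : ℕ => walkExp s (n + 1) (fun x => f x * f' x) / ((n : ℝ) + 1)) ω
      (𝓝 (covForm ω s f f')) := by
  refine tendsto_ulim ω _ (L ^ 2 + L' ^ 2) (Eventually.of_forall fun n => ?_)
  rw [abs_div, abs_of_pos (by positivity : (0:ℝ) < n + 1), div_le_iff₀ (by positivity)]
  have h1 := h.walkExp_sq_le (n + 1)
  have h2 := h'.walkExp_sq_le (n + 1)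
  have h3 : walkExp s (n + 1) (fun x => f x * f' x) ≤
      walkExp s (n + 1) fun x => f x ^ 2 + f' x ^ 2 :=
    walkExp_mono s _ fun x => by nlinarith [sq_nonneg (f x - f' x), sq_nonneg (f x + f' x)]
  have h4 : walkExp s (n + 1) (fun x => -1 * (f x * f' x)) ≤
      walkExp s (n + 1) fun x => f x ^ 2 + f' x ^ 2 :=
    walkExp_mono s _ fun x => by nlinarith [sq_nonneg (f x - f' x), sq_nonneg (f x + f' x)]
  rw [walkExp_add] at h3 h4
  rw [walkExp_const_mul] at h4
  push_cast at h1 h2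
  rw [abs_le]
  constructor <;> linarith

variable {κ : ℝ}

lemma tendsto_covForm_sq [Nonempty ι] (h : IsLipHarmonic s L f) :
    Tendsto (fun n : ℕ => walkExp s (n + 1) (fun x => f x ^ 2) / ((n : ℝ) + 1)) ω
      (𝓝 (covForm ω s f f)) := by
  simpa only [pow_two] using tendsto_covForm ω h h

lemma covForm_nonneg [Nonempty ι] (h : IsLipHarmonic s L f) : 0 ≤ covForm ω s f f :=
  ge_of_tendsto' (tendsto_covForm_sq ω h) fun n =>
    div_nonneg (walkExp_nonneg s _ fun x => sq_nonneg _) (by positivity)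

lemma sq_apply_le_covForm [Nonempty ι]
    (hκ : ∀ᶠ n : ℕ in ω, ∀ i, walkHellinger s n i ≤ κ / ((n : ℝ) + 1))
    (h : IsLipHarmonic s L f) (i : ι) :
    f (s i) ^ 2 ≤ κ * (2 * (Fintype.card ι + 1)) * covForm ω s f f := by
  refine ge_of_tendsto ((tendsto_covForm_sq ω h).const_mul _) ?_
  filter_upwards [hκ] with n hn
  have h1 := sq_walkExp_sub_le (s := s) n f i
  rw [IsLipHarmonic.walkExp_eq h.harmonic, h.map_one, sub_zero,
    IsLipHarmonic.walkExp_eq (f := fun x => f (s i * x)), mul_one] at h1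
  · refine h1.trans ?_
    have : 0 ≤ walkExp s (n + 1) fun x => f x ^ 2 := walkExp_nonneg s _ fun x => sq_nonneg _
    calc _ ≤ κ / ((n : ℝ) + 1) * (2 * (Fintype.card ι + 1) * walkExp s (n + 1) fun x => f x ^ 2) := by
          gcongr; exact hn i
      _ = _ := by ring
  · intro x
    have := h.harmonic (s i * x)
    simpa only [markov, mul_assoc] using this

lemma tendsto_const_div_sqrt (hω : (ω : Filter ℕ) ≤ atTop) (c : ℝ) :
    Tendsto (fun n : ℕ => c / √((n : ℝ) + 1)) ω (𝓝 0) := by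
  refine Tendsto.mono_left ?_ hω
  refine tendsto_const_nhds.div_atTop ?_
  exact Real.tendsto_sqrt_atTop.comp
    (tendsto_atTop_add_const_right _ _ tendsto_natCast_atTop_atTop)

lemma covForm_translate_step [Nonempty ι] (hω : (ω : Filter ℕ) ≤ atTop)
    (hκ : ∀ᶠ n : ℕ in ω, ∀ i, walkHellinger s n i ≤ κ / ((n : ℝ) + 1))
    (h : IsLipHarmonic s L f) (i : ι) :
    covForm ω s (leftTranslate (s i) f) (leftTranslate (s i) f) = covForm ω s f f := by
  have ht := h.translate (s i)
  have hL := h.nonneg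
  set g := leftTranslate (s i) f with hg
  set M := κ * (2 * (Fintype.card ι + 1) * (8 * L ^ 4))
  have hlim : Tendsto (fun n : ℕ => √M / √((n : ℝ) + 1) + (L ^ 2 + f (s i) ^ 2) / √((n : ℝ) + 1))
      ω (𝓝 0) := by
    simpa using (tendsto_const_div_sqrt ω hω (√M)).add
      (tendsto_const_div_sqrt ω hω (L ^ 2 + f (s i) ^ 2))
  have hd := (tendsto_covForm_sq ω ht).sub (tendsto_covForm_sq ω h)
  have h0 : Tendsto (fun n : ℕ => walkExp s (n + 1) (fun x => g x ^ 2) / ((n : ℝ) + 1) -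
      walkExp s (n + 1) (fun x => f x ^ 2) / ((n : ℝ) + 1)) ω (𝓝 0) := by
    rw [tendsto_zero_iff_abs_tendsto_zero]
    refine squeeze_zero' (Eventually.of_forall fun _ => abs_nonneg _) ?_ hlim
    filter_upwards [hκ] with n hn
    have h1 := sq_walkExp_sub_le (s := s) n (fun x => f x ^ 2) i
    have h2 : walkExp s n (fun x => f (s i * x) ^ 2) =
        walkExp s n (fun x => g x ^ 2) + f (s i) ^ 2 := by
      have e : (fun x => f (s i * x) ^ 2) = fun x => (g x ^ 2 + (2 * f (s i)) * g x) + f (s i) ^ 2 := by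
        ext x; simp only [hg, leftTranslate]; ring
      rw [e, walkExp_add, walkExp_add, walkExp_const_mul, walkExp_const,
        IsLipHarmonic.walkExp_eq ht.harmonic, ht.map_one]; ring
    have h3 : walkExp s n (fun x => g x ^ 2) ≤ walkExp s (n + 1) (fun x => g x ^ 2) ∧
        walkExp s (n + 1) (fun x => g x ^ 2) ≤ walkExp s n (fun x => g x ^ 2) + L ^ 2 := by
      rw [walkExp_succ, ← walkExp_const s n (L ^ 2), ← walkExp_add]
      refine ⟨walkExp_mono s n fun x => ?_, walkExp_mono s n fun x => ?_⟩
      · rw [markov_sq ht.harmonic]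
        exact le_add_of_nonneg_right (avg_nonneg fun _ => sq_nonneg _)
      · rw [markov_sq ht.harmonic]
        gcongr
        rw [← avg_const (ι := ι) (L ^ 2)]
        exact avg_mono fun i => sq_le_sq' (abs_le.1 (ht.lipschitz x i)).1
          (abs_le.1 (ht.lipschitz x i)).2
    have h4 : |walkExp s n (fun x => f (s i * x) ^ 2) - walkExp s (n + 1) fun x => f x ^ 2| ≤
        √M * √((n : ℝ) + 1) := by
      have hκ0 : 0 ≤ κ := by
        have := (walkHellinger_nonneg n i).trans (hn i)
        by_contra! hk
        exact absurd this (not_le.2 (div_neg_of_neg_of_pos hk (by positivity)))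
      rw [← Real.sqrt_mul (by positivity)]
      refine Real.abs_le_sqrt (h1.trans ?_)
      have h5 := h.walkExp_four_le (n + 1)
      have e : (fun x => (f x ^ 2) ^ 2) = fun x => f x ^ 4 := by ext x; ring
      rw [e]
      calc _ ≤ κ / ((n : ℝ) + 1) * (2 * (Fintype.card ι + 1) * (8 * L ^ 4 * ((n + 1 : ℕ) : ℝ) ^ 2)) := by
            gcongr
            · exact mul_nonneg (by positivity) (walkExp_nonneg s _ fun x => by positivity)
            · exact hn i
        _ = _ := by simp only [M]; push_cast; field_simp
    have hs1 : (1:ℝ) ≤ √((n : ℝ) + 1) := by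
      rw [Real.one_le_sqrt]; linarith [(Nat.cast_nonneg n : (0:ℝ) ≤ n)]
    have hs2 : √((n : ℝ) + 1) * √((n : ℝ) + 1) = n + 1 := Real.mul_self_sqrt (by positivity)
    rw [Function.comp_apply, ← sub_div, abs_div, abs_of_pos (by positivity : (0:ℝ) < n + 1), ← add_div,
      div_le_div_iff₀ (by positivity) (by positivity)]
    have h6 : |walkExp s (n + 1) (fun x => g x ^ 2) - walkExp s (n + 1) fun x => f x ^ 2| ≤
        √M * √((n : ℝ) + 1) + (L ^ 2 + f (s i) ^ 2) := by
      rw [h2] at h4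
      rw [abs_le] at h4 ⊢
      have := sq_nonneg (f (s i))
      have := sq_nonneg L
      constructor <;> linarith [h3.1, h3.2, h4.1, h4.2]
    have h7 : 0 ≤ L ^ 2 + f (s i) ^ 2 := by positivity
    calc _ ≤ (√M * √((n : ℝ) + 1) + (L ^ 2 + f (s i) ^ 2) * √((n : ℝ) + 1)) * √((n : ℝ) + 1) := by
          gcongr
          refine h6.trans ?_
          gcongr
          exact le_mul_of_one_le_right h7 hs1
      _ = _ := by rw [← add_mul, mul_assoc, hs2]
  linarith [tendsto_nhds_unique hd h0]

end Moments

end HarmonicSpace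

section HarmonicRepresentation
universe u
open scoped Classical Pointwise Topology
open Filter

variable {G : Type*} [Group G] {S : Finset G}

lemma covForm_translate {ω : Ultrafilter ℕ} (hS : IsSymmGen S) (hω : (ω : Filter ℕ) ≤ atTop) {κ : ℝ}
    (hκ : ∀ᶠ n : ℕ in ω, ∀ i, walkHellinger (pairMul S) n i ≤ κ / ((n : ℝ) + 1)) (g : G) {L : ℝ}
    {f : G → ℝ} (h : IsLipHarmonic (pairMul S) L f) :
    covForm ω (pairMul S) (leftTranslate g f) (leftTranslate g f) =
      covForm ω (pairMul S) f f := by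
  have hne := hS.nonempty
  revert g
  refine hS.induction ?_ fun x hx s hs => ?_
  · congr 1 <;> ext x <;> simp [leftTranslate, h.map_one]
  · have h1 := covForm_translate_step ω hω hκ (h.translate x) (⟨s, hs⟩, ⟨1, hS.one_mem⟩)
    rw [hx] at h1
    rw [← h1]
    congr 1 <;> ext y <;> simp [leftTranslate, pairMul, mul_assoc]

/-- The space of Lipschitz harmonic functions vanishing at the identity. -/
def harmonicSubmodule (hS : IsSymmGen S) : Submodule ℝ (G → ℝ) where
  carrier := {f | ∃ L, IsLipHarmonic (pairMul S) L f}
  zero_mem' := by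
    have := hS.nonempty
    exact ⟨0, rfl, fun x => by simp [markov, avg_const], fun x i => by simp⟩
  add_mem' := by
    rintro f f' ⟨L, h⟩ ⟨L', h'⟩
    refine ⟨L + L', by simp [h.map_one, h'.map_one], fun x => ?_, fun x i => ?_⟩
    · have h1 := h.harmonic x
      have h2 := h'.harmonic x
      simp only [markov, Pi.add_apply, avg_add] at h1 h2 ⊢
      rw [h1, h2]
    · simp only [Pi.add_apply]
      rw [add_sub_add_comm]
      exact (abs_add_le _ _).trans (add_le_add (h.lipschitz x i) (h'.lipschitz x i))
  smul_mem' := by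
    rintro c f ⟨L, h⟩
    refine ⟨|c| * L, by simp [h.map_one], fun x => ?_, fun x i => ?_⟩
    · have h1 := h.harmonic x
      simp only [markov, Pi.smul_apply, smul_eq_mul, avg_mul_left] at h1 ⊢
      rw [h1]
    · simp only [Pi.smul_apply, smul_eq_mul]
      rw [← mul_sub, abs_mul]
      exact mul_le_mul_of_nonneg_left (h.lipschitz x i) (abs_nonneg _)

/-- The space of Lipschitz harmonic functions, as a type to be endowed with the covariance form. -/
def HarmonicSpace (hS : IsSymmGen S) : Type _ := ↥(harmonicSubmodule hS)

noncomputable instance (hS : IsSymmGen S) : AddCommGroup (HarmonicSpace hS) :=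
  inferInstanceAs (AddCommGroup ↥(harmonicSubmodule hS))

noncomputable instance (hS : IsSymmGen S) : Module ℝ (HarmonicSpace hS) :=
  inferInstanceAs (Module ℝ ↥(harmonicSubmodule hS))

/-- Evaluation of the elements of the space of Lipschitz harmonic functions. -/
def HarmonicSpace.ev (hS : IsSymmGen S) : HarmonicSpace hS →ₗ[ℝ] (G → ℝ) :=
  (harmonicSubmodule hS).subtype

lemma HarmonicSpace.ev_injective (hS : IsSymmGen S) : Function.Injective (ev hS) :=
  Subtype.val_injective

lemma HarmonicSpace.prop (hS : IsSymmGen S) (v : HarmonicSpace hS) :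
    ∃ L, IsLipHarmonic (pairMul S) L (ev hS v) := v.2

/-- Translation by a group element on the space of Lipschitz harmonic functions. -/
noncomputable def HarmonicSpace.transl (hS : IsSymmGen S) (g : G) : HarmonicSpace hS →ₗ[ℝ] HarmonicSpace hS where
  toFun v := ⟨leftTranslate g (ev hS v), by
    have := hS.nonempty
    obtain ⟨L, h⟩ := prop hS v
    exact ⟨L, h.translate g⟩⟩
  map_add' v w := ev_injective hS (by ext x; exact add_sub_add_comm _ _ _ _)
  map_smul' c v := ev_injective hS (by ext x; exact (mul_sub c _ _).symm)

lemma HarmonicSpace.ev_transl (hS : IsSymmGen S) (g : G) (v : HarmonicSpace hS) (x : G) :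
    ev hS (transl hS g v) x = ev hS v (g * x) - ev hS v g := rfl

lemma IsLipHarmonic.eq_zero_of_finite_range (hS : IsSymmGen S) {L : ℝ} {f : G → ℝ}
    (h : IsLipHarmonic (pairMul S) L f) (hf : (Set.range f).Finite) : f = 0 := by
  obtain ⟨_, ⟨x₀, rfl⟩, hx₀⟩ := Set.exists_max_image _ id hf ⟨_, 1, rfl⟩
  simp only [Set.mem_range, id, forall_exists_index, forall_apply_eq_imp_iff] at hx₀
  have h1 : ∀ x, f (x₀ * x) = f x₀ := by
    refine hS.induction (by simp) fun x hx s hs => ?_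
    have h2 := h.harmonic (x₀ * x)
    rw [hx] at h2
    have := eq_of_avg_eq_of_le (fun i => hx₀ (x₀ * x * pairMul S i)) h2
      (⟨s, hs⟩, ⟨1, hS.one_mem⟩)
    simpa [pairMul, mul_assoc] using this
  ext x
  have e1 := h1 (x₀⁻¹ * x)
  have e2 := h1 (x₀⁻¹ * 1)
  rw [mul_inv_cancel_left] at e1 e2
  rw [e1, ← e2, h.map_one]; rfl

/-- An infinite finitely generated group of polynomial growth has a nonzero finite-dimensional
space of functions on which it acts by bounded affine translations. -/
theorem exists_finiteDimensional_cocycle {G : Type u} [Group G] [Group.FG G] [Infinite G] {d : ℕ}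
    (hG : GrowthLE G d) :
    ∃ (V : Type u) (_ : NormedAddCommGroup V) (_ : NormedSpace ℝ V) (_ : FiniteDimensional ℝ V)
      (_ : Nontrivial V) (ev : V →ₗ[ℝ] (G → ℝ)) (π : G →* (V →L[ℝ] V)),
      (∀ g, ‖π g‖ ≤ 1) ∧ (∀ v g x, ev v (g * x) = ev (π g⁻¹ v) x + ev v g) ∧
      ∀ v, (Set.range (ev v)).Finite → v = 0 := by
  obtain ⟨S, hS⟩ := exists_isSymmGen G
  have hne := hS.nonempty
  have hfr := frequently_walkEntropy_sub_le (pairMul S) hG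
  obtain ⟨u, hu0, hu1, huh, Lu, huL⟩ := exists_lipschitz_harmonic hS hG
  have : NeBot (atTop ⊓ 𝓟 {n : ℕ | walkEntropy (pairMul S) (n + 1) - walkEntropy (pairMul S) n ≤
    (d + 1) / ((n : ℝ) + 1)}) := frequently_iff_neBot.1 hfr
  let ω : Ultrafilter ℕ := Ultrafilter.of (atTop ⊓ 𝓟 {n : ℕ | walkEntropy (pairMul S) (n + 1) -
    walkEntropy (pairMul S) n ≤ (d + 1) / ((n : ℝ) + 1)})
  have hω : (ω : Filter ℕ) ≤ atTop := (Ultrafilter.of_le _).trans inf_le_left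
  set κ : ℝ := Fintype.card (↥S × ↥S) * (d + 1 : ℝ) with hκdef
  have hκ : ∀ᶠ n : ℕ in ω, ∀ i, walkHellinger (pairMul S) n i ≤ κ / ((n : ℝ) + 1) := by
    have : ∀ᶠ n : ℕ in ω, walkEntropy (pairMul S) (n + 1) - walkEntropy (pairMul S) n ≤
        (d + 1) / ((n : ℝ) + 1) := (Ultrafilter.of_le _).trans inf_le_right (mem_principal_self _)
    filter_upwards [this] with n hn i
    have h1 := le_card_mul_avg (F := walkHellinger (pairMul S) n)
      (fun i => walkHellinger_nonneg n i) i
    refine h1.trans ?_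
    rw [hκdef, mul_div_assoc]
    gcongr
    exact (avg_walkHellinger_le _ n).trans hn
  let ev := HarmonicSpace.ev hS
  let B : HarmonicSpace hS → HarmonicSpace hS → ℝ := fun v w => covForm ω (pairMul S) (ev v) (ev w)
  have hB : ∀ v w, Tendsto (fun n : ℕ => walkExp (pairMul S) (n + 1) (fun x => ev v x * ev w x) /
      ((n : ℝ) + 1)) ω (𝓝 (B v w)) := fun v w => by
    obtain ⟨L, h⟩ := HarmonicSpace.prop hS v
    obtain ⟨L', h'⟩ := HarmonicSpace.prop hS w
    exact tendsto_covForm ω h h'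
  set c : ℝ := κ * (2 * (Fintype.card (↥S × ↥S) + 1)) with hc
  have hBt : ∀ g v, B (HarmonicSpace.transl hS g v) (HarmonicSpace.transl hS g v) = B v v := by
    intro g v
    obtain ⟨L, h⟩ := HarmonicSpace.prop hS v
    exact covForm_translate hS hω hκ g h
  have hpt : ∀ v x i, (ev v (x * pairMul S i) - ev v x) ^ 2 ≤ c * B v v := by
    intro v x i
    obtain ⟨L, h⟩ := HarmonicSpace.prop hS v
    rw [← hBt x v]
    exact sq_apply_le_covForm ω hκ (h.translate x) i
  let core : InnerProductSpace.Core ℝ (HarmonicSpace hS) :=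
    { inner := B
      conj_inner_symm := fun v w => by
        simp only [conj_trivial, B, covForm, mul_comm]
      re_inner_nonneg := fun v => by
        obtain ⟨L, h⟩ := HarmonicSpace.prop hS v
        exact covForm_nonneg ω h
      add_left := fun v w z => by
        refine tendsto_nhds_unique (hB (v + w) z) ?_
        convert (hB v z).add (hB w z) using 2 with n
        rw [← add_div, ← walkExp_add]
        simp only [map_add, Pi.add_apply, add_mul]
      smul_left := fun v w r => by
        refine tendsto_nhds_unique (hB (r • v) w) ?_
        rw [conj_trivial]
        convert (hB v w).const_mul r using 2 with n
        rw [mul_div, ← walkExp_const_mul]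
        simp only [map_smul, Pi.smul_apply, smul_eq_mul, mul_assoc]
      definite := fun v hv => by
        change B v v = 0 at hv
        have h1 : ∀ x, ∀ s ∈ S, ev v (x * s) = ev v x := by
          intro x s hs
          have := hpt v x (⟨s, hs⟩, ⟨1, hS.one_mem⟩)
          rw [hv, mul_zero] at this
          have := pow_eq_zero_iff (two_ne_zero) |>.1 (le_antisymm this (sq_nonneg _))
          simpa [pairMul, sub_eq_zero] using this
        apply HarmonicSpace.ev_injective hS
        rw [map_zero]
        ext x
        obtain ⟨L, h⟩ := HarmonicSpace.prop hS v
        rw [Pi.zero_apply]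
        exact (hS.eq_const h1 x).trans h.map_one }
  let _ : NormedAddCommGroup (HarmonicSpace hS) := core.toNormedAddCommGroup
  let _ : InnerProductSpace ℝ (HarmonicSpace hS) := InnerProductSpace.ofCore core.toCore
  have hin : ∀ v w : HarmonicSpace hS, inner ℝ v w = B v w := fun v w => rfl
  have hpt' : ∀ (v : HarmonicSpace hS) x i, (ev v (x * pairMul S i) - ev v x) ^ 2 ≤ c * ‖v‖ ^ 2 := by
    intro v x i
    rw [← real_inner_self_eq_norm_sq, hin]
    exact hpt v x i
  have hcard : ∀ (k : ℕ) (e : Fin k → HarmonicSpace hS), Orthonormal ℝ e → (k : ℝ) ≤ c := by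
    intro k e he
    have h1 : ∀ x i, ∑ j, (ev (e j) (x * pairMul S i) - ev (e j) x) ^ 2 ≤ c := by
      intro x i
      set T := ∑ j, (ev (e j) (x * pairMul S i) - ev (e j) x) ^ 2 with hT
      have hT0 : 0 ≤ T := Finset.sum_nonneg fun _ _ => sq_nonneg _
      have h2 := hpt' (∑ j, (ev (e j) (x * pairMul S i) - ev (e j) x) • e j) x i
      have h3 : ‖∑ j, (ev (e j) (x * pairMul S i) - ev (e j) x) • e j‖ ^ 2 = T := by
        rw [← real_inner_self_eq_norm_sq, he.inner_sum]
        simp [hT, pow_two]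
      rw [h3] at h2
      have h4 : ev (∑ j, (ev (e j) (x * pairMul S i) - ev (e j) x) • e j) (x * pairMul S i) -
          ev (∑ j, (ev (e j) (x * pairMul S i) - ev (e j) x) • e j) x = T := by
        simp only [map_sum, map_smul, Finset.sum_apply, Pi.smul_apply, smul_eq_mul,
          ← Finset.sum_sub_distrib, ← mul_sub, hT, pow_two]
      rw [h4, pow_two] at h2
      rcases hT0.eq_or_lt with h0 | h0
      · rw [← h0, hc, hκdef]; positivity
      · exact le_of_mul_le_mul_right h2 h0
    have h2 : ∀ n : ℕ, walkExp (pairMul S) n (fun x => ∑ j, ev (e j) x ^ 2) ≤ n * c := by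
      intro n
      induction n with
      | zero =>
        have : ∀ j, ev (e j) 1 = 0 := fun j => by
          obtain ⟨L, h⟩ := HarmonicSpace.prop hS (e j)
          exact h.map_one
        simp [walkExp_zero, this]
      | succ n ih =>
        rw [walkExp_succ]
        have : walkExp (pairMul S) n (markov (pairMul S) fun x => ∑ j, ev (e j) x ^ 2) ≤
            walkExp (pairMul S) n fun x => (∑ j, ev (e j) x ^ 2) + c := by
          refine walkExp_mono _ n fun x => ?_
          have h3 : markov (pairMul S) (fun x => ∑ j, ev (e j) x ^ 2) x =
              ∑ j, markov (pairMul S) (fun x => ev (e j) x ^ 2) x := by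
            simp only [markov, avg_sum]
          have h4 : ∀ j, markov (pairMul S) (fun x => ev (e j) x ^ 2) x = ev (e j) x ^ 2 +
              avg fun i => (ev (e j) (x * pairMul S i) - ev (e j) x) ^ 2 := fun j => by
            obtain ⟨L, h⟩ := HarmonicSpace.prop hS (e j)
            exact markov_sq h.harmonic x
          rw [h3]
          simp only [h4]
          rw [Finset.sum_add_distrib, ← avg_sum]
          gcongr
          rw [← avg_const (ι := ↥S × ↥S) c]
          exact avg_mono fun i => h1 x i
        rw [walkExp_add, walkExp_const] at this
        push_cast; linarith
    have h3 : Tendsto (fun n : ℕ => ∑ j, walkExp (pairMul S) (n + 1)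
        (fun x => ev (e j) x * ev (e j) x) / ((n : ℝ) + 1)) ω (𝓝 (∑ j, B (e j) (e j))) :=
      tendsto_finsetSum _ fun j _ => hB _ _
    have h4 : ∑ j, B (e j) (e j) = k := by
      have : ∀ j, B (e j) (e j) = 1 := fun j => by
        rw [← hin, real_inner_self_eq_norm_sq, he.1 j]; norm_num
      simp [this]
    rw [h4] at h3
    refine le_of_tendsto' h3 fun n => ?_
    rw [← Finset.sum_div, ← walkExp_sum, div_le_iff₀ (by positivity)]
    have := h2 (n + 1)
    simp only [pow_two] at this
    push_cast at this
    linarith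
  have hfd : FiniteDimensional ℝ (HarmonicSpace hS) := by
    by_contra hnf
    obtain ⟨k, hk⟩ := exists_nat_gt c
    have h1 : (k : Cardinal) ≤ Module.rank ℝ (HarmonicSpace hS) := by
      refine (Cardinal.natCast_lt_aleph0 (n := k)).le.trans ?_
      rw [← not_lt]
      exact fun h => hnf (Module.rank_lt_aleph0_iff.1 h)
    obtain ⟨b, hb⟩ := (Module.le_rank_iff (n := k)).1 h1
    have h2 := hcard k _ (InnerProductSpace.gramSchmidtNormed_orthonormal hb)
    linarith
  have hnorm : ∀ g (v : HarmonicSpace hS), ‖HarmonicSpace.transl hS g v‖ = ‖v‖ := by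
    intro g v
    rw [← sq_eq_sq₀ (norm_nonneg _) (norm_nonneg _), ← real_inner_self_eq_norm_sq,
      ← real_inner_self_eq_norm_sq, hin, hin, hBt]
  let π : G →* (HarmonicSpace hS →L[ℝ] HarmonicSpace hS) :=
    { toFun := fun g => LinearIsometry.toContinuousLinearMap ⟨HarmonicSpace.transl hS g⁻¹, hnorm g⁻¹⟩
      map_one' := by
        ext v
        apply HarmonicSpace.ev_injective hS
        ext x
        obtain ⟨L, h⟩ := HarmonicSpace.prop hS v
        change HarmonicSpace.ev hS (HarmonicSpace.transl hS 1⁻¹ v) x = _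
        rw [HarmonicSpace.ev_transl]
        simp [h.map_one]
      map_mul' := fun g g' => by
        ext v
        apply HarmonicSpace.ev_injective hS
        ext x
        change HarmonicSpace.ev hS (HarmonicSpace.transl hS (g * g')⁻¹ v) x =
          HarmonicSpace.ev hS (HarmonicSpace.transl hS g⁻¹ (HarmonicSpace.transl hS g'⁻¹ v)) x
        simp only [HarmonicSpace.ev_transl, mul_inv_rev, mul_assoc]
        ring }
  refine ⟨HarmonicSpace hS, inferInstance, inferInstance, hfd, ?_, ev, π, ?_, ?_, ?_⟩
  · refine ⟨⟨u, Lu, hu1, huh, huL⟩, 0, fun h => hu0 ?_⟩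
    exact congrArg (HarmonicSpace.ev hS) h
  · exact fun g => LinearIsometry.norm_toContinuousLinearMap_le _
  · intro v g x
    change HarmonicSpace.ev hS v (g * x) =
      HarmonicSpace.ev hS (HarmonicSpace.transl hS g⁻¹⁻¹ v) x + HarmonicSpace.ev hS v g
    rw [HarmonicSpace.ev_transl, inv_inv]; ring
  · intro v hv
    obtain ⟨L, h⟩ := HarmonicSpace.prop hS v
    apply HarmonicSpace.ev_injective hS
    rw [map_zero]
    exact h.eq_zero_of_finite_range hS hv

end HarmonicRepresentation

section BoundedRepresentation
open scoped Classical Pointwise commutatorElement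
universe u

section Commutators
variable {G A : Type*} [Group G] [NormedRing A] {π : G →* A}

lemma norm_map_mul_le (hπ : ∀ g, ‖π g‖ ≤ 1) (g : G) (a : A) : ‖π g * a‖ ≤ ‖a‖ :=
  (norm_mul_le _ _).trans (mul_le_of_le_one_left (norm_nonneg _) (hπ g))

lemma norm_mul_map_le (hπ : ∀ g, ‖π g‖ ≤ 1) (g : G) (a : A) : ‖a * π g‖ ≤ ‖a‖ :=
  (norm_mul_le _ _).trans (mul_le_of_le_one_right (norm_nonneg _) (hπ g))

lemma norm_map_mul_sub_one_le (hπ : ∀ g, ‖π g‖ ≤ 1) (g h : G) :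
    ‖π (g * h) - 1‖ ≤ ‖π g - 1‖ + ‖π h - 1‖ := by
  have : π (g * h) - 1 = (π g - 1) + π g * (π h - 1) := by rw [map_mul]; noncomm_ring
  rw [this]
  exact (norm_add_le _ _).trans (add_le_add le_rfl (norm_map_mul_le hπ _ _))

lemma norm_map_inv_sub_one_le (hπ : ∀ g, ‖π g‖ ≤ 1) (g : G) : ‖π g⁻¹ - 1‖ ≤ ‖π g - 1‖ := by
  have : π g⁻¹ - 1 = -(π g⁻¹ * (π g - 1)) := by
    rw [mul_sub, ← map_mul]; simp
  rw [this, norm_neg]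
  exact norm_map_mul_le hπ _ _

lemma norm_map_pow_sub_one_le (hπ : ∀ g, ‖π g‖ ≤ 1) (g : G) (n : ℕ) :
    ‖π (g ^ n) - 1‖ ≤ n * ‖π g - 1‖ := by
  induction n with
  | zero => simp
  | succ n ih =>
    rw [pow_succ]
    refine (norm_map_mul_sub_one_le hπ _ _).trans ?_
    push_cast; linarith

lemma norm_map_commutator_sub_one_le (hπ : ∀ g, ‖π g‖ ≤ 1) (g h : G) :
    ‖π ⁅g, h⁆ - 1‖ ≤ 2 * ‖π g - 1‖ * ‖π h - 1‖ := by
  have : π ⁅g, h⁆ - 1 = ((π g - 1) * (π h - 1) - (π h - 1) * (π g - 1)) * π (g⁻¹ * h⁻¹) := by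
    have e : (π g - 1) * (π h - 1) - (π h - 1) * (π g - 1) = π (g * h) - π (h * g) := by
      rw [map_mul, map_mul]; noncomm_ring
    rw [e, sub_mul, ← map_mul, ← map_mul, commutatorElement_def]
    simp [mul_assoc]
  rw [this]
  refine (norm_mul_map_le hπ _ _).trans ((norm_sub_le _ _).trans ?_)
  have h1 := norm_mul_le (π g - 1) (π h - 1)
  have h2 := norm_mul_le (π h - 1) (π g - 1)
  linarith

variable [NormedAlgebra ℝ A]

lemma half_norm_le_norm_map_pow_sub_one (hπ : ∀ g, ‖π g‖ ≤ 1) (g : G) {n : ℕ} (hn : 1 ≤ n)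
    (h : n * ‖π g - 1‖ ≤ 1) : ‖π g - 1‖ / 2 ≤ ‖π (g ^ n) - 1‖ := by
  have key : ∀ n : ℕ, ‖π (g ^ n) - 1 - (n : ℝ) • (π g - 1)‖ ≤ n * (n - 1) / 2 * ‖π g - 1‖ ^ 2 := by
    intro n
    induction n with
    | zero => simp
    | succ n ih =>
      have e : π (g ^ (n + 1)) - 1 - ((n + 1 : ℕ) : ℝ) • (π g - 1) =
          (π (g ^ n) - 1 - (n : ℝ) • (π g - 1)) + (π (g ^ n) - 1) * (π g - 1) := by
        rw [pow_succ, map_mul, Nat.cast_succ, add_smul, one_smul]; noncomm_ring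
      rw [e]
      refine (norm_add_le _ _).trans ?_
      have h1 := norm_mul_le (π (g ^ n) - 1) (π g - 1)
      have h2 := mul_le_mul_of_nonneg_right (norm_map_pow_sub_one_le hπ g n) (norm_nonneg (π g - 1))
      push_cast
      nlinarith
  have h1 := key n
  set x := ‖π g - 1‖
  have hx : 0 ≤ x := norm_nonneg _
  have hn' : (1:ℝ) ≤ n := by exact_mod_cast hn
  have h2 : ‖(n : ℝ) • (π g - 1)‖ = n * x := by rw [norm_smul]; simp [x]
  have h3 := norm_sub_norm_le ((n : ℝ) • (π g - 1)) (π (g ^ n) - 1)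
  rw [h2, norm_sub_rev (_ • _)] at h3
  have h4 : n * x * x * (n - 1) ≤ 1 * x * (n - 1) := by gcongr
  nlinarith

lemma map_eq_one_of_norm_pow_sub_one_le (g : G) (h : ∀ n : ℕ, ‖π (g ^ n) - 1‖ ≤ 1 / 2) :
    π g = 1 := by
  have key : ∀ k : ℕ, (3 / 2) ^ k * ‖π g - 1‖ ≤ ‖π (g ^ 2 ^ k) - 1‖ := by
    intro k
    induction k with
    | zero => simp
    | succ k ih =>
      have e : (2 : ℝ) • (π (g ^ 2 ^ k) - 1) = (π (g ^ 2 ^ (k + 1)) - 1) -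
          (π (g ^ 2 ^ k) - 1) * (π (g ^ 2 ^ k) - 1) := by
        rw [pow_succ 2, pow_mul, pow_two, map_mul, two_smul]; noncomm_ring
      have h1 : 2 * ‖π (g ^ 2 ^ k) - 1‖ ≤ ‖π (g ^ 2 ^ (k + 1)) - 1‖ +
          ‖π (g ^ 2 ^ k) - 1‖ * ‖π (g ^ 2 ^ k) - 1‖ := by
        calc 2 * ‖π (g ^ 2 ^ k) - 1‖ = ‖(2 : ℝ) • (π (g ^ 2 ^ k) - 1)‖ := by rw [norm_smul]; simp
          _ ≤ _ := by
            rw [e]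
            exact (norm_sub_le _ _).trans (by gcongr; exact norm_mul_le _ _)
      have h2 := mul_le_mul_of_nonneg_right (h (2 ^ k)) (norm_nonneg (π (g ^ 2 ^ k) - 1))
      rw [pow_succ]
      linarith
  by_contra hne
  have hpos : 0 < ‖π g - 1‖ := norm_pos_iff.2 (sub_ne_zero.2 hne)
  obtain ⟨k, hk⟩ := pow_unbounded_of_one_lt (1 / 2 / ‖π g - 1‖) (by norm_num : (1:ℝ) < 3 / 2)
  rw [div_lt_iff₀ hpos] at hk
  linarith [key k, h (2 ^ k)]

/-- If the iterated commutators `⁅..⁅g, h⁆.., h⁆` of elements with small displacement become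
trivial, then `g` and `h` already commute. -/
lemma map_commutator_eq_one_of_iterate (hπ : ∀ g, ‖π g‖ ≤ 1) {g h : G} (hg : ‖π g - 1‖ ≤ 1 / 4)
    (hh : ‖π h - 1‖ ≤ 1 / 4) (k : ℕ) (hk : π ((fun x => ⁅x, h⁆)^[k] g) = 1) : π ⁅g, h⁆ = 1 := by
  induction k generalizing g with
  | zero =>
    simp only [Function.iterate_zero, id] at hk
    have e : ⁅g, h⁆ = g * h * g⁻¹ * h⁻¹ := rfl
    have hgi : π g⁻¹ = 1 := by
      have : π g⁻¹ * π g = 1 := by rw [← map_mul]; simp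
      rwa [hk, mul_one] at this
    rw [e]
    simp only [map_mul, hk, hgi, one_mul, mul_one]
    rw [← map_mul]; simp
  | succ k ih =>
    rw [Function.iterate_succ_apply] at hk
    have hx0 : ‖π g - 1‖ * ‖π h - 1‖ ≤ 1 / 4 * (1 / 4) := by gcongr
    have h2 := norm_map_commutator_sub_one_le hπ g h
    have h1 : π ⁅⁅g, h⁆, h⁆ = 1 := ih (by linarith) hk
    have hcomm : π (⁅g, h⁆ * h) = π (h * ⁅g, h⁆) := by
      have : ⁅g, h⁆ * h = ⁅⁅g, h⁆, h⁆ * (h * ⁅g, h⁆) := by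
        simp only [commutatorElement_def]; group
      rw [this, map_mul, h1, one_mul]
    have hB : ∀ n : ℕ, π (h ^ n * g) = π ((⁅g, h⁆⁻¹) ^ n * g * h ^ n) := by
      intro n
      induction n with
      | zero => simp
      | succ n ihn =>
        have e1 : h * g = ⁅g, h⁆⁻¹ * g * h := by simp only [commutatorElement_def]; group
        have e2 : ∀ n : ℕ, π (h ^ n * ⁅g, h⁆⁻¹) = π (⁅g, h⁆⁻¹ * h ^ n) := by
          intro n
          induction n with
          | zero => simp
          | succ n ihn =>
            have e3 : π (h * ⁅g, h⁆⁻¹) = π (⁅g, h⁆⁻¹ * h) := by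
              have a1 : h * ⁅g, h⁆⁻¹ = ⁅g, h⁆⁻¹ * (⁅g, h⁆ * h) * ⁅g, h⁆⁻¹ := by group
              have a2 : ⁅g, h⁆⁻¹ * h = ⁅g, h⁆⁻¹ * (h * ⁅g, h⁆) * ⁅g, h⁆⁻¹ := by group
              rw [a1, a2, map_mul, map_mul _ _ (⁅g, h⁆ * h), hcomm]
              simp only [map_mul]
            calc π (h ^ (n + 1) * ⁅g, h⁆⁻¹) = π (h ^ n) * π (h * ⁅g, h⁆⁻¹) := by
                  rw [← map_mul, pow_succ, mul_assoc]
              _ = π (h ^ n * ⁅g, h⁆⁻¹) * π h := by rw [e3]; simp only [map_mul, mul_assoc]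
              _ = _ := by rw [ihn, pow_succ]; simp only [map_mul, mul_assoc]
        calc π (h ^ (n + 1) * g) = π (h ^ n) * π (h * g) := by rw [← map_mul, pow_succ, mul_assoc]
          _ = π (h ^ n * ⁅g, h⁆⁻¹) * π (g * h) := by rw [e1]; simp only [map_mul, mul_assoc]
          _ = π ⁅g, h⁆⁻¹ * π (h ^ n * g) * π h := by rw [e2]; simp only [map_mul, mul_assoc]
          _ = _ := by rw [ihn, pow_succ' (⁅g, h⁆⁻¹), pow_succ h]; simp only [map_mul, mul_assoc]
    have hC : π ⁅g, h⁆⁻¹ = 1 := by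
      refine map_eq_one_of_norm_pow_sub_one_le _ fun n => ?_
      have e : π ((⁅g, h⁆⁻¹) ^ n) = π (h ^ n * g * (h ^ n)⁻¹ * g⁻¹) := by
        have a1 : (⁅g, h⁆⁻¹) ^ n = ((⁅g, h⁆⁻¹) ^ n * g * h ^ n) * ((h ^ n)⁻¹ * g⁻¹) := by group
        rw [a1, map_mul, ← hB, ← map_mul]; simp only [mul_assoc]
      rw [e]
      refine (norm_map_mul_sub_one_le hπ _ _).trans ?_
      have e2 : π (h ^ n * g * (h ^ n)⁻¹) - 1 = π (h ^ n) * ((π g - 1) * π (h ^ n)⁻¹) := by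
        rw [sub_mul, mul_sub, one_mul, ← map_mul, ← map_mul, ← map_mul]
        simp [mul_assoc]
      have e3 := norm_map_inv_sub_one_le hπ g
      have e4 : ‖π (h ^ n * g * (h ^ n)⁻¹) - 1‖ ≤ ‖π g - 1‖ := by
        rw [e2]
        exact (norm_map_mul_le hπ _ _).trans (norm_mul_map_le hπ _ _)
      linarith
    have : π ⁅g, h⁆ * π ⁅g, h⁆⁻¹ = 1 := by rw [← map_mul, mul_inv_cancel, map_one]
    rwa [hC, mul_one] at this

end Commutators
end BoundedRepresentation

section BoundedRepresentationGrowth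
open scoped Classical Pointwise commutatorElement
universe u

section Products
variable {G A : Type*} [Group G]

/-- Products of powers of the iterated commutators of `g` with `h`. -/
def commProd (h : G) : (k : ℕ) → G → (ℕ → ℕ) → G
  | 0, _, _ => 1
  | k + 1, g, a => g ^ a 0 * commProd h k ⁅g, h⁆ fun i => a (i + 1)

lemma commProd_mem {S : Finset G} (h1 : 1 ∈ S) (hinv : ∀ x ∈ S, x⁻¹ ∈ S) {h : G} (hh : h ∈ S)
    {m : ℕ} {a : ℕ → ℕ} (ha : ∀ i, a i < m) (k : ℕ) {g : G} {l : ℕ} (hg : g ∈ S ^ l) :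
    commProd h k g a ∈ S ^ (m * ((l + 2) * (2 ^ k - 1))) := by
  have hinvp : ∀ n, ∀ x ∈ S ^ n, x⁻¹ ∈ S ^ n := by
    have : S⁻¹ = S := by
      ext x; simp only [Finset.mem_inv']
      exact ⟨fun hx => by simpa using hinv _ hx, hinv x⟩
    intro n x hx
    have h2 := Finset.inv_mem_inv hx
    rwa [← inv_pow, this] at h2
  induction k generalizing g l a with
  | zero => exact Finset.one_mem_pow h1
  | succ k ih =>
    have hc : ⁅g, h⁆ ∈ S ^ (l + 1 + l + 1) := by
      rw [commutatorElement_def, pow_succ, pow_add, pow_succ]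
      exact Finset.mul_mem_mul (Finset.mul_mem_mul (Finset.mul_mem_mul hg hh) (hinvp _ _ hg))
        (hinv _ hh)
    have h2 := ih (a := fun i => a (i + 1)) (fun i => ha _) hc
    have h3 : g ^ a 0 ∈ S ^ (l * a 0) := by rw [pow_mul]; exact Finset.pow_mem_pow hg
    have h4 := Finset.mul_mem_mul h3 h2
    rw [← pow_add] at h4
    refine Finset.pow_subset_pow_right h1 ?_ h4
    have e1 : l * a 0 ≤ l * m := Nat.mul_le_mul_left _ (ha 0).le
    obtain ⟨q, hq⟩ : ∃ q, 2 ^ k = q + 1 := ⟨2 ^ k - 1, (Nat.sub_add_cancel Nat.one_le_two_pow).symm⟩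
    have e3 : 2 ^ (k + 1) - 1 = 2 * q + 1 := by lia
    rw [e3, hq, Nat.add_sub_cancel]
    nlinarith

variable [NormedRing A] {π : G →* A}

lemma norm_map_commProd_sub_one_le (hπ : ∀ g, ‖π g‖ ≤ 1) {m : ℕ} {a : ℕ → ℕ} (ha : ∀ i, a i < m)
    {h : G} (hh : ‖π h - 1‖ ≤ 1 / 4) (k : ℕ) (g : G) :
    ‖π (commProd h k g a) - 1‖ ≤ 2 * m * ‖π g - 1‖ := by
  induction k generalizing g a with
  | zero => simp [commProd]; positivity
  | succ k ih =>
    rw [commProd]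
    refine (norm_map_mul_sub_one_le hπ _ _).trans ?_
    have h1 := norm_map_pow_sub_one_le hπ g (a 0)
    have h2 := ih (a := fun i => a (i + 1)) (fun i => ha _) ⁅g, h⁆
    have h3 := norm_map_commutator_sub_one_le hπ g h
    have h4 : ‖π g - 1‖ * ‖π h - 1‖ ≤ ‖π g - 1‖ * (1 / 4) := by gcongr
    have h5 : (a 0 : ℝ) * ‖π g - 1‖ ≤ m * ‖π g - 1‖ := by
      gcongr; exact (ha 0).le
    have h6 : 2 * (m:ℝ) * ‖π ⁅g, h⁆ - 1‖ ≤ 2 * m * (‖π g - 1‖ * (1 / 2)) := by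
      gcongr; linarith
    linarith

lemma eq_of_map_commProd_eq [NormedAlgebra ℝ A] (hπ : ∀ g, ‖π g‖ ≤ 1) {m : ℕ} (hm : 1 ≤ m) {h : G}
    (hh : ‖π h - 1‖ ≤ 1 / (32 * m)) (k : ℕ) {g : G} (hg : ‖π g - 1‖ ≤ 1 / (32 * m))
    (hne : ∀ i, π ((fun x => ⁅x, h⁆)^[i] g) ≠ 1) {a b : ℕ → ℕ} (ha : ∀ i, a i < m)
    (hb : ∀ i, b i < m) (hab : π (commProd h k g a) = π (commProd h k g b)) :
    ∀ i < k, a i = b i := by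
  have hm' : (1:ℝ) ≤ m := by exact_mod_cast hm
  have hq : 1 / (32 * (m:ℝ)) ≤ 1 / 4 := by
    rw [div_le_div_iff₀ (by positivity) (by norm_num)]; linarith
  induction k generalizing g a b with
  | zero => intro i hi; lia
  | succ k ih =>
    have hlt : ∀ {a b : ℕ → ℕ}, (∀ i, a i < m) → (∀ i, b i < m) →
        π (commProd h (k + 1) g a) = π (commProd h (k + 1) g b) → ¬ b 0 < a 0 := by
      intro a b ha hb hab hlt
      set P := commProd h k ⁅g, h⁆ fun i => a (i + 1)
      set Q := commProd h k ⁅g, h⁆ fun i => b (i + 1)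
      have h1 : π (g ^ (a 0 - b 0)) = π (Q * P⁻¹) := by
        have e1 : g ^ (a 0 - b 0) = (g ^ b 0)⁻¹ * ((g ^ a 0 * P) * P⁻¹) := by
          rw [mul_inv_cancel_right, pow_sub _ hlt.le]
          exact ((Commute.refl g).pow_pow _ _).inv_right.eq
        have e2 : Q * P⁻¹ = (g ^ b 0)⁻¹ * ((g ^ b 0 * Q) * P⁻¹) := by group
        rw [e1, e2, map_mul, map_mul, map_mul _ _ (_ * P⁻¹), map_mul _ _ P⁻¹]
        congr 2
      have h2 : ‖π (Q * P⁻¹) - 1‖ ≤ 4 * m * ‖π ⁅g, h⁆ - 1‖ := by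
        refine (norm_map_mul_sub_one_le hπ _ _).trans ?_
        have e1 := norm_map_commProd_sub_one_le hπ (a := fun i => a (i + 1)) (fun i => ha _)
          (hh.trans hq) k ⁅g, h⁆
        have e2 := norm_map_commProd_sub_one_le hπ (a := fun i => b (i + 1)) (fun i => hb _)
          (hh.trans hq) k ⁅g, h⁆
        have e3 := norm_map_inv_sub_one_le hπ P
        linarith
      have h3 := norm_map_commutator_sub_one_le hπ g h
      have hx : 0 < ‖π g - 1‖ := norm_pos_iff.2 (sub_ne_zero.2 (hne 0))
      have h4 : ‖π g - 1‖ / 2 ≤ ‖π (g ^ (a 0 - b 0)) - 1‖ := by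
        refine half_norm_le_norm_map_pow_sub_one hπ g (by lia) ?_
        calc ((a 0 - b 0 : ℕ) : ℝ) * ‖π g - 1‖ ≤ m * (1 / (32 * m)) := by
              gcongr
              have := ha 0
              lia
          _ ≤ 1 := by field_simp; norm_num
      rw [h1] at h4
      have h5 : 4 * m * ‖π ⁅g, h⁆ - 1‖ ≤ 4 * m * (2 * ‖π g - 1‖ * (1 / (32 * m))) := by
        gcongr
        exact h3.trans (by gcongr)
      have h6 : 4 * m * (2 * ‖π g - 1‖ * (1 / (32 * m))) = ‖π g - 1‖ / 4 := by field_simp; norm_num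
      linarith
    have h0 : a 0 = b 0 := le_antisymm (not_lt.1 (hlt ha hb hab)) (not_lt.1 (hlt hb ha hab.symm))
    have htail : π (commProd h k ⁅g, h⁆ fun i => a (i + 1)) =
        π (commProd h k ⁅g, h⁆ fun i => b (i + 1)) := by
      simp only [commProd, h0, map_mul] at hab
      have e : π (g ^ b 0)⁻¹ * π (g ^ b 0) = 1 := by rw [← map_mul]; simp
      have := congrArg (π (g ^ b 0)⁻¹ * ·) hab
      simpa only [← mul_assoc, e, one_mul] using this
    have hg' : ‖π ⁅g, h⁆ - 1‖ ≤ 1 / (32 * m) := by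
      refine (norm_map_commutator_sub_one_le hπ g h).trans ?_
      calc 2 * ‖π g - 1‖ * ‖π h - 1‖ ≤ 2 * (1 / (32 * m)) * (1 / 4) := by
            gcongr; exact hh.trans hq
        _ ≤ _ := by have : 0 < 1 / (32 * (m:ℝ)) := by positivity
                    linarith
    have := ih hg' (fun i => hne (i + 1)) (a := fun i => a (i + 1)) (b := fun i => b (i + 1))
      (fun i => ha _) (fun i => hb _) htail
    intro i hi
    cases i with
    | zero => exact h0
    | succ i => exact this i (by lia)

lemma map_commutator_eq_one_of_growthLE [NormedAlgebra ℝ A] (hπ : ∀ g, ‖π g‖ ≤ 1) {d : ℕ}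
    (hG : GrowthLE G d) {g h : G} (hg : ‖π g - 1‖ ≤ 1 / (32 * (2 ^ (d + 1) : ℕ)))
    (hh : ‖π h - 1‖ ≤ 1 / (32 * (2 ^ (d + 1) : ℕ))) : π ⁅g, h⁆ = 1 := by
  set m : ℕ := 2 ^ (d + 1) with hm
  have hm1 : 1 ≤ m := Nat.one_le_two_pow
  have hm' : (1:ℝ) ≤ m := by exact_mod_cast hm1
  have hq : 1 / (32 * (m:ℝ)) ≤ 1 / 4 := by
    rw [div_le_div_iff₀ (by positivity) (by norm_num)]; linarith
  by_contra hne0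
  have hne : ∀ i, π ((fun x => ⁅x, h⁆)^[i] g) ≠ 1 := fun i hi =>
    hne0 (map_commutator_eq_one_of_iterate hπ (hg.trans hq) (hh.trans hq) i hi)
  set S : Finset G := {1, g, h, g⁻¹, h⁻¹} with hS
  have hS1 : 1 ∈ S := by simp [hS]
  have hSi : ∀ x ∈ S, x⁻¹ ∈ S := by
    intro x hx
    simp only [hS, Finset.mem_insert, Finset.mem_singleton] at hx ⊢
    rcases hx with rfl | rfl | rfl | rfl | rfl <;> simp
  obtain ⟨C, hC⟩ := hG S
  have key : ∀ k : ℕ, m ^ k ≤ C * (m * (3 * 2 ^ k) + 1) ^ d := by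
    intro k
    refine le_trans ?_ (hC _)
    let ext : (Fin k → Fin m) → ℕ → ℕ := fun a i => if hi : i < k then a ⟨i, hi⟩ else 0
    have hext : ∀ a i, ext a i < m := fun a i => by
      simp only [ext]; split_ifs
      · exact (a _).2
      · lia
    have hcard : (Finset.univ : Finset (Fin k → Fin m)).card = m ^ k := by simp
    rw [← hcard]
    refine Finset.card_le_card_of_injOn (fun a => commProd h k g (ext a)) ?_ ?_
    · intro a _
      have := commProd_mem hS1 hSi (h := h) (by simp [hS]) (hext a) k (g := g) (l := 1)
        (by simp [hS])
      refine Finset.pow_subset_pow_right hS1 ?_ this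
      gcongr
      lia
    · intro a _ b _ hab
      have := eq_of_map_commProd_eq hπ hm1 hh k hg hne (hext a) (hext b) (congrArg π hab)
      ext i
      have := this i i.2
      simpa [ext] using this
  have key2 : ∀ k : ℕ, 2 ^ k ≤ C * (4 * m) ^ d := by
    intro k
    have h1 := key k
    have h2 : (m * (3 * 2 ^ k) + 1) ^ d ≤ (4 * m) ^ d * 2 ^ (k * d) := by
      rw [pow_mul, ← mul_pow]
      gcongr
      have : 1 ≤ m * 2 ^ k := Nat.mul_pos hm1 (by positivity)
      nlinarith
    have h3 : m ^ k = 2 ^ k * 2 ^ (k * d) := by rw [hm, ← pow_mul, ← pow_add]; ring_nf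
    rw [h3] at h1
    refine Nat.le_of_mul_le_mul_right ((h1.trans (Nat.mul_le_mul_left _ h2)).trans_eq ?_)
      (by positivity : 0 < 2 ^ (k * d))
    ring
  exact absurd (key2 (C * (4 * m) ^ d)) (not_le.2 Nat.lt_two_pow_self)

end Products

/-- A finitely generated group with infinite image in a commutative group surjects onto `ℤ`. -/
lemma exists_surjective_int_of_infinite_range {N A : Type*} [Group N] [Group.FG N] [Group A]
    (φ : N →* A) (hc : ∀ x y, φ x * φ y = φ y * φ x) (hinf : Infinite φ.range) :
    ∃ f : N →* Multiplicative ℤ, Function.Surjective f := by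
  let _ : CommGroup φ.range :=
    { (inferInstance : Group φ.range) with
      mul_comm := by
        rintro ⟨_, x, rfl⟩ ⟨_, y, rfl⟩
        exact Subtype.ext (hc x y) }
  have hfg : Group.FG φ.range := Group.fg_of_surjective φ.rangeRestrict_surjective
  obtain ⟨ι, j, _, _, p, hp, e, ⟨E⟩⟩ :=
    CommGroup.equiv_free_prod_prod_multiplicative_zmod φ.range
  rcases isEmpty_or_nonempty j with hj | ⟨⟨i⟩⟩
  · have : ∀ i, NeZero (p i ^ e i) := fun i => ⟨pow_ne_zero _ (hp i).ne_zero⟩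
    have : ∀ i, Finite (Multiplicative (ZMod (p i ^ e i))) := fun i =>
      inferInstanceAs (Finite (ZMod (p i ^ e i)))
    exact absurd (Finite.of_equiv _ E.symm.toEquiv) (not_finite_iff_infinite.2 hinf)
  · refine ⟨(Pi.evalMonoidHom (fun _ : j => Multiplicative ℤ) i).comp
      ((MonoidHom.fst _ _).comp (E.toMonoidHom.comp φ.rangeRestrict)), ?_⟩
    refine (Function.surjective_eval i).comp (Prod.fst_surjective.comp
      (E.surjective.comp φ.rangeRestrict_surjective))

end BoundedRepresentationGrowth

section VirtualSurjection
open scoped Classical Pointwise commutatorElement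
universe u

/-- An isometric representation on a finite dimensional space of a group of polynomial growth is
commutative on a subgroup of finite index. -/
lemma exists_finiteIndex_commute_of_growthLE {G A : Type*} [Group G] [NormedRing A]
    [NormedAlgebra ℝ A] [FiniteDimensional ℝ A] {π : G →* A} (hπ : ∀ g, ‖π g‖ ≤ 1) {d : ℕ}
    (hG : GrowthLE G d) :
    ∃ L : Subgroup G, L.FiniteIndex ∧ ∀ x ∈ L, ∀ y ∈ L, Commute (π x) (π y) := by
  set ε : ℝ := 1 / (32 * (2 ^ (d + 1) : ℕ)) with hε
  have hε0 : 0 < ε := by positivity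
  set U : Set G := {g | ‖π g - 1‖ ≤ ε} with hU
  refine ⟨Subgroup.closure U, ?_, ?_⟩
  · have : ProperSpace A := FiniteDimensional.proper ℝ A
    have htb : TotallyBounded (Set.range π) :=
      (isCompact_closedBall (0 : A) 1).totallyBounded.subset (by
        rintro _ ⟨g, rfl⟩; simpa using hπ g)
    obtain ⟨t, ht, htf, hcov⟩ := Metric.finite_approx_of_totallyBounded htb ε hε0
    choose! r hr using fun y (hy : y ∈ t) => ht hy
    have hfin : Finite (G ⧸ Subgroup.closure U) := by
      refine Set.finite_univ_iff.1 ((htf.image fun y => (r y : G ⧸ Subgroup.closure U)).subset ?_)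
      intro q _
      obtain ⟨g, rfl⟩ := QuotientGroup.mk_surjective q
      obtain ⟨y, hy, hgy⟩ := Set.mem_iUnion₂.1 (hcov ⟨g, rfl⟩)
      refine ⟨y, hy, QuotientGroup.eq.2 (Subgroup.subset_closure ?_)⟩
      have e : π ((r y)⁻¹ * g) - 1 = π (r y)⁻¹ * (π g - y) := by
        have : π (r y)⁻¹ * y = 1 := by
          nth_rewrite 2 [← hr y hy]
          rw [← map_mul, inv_mul_cancel, map_one]
        rw [mul_sub, this, map_mul]
      show ‖_‖ ≤ ε
      rw [e]
      refine (norm_mul_le _ _).trans ?_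
      have h1 := hπ (r y)⁻¹
      have h2 : ‖π g - y‖ < ε := by simpa [dist_eq_norm] using hgy
      nlinarith [norm_nonneg (π g - y), norm_nonneg (π (r y)⁻¹)]
    exact Subgroup.finiteIndex_of_finite_quotient
  · have hcomm : ∀ x ∈ U, ∀ y ∈ U, Commute (π x) (π y) := by
      intro x hx y hy
      have h1 := map_commutator_eq_one_of_growthLE hπ hG hx hy
      have h2 : x * y = ⁅x, y⁆ * (y * x) := by rw [commutatorElement_def]; group
      show π x * π y = π y * π x
      rw [← map_mul, h2, map_mul, h1, one_mul, map_mul]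
    have hinv : ∀ {x : G} {b : A}, Commute (π x) b → Commute (π x⁻¹) b := by
      intro x b h
      have : Commute (((π.toHomUnits x)⁻¹ : Aˣ) : A) b := Commute.units_inv_left h
      rwa [← map_inv] at this
    have step : ∀ b : A, (∀ x ∈ U, Commute (π x) b) → ∀ x ∈ Subgroup.closure U,
        Commute (π x) b := by
      intro b hb x hx
      induction hx using Subgroup.closure_induction with
      | mem x hx => exact hb x hx
      | one => simp
      | mul x y _ _ h1 h2 => rw [map_mul]; exact h1.mul_left h2
      | inv x _ h => exact hinv h
    intro x hx y hy
    refine step _ (fun x hx => ?_) x hx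
    exact (step _ (fun y hy => hcomm y hy x hx) y hy).symm

/-- An infinite finitely generated group of polynomial growth virtually surjects onto `ℤ`. -/
theorem exists_finiteIndex_surjective_int {G : Type u} [Group G] [Group.FG G] [Infinite G] {d : ℕ}
    (hG : GrowthLE G d) : ∃ H : Subgroup G, H.FiniteIndex ∧
      ∃ f : H →* Multiplicative ℤ, Function.Surjective f := by
  obtain ⟨V, _, _, _, _, ev, π, hπ, hev, hfinv⟩ := exists_finiteDimensional_cocycle hG
  obtain ⟨L, hL, hcomm⟩ := exists_finiteIndex_commute_of_growthLE hπ hG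
  set ρ := π.toHomUnits
  have hLfg : Group.FG L := Subgroup.fg_of_index_ne_zero L
  by_cases hinf : Infinite (ρ.comp L.subtype).range
  · refine ⟨L, hL, exists_surjective_int_of_infinite_range (ρ.comp L.subtype) ?_ hinf⟩
    intro x y
    exact Units.ext (hcomm x x.2 y y.2)
  have hfin : Finite (L.map ρ) := by
    rw [not_infinite_iff_finite, MonoidHom.range_comp, Subgroup.range_subtype] at hinf
    exact hinf
  have hN : ρ.ker.FiniteIndex := by
    constructor
    have h1 := Subgroup.relIndex_ker L ρ
    have h2 : (ρ.ker ⊓ L).relIndex L * L.index = (ρ.ker ⊓ L).index :=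
      Subgroup.relIndex_mul_index inf_le_right
    rw [Subgroup.inf_relIndex_right, h1] at h2
    have h3 : (ρ.ker ⊓ L).index ≠ 0 := by
      rw [← h2]; exact mul_ne_zero Nat.card_pos.ne' hL.index_ne_zero
    have : (ρ.ker ⊓ L).FiniteIndex := ⟨h3⟩
    exact (Subgroup.finiteIndex_of_le (H := ρ.ker ⊓ L) inf_le_left).index_ne_zero
  have hNfg : Group.FG ρ.ker := Subgroup.fg_of_index_ne_zero _
  obtain ⟨v, hv⟩ := exists_ne (0 : V)
  have hker : ∀ n ∈ ρ.ker, ∀ x, ev v (n * x) = ev v x + ev v n := by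
    intro n hn x
    have : π n⁻¹ = 1 := by
      exact congrArg Units.val (inv_mem hn : n⁻¹ ∈ ρ.ker)
    rw [hev, this]; rfl
  let φ : ρ.ker →* Multiplicative ℝ := MonoidHom.mk' (fun n => Multiplicative.ofAdd (ev v n))
    fun a b => by
      rw [← ofAdd_add, Subgroup.coe_mul, hker a a.2, add_comm]
  refine ⟨ρ.ker, hN, exists_surjective_int_of_infinite_range φ (fun x y => mul_comm _ _) ?_⟩
  by_contra hfinφ
  rw [not_infinite_iff_finite] at hfinφ
  have hzero : ∀ n ∈ ρ.ker, ev v n = 0 := by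
    intro n hn
    obtain ⟨k, hk, hk1⟩ := isOfFinOrder_iff_pow_eq_one.1 (isOfFinOrder_of_finite
      (⟨φ ⟨n, hn⟩, ⟨n, hn⟩, rfl⟩ : φ.range))
    have h1 := congrArg (fun z : φ.range => Multiplicative.toAdd (z : Multiplicative ℝ)) hk1
    have h2 : k • ev v n = 0 := by simpa [φ] using h1
    rcases smul_eq_zero.1 h2 with h | h
    · lia
    · exact h
  refine hv (hfinv v ?_)
  have : Finite (G ⧸ ρ.ker) := Subgroup.finite_quotient_of_finiteIndex
  refine (Set.finite_range fun q : G ⧸ ρ.ker => ev v q.out).subset ?_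
  rintro _ ⟨x, rfl⟩
  refine ⟨(x : G ⧸ ρ.ker), ?_⟩
  set y := (x : G ⧸ ρ.ker).out
  have hy : y⁻¹ * x ∈ ρ.ker := QuotientGroup.eq.1 (QuotientGroup.out_eq' _)
  have h1 : x * y⁻¹ ∈ ρ.ker := by
    have := (inferInstance : ρ.ker.Normal).mem_comm hy
    exact this
  have h2 := hker _ h1 y
  rw [hzero _ h1, inv_mul_cancel_right] at h2
  simpa using h2.symm

end VirtualSurjection

section ConjugateWords
open scoped Classical Pointwise
variable {G : Type*} [Group G]

/-- The product of the conjugates `tⁱ z t⁻ⁱ` selected by a list of booleans. -/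
def conjWord (t z : G) : List Bool → G
  | [] => 1
  | b :: l => (if b then z else 1) * (t * conjWord t z l * t⁻¹)

lemma conjWord_mem {S : Finset G} {t z : G} (h1 : 1 ∈ S) (ht : t ∈ S) (hti : t⁻¹ ∈ S) (hz : z ∈ S)
    (l : List Bool) : conjWord t z l ∈ S ^ (3 * l.length) := by
  induction l with
  | nil => exact Finset.one_mem_pow h1
  | cons b l ih =>
    have h2 : conjWord t z (b :: l) ∈ S * (S * S ^ (3 * l.length) * S) :=
      Finset.mul_mem_mul (by split_ifs <;> assumption)
        (Finset.mul_mem_mul (Finset.mul_mem_mul ht ih) hti)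
    rw [← pow_succ', ← pow_succ, ← pow_succ'] at h2
    convert h2 using 2
    simp only [List.length_cons]; ring

lemma exists_conjWord_eq {d : ℕ} (hG : GrowthLE G d) (t z : G) :
    ∃ l l' : List Bool, z * (t * conjWord t z l * t⁻¹) = t * conjWord t z l' * t⁻¹ := by
  by_contra! hne
  have hinj : ∀ l l' : List Bool, l.length = l'.length → conjWord t z l = conjWord t z l' →
      l = l' := by
    intro l
    induction l with
    | nil => intro l' hl _; exact (List.length_eq_zero_iff.1 hl.symm).symm
    | cons b l ih =>
      intro l' hl h
      obtain _ | ⟨b', l'⟩ := l'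
      · simp at hl
      have hl' : l.length = l'.length := by simpa using hl
      cases b <;> cases b' <;> simp only [conjWord, if_true, Bool.false_eq_true, if_false, one_mul] at h
      · rw [ih l' hl' (by simpa using h)]
      · exact absurd h.symm (hne _ _)
      · exact absurd h (hne _ _)
      · rw [ih l' hl' (by simpa using h)]
  obtain ⟨C, hC⟩ := hG {1, t, t⁻¹, z}
  have key : ∀ n : ℕ, 2 ^ n ≤ C * (3 * n + 1) ^ d := by
    intro n
    refine le_trans ?_ (hC _)
    rw [← Fintype.card_bool, ← card_vector n, ← Finset.card_univ]
    refine Finset.card_le_card_of_injOn (fun v : List.Vector Bool n => conjWord t z v.1) ?_ ?_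
    · intro v _
      have := conjWord_mem (S := {1, t, t⁻¹, z}) (t := t) (z := z) (by simp) (by simp) (by simp)
        (by simp) v.1
      rwa [v.2] at this
    · intro v _ v' _ h
      exact Subtype.ext (hinj _ _ (v.2.trans v'.2.symm) h)
  have h1 : Filter.Tendsto (fun n : ℕ => (n : ℝ) ^ d / 2 ^ n) Filter.atTop (nhds 0) :=
    tendsto_pow_const_div_const_pow_of_one_lt d one_lt_two
  have h2 : ∀ᶠ n : ℕ in Filter.atTop, (n : ℝ) ^ d / 2 ^ n < 1 / (C * 4 ^ d + 1) :=
    h1.eventually_lt_const (by positivity)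
  obtain ⟨n, hn, hn1⟩ := (h2.and (Filter.eventually_ge_atTop 1)).exists
  rw [div_lt_div_iff₀ (by positivity) (by positivity)] at hn
  have h3 : (2 : ℝ) ^ n ≤ C * (4 * n) ^ d := by
    calc (2 : ℝ) ^ n ≤ C * (3 * n + 1) ^ d := by exact_mod_cast key n
      _ ≤ C * (4 * n) ^ d := by
        gcongr
        have : (1 : ℝ) ≤ n := by exact_mod_cast hn1
        linarith
  rw [mul_pow] at h3
  nlinarith [pow_nonneg (Nat.cast_nonneg (α := ℝ) n) d]

/-- Under polynomial growth, the eigenvalues of a conjugation on a normalized subgroup lie outside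
the open unit disc. -/
lemma one_le_norm_of_conj_eigenvalue {d : ℕ} (hG : GrowthLE G d) {A : Subgroup G} {t : G}
    (ht : ∀ a ∈ A, t * a * t⁻¹ ∈ A) (f : G → ℂ) (hf : ∀ a ∈ A, ∀ b ∈ A, f (a * b) = f a + f b)
    {μ : ℂ} (hμ : ∀ a ∈ A, f (t * a * t⁻¹) = μ * f a) {a : G} (ha : a ∈ A) (hfa : f a ≠ 0) :
    1 ≤ ‖μ‖ := by
  by_contra! hlt
  obtain ⟨k, hk⟩ := exists_pow_lt_of_lt_one (by norm_num : (0:ℝ) < 1 / 3) hlt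
  have hconj : ∀ a ∈ A, ∀ k : ℕ, t ^ k * a * (t ^ k)⁻¹ ∈ A ∧
      f (t ^ k * a * (t ^ k)⁻¹) = μ ^ k * f a := by
    intro a ha k
    induction k with
    | zero => simpa using ha
    | succ k ih =>
      have e : t ^ (k + 1) * a * (t ^ (k + 1))⁻¹ = t * (t ^ k * a * (t ^ k)⁻¹) * t⁻¹ := by
        rw [pow_succ']; group
      rw [e]
      exact ⟨ht _ ih.1, by rw [hμ _ ih.1, ih.2]; ring⟩
  have h1 : f 1 = 0 := by simpa using hf 1 A.one_mem 1 A.one_mem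
  have hw : ∀ l : List Bool, conjWord (t ^ k) a l ∈ A ∧
      ‖f (conjWord (t ^ k) a l)‖ ≤ 3 / 2 * ‖f a‖ := by
    intro l
    induction l with
    | nil => exact ⟨A.one_mem, by simp [conjWord, h1]⟩
    | cons b l ih =>
      have h2 : (if b then a else 1) ∈ A := by split_ifs; exacts [ha, A.one_mem]
      have h3 : ‖f (if b then a else 1)‖ ≤ ‖f a‖ := by
        split_ifs
        · exact le_rfl
        · simp [h1]
      obtain ⟨h4, h5⟩ := hconj _ ih.1 k
      refine ⟨A.mul_mem h2 h4, ?_⟩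
      rw [conjWord, hf _ h2 _ h4, h5]
      refine (norm_add_le _ _).trans ?_
      rw [norm_mul, norm_pow]
      have := mul_le_mul hk.le ih.2 (norm_nonneg _) (by norm_num)
      linarith
  obtain ⟨l, l', h⟩ := exists_conjWord_eq hG (t ^ k) a
  obtain ⟨m1, e1⟩ := hconj _ (hw l).1 k
  obtain ⟨m2, e2⟩ := hconj _ (hw l').1 k
  have h2 := congrArg f h
  rw [hf _ ha _ m1, e1, e2] at h2
  have h3 : f a = μ ^ k * (f (conjWord (t ^ k) a l') - f (conjWord (t ^ k) a l)) := by
    linear_combination h2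
  have h5 : 0 < ‖f a‖ := norm_pos_iff.2 hfa
  have h6 : ‖f a‖ < ‖f a‖ := by
    conv_lhs => rw [h3, norm_mul, norm_pow]
    have h7 : ‖f (conjWord (t ^ k) a l') - f (conjWord (t ^ k) a l)‖ ≤ 3 * ‖f a‖ := by
      refine (norm_sub_le _ _).trans ?_
      linarith [(hw l).2, (hw l').2]
    calc ‖μ‖ ^ k * _ ≤ ‖μ‖ ^ k * (3 * ‖f a‖) := by gcongr
      _ < 1 / 3 * (3 * ‖f a‖) := by gcongr
      _ = _ := by ring
  exact lt_irrefl _ h6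

/-- The subgroup generated by all the conjugates of `z` by the powers of `t`. -/
def conjClosure (t z : G) : Subgroup G :=
  Subgroup.closure (Set.range fun i : ℤ => t ^ i * z * (t ^ i)⁻¹)

lemma conj_mem_conjClosure (t z : G) (i : ℤ) : t ^ i * z * (t ^ i)⁻¹ ∈ conjClosure t z :=
  Subgroup.subset_closure ⟨i, rfl⟩

lemma conj_mem_conjClosure_of_mem {t z a : G} (ha : a ∈ conjClosure t z) (i : ℤ) :
    t ^ i * a * (t ^ i)⁻¹ ∈ conjClosure t z := by
  refine Subgroup.closure_induction (p := fun a _ => t ^ i * a * (t ^ i)⁻¹ ∈ conjClosure t z)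
    ?_ ?_ ?_ ?_ ha
  · rintro _ ⟨j, rfl⟩
    convert conj_mem_conjClosure t z (i + j) using 1
    simp only [zpow_add]; group
  · simp
  · intro x y _ _ hx hy
    convert mul_mem hx hy using 1
    group
  · intro x _ hx
    convert inv_mem hx using 1
    group

/-- Half of the finite generation of `conjClosure t z`. -/
lemma exists_neg_conj_mem {d : ℕ} (hG : GrowthLE G d) (t z : G) :
    ∃ n : ℕ, ∀ j : ℕ, t ^ (-(j : ℤ)) * z * (t ^ (-(j : ℤ)))⁻¹ ∈
      Subgroup.closure ((fun i : ℕ => t ^ i * z * (t ^ i)⁻¹) '' Set.Icc 1 n) := by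
  obtain ⟨l, l', h⟩ := exists_conjWord_eq hG t z
  set n := max l.length l'.length
  refine ⟨n, ?_⟩
  have hstep : ∀ (b : ℕ), ∀ x ∈ Subgroup.closure ((fun i : ℕ => t ^ i * z * (t ^ i)⁻¹) '' Set.Iio b),
      t * x * t⁻¹ ∈ Subgroup.closure ((fun i : ℕ => t ^ i * z * (t ^ i)⁻¹) '' Set.Icc 1 b) := by
    intro b x hx
    induction hx using Subgroup.closure_induction with
    | mem x hx =>
      obtain ⟨i, hi, rfl⟩ := hx
      refine Subgroup.subset_closure ⟨i + 1, ⟨by lia, ?_⟩, ?_⟩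
      · exact hi
      · simp only [pow_succ']; group
    | one => simp
    | mul x y _ _ hx hy => convert mul_mem hx hy using 1; group
    | inv x _ hx => convert inv_mem hx using 1; group
  have hword : ∀ l : List Bool, conjWord t z l ∈
      Subgroup.closure ((fun i : ℕ => t ^ i * z * (t ^ i)⁻¹) '' Set.Iio l.length) := by
    intro l
    induction l with
    | nil => exact one_mem _
    | cons b l ih =>
      refine mul_mem ?_ ?_
      · split_ifs
        · exact Subgroup.subset_closure ⟨0, by simp, by simp⟩
        · exact one_mem _
      · refine Subgroup.closure_mono (Set.image_mono ?_) (hstep _ _ ih)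
        intro i hi
        simp only [Set.mem_Icc] at hi
        simp only [List.length_cons, Set.mem_Iio]
        lia
  set N := Subgroup.closure ((fun i : ℕ => t ^ i * z * (t ^ i)⁻¹) '' Set.Icc 1 n)
  have hz : z ∈ N := by
    have e : z = (t * conjWord t z l' * t⁻¹) * (t * conjWord t z l * t⁻¹)⁻¹ := by
      rw [← h]; group
    rw [e]
    have hm : ∀ l : List Bool, l.length ≤ n → t * conjWord t z l * t⁻¹ ∈ N := fun l hl =>
      Subgroup.closure_mono (Set.image_mono (Set.Icc_subset_Icc_right hl)) (hstep _ _ (hword l))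
    exact mul_mem (hm _ (le_max_right _ _)) (inv_mem (hm _ (le_max_left _ _)))
  have hinv : ∀ x ∈ N, t⁻¹ * x * t ∈ N := by
    intro x hx
    induction hx using Subgroup.closure_induction with
    | mem x hx =>
      obtain ⟨i, hi, rfl⟩ := hx
      obtain ⟨i, rfl⟩ : ∃ k, i = k + 1 := ⟨i - 1, by have := hi.1; lia⟩
      have e : t⁻¹ * (t ^ (i + 1) * z * (t ^ (i + 1))⁻¹) * t = t ^ i * z * (t ^ i)⁻¹ := by
        rw [pow_succ']; group
      simp only [e]
      rcases Nat.eq_zero_or_pos i with rfl | hi0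
      · simpa using hz
      · exact Subgroup.subset_closure ⟨i, ⟨hi0, by have := hi.2; lia⟩, rfl⟩
    | one => simp
    | mul x y _ _ hx hy => convert mul_mem hx hy using 1; group
    | inv x _ hx => convert inv_mem hx using 1; group
  intro j
  induction j with
  | zero => simpa using hz
  | succ j ih =>
    convert hinv _ ih using 1
    rw [show -((j + 1 : ℕ) : ℤ) = -1 + -(j : ℤ) by push_cast; ring, zpow_add]
    group

lemma fg_conjClosure {d : ℕ} (hG : GrowthLE G d) (t z : G) : (conjClosure t z).FG := by
  obtain ⟨n, hn⟩ := exists_neg_conj_mem hG t z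
  obtain ⟨m, hm⟩ := exists_neg_conj_mem hG t⁻¹ z
  rw [Subgroup.fg_iff]
  refine ⟨(fun i : ℤ => t ^ i * z * (t ^ i)⁻¹) '' Set.Icc (-m : ℤ) n, ?_,
    (Set.finite_Icc _ _).image _⟩
  refine le_antisymm (Subgroup.closure_mono (Set.image_subset_range _ _)) ?_
  refine (Subgroup.closure_le _).2 ?_
  rintro _ ⟨j, rfl⟩
  rcases le_total j 0 with hj | hj
  · obtain ⟨k, rfl⟩ : ∃ k : ℕ, j = -(k : ℤ) := ⟨j.natAbs, by lia⟩
    refine Subgroup.closure_mono ?_ (hn k)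
    rintro _ ⟨i, hi, rfl⟩
    exact ⟨i, ⟨by lia, by exact_mod_cast hi.2⟩, by simp⟩
  · obtain ⟨k, rfl⟩ : ∃ k : ℕ, j = (k : ℤ) := ⟨j.natAbs, by lia⟩
    have h1 := hm k
    rw [inv_zpow', neg_neg] at h1
    refine Subgroup.closure_mono ?_ h1
    rintro _ ⟨i, hi, rfl⟩
    exact ⟨-i, ⟨by have := hi.2; lia, by lia⟩, by simp⟩

/-- **Milnor's lemma**: the kernel of a surjection onto `ℤ` of a finitely generated group of
polynomial growth is finitely generated. -/
lemma fg_ker_of_surjective_int [Group.FG G] {d : ℕ} (hG : GrowthLE G d) (f : G →* Multiplicative ℤ)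
    {t : G} (ht : f t = Multiplicative.ofAdd 1) : f.ker.FG := by
  obtain ⟨S, hS⟩ := Group.fg_def.1 (inferInstance : Group.FG G)
  let φ : G → ℤ := fun g => Multiplicative.toAdd (f g)
  have hφm : ∀ g h, φ (g * h) = φ g + φ h := fun g h => by simp [φ]
  have hφi : ∀ g, φ g⁻¹ = - φ g := fun g => by simp [φ]
  have hφt : ∀ k : ℤ, φ (t ^ k) = k := fun k => by simp [φ, ht]
  let N : Subgroup G := ⨆ s : S, conjClosure t (s * t ^ (-φ s))
  have hNfg : N.FG := Subgroup.FG.iSup _ fun s => fg_conjClosure hG _ _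
  have hNconj : ∀ x ∈ N, ∀ i : ℤ, t ^ i * x * (t ^ i)⁻¹ ∈ N := by
    intro x hx i
    have hle : N ≤ N.comap (MulAut.conj (t ^ i)).toMonoidHom := by
      refine iSup_le fun s y hy => ?_
      exact Subgroup.mem_iSup_of_mem s (conj_mem_conjClosure_of_mem hy i)
    exact hle hx
  have hmem : ∀ g, g * t ^ (-φ g) ∈ N := by
    intro g
    have hg : g ∈ Subgroup.closure (S : Set G) := hS ▸ Subgroup.mem_top g
    induction hg using Subgroup.closure_induction with
    | mem s hs =>
      refine Subgroup.mem_iSup_of_mem (⟨s, hs⟩ : S) ?_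
      simpa using conj_mem_conjClosure t (s * t ^ (-φ s)) 0
    | one => simp [φ]
    | mul x y _ _ hx hy =>
      convert mul_mem hx (hNconj _ hy (φ x)) using 1
      rw [hφm, neg_add_rev, zpow_add]; group
    | inv x _ hx =>
      convert hNconj _ (inv_mem hx) (-φ x) using 1
      rw [hφi]; group
  have hker : ∀ {x}, x ∈ f.ker ↔ φ x = 0 := by
    intro x; exact Iff.rfl
  have hEq : f.ker = N := by
    refine le_antisymm (fun g hg => ?_) (iSup_le fun s => ?_)
    · have := hmem g
      rw [hker.1 hg] at this
      simpa using this
    · refine (Subgroup.closure_le _).2 ?_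
      rintro _ ⟨i, rfl⟩
      refine hker.2 ?_
      simp only [hφm, hφi, hφt]
      ring
  rw [hEq]; exact hNfg

end ConjugateWords

section AlmostPeriodicElements
open scoped Classical
open Module

/-- An automorphism of an infinite finitely generated abelian group all of whose complex eigenvalues
lie in the closed unit disc has a periodic element of infinite order. -/
lemma exists_iterate_eq_of_eigenvalue_norm_le_one {A : Type*} [AddCommGroup A] [Module.Finite ℤ A]
    (hA : ∃ f : A →+ ℤ, f ≠ 0) (T : A ≃+ A)
    (h : ∀ f : A →+ ℂ, f ≠ 0 → ∀ μ : ℂ, (∀ a, f (T a) = μ * f a) → ‖μ‖ ≤ 1) :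
    ∃ a : A, ¬ IsOfFinAddOrder a ∧ ∃ k, 0 < k ∧ T^[k] a = a := by
  let Ω := AlgebraicClosure ℚ
  have hΩ : Algebra.IsAlgebraic ℚ Ω := by
    convert AlgebraicClosure.isAlgebraic ℚ
    · rfl
    · exact Subsingleton.elim _ _
  let W := A →ₗ[ℤ] Ω
  have hWfin : FiniteDimensional Ω W := by
    obtain ⟨s, hs⟩ := (Module.Finite.fg_top : (⊤ : Submodule ℤ A).FG)
    let e : W →ₗ[Ω] (s → Ω) :=
      { toFun := fun f a => f a
        map_add' := fun f g => rfl
        map_smul' := fun c f => rfl }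
    refine FiniteDimensional.of_injective e fun f g hfg => ?_
    refine LinearMap.ext_on hs fun a ha => congrFun hfg ⟨a, ha⟩
  have hWnt : Nontrivial W := by
    obtain ⟨f, hf⟩ := hA
    refine ⟨⟨((Int.castAddHom Ω).comp f).toIntLinearMap, 0, fun h0 => hf ?_⟩⟩
    ext a
    have : ((f a : ℤ) : Ω) = 0 := DFunLike.congr_fun h0 a
    simpa using this
  let E : W →ₗ[Ω] W :=
    { toFun := fun f => f.comp T.toAddMonoidHom.toIntLinearMap
      map_add' := fun f g => rfl
      map_smul' := fun c f => rfl }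
  obtain ⟨μ, hμ⟩ := Module.End.exists_eigenvalue E
  obtain ⟨f, hf⟩ := hμ.exists_hasEigenvector
  have hf0 : f ≠ 0 := hf.2
  have hfT : ∀ a, f (T a) = μ * f a := fun a => DFunLike.congr_fun hf.apply_eq_smul a
  obtain ⟨a₀, ha₀⟩ : ∃ a, f a ≠ 0 := by
    by_contra! h0
    exact hf0 (LinearMap.ext h0)
  have hμ0 : μ ≠ 0 := by
    rintro rfl
    apply ha₀
    rw [← T.apply_symm_apply a₀, hfT, zero_mul]
  have hμi : IsIntegral ℤ μ := by
    refine isIntegral_of_smul_mem_submodule (M := Ω) (LinearMap.range f) ?_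
      (Submodule.FG.map f Module.Finite.fg_top |> fun h => by rwa [Submodule.map_top] at h) μ ?_
    · exact (Submodule.ne_bot_iff _).2 ⟨f a₀, ⟨a₀, rfl⟩, ha₀⟩
    · rintro _ ⟨a, rfl⟩
      exact ⟨T a, hfT a⟩
  obtain ⟨n, hn, hμn⟩ : ∃ n : ℕ, 0 < n ∧ μ ^ n = 1 := by
    let K := IntermediateField.adjoin ℚ ({μ} : Set Ω)
    have : FiniteDimensional ℚ K :=
      IntermediateField.adjoin.finiteDimensional (hΩ.isAlgebraic μ).isIntegral
    have : NumberField K := ⟨⟩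
    let x : K := IntermediateField.AdjoinSimple.gen ℚ μ
    have hx : algebraMap K Ω x = μ := IntermediateField.AdjoinSimple.algebraMap_gen ℚ μ
    have hxint : IsIntegral ℤ x := by
      refine (isIntegral_algebraMap_iff (algebraMap K Ω).injective).1 ?_
      rwa [hx]
    obtain ⟨n, hn, hxn⟩ := NumberField.Embeddings.pow_eq_one_of_norm_le_one K ℂ (x := x)
      (fun h0 => hμ0 (by rw [← hx, h0, map_zero])) hxint (fun φ => by
        let _ : Algebra K ℂ := φ.toAlgebra
        have : Algebra.IsAlgebraic K Ω := Algebra.IsAlgebraic.tower_top (K := ℚ) K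
        let ψ : Ω →ₐ[K] ℂ := IsAlgClosed.lift
        have hψ : ψ μ = φ x := by rw [← hx]; exact ψ.commutes x
        rw [← hψ]
        refine h (ψ.toRingHom.toAddMonoidHom.comp f.toAddMonoidHom) ?_ (ψ μ) ?_
        · intro h0
          refine ha₀ (ψ.toRingHom.injective ?_)
          rw [map_zero]
          exact DFunLike.congr_fun h0 a₀
        · intro a
          show ψ (f (T a)) = ψ μ * ψ (f a)
          rw [hfT, map_mul])
    refine ⟨n, hn, ?_⟩
    rw [← hx, ← map_pow, hxn, map_one]
  have hfTk : ∀ (k : ℕ) a, f (T^[k] a) = μ ^ k * f a := by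
    intro k
    induction k with
    | zero => simp
    | succ k ih => intro a; rw [Function.iterate_succ_apply', hfT, ih]; ring
  by_contra! hcon
  let D : A →ₗ[ℤ] A := (T.toAddMonoidHom.toIntLinearMap ^ n) - LinearMap.id
  have hD : ∀ a, D a = T^[n] a - a := fun a => by
    simp only [D, LinearMap.sub_apply, LinearMap.id_apply, Module.End.pow_apply]; rfl
  have hker : finrank ℤ (LinearMap.ker D) = 0 := by
    rw [Module.finrank_eq_zero_iff]
    rintro ⟨a, ha⟩
    have ha' : T^[n] a = a := sub_eq_zero.1 ((hD a).symm.trans ha)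
    obtain ⟨m, hm, hma⟩ := isOfFinAddOrder_iff_nsmul_eq_zero.1
      (by_contra fun h1 => hcon a h1 n hn ha' : IsOfFinAddOrder a)
    refine ⟨(m : ℤ), by exact_mod_cast hm.ne', Subtype.ext ?_⟩
    simpa using hma
  have hrange : finrank ℤ (LinearMap.range D) = finrank ℤ A := by
    have := Submodule.finrank_quotient_add_finrank (LinearMap.ker D)
    rw [D.quotKerEquivRange.finrank_eq] at this
    lia
  have hquot : finrank ℤ (A ⧸ LinearMap.range D) = 0 := by
    have := Submodule.finrank_quotient_add_finrank (LinearMap.range D)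
    lia
  obtain ⟨m, hm, hma⟩ := Module.finrank_eq_zero_iff.1 hquot (Submodule.Quotient.mk a₀)
  rw [← Submodule.Quotient.mk_smul, Submodule.Quotient.mk_eq_zero] at hma
  obtain ⟨b, hb⟩ := hma
  have h1 : f (m • a₀) = 0 := by
    rw [← hb, hD, map_sub, hfTk, hμn, one_mul, sub_self]
  rw [map_smul, smul_eq_zero] at h1
  exact h1.elim hm ha₀

end AlmostPeriodicElements

section PolynomialGrowth
open scoped Classical Pointwise
universe u

lemma finiteIndex_of_relIndex_ker {G : Type*} [Group G] (f : G →* Multiplicative ℤ) {t : G}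
    (ht : f t = Multiplicative.ofAdd 1) {C : Subgroup G} (hC : C.relIndex f.ker ≠ 0) {k : ℕ}
    (hk : 0 < k) (htC : t ^ k ∈ C) : C.FiniteIndex := by
  have : (C.subgroupOf f.ker).FiniteIndex := ⟨hC⟩
  have : Finite (f.ker ⧸ C.subgroupOf f.ker) := Subgroup.finite_quotient_of_finiteIndex
  have hsurj : Function.Surjective (fun p : Fin k × (f.ker ⧸ C.subgroupOf f.ker) =>
      ((t ^ (p.1 : ℕ) * p.2.out : G) : G ⧸ C)) := by
    intro q
    obtain ⟨g, rfl⟩ := QuotientGroup.mk_surjective q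
    set n : ℤ := Multiplicative.toAdd (f g) with hn
    have hk' : (0 : ℤ) < k := by exact_mod_cast hk
    have hr0 := Int.emod_nonneg n hk'.ne'
    have hrk := Int.emod_lt_of_pos n hk'
    let r : Fin k := ⟨(n % k).toNat, by lia⟩
    have hr : ((r : ℕ) : ℤ) = n % k := Int.toNat_of_nonneg hr0
    have hker : t ^ (-(r : ℕ) : ℤ) * g * t ^ (-(k * (n / k)) : ℤ) ∈ f.ker := by
      rw [MonoidHom.mem_ker]
      apply Multiplicative.toAdd.injective
      simp only [map_mul, map_zpow, ht, toAdd_mul, toAdd_zpow, toAdd_ofAdd, ← hn, toAdd_one,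
        smul_eq_mul, mul_one]
      have := Int.emod_add_mul_ediv n k
      linarith
    set m : f.ker := ⟨_, hker⟩ with hm
    refine ⟨(r, (m : f.ker ⧸ C.subgroupOf f.ker)), QuotientGroup.eq.2 ?_⟩
    have h1 : (m : f.ker ⧸ C.subgroupOf f.ker).out⁻¹ * m ∈ C.subgroupOf f.ker :=
      QuotientGroup.eq.1 (QuotientGroup.out_eq' _)
    have h2 : ((m : f.ker ⧸ C.subgroupOf f.ker).out : G)⁻¹ * m ∈ C := h1
    have h3 : t ^ ((k : ℤ) * (n / k)) ∈ C := by
      rw [zpow_mul, zpow_natCast]; exact zpow_mem htC _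
    convert mul_mem h2 h3 using 1
    simp only [hm, zpow_neg, zpow_natCast]
    group
  have := Finite.of_surjective _ hsurj
  exact Subgroup.finiteIndex_of_finite_quotient

lemma isOfFinOrder_coe_iff {G : Type*} [Group G] {H : Subgroup G} {x : H} :
    IsOfFinOrder (x : G) ↔ IsOfFinOrder x :=
  Subgroup.subtype_injective H |>.isOfFinOrder_iff (f := H.subtype)

lemma mem_centralizer_singleton {G : Type*} [Group G] {a b : G} (h : a * b = b * a) :
    a ∈ Subgroup.centralizer {b} := by
  rw [Subgroup.mem_centralizer_singleton_iff]; exact h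

/-- The kernel of a surjection onto `ℤ` contains an element of infinite order commuting with a power
of `t` and almost commuting with the kernel, provided it contains an element of infinite order with
the latter property. -/
lemma exists_finiteIndex_centralizer_of_ker {G : Type*} [Group G] {d : ℕ} (hG : GrowthLE G d)
    (f : G →* Multiplicative ℤ) {t : G} (ht : f t = Multiplicative.ofAdd 1) {z : G}
    (hz : z ∈ f.ker) (hzo : ¬ IsOfFinOrder z)
    (hzc : (Subgroup.centralizer {z}).relIndex f.ker ≠ 0) :
    ∃ a : G, ¬ IsOfFinOrder a ∧ (Subgroup.centralizer {a}).FiniteIndex := by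
  set K := conjClosure t z with hK
  have hKfg : K.FG := fg_conjClosure hG t z
  have hKM : K ≤ f.ker := by
    refine (Subgroup.closure_le _).2 ?_
    rintro _ ⟨i, rfl⟩
    exact (inferInstance : f.ker.Normal).conj_mem z hz (t ^ i)
  have hconj : ∀ a ∈ K, ∀ i : ℤ, t ^ i * a * (t ^ i)⁻¹ ∈ K := fun a ha i =>
    conj_mem_conjClosure_of_mem ha i
  have hcz : ∀ i : ℤ, (Subgroup.centralizer {t ^ i * z * (t ^ i)⁻¹}).relIndex f.ker ≠ 0 := by
    intro i
    have h1 := Subgroup.relIndex_map_map_of_injective (f := (MulAut.conj (t ^ i)).toMonoidHom)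
      (Subgroup.centralizer {z}) f.ker (MulAut.conj (t ^ i)).injective
    have h2 : f.ker.map (MulAut.conj (t ^ i)).toMonoidHom ≤ f.ker := by
      rintro _ ⟨x, hx, rfl⟩
      exact (inferInstance : f.ker.Normal).conj_mem x hx (t ^ i)
    have h2' : f.ker ≤ f.ker.map (MulAut.conj (t ^ i)).toMonoidHom := by
      intro x hx
      refine ⟨(t ^ i)⁻¹ * x * ((t ^ i)⁻¹)⁻¹,
        (inferInstance : f.ker.Normal).conj_mem x hx (t ^ i)⁻¹, ?_⟩
      show t ^ i * ((t ^ i)⁻¹ * x * ((t ^ i)⁻¹)⁻¹) * (t ^ i)⁻¹ = x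
      group
    have h3 : (Subgroup.centralizer {z}).map (MulAut.conj (t ^ i)).toMonoidHom ≤
        Subgroup.centralizer {t ^ i * z * (t ^ i)⁻¹} := by
      rintro _ ⟨x, hx, rfl⟩
      have hx' : x * z = z * x := Subgroup.mem_centralizer_singleton_iff.1 hx
      refine mem_centralizer_singleton ?_
      simp only [MulEquiv.coe_toMonoidHom, MulAut.conj_apply]
      calc t ^ i * x * (t ^ i)⁻¹ * (t ^ i * z * (t ^ i)⁻¹) = t ^ i * (x * z) * (t ^ i)⁻¹ := by group
        _ = _ := by rw [hx']; group
    rw [le_antisymm h2 h2'] at h1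
    intro h0
    have h4 := Subgroup.relIndex_dvd_of_le_left f.ker h3
    rw [h0, h1] at h4
    exact hzc (Nat.eq_zero_of_zero_dvd h4)
  have hcK : ∀ a ∈ K, (Subgroup.centralizer {a}).relIndex f.ker ≠ 0 := by
    intro a ha
    have mono : ∀ {H H' : Subgroup G}, H ≤ H' → H.relIndex f.ker ≠ 0 → H'.relIndex f.ker ≠ 0 :=
      fun hle h0 h1 => h0 (Nat.eq_zero_of_zero_dvd (h1 ▸ Subgroup.relIndex_dvd_of_le_left f.ker hle))
    induction ha using Subgroup.closure_induction with
    | mem x hx => obtain ⟨i, rfl⟩ := hx; exact hcz i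
    | one => simp [Subgroup.centralizer_eq_top_iff_subset.2 (Set.singleton_subset_iff.2 (one_mem (Subgroup.center G)))]
    | mul x y _ _ hx hy =>
      refine mono ?_ (Subgroup.relIndex_inf_ne_zero hx hy)
      intro g hg
      have h1 := Subgroup.mem_centralizer_singleton_iff.1 hg.1
      have h2 := Subgroup.mem_centralizer_singleton_iff.1 hg.2
      refine mem_centralizer_singleton ?_
      rw [← mul_assoc, h1, mul_assoc, h2, mul_assoc]
    | inv x _ hx =>
      refine mono ?_ hx
      intro g hg
      have h1 : Commute g x := Subgroup.mem_centralizer_singleton_iff.1 hg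
      exact mem_centralizer_singleton h1.inv_right
  have hKc : (Subgroup.centralizer (K : Set G)).relIndex f.ker ≠ 0 := by
    obtain ⟨s, hs⟩ := hKfg
    have hle : (⨅ x : s, Subgroup.centralizer {(x : G)}) ≤ Subgroup.centralizer (K : Set G) := by
      rw [← hs, Subgroup.centralizer_closure]
      intro g hg x hx
      exact (Subgroup.mem_centralizer_singleton_iff.1 ((Subgroup.mem_iInf.1 hg) ⟨x, hx⟩)).symm
    have h1 : (⨅ x : s, Subgroup.centralizer {(x : G)}).relIndex f.ker ≠ 0 :=
      Subgroup.relIndex_iInf_ne_zero fun x => hcK x (hs ▸ Subgroup.subset_closure x.2)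
    exact fun h0 => h1 (Nat.eq_zero_of_zero_dvd (h0 ▸ Subgroup.relIndex_dvd_of_le_left f.ker hle))
  set A : Subgroup G := K ⊓ Subgroup.centralizer (K : Set G) with hA
  have hAfi : (A.subgroupOf K).FiniteIndex := by
    refine ⟨fun h0 => hKc ?_⟩
    change A.relIndex K = 0 at h0
    rw [hA, Subgroup.inf_relIndex_left] at h0
    exact Subgroup.relIndex_eq_zero_of_le_right hKM h0
  have hAK : A ≤ K := inf_le_left
  have hKfg' : Group.FG K := (Group.fg_iff_subgroup_fg K).2 hKfg
  have hAfg' : Group.FG (A.subgroupOf K) := Subgroup.fg_of_index_ne_zero _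
  have hAfg : Group.FG A :=
    Group.fg_of_surjective (f := (Subgroup.subgroupOfEquivOfLe hAK).toMonoidHom)
      (Subgroup.subgroupOfEquivOfLe hAK).surjective
  have hAinf : Infinite A := by
    rw [← not_finite_iff_infinite]
    intro hfin
    have h1 : Finite (A.subgroupOf K) := Finite.of_equiv _ (Subgroup.subgroupOfEquivOfLe hAK).symm.toEquiv
    have h2 : Finite K := by
      rw [Subgroup.finite_iff_finite_and_finiteIndex (A.subgroupOf K)]
      exact ⟨h1, hAfi⟩
    have hzK : z ∈ K := by simpa using conj_mem_conjClosure t z 0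
    exact hzo ((isOfFinOrder_coe_iff (x := (⟨z, hzK⟩ : K))).2 (isOfFinOrder_of_finite _))
  have hAconj : ∀ a ∈ A, ∀ i : ℤ, t ^ i * a * (t ^ i)⁻¹ ∈ A := by
    rintro a ⟨ha, hac⟩ i
    refine ⟨hconj a ha i, fun x hx => ?_⟩
    have h1 := hac _ (hconj x hx (-i))
    have h2 : x = t ^ i * (t ^ (-i) * x * (t ^ (-i))⁻¹) * (t ^ i)⁻¹ := by group
    calc x * (t ^ i * a * (t ^ i)⁻¹)
        = t ^ i * ((t ^ (-i) * x * (t ^ (-i))⁻¹) * a) * (t ^ i)⁻¹ := by group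
      _ = t ^ i * (a * (t ^ (-i) * x * (t ^ (-i))⁻¹)) * (t ^ i)⁻¹ := by rw [h1]
      _ = _ := by group
  let _ : CommGroup A :=
    { (inferInstance : Group A) with
      mul_comm := fun x y => Subtype.ext (y.2.2 x x.2.1) }
  have hmodfin : Module.Finite ℤ (Additive A) :=
    Module.Finite.iff_addGroup_fg.2 (GroupFG.iff_add_fg.1 hAfg)
  let T : A ≃* A :=
    { toFun := fun a => ⟨t * a * t⁻¹, by simpa using hAconj a a.2 1⟩
      invFun := fun a => ⟨t⁻¹ * a * t, by simpa using hAconj a a.2 (-1)⟩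
      left_inv := fun a => Subtype.ext (by simp; group)
      right_inv := fun a => Subtype.ext (by simp; group)
      map_mul' := fun a b => Subtype.ext (by simp) }
  have hTk : ∀ (k : ℕ) (a : A), ((T^[k] a : A) : G) = t ^ k * a * (t ^ k)⁻¹ := by
    intro k a
    induction k with
    | zero => simp
    | succ k ih =>
      rw [Function.iterate_succ_apply']
      show t * _ * t⁻¹ = _
      rw [ih, pow_succ']; group
  have hAZ : ∃ φ : Additive A →+ ℤ, φ ≠ 0 := by
    obtain ⟨φ, hφ⟩ := exists_surjective_int_of_infinite_range (MonoidHom.id A)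
      (fun x y => mul_comm x y) (by
        exact Infinite.of_injective (fun a : A => (⟨a, a, rfl⟩ : (MonoidHom.id A).range))
          fun a b h => congrArg Subtype.val h)
    refine ⟨MonoidHom.toAdditiveLeft φ, fun h0 => ?_⟩
    obtain ⟨x, hx⟩ := hφ (Multiplicative.ofAdd 1)
    have := DFunLike.congr_fun h0 (Additive.ofMul x)
    have h2 : Multiplicative.toAdd (φ x) = 0 := this
    rw [hx] at h2
    exact one_ne_zero h2
  obtain ⟨a, hao, k, hk, hka⟩ := exists_iterate_eq_of_eigenvalue_norm_le_one hAZ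
      (MulEquiv.toAdditive T) (by
    intro φ hφ μ hμ
    obtain ⟨x, hx⟩ : ∃ x, φ x ≠ 0 := by
      by_contra! h0
      exact hφ (AddMonoidHom.ext h0)
    have hμ0 : μ ≠ 0 := by
      rintro rfl
      apply hx
      rw [← (MulEquiv.toAdditive T).apply_symm_apply x, hμ, zero_mul]
    let F : G → ℂ := fun g => if h : g ∈ A then φ (Additive.ofMul ⟨g, h⟩) else 0
    have hF : ∀ g (h : g ∈ A), F g = φ (Additive.ofMul ⟨g, h⟩) := fun g h => dif_pos h
    have hA' : ∀ a ∈ A, t⁻¹ * a * t⁻¹⁻¹ ∈ A := fun a ha => by simpa using hAconj a ha (-1)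
    have h1 := one_le_norm_of_conj_eigenvalue hG (A := A) (t := t⁻¹) hA' F
      (fun a ha b hb => by
        rw [hF _ ha, hF _ hb, hF _ (mul_mem ha hb), ← map_add]
        rfl) (μ := μ⁻¹)
      (fun a ha => by
        rw [hF _ ha, hF _ (hA' a ha), eq_inv_mul_iff_mul_eq₀ hμ0, ← hμ]
        congr 1
        apply Additive.toMul.injective
        refine Subtype.ext ?_
        show t * (t⁻¹ * a * t⁻¹⁻¹) * t⁻¹ = a
        group) (a := x.toMul) x.toMul.2 (by rw [hF _ x.toMul.2]; exact hx)
    rw [norm_inv] at h1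
    exact (one_le_inv₀ (norm_pos_iff.2 hμ0)).1 h1)
  refine ⟨(a.toMul : A), fun h => hao ?_, finiteIndex_of_relIndex_ker f ht
    (hcK _ (hAK a.toMul.2)) hk ?_⟩
  · exact (isOfFinAddOrder_ofMul_iff (x := a.toMul)).2 (isOfFinOrder_coe_iff.1 h)
  · have h1 : ((T^[k] a.toMul : A) : G) = a.toMul := congrArg (fun x : Additive A => (x.toMul : G)) hka
    rw [hTk] at h1
    refine mem_centralizer_singleton ?_
    rw [mul_inv_eq_iff_eq_mul] at h1
    exact h1

/-- An infinite finitely generated group of polynomial growth contains an element of infinite order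
whose centralizer has finite index. -/
theorem exists_finiteIndex_centralizer_of_growthLE (d : ℕ) : ∀ (G : Type u) [Group G] [Group.FG G]
    [Infinite G], GrowthLE G d →
      ∃ z : G, ¬ IsOfFinOrder z ∧ (Subgroup.centralizer {z}).FiniteIndex := by
  induction d with
  | zero =>
    intro G _ _ _ hG
    exact absurd hG.finite_of_zero (not_finite_iff_infinite.2 inferInstance)
  | succ d ih =>
    intro G _ _ _ hG
    obtain ⟨H, hH, f, hf⟩ := exists_finiteIndex_surjective_int hG
    have hHG : GrowthLE H (d + 1) := hG.of_injective H.subtype H.subtype_injective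
    have hHfg : Group.FG H := Subgroup.fg_of_index_ne_zero H
    suffices h : ∃ a : H, ¬ IsOfFinOrder a ∧ (Subgroup.centralizer {a}).FiniteIndex by
      obtain ⟨a, ha, hac⟩ := h
      refine ⟨a, fun h => ha (isOfFinOrder_coe_iff.1 h), ?_⟩
      have h1 : ((Subgroup.centralizer {a}).map H.subtype).FiniteIndex :=
        ⟨by rw [Subgroup.index_map_subtype]; exact mul_ne_zero hac.index_ne_zero hH.index_ne_zero⟩
      refine Subgroup.finiteIndex_of_le (H := (Subgroup.centralizer {a}).map H.subtype) ?_
      rintro _ ⟨x, hx, rfl⟩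
      exact mem_centralizer_singleton
        (congrArg Subtype.val (Subgroup.mem_centralizer_singleton_iff.1 hx))
    obtain ⟨t, ht⟩ := hf (Multiplicative.ofAdd 1)
    have hft : ∀ k : ℕ, 0 < k → f (t ^ k) ≠ 1 := by
      intro k hk h0
      have := congrArg Multiplicative.toAdd h0
      simp [ht] at this
      lia
    have hto : ¬ IsOfFinOrder (f t) := by
      intro h
      obtain ⟨k, hk, hk1⟩ := isOfFinOrder_iff_pow_eq_one.1 h
      exact hft k hk (by rw [map_pow, hk1])
    have hMfg : Group.FG f.ker := (Group.fg_iff_subgroup_fg _).2 (fg_ker_of_surjective_int hHG f ht)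
    have hMG : GrowthLE f.ker d := hHG.ker_of_infinite_order f t hto
    by_cases hMinf : Infinite f.ker
    · obtain ⟨z, hz, hzc⟩ := ih f.ker hMG
      refine exists_finiteIndex_centralizer_of_ker hHG f ht z.2
        (fun h => hz (isOfFinOrder_coe_iff.1 h)) (fun h0 => hzc.index_ne_zero ?_)
      refine Nat.eq_zero_of_zero_dvd ?_
      rw [← h0]
      refine Subgroup.index_dvd_of_le fun x hx => ?_
      refine mem_centralizer_singleton ?_
      exact congrArg Subtype.val (Subgroup.mem_centralizer_singleton_iff.1 hx)
    · have hfin : Finite f.ker := not_infinite_iff_finite.1 hMinf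
      obtain ⟨k, hk, hk1⟩ := isOfFinOrder_iff_pow_eq_one.1
        (isOfFinOrder_of_finite (MulAut.conjNormal (H := f.ker) t))
      have hcomm : ∀ x ∈ f.ker, x * t ^ k = t ^ k * x := by
        intro x hx
        rw [← map_pow] at hk1
        have := congrArg Subtype.val (DFunLike.congr_fun hk1 ⟨x, hx⟩)
        rw [MulAut.conjNormal_apply] at this
        exact (mul_inv_eq_iff_eq_mul.1 this).symm
      refine ⟨t ^ k, fun h => ?_, finiteIndex_of_relIndex_ker f ht (k := 1) ?_ one_pos ?_⟩
      · obtain ⟨m, hm, hm1⟩ := isOfFinOrder_iff_pow_eq_one.1 h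
        rw [← pow_mul] at hm1
        exact hft (k * m) (by positivity) (by rw [hm1, map_one])
      · have h1 : f.ker ≤ Subgroup.centralizer {t ^ k} := fun x hx =>
          mem_centralizer_singleton (hcomm x hx)
        rw [Subgroup.relIndex_eq_one.2 h1]
        exact one_ne_zero
      · refine mem_centralizer_singleton ?_
        rw [pow_one]
        exact (Commute.refl t).pow_right k

/-- **Gromov's theorem on groups of polynomial growth.** -/
theorem isVirtuallyNilpotent_of_growthLE (d : ℕ) : ∀ (G : Type u) [Group G] [Group.FG G],
    GrowthLE G d → IsVirtuallyNilpotent G := by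
  induction d with
  | zero =>
    intro G _ _ hG
    have := hG.finite_of_zero
    exact IsVirtuallyNilpotent.of_finite G
  | succ d ih =>
    intro G _ _ hG
    by_cases hfin : Finite G
    · exact IsVirtuallyNilpotent.of_finite G
    have : Infinite G := not_finite_iff_infinite.1 hfin
    obtain ⟨z, hz, hzc⟩ := exists_finiteIndex_centralizer_of_growthLE (d + 1) G hG
    set H := Subgroup.centralizer {z}
    have hHfg : Group.FG H := Subgroup.fg_of_index_ne_zero H
    have hzH : z ∈ H := mem_centralizer_singleton rfl
    let w : H := ⟨z, hzH⟩
    have hcen : Subgroup.zpowers w ≤ Subgroup.center H := by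
      rw [Subgroup.zpowers_le]
      refine Subgroup.mem_center_iff.2 fun g => Subtype.ext ?_
      exact Subgroup.mem_centralizer_singleton_iff.1 g.2
    have : (Subgroup.zpowers w).Normal := ⟨fun n hn g => by
      rwa [Subgroup.mem_center_iff.1 (hcen hn) g, mul_inv_cancel_right]⟩
    have hQ : GrowthLE (H ⧸ Subgroup.zpowers w) d :=
      (hG.of_injective H.subtype H.subtype_injective).quotient_of_infinite_order
        (QuotientGroup.mk' _) (QuotientGroup.mk'_surjective _) w
        ((QuotientGroup.eq_one_iff w).2 (Subgroup.mem_zpowers w))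
        (fun h => hz (isOfFinOrder_coe_iff.2 h))
    have := ih _ hQ
    refine IsVirtuallyNilpotent.of_finiteIndex H
      (IsVirtuallyNilpotent.of_ker_le_center (QuotientGroup.mk' (Subgroup.zpowers w)) ?_ this)
    rwa [QuotientGroup.ker_mk']

end PolynomialGrowth

section FinitaryGromov
open scoped Classical Pointwise commutatorElement
open Filter
universe u

lemma exists_freeGroup_lift_image {G : Type*} [Group G] {S : Finset G} (hS : S.Nonempty) {s : ℕ}
    (hs : S.card ≤ s) :
    ∃ φ : FreeGroup (Fin s) →* G, (Finset.univ.image FreeGroup.of).image φ = S := by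
  have : Nonempty S := hS.to_subtype
  obtain ⟨e⟩ : Nonempty (S ↪ Fin s) := by
    apply Function.Embedding.nonempty_of_card_le
    simpa using hs
  refine ⟨FreeGroup.lift fun i => ((Function.invFun e i : S) : G), ?_⟩
  ext x
  simp only [Finset.mem_image, Finset.mem_univ, true_and, exists_exists_eq_and, FreeGroup.lift_apply_of]
  constructor
  · rintro ⟨i, rfl⟩; exact (Function.invFun e i).2
  · intro hx
    exact ⟨e ⟨x, hx⟩, congrArg Subtype.val (Function.leftInverse_invFun e.injective ⟨x, hx⟩)⟩

lemma card_image_pow_le {F G Q : Type*} [Group F] [Group G] [Group Q] (φ : F →* G) (π : F →* Q)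
    {T : Finset F} {m : ℕ} (h : ∀ x ∈ T ^ m, ∀ y ∈ T ^ m, φ x = φ y → π x = π y) :
    ((T.image π) ^ m).card ≤ ((T.image φ) ^ m).card := by
  rw [← Finset.image_pow φ T, ← Finset.image_pow π T]
  have hφπ : ∀ z ∈ (T ^ m).image π, ∃ x ∈ T ^ m, π x = z := fun z hz =>
    Finset.mem_image.1 hz
  choose! r hr hr' using hφπ
  refine Finset.card_le_card_of_injOn (fun z => φ (r z))
    (fun z hz => Finset.mem_image_of_mem _ (hr z hz)) fun z hz w hw hzw => ?_
  rw [← hr' z hz, ← hr' w hw]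
  exact h _ (hr z hz) _ (hr w hw) hzw

/-- The kernel of the ultraproduct of a sequence of homomorphisms. -/
def eventualKer {F : Type*} [Group F] {G : ℕ → Type*} [∀ n, Group (G n)] (φ : ∀ n, F →* G n)
    (l : Filter ℕ) : Subgroup F where
  carrier := {x | ∀ᶠ n in l, φ n x = 1}
  one_mem' := by simp
  mul_mem' := fun {x y} hx hy => by
    filter_upwards [hx, hy] with n h1 h2
    rw [map_mul, h1, h2, one_mul]
  inv_mem' := fun {x} hx => by
    filter_upwards [hx] with n h1
    rw [map_inv, h1, inv_one]

lemma mem_eventualKer {F : Type*} [Group F] {G : ℕ → Type*} [∀ n, Group (G n)]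
    {φ : ∀ n, F →* G n} {l : Filter ℕ} {x : F} :
    x ∈ eventualKer φ l ↔ ∀ᶠ n in l, φ n x = 1 := Iff.rfl

instance eventualKer_normal {F : Type*} [Group F] {G : ℕ → Type*} [∀ n, Group (G n)]
    (φ : ∀ n, F →* G n) (l : Filter ℕ) : (eventualKer φ l).Normal :=
  ⟨fun x hx g => by
    filter_upwards [hx] with n h1
    rw [map_mul, map_mul, h1, mul_one, map_inv, mul_inv_cancel]⟩

lemma IsVirtuallyNilpotent.eventually_range {F : Type*} [Group F] [Group.FG F] {G : ℕ → Type*}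
    [∀ n, Group (G n)] {φ : ∀ n, F →* G n} {l : Filter ℕ}
    (h : IsVirtuallyNilpotent (F ⧸ eventualKer φ l)) :
    ∀ᶠ n in l, IsVirtuallyNilpotent (φ n).range := by
  obtain ⟨H, hH, hn⟩ := h
  set π := QuotientGroup.mk' (eventualKer φ l)
  have hfi : (H.comap π).FiniteIndex := ⟨by
    rw [Subgroup.index_comap]
    exact (inferInstance : (H.subgroupOf π.range).FiniteIndex).index_ne_zero⟩
  have hfg : Group.FG (H.comap π) := Subgroup.fg_of_index_ne_zero _
  obtain ⟨Y, hY⟩ := Group.fg_def.1 hfg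
  let π' : H.comap π →* H := (π.comp (H.comap π).subtype).codRestrict H fun x => x.2
  obtain ⟨c, hc⟩ := exists_leftCommutators_trivial (π' '' (Y : Set (H.comap π)))
  rw [leftCommutators_image] at hc
  have hev : ∀ᶠ n in l, ∀ x ∈ leftCommutators (Y : Set (H.comap π)) c, φ n x = 1 := by
    rw [eventually_all_finite (leftCommutators_finite Y.finite_toSet c)]
    intro x hx
    have h1 : π' x = 1 := hc ⟨x, hx, rfl⟩
    have h2 : π x = 1 := congrArg Subtype.val h1
    exact mem_eventualKer.1 ((QuotientGroup.eq_one_iff (x : F)).1 h2)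
  filter_upwards [hev] with n hn
  let ψ := (φ n).rangeRestrict
  refine ⟨(H.comap π).map ψ, ⟨fun h0 => hfi.index_ne_zero ?_⟩, ?_⟩
  · exact Nat.eq_zero_of_zero_dvd
      (h0 ▸ (H.comap π).index_map_dvd (φ n).rangeRestrict_surjective)
  · let ρ := ψ.subgroupMap (H.comap π)
    have hρ : Function.Surjective ρ := ψ.subgroupMap_surjective _
    refine isNilpotent_of_leftCommutators (ρ '' (Y : Set (H.comap π))) ?_ c ?_
    · rw [← MonoidHom.map_closure, hY, Subgroup.map_top_of_surjective _ hρ]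
    · rw [leftCommutators_image]
      rintro _ ⟨x, hx, rfl⟩
      exact Subtype.ext (Subtype.ext (hn x hx))

lemma growthLE_of_eventually_inj {F Q : Type*} [Group F] [Group Q] {G : ℕ → Type*}
    [∀ n, Group (G n)] (φ : ∀ n, F →* G n) (π : F →* Q)
    (hπ : ∀ x y, (∀ᶠ n in (hyperfilter ℕ : Filter ℕ), φ n x = φ n y) → π x = π y)
    {T : Finset F} (hT : IsSymmGen (T.image π)) {s K : ℕ}
    (hgr : ∀ n, ∀ k ≤ n, (((T.image (φ n)) ^ 2 ^ k).card ≤ s * 2 ^ (K * k))) : GrowthLE Q K := by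
  refine GrowthLE.of_two_pow hT (s := s) fun k => ?_
  have h3 : ∀ᶠ n in (hyperfilter ℕ : Filter ℕ), ∀ x ∈ T ^ 2 ^ k, ∀ y ∈ T ^ 2 ^ k,
      φ n x = φ n y → π x = π y := by
    refine (eventually_all_finset _).2 fun x _ => (eventually_all_finset _).2 fun y _ => ?_
    by_cases hxy : π x = π y
    · exact Eventually.of_forall fun _ _ => hxy
    · have := Ultrafilter.eventually_not.2 (fun h => hxy (hπ x y h))
      filter_upwards [this] with n hn h
      exact absurd h hn
  have h4 : ∀ᶠ n in (hyperfilter ℕ : Filter ℕ), k ≤ n :=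
    Nat.hyperfilter_le_atTop (eventually_ge_atTop k)
  obtain ⟨n, hn, hkn⟩ := (h3.and h4).exists
  exact (card_image_pow_le (φ n) π hn).trans (hgr n k hkn)

/-- A finitary version of **Gromov's theorem**: polynomial growth up to a large enough scale,
depending only on the size of the generating set and on the growth bound, implies virtual
nilpotency. -/
theorem exists_scale_isVirtuallyNilpotent (s K : ℕ) :
    ∃ k₀ : ℕ, ∀ (G : Type u) [Group G] (S : Finset G), 1 ∈ S → (∀ x ∈ S, x⁻¹ ∈ S) →
      S.card ≤ s → (∀ k ≤ k₀, (S ^ 2 ^ k).card ≤ s * 2 ^ (K * k)) →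
      IsVirtuallyNilpotent (Subgroup.closure (S : Set G)) := by
  by_contra! hcon
  choose G hG S h1 hinv hs hgr hnv using hcon
  choose φ hφ using fun n => exists_freeGroup_lift_image ⟨1, h1 n⟩ (hs n)
  set 𝒰 : Ultrafilter ℕ := hyperfilter ℕ
  set T : Finset (FreeGroup (Fin s)) := Finset.univ.image FreeGroup.of with hT
  set N := eventualKer φ 𝒰
  set π := QuotientGroup.mk' N
  have hπ : ∀ x y, π x = π y ↔ ∀ᶠ n in (𝒰 : Filter ℕ), φ n x = φ n y := by
    intro x y
    rw [QuotientGroup.mk'_apply, QuotientGroup.mk'_apply, QuotientGroup.eq, mem_eventualKer]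
    refine eventually_congr (Eventually.of_forall fun n => ?_)
    rw [map_mul, map_inv, inv_mul_eq_one]
  have hTcl : Subgroup.closure (T : Set (FreeGroup (Fin s))) = ⊤ := by
    rw [hT, Finset.coe_image, Finset.coe_univ, Set.image_univ, FreeGroup.closure_range_of]
  have hex : ∀ y : FreeGroup (Fin s), (∀ n, φ n y ∈ S n) → π y ∈ T.image π := by
    intro y hy
    have h2 : ∀ᶠ n in (𝒰 : Filter ℕ), ∃ i : Fin s, φ n (FreeGroup.of i) = φ n y := by
      refine Eventually.of_forall fun n => ?_
      have := hy n
      rw [← hφ n] at this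
      simpa [hT] using this
    obtain ⟨i, hi⟩ := (Ultrafilter.eventually_exists_iff).1 h2
    exact Finset.mem_image.2 ⟨FreeGroup.of i, by simp [hT], (hπ _ _).2 hi⟩
  have hsym : IsSymmGen (T.image π) := by
    refine ⟨?_, ?_, ?_⟩
    · rw [← map_one π]
      exact hex 1 fun n => by rw [map_one]; exact h1 n
    · intro x hx
      obtain ⟨y, hy, rfl⟩ := Finset.mem_image.1 hx
      rw [← map_inv]
      refine hex _ fun n => ?_
      rw [map_inv]
      exact hinv n _ (hφ n ▸ Finset.mem_image_of_mem _ hy)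
    · rw [Finset.coe_image, ← MonoidHom.map_closure, hTcl,
        Subgroup.map_top_of_surjective _ (QuotientGroup.mk'_surjective N)]
  have hgrowth : GrowthLE (FreeGroup (Fin s) ⧸ N) K :=
    growthLE_of_eventually_inj φ π (fun x y h => (hπ x y).2 h) (by convert hsym) fun n k hk => by
      rw [hφ n]; exact hgr n k hk
  have hfgF : Group.FG (FreeGroup (Fin s)) := inferInstance
  have hvn := isVirtuallyNilpotent_of_growthLE K (FreeGroup (Fin s) ⧸ N) hgrowth
  obtain ⟨n, hn⟩ := hvn.eventually_range.exists
  refine hnv n (IsVirtuallyNilpotent.mono (le_of_eq ?_) hn)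
  rw [← hφ n, Finset.coe_image, ← MonoidHom.map_closure, hTcl, MonoidHom.range_eq_map]

end FinitaryGromov

section ApproximateGroups
open scoped Classical Pointwise
universe u

/-- In a malnormal subgroup, the double translates of a finite set by an outside element have
full cardinality. -/
lemma card_mul_singleton_mul_of_malnormal {G : Type u} [Group G] {E : Subgroup G} {g : G}
    (hg : ∀ x ∈ E, g * x * g⁻¹ ∈ E → x = 1) {B : Finset G} (hB : (B : Set G) ⊆ E) :
    (B * {g} * B).card = B.card ^ 2 := by
  have : B * {g} * B = (B ×ˢ B).image fun p => p.1 * g * p.2 := by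
    ext x
    simp only [Finset.mem_mul, Finset.mem_singleton, Finset.mem_image, Finset.mem_product,
      Prod.exists]
    constructor
    · rintro ⟨_, ⟨b, hb, _, rfl, rfl⟩, c, hc, rfl⟩
      exact ⟨b, c, ⟨hb, hc⟩, rfl⟩
    · rintro ⟨b, c, ⟨hb, hc⟩, rfl⟩
      exact ⟨b * g, ⟨b, hb, g, rfl, rfl⟩, c, hc, rfl⟩
  rw [this, Finset.card_image_of_injOn, Finset.card_product, sq]
  rintro ⟨b, c⟩ hbc ⟨b', c'⟩ hbc' h
  simp only [Finset.coe_product, Set.mem_prod, Finset.mem_coe] at hbc hbc' h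
  have h1 : g * (c * c'⁻¹) * g⁻¹ = b⁻¹ * b' := by
    calc g * (c * c'⁻¹) * g⁻¹ = b⁻¹ * (b * g * c) * c'⁻¹ * g⁻¹ := by group
      _ = b⁻¹ * (b' * g * c') * c'⁻¹ * g⁻¹ := by rw [h]
      _ = b⁻¹ * b' := by group
  have h2 : c * c'⁻¹ = 1 := hg _ (E.mul_mem (hB hbc.2) (E.inv_mem (hB hbc'.2)))
    (h1 ▸ E.mul_mem (E.inv_mem (hB hbc.1)) (hB hbc'.1))
  have h3 : c = c' := mul_inv_eq_one.1 h2
  rw [h2, mul_one, mul_inv_cancel, eq_comm, inv_mul_eq_one] at h1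
  rw [h1, h3]

lemma pow_two_pow_subset_of_chain {G : Type u} [Group G] {W : ℕ → Finset G} (hmul : ∀ i, W (i + 1) * W (i + 1) ⊆ W i)
    (k : ℕ) : ∀ i, W (i + k) ^ 2 ^ k ⊆ W i := by
  induction k with
  | zero => intro i; simp
  | succ k ih =>
    intro i
    rw [pow_succ, pow_mul, sq]
    have := ih (i + 1)
    rw [show i + 1 + k = i + (k + 1) by lia] at this
    exact (Finset.mul_subset_mul this this).trans (hmul i)

lemma card_le_pow_mul_of_chain {α : Type*} {W : ℕ → Finset α} {K : ℕ}
    (hK : ∀ i, (W i).card ≤ K * (W (i + 1)).card) (k : ℕ) :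
    ∀ i, (W i).card ≤ K ^ k * (W (i + k)).card := by
  induction k with
  | zero => intro i; simp
  | succ k ih =>
    intro i
    calc (W i).card ≤ K ^ k * (W (i + k)).card := ih i
      _ ≤ K ^ k * (K * (W (i + k + 1)).card) := Nat.mul_le_mul_left _ (hK _)
      _ = _ := by rw [pow_succ, mul_assoc]; rfl

/-- A long chain of finite symmetric sets with bounded doubling, shrinking to the identity, lies
in a malnormal subgroup as soon as every virtually nilpotent subgroup does. -/
theorem exists_malnormal_of_chain (K : ℕ) : ∃ n₁ : ℕ, ∀ (G : Type u) [Group G] (Γ : Subgroup G)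
    (_ : ∀ g ∈ Γ, g ≠ 1 → ¬ IsOfFinOrder g) (𝓔 : Set (Subgroup G))
    (_ : ∀ E ∈ 𝓔, ∀ g ∈ Γ, g ∉ E → ∀ x ∈ E, g * x * g⁻¹ ∈ E → x = 1)
    (_ : ∀ S : Finset G, (S : Set G) ⊆ Γ → (∃ x ∈ S, x ≠ 1) →
      IsVirtuallyNilpotent (Subgroup.closure (S : Set G)) → ∃ E ∈ 𝓔, (S : Set G) ⊆ E)
    (W : ℕ → Finset G) (_ : ∀ i, (W i : Set G) ⊆ Γ) (_ : ∀ i, 1 ∈ W i)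
    (_ : ∀ i, ∀ x ∈ W i, x⁻¹ ∈ W i) (_ : ∀ i, W (i + 1) * W (i + 1) ⊆ W i)
    (_ : ∀ i, (W i).card ≤ K * (W (i + 1)).card) (_ : ∃ i, W i = {1}),
    n₁ ≤ (W 0).card → ∃ E ∈ 𝓔, (W 2 : Set G) ⊆ E := by
  obtain ⟨k₀, hk₀⟩ := exists_scale_isVirtuallyNilpotent.{u} (K ^ (3 * K + 1)) K
  refine ⟨K ^ (3 * K + k₀ + 4) + 1, ?_⟩
  intro G _ Γ htf 𝓔 hmal hvn W hWΓ h1 hinv hmul hK htriv hcard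
  have hK0 : 0 < K := by
    rcases Nat.eq_zero_or_pos K with rfl | h
    · have h2 := hK 0
      have h3 := Finset.card_pos.2 ⟨1, h1 0⟩
      lia
    · exact h
  have hanti : Antitone W := antitone_nat_of_succ_le fun i x hx =>
    hmul i (by simpa using Finset.mul_mem_mul hx (h1 (i + 1)))
  set I := Nat.find htriv with hI
  have hWI : W I = {1} := Nat.find_spec htriv
  have hIbig : 3 * K + k₀ + 4 < I := by
    by_contra! hle
    have h2 := card_le_pow_mul_of_chain hK I 0
    rw [zero_add, hWI, Finset.card_singleton, mul_one] at h2
    have h3 : K ^ I ≤ K ^ (3 * K + k₀ + 4) := Nat.pow_le_pow_right hK0 hle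
    lia
  obtain ⟨i₀, hi₀⟩ : ∃ i₀, i₀ + (3 * K + 1) = I := ⟨I - (3 * K + 1), by lia⟩
  obtain ⟨x, hx, hx1⟩ : ∃ x ∈ W (i₀ + 3 * K), x ≠ 1 := by
    by_contra! h
    have h2 : W (i₀ + 3 * K) = {1} := Finset.eq_singleton_iff_unique_mem.2 ⟨h1 _, h⟩
    have := Nat.find_min htriv (m := i₀ + 3 * K) (by lia)
    exact this h2
  have hxS : x ∈ W i₀ := hanti (by lia) hx
  have hsize : K ^ 3 < (W i₀).card := by
    have h2 : ((Finset.range (2 ^ (3 * K))).image fun m => x ^ m) ⊆ W i₀ := by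
      intro y hy
      obtain ⟨m, hm, rfl⟩ := Finset.mem_image.1 hy
      refine pow_two_pow_subset_of_chain hmul (3 * K) i₀ ?_
      exact Finset.pow_subset_pow_right (h1 _) (Finset.mem_range.1 hm).le (Finset.pow_mem_pow hx)
    have hinj : Function.Injective fun m : ℕ => x ^ m :=
      injective_pow_iff_not_isOfFinOrder.2 (htf x (hWΓ _ hx) hx1)
    have h3 := Finset.card_le_card h2
    rw [Finset.card_image_of_injective _ hinj, Finset.card_range] at h3
    have h4 : K ^ 3 < (2 ^ K) ^ 3 := Nat.pow_lt_pow_left Nat.lt_two_pow_self (by norm_num)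
    rw [← pow_mul, mul_comm] at h4
    lia
  have hvnS : IsVirtuallyNilpotent (Subgroup.closure (W i₀ : Set G)) := by
    refine hk₀ G (W i₀) (h1 _) (hinv _) ?_ fun k hk => ?_
    · have h2 := card_le_pow_mul_of_chain hK (3 * K + 1) i₀
      rwa [hi₀, hWI, Finset.card_singleton, mul_one] at h2
    · obtain ⟨j, hj⟩ : ∃ j, j + k = i₀ := ⟨i₀ - k, by lia⟩
      have h2 := Finset.card_le_card (pow_two_pow_subset_of_chain hmul k j)
      have h3 := card_le_pow_mul_of_chain hK (3 * K + 1 + k) j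
      rw [show j + (3 * K + 1 + k) = I by lia, hWI, Finset.card_singleton, mul_one] at h3
      rw [hj] at h2
      refine h2.trans (h3.trans ?_)
      rw [pow_add, pow_mul]
      exact Nat.mul_le_mul_left _ (Nat.pow_le_pow_left Nat.lt_two_pow_self.le _)
  obtain ⟨E, hE, hSE⟩ := hvn (W i₀) (hWΓ _) ⟨x, hxS, hx1⟩ hvnS
  refine ⟨E, hE, ?_⟩
  have hdown : ∀ d, ∀ i, 2 ≤ i → i + d = i₀ → (W i : Set G) ⊆ E := by
    intro d
    induction d with
    | zero => intro i _ hi; rw [add_zero] at hi; rwa [hi]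
    | succ d ih =>
      intro i hi2 hi
      have hB : (W (i + 1) : Set G) ⊆ E := ih (i + 1) (by lia) (by lia)
      intro g hg
      by_contra hgE
      have h2 := card_mul_singleton_mul_of_malnormal (hmal E hE g (hWΓ _ hg) hgE) hB
      obtain ⟨l, rfl⟩ : ∃ l, l + 2 = i := ⟨i - 2, by lia⟩
      have h3 : W (l + 2 + 1) * {g} * W (l + 2 + 1) ⊆ W l := by
        have h4 : W (l + 2 + 1) * {g} ⊆ W (l + 1) :=
          (Finset.mul_subset_mul (hanti (by lia)) (Finset.singleton_subset_iff.2 hg)).trans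
            (hmul (l + 1))
        exact (Finset.mul_subset_mul h4 (hanti (by lia))).trans (hmul l)
      have h5 := Finset.card_le_card h3
      have h6 := card_le_pow_mul_of_chain hK 3 l
      have h7 : (W i₀).card ≤ (W (l + 2 + 1)).card := Finset.card_le_card (hanti (by lia))
      rw [h2] at h5
      rw [show l + 3 = l + 2 + 1 by lia] at h6
      have h8 := h5.trans h6
      rw [sq] at h8
      have h9 := Nat.le_of_mul_le_mul_right h8 (by lia)
      lia
  exact hdown (i₀ - 2) 2 le_rfl (by lia)

end ApproximateGroups

section Hyperbolic
open scoped Pointwise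

variable {X : Type*} [MetricSpace X] {δ : ℝ}

/-- The Gromov product of `x` and `y` based at `o`. -/
noncomputable def gromovProd (x y o : X) : ℝ := (dist x o + dist y o - dist x y) / 2

lemma gromovProd_comm (x y o : X) : gromovProd x y o = gromovProd y x o := by
  simp only [gromovProd, dist_comm x y]; ring

lemma gromovProd_nonneg (x y o : X) : 0 ≤ gromovProd x y o := by
  have := dist_triangle_right x y o
  simp only [gromovProd]; linarith

lemma gromovProd_add (x y o : X) : gromovProd x y o + gromovProd o y x = dist x o := by
  simp only [gromovProd, dist_comm o x, dist_comm y x]; rw [dist_comm y o]; ring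

lemma gromovProd_le_left (x y o : X) : gromovProd x y o ≤ dist x o := by
  have := gromovProd_nonneg o y x
  linarith [gromovProd_add x y o]

lemma gromovProd_map (g : X ≃ᵢ X) (x y o : X) :
    gromovProd (g x) (g y) (g o) = gromovProd x y o := by
  simp only [gromovProd, g.dist_eq]

lemma IsDeltaHyperbolic.nonneg (h : IsDeltaHyperbolic X δ) (x : X) : 0 ≤ δ := by
  have := h x x x x
  simp only [dist_self, add_zero, max_self] at this
  linarith

lemma IsDeltaHyperbolic.four (h : IsDeltaHyperbolic X δ) (x y z w : X) :
    dist x y + dist z w ≤ dist x z + dist y w + 2 * δ ∨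
      dist x y + dist z w ≤ dist x w + dist y z + 2 * δ := by
  have := h x y z w
  rcases max_cases (dist x z + dist y w) (dist x w + dist y z) with h1 | h1
  · left; linarith
  · right; linarith

lemma IsDeltaHyperbolic.gromovProd_le (h : IsDeltaHyperbolic X δ) (x y z o : X) :
    gromovProd x y o ≤ gromovProd x z o + δ ∨ gromovProd y z o ≤ gromovProd x z o + δ := by
  simp only [gromovProd]
  rcases h.four x z y o with h1 | h1
  · left; linarith
  · right; rw [dist_comm z y] at h1; linarith

/-- A point `z` of a geodesic from `u` to `v` at the right distance from `u` is close to `y`. -/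
lemma IsDeltaHyperbolic.dist_le_of_gromovProd (h : IsDeltaHyperbolic X δ) {u v y z : X}
    (hz : dist u z + dist z v = dist u v) (huz : dist u z = gromovProd y v u) :
    dist y z ≤ gromovProd u v y + 2 * δ := by
  simp only [gromovProd] at *
  rw [dist_comm v u] at huz
  rw [dist_comm u y, dist_comm v y]
  rcases h.four y z u v with h1 | h1
  · linarith
  · rw [dist_comm z u] at h1; linarith

/-- Points at the same parameter of two geodesics with nearby endpoints are close. -/
lemma IsDeltaHyperbolic.dist_le_of_fellow (h : IsDeltaHyperbolic X δ) {o p o' q y z : X}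
    {s t A B : ℝ} (hoy : dist o y = s) (hyp : dist y p = t) (hop : dist o p = s + t)
    (hoz : dist o' z = s) (hzq : dist z q = t) (hoq : dist o' q = s + t)
    (hA : dist o o' ≤ A) (hB : dist p q ≤ B) (hAB : B ≤ 2 * t + A) :
    dist y z ≤ A + 4 * δ := by
  have hδ := h.nonneg o
  have h0 := dist_triangle y o o'
  have h1 := dist_triangle q o' o
  rw [dist_comm y o] at h0
  rw [dist_comm q o', dist_comm o' o] at h1
  rcases h.four y z o' q with h2 | h2
  · linarith
  · rw [dist_comm z o'] at h2
    rcases h.four y q o p with h3 | h3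
    · rw [dist_comm y o, dist_comm q p] at h3; linarith
    · linarith

section LocalToGlobal

variable {D L : ℝ} {x : ℕ → X} {n : ℕ}

lemma IsDeltaHyperbolic.local_to_global (h : IsDeltaHyperbolic X δ) (hD : 0 ≤ D) (hδ : 0 ≤ δ)
    (hL : 2 * D + 3 * δ < L) (hd : ∀ i < n, L ≤ dist (x i) (x (i + 1)))
    (hp : ∀ i, i + 2 ≤ n → gromovProd (x i) (x (i + 2)) (x (i + 1)) ≤ D) :
    ∀ m < n, gromovProd (x 0) (x (m + 1)) (x m) ≤ D + δ := by
  intro m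
  induction m with
  | zero =>
    intro _
    have := gromovProd_le_left (x 0) (x (0 + 1)) (x 0)
    rw [dist_self] at this
    linarith
  | succ m ih =>
    intro hm
    have h1 := ih (by lia)
    have h2 := gromovProd_add (x m) (x 0) (x (m + 1))
    rw [gromovProd_comm (x (m + 1))] at h2
    rcases h.gromovProd_le (x m) (x 0) (x (m + 2)) (x (m + 1)) with h3 | h3
    · linarith [hp m (by lia), hd m (by lia)]
    · linarith [hp m (by lia)]

lemma IsDeltaHyperbolic.local_to_global_rev (h : IsDeltaHyperbolic X δ) (hD : 0 ≤ D) (hδ : 0 ≤ δ)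
    (hL : 2 * D + 3 * δ < L) (hd : ∀ i < n, L ≤ dist (x i) (x (i + 1)))
    (hp : ∀ i, i + 2 ≤ n → gromovProd (x i) (x (i + 2)) (x (i + 1)) ≤ D) {i k : ℕ}
    (hik : i < k) (hk : k ≤ n) :
    gromovProd (x i) (x k) (x (i + 1)) ≤ D + δ := by
  have := h.local_to_global (x := fun j => x (k - j)) (n := k - i) hD hδ hL
    (fun j hj => by
      have h1 := hd (k - (j + 1)) (by lia)
      rw [show k - (j + 1) + 1 = k - j by lia] at h1
      rwa [dist_comm])
    (fun j hj => by
      have h1 := hp (k - (j + 2)) (by lia)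
      rw [show k - (j + 2) + 2 = k - j by lia, show k - (j + 2) + 1 = k - (j + 1) by lia] at h1
      rwa [gromovProd_comm]) (k - i - 1) (by lia)
  rw [show k - (k - i - 1 + 1) = i by lia, show k - (k - i - 1) = i + 1 by lia,
    Nat.sub_zero, gromovProd_comm] at this
  exact this

lemma IsDeltaHyperbolic.gromovProd_le_of_local (h : IsDeltaHyperbolic X δ) (hD : 0 ≤ D)
    (hδ : 0 ≤ δ) (hL : 2 * D + 3 * δ < L) (hd : ∀ i < n, L ≤ dist (x i) (x (i + 1)))
    (hp : ∀ i, i + 2 ≤ n → gromovProd (x i) (x (i + 2)) (x (i + 1)) ≤ D) {j k : ℕ}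
    (hjk : j < k) (hk : k ≤ n) : gromovProd (x 0) (x k) (x j) ≤ D + 2 * δ := by
  have h1 := h.local_to_global hD hδ hL hd hp j (by lia)
  have h2 := h.local_to_global_rev hD hδ hL hd hp hjk hk
  have h3 := gromovProd_add (x (j + 1)) (x k) (x j)
  have h4 := hd j (by lia)
  rw [dist_comm] at h4
  rcases h.gromovProd_le (x 0) (x k) (x (j + 1)) (x j) with h5 | h5
  · linarith
  · rw [gromovProd_comm (x k)] at h5; linarith

lemma IsDeltaHyperbolic.dist_ge_of_local (h : IsDeltaHyperbolic X δ) (hD : 0 ≤ D) (hδ : 0 ≤ δ)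
    (hL : 2 * D + 3 * δ < L) (hd : ∀ i < n, L ≤ dist (x i) (x (i + 1)))
    (hp : ∀ i, i + 2 ≤ n → gromovProd (x i) (x (i + 2)) (x (i + 1)) ≤ D) :
    ∀ m ≤ n, m * (L - 2 * D - 2 * δ) ≤ dist (x 0) (x m) := by
  intro m
  induction m with
  | zero => intro _; simp
  | succ m ih =>
    intro hm
    have h1 := ih (by lia)
    have h2 := h.local_to_global hD hδ hL hd hp m (by lia)
    have h3 := hd m (by lia)
    simp only [gromovProd] at h2
    rw [dist_comm (x (m + 1)) (x m)] at h2
    push_cast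
    linarith

end LocalToGlobal

/-- Ping-pong: two isometries all of whose nontrivial powers move a base point far away, in
directions with bounded Gromov products, freely generate a free group. -/
lemma IsDeltaHyperbolic.free_of_gromovProd_le (hyp : IsDeltaHyperbolic X δ) (hδ : 0 < δ)
    {g h : X ≃ᵢ X} {o : X} {D : ℝ}
    (hg : ∀ k : ℤ, k ≠ 0 → 2 * D + 4 * δ ≤ dist o ((g ^ k) o))
    (hh : ∀ k : ℤ, k ≠ 0 → 2 * D + 4 * δ ≤ dist o ((h ^ k) o))
    (hgh : ∀ k l : ℤ, k ≠ 0 → l ≠ 0 → gromovProd ((g ^ k) o) ((h ^ l) o) o ≤ D) :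
    Function.Injective (FreeGroup.lift fun i : Bool => if i then g else h) := by
  set a : Bool → (X ≃ᵢ X) := fun i => if i then g else h with ha
  have hD : 0 ≤ D := (gromovProd_nonneg _ _ _).trans (hgh 1 1 one_ne_zero one_ne_zero)
  have hd : ∀ i, ∀ k : ℤ, k ≠ 0 → 2 * D + 4 * δ ≤ dist o ((a i ^ k) o) := by
    intro i; cases i
    · simpa [ha] using hh
    · simpa [ha] using hg
  have hp : ∀ i j, i ≠ j → ∀ k l : ℤ, k ≠ 0 → l ≠ 0 →
      gromovProd ((a i ^ k) o) ((a j ^ l) o) o ≤ D := by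
    intro i j hij k l hk hl
    cases i <;> cases j
    · exact absurd rfl hij
    · rw [gromovProd_comm]; simpa [ha] using hgh l k hl hk
    · simpa [ha] using hgh k l hk hl
    · exact absurd rfl hij
  let _ : MulAction (X ≃ᵢ X) X :=
    { smul := fun g x => g x, one_smul := fun _ => rfl, mul_smul := fun _ _ _ => rfl }
  let S : Bool → Set X := fun i => {y | ∃ k : ℤ, k ≠ 0 ∧ D + 2 * δ ≤ gromovProd ((a i ^ k) o) y o}
  have : FreeGroup.lift a =
      (Monoid.CoprodI.lift fun i => FreeGroup.lift fun _ => a i).comp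
        (@freeGroupEquivCoprodI Bool).toMonoidHom := by
    ext i
    simp
  rw [this, MonoidHom.coe_comp]
  refine Function.Injective.comp ?_ (MulEquiv.injective freeGroupEquivCoprodI)
  refine Monoid.CoprodI.lift_injective_of_ping_pong
    (fun i : Bool => (FreeGroup.lift fun _ : Unit => a i)) ?_ S ?_ ?_ ?_
  · right
    refine ⟨true, ?_⟩
    have := Cardinal.aleph0_le_mk (FreeGroup Unit)
    exact (Cardinal.ofNat_lt_aleph0 (n := 3)).le.trans this
  · intro i
    refine ⟨(a i ^ (1 : ℤ)) o, 1, one_ne_zero, ?_⟩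
    have := hd i 1 one_ne_zero
    simp only [gromovProd, dist_self]
    rw [dist_comm] at this
    linarith
  · intro i j hij
    refine Set.disjoint_left.2 ?_
    rintro y ⟨k, hk, hky⟩ ⟨l, hl, hly⟩
    have h1 := hp i j hij k l hk hl
    rw [gromovProd_comm] at hly
    rcases hyp.gromovProd_le ((a i ^ k) o) y ((a j ^ l) o) o with h2 | h2 <;> linarith
  · intro i j hij
    refine FreeGroup.freeGroupUnitEquivInt.forall_congr_left.mpr ?_
    intro n hne1
    have hn0 : n ≠ 0 := by
      rintro rfl
      apply hne1
      simp [FreeGroup.freeGroupUnitEquivInt]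
    change FreeGroup.lift (fun _ => a i) (FreeGroup.of () ^ n) • S j ⊆ S i
    simp only [map_zpow, FreeGroup.lift_apply_of]
    rintro _ ⟨y, ⟨l, hl, hly⟩, rfl⟩
    refine ⟨n, hn0, ?_⟩
    change _ ≤ gromovProd ((a i ^ n) o) ((a i ^ n) y) o
    have h1 := hp i j hij (-n) l (neg_ne_zero.2 hn0) hl
    have h2 : gromovProd ((a i ^ n) o) ((a i ^ n) y) o = gromovProd o y ((a i ^ (-n)) o) := by
      rw [← gromovProd_map (a i ^ n) o y ((a i ^ (-n)) o), ← IsometryEquiv.mul_apply,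
        ← zpow_add, add_neg_cancel, zpow_zero]; rfl
    have h3 := gromovProd_add ((a i ^ (-n)) o) y o
    have h4 := hd i (-n) (neg_ne_zero.2 hn0)
    rw [dist_comm] at h4
    rw [h2]
    rw [gromovProd_comm] at hly
    rcases hyp.gromovProd_le ((a i ^ (-n)) o) y ((a j ^ l) o) o with h5 | h5 <;> linarith

end Hyperbolic

section Bicombing
open Metric Filter

universe u

variable {X : Type u} [MetricSpace X] {σ : X → X → ℝ → X}

lemma IsGCB.dist_le (hσ : IsGCB σ) (x y x' y' : X) {t : ℝ} (ht : t ∈ Set.Icc (0 : ℝ) 1) :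
    dist (σ x y t) (σ x' y' t) ≤ (1 - t) * dist x x' + t * dist y y' := by
  have := (hσ.convex x y x' y').2 (Set.left_mem_Icc.2 zero_le_one)
    (Set.right_mem_Icc.2 zero_le_one) (sub_nonneg.2 ht.2) ht.1 (by ring)
  simpa [hσ.source, hσ.target] using this

/-- A `σ`-geodesic line. -/
def IsSigmaLine (σ : X → X → ℝ → X) (γ : ℝ → X) : Prop :=
  Isometry γ ∧ ∀ s t : ℝ, s ≤ t → ∀ l ∈ Set.Icc (0 : ℝ) 1,
    σ (γ s) (γ t) l = γ (s + l * (t - s))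

lemma IsGCB.exists_line (hσ : IsGCB σ) (x y : X) :
    ∃ γ, IsSigmaLine σ γ ∧ γ 0 = x ∧ γ (dist x y) = y := by
  obtain ⟨γ, h1, h2, h3⟩ := hσ.geodComplete x y
  refine ⟨γ, ⟨h1, h2⟩, ?_, ?_⟩
  · rw [← hσ.source x y, h3 0 (by simp), zero_mul]
  · have := h3 1 (by simp)
    rw [hσ.target, one_mul] at this
    exact this.symm

namespace IsSigmaLine

variable {γ γ' : ℝ → X}

lemma dist_eq (h : IsSigmaLine σ γ) (s t : ℝ) : dist (γ s) (γ t) = |s - t| := by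
  rw [h.1.dist_eq, Real.dist_eq]

lemma dist_of_le (h : IsSigmaLine σ γ) {s t : ℝ} (hst : s ≤ t) : dist (γ s) (γ t) = t - s := by
  rw [h.dist_eq, abs_sub_comm, abs_of_nonneg (by linarith)]

lemma shift (h : IsSigmaLine σ γ) (a : ℝ) : IsSigmaLine σ fun t => γ (t + a) := by
  refine ⟨Isometry.of_dist_eq fun s t => ?_, fun s t hst l hl => ?_⟩
  · rw [h.dist_eq, Real.dist_eq]; congr 1; ring
  · rw [h.2 (s + a) (t + a) (by linarith) l hl]; congr 1; ring

lemma reverse (hσ : IsGCB σ) (h : IsSigmaLine σ γ) : IsSigmaLine σ fun t => γ (-t) := by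
  refine ⟨Isometry.of_dist_eq fun s t => ?_, fun s t hst l hl => ?_⟩
  · rw [h.dist_eq, Real.dist_eq, abs_sub_comm]; congr 1; ring
  · rw [hσ.reversible _ _ l hl, h.2 (-t) (-s) (by linarith) (1 - l)
      ⟨by linarith [hl.2], by linarith [hl.1]⟩]
    congr 1; ring

lemma map (h : IsSigmaLine σ γ) {g : X ≃ᵢ X} (hg : IsSigmaIsometry σ g) :
    IsSigmaLine σ fun t => g (γ t) :=
  ⟨g.isometry.comp h.1, fun s t hst l hl => by rw [← hg _ _ l hl, h.2 s t hst l hl]⟩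

lemma convexOn_dist (hσ : IsGCB σ) (h : IsSigmaLine σ γ) (h' : IsSigmaLine σ γ') :
    ConvexOn ℝ Set.univ fun t => dist (γ t) (γ' t) := by
  have key : ∀ s t : ℝ, s ≤ t → ∀ a b : ℝ, 0 ≤ a → 0 ≤ b → a + b = 1 →
      dist (γ (a * s + b * t)) (γ' (a * s + b * t)) ≤
        a * dist (γ s) (γ' s) + b * dist (γ t) (γ' t) := by
    intro s t hst a b ha hb hab
    have hb' : b ∈ Set.Icc (0 : ℝ) 1 := ⟨hb, by linarith⟩
    have h1 := hσ.dist_le (γ s) (γ t) (γ' s) (γ' t) hb'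
    rw [h.2 s t hst b hb', h'.2 s t hst b hb', show 1 - b = a by linarith,
      show s + b * (t - s) = a * s + b * t by rw [← sub_eq_zero]; linear_combination (-s) * hab] at h1
    exact h1
  refine ⟨convex_univ, fun s _ t _ a b ha hb hab => ?_⟩
  simp only [smul_eq_mul]
  rcases le_total s t with hst | hst
  · exact key s t hst a b ha hb hab
  · have := key t s hst b a hb ha (by linarith)
    rw [add_comm (b * t), add_comm (b * _)] at this
    exact this

lemma dist_le_of_mem (hσ : IsGCB σ) (h : IsSigmaLine σ γ) (h' : IsSigmaLine σ γ') {s t r C : ℝ}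
    (hs : dist (γ s) (γ' s) ≤ C) (hr : dist (γ r) (γ' r) ≤ C) (hst : s ≤ t) (htr : t ≤ r) :
    dist (γ t) (γ' t) ≤ C :=
  ((convexOn_dist hσ h h').le_max_of_mem_Icc (Set.mem_univ s) (Set.mem_univ r) ⟨hst, htr⟩).trans
    (max_le hs hr)

/-- If two lines stay at bounded distance in the future, their distance is nonincreasing. -/
lemma antitone_dist (hσ : IsGCB σ) (h : IsSigmaLine σ γ) (h' : IsSigmaLine σ γ') {C : ℝ}
    (hC : ∀ t, 0 ≤ t → dist (γ t) (γ' t) ≤ C) : Antitone fun t => dist (γ t) (γ' t) := by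
  intro s t hst
  by_contra! hlt
  rcases hst.eq_or_lt with rfl | hst
  · exact lt_irrefl _ hlt
  set fs := dist (γ s) (γ' s)
  set ft := dist (γ t) (γ' t)
  set r := max 0 (max (t + 1) (s + (C - fs + 1) * (t - s) / (ft - fs))) with hr
  have hrt : t < r := lt_of_lt_of_le (by linarith) ((le_max_left _ _).trans (le_max_right _ _))
  have hr2 : s + (C - fs + 1) * (t - s) / (ft - fs) ≤ r :=
    (le_max_right _ _).trans (le_max_right _ _)
  have h1 := (convexOn_dist hσ h h').secant_mono_aux1 (Set.mem_univ s) (Set.mem_univ r) hst hrt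
  have h2 := hC r (le_max_left _ _)
  have h3 : (C - fs + 1) * (t - s) / (ft - fs) ≤ r - s := by linarith
  rw [div_le_iff₀ (by linarith)] at h3
  change (r - s) * ft ≤ (r - t) * fs + (t - s) * dist (γ r) (γ' r) at h1
  nlinarith

end IsSigmaLine

/-- Packing at some scale gives packing at all smaller scales, with the same constant. -/
lemma IsGCB.isPacked_of_le (hσ : IsGCB σ) {P₀ r₀ r : ℝ} (hp : IsPacked X P₀ r₀) (hr : 0 < r)
    (hrr : r ≤ r₀) : IsPacked X P₀ r := by
  classical
  intro x S hS hsep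
  have hr0 : 0 < r₀ := hr.trans_le hrr
  have hmem : r / r₀ ∈ Set.Icc (0 : ℝ) 1 := ⟨by positivity, (div_le_one hr0).2 hrr⟩
  have hext : ∀ y, ∃ y', σ x y' (r / r₀) = y ∧ dist x y' = r₀ / r * dist x y := by
    intro y
    obtain ⟨γ, hγ, h0, hy⟩ := hσ.exists_line x y
    have hnn : 0 ≤ r₀ / r * dist x y := by positivity
    refine ⟨γ (r₀ / r * dist x y), ?_, ?_⟩
    · have := hγ.2 0 (r₀ / r * dist x y) hnn _ hmem
      rw [h0] at this
      rw [this]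
      conv_rhs => rw [← hy]
      congr 1
      field_simp
      ring
    · have := hγ.dist_of_le hnn
      rwa [h0, sub_zero] at this
  choose e he hde using hext
  have hexp : ∀ y z, r₀ / r * dist y z ≤ dist (e y) (e z) := by
    intro y z
    have := hσ.dist_le x (e y) x (e z) hmem
    rw [he, he, dist_self, mul_zero, zero_add, div_mul_eq_mul_div, le_div_iff₀ hr0] at this
    rw [div_mul_eq_mul_div, div_le_iff₀ hr]
    linarith
  have hinj : Set.InjOn e S := by
    intro y _ z _ hyz
    rw [← he y, hyz, he z]
  have := hp x (S.image e) ?_ ?_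
  · rwa [Finset.card_image_of_injOn hinj] at this
  · intro y hy
    obtain ⟨z, hz, rfl⟩ := Finset.mem_image.1 (Finset.mem_coe.1 hy)
    have h1 := hS hz
    rw [Metric.mem_closedBall, dist_comm] at h1 ⊢
    rw [hde, div_mul_eq_mul_div, div_le_iff₀ hr]
    nlinarith
  · intro y hy z hz hyz
    obtain ⟨y, hy', rfl⟩ := Finset.mem_image.1 hy
    obtain ⟨z, hz', rfl⟩ := Finset.mem_image.1 hz
    have h1 := hsep y hy' z hz' (fun h => hyz (h ▸ rfl))
    refine lt_of_lt_of_le ?_ (hexp y z)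
    rw [div_mul_eq_mul_div, lt_div_iff₀ hr]
    nlinarith

lemma IsPacked.exists_cover {P₀ r : ℝ} (hp : IsPacked X P₀ r) (hr : 0 < r) (x : X) :
    ∃ T : Finset X, T.card ≤ ⌊P₀⌋₊ ∧ closedBall x (3 * r) ⊆ ⋃ y ∈ T, closedBall y (2 * r) := by
  classical
  set A : Set ℕ := {n | ∃ T : Finset X, (T : Set X) ⊆ closedBall x (3 * r) ∧
    (∀ a ∈ T, ∀ b ∈ T, a ≠ b → 2 * r < dist a b) ∧ T.card = n} with hA
  have hbdd : ∀ n ∈ A, n ≤ ⌊P₀⌋₊ := by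
    rintro n ⟨T, h1, h2, rfl⟩
    exact Nat.le_floor (hp x T h1 h2)
  have hmem := Nat.sSup_mem (s := A) ⟨0, ∅, by simp⟩ ⟨_, hbdd⟩
  obtain ⟨T, hT1, hT2, hT3⟩ := hmem
  refine ⟨T, hbdd _ ⟨T, hT1, hT2, rfl⟩, fun z hz => ?_⟩
  by_contra hz'
  simp only [Set.mem_iUnion, Metric.mem_closedBall, not_exists, not_le] at hz'
  have hzT : z ∉ T := fun h => by
    have := hz' z h
    rw [dist_self] at this
    linarith
  have : (insert z T).card ∈ A := by
    refine ⟨insert z T, ?_, ?_, rfl⟩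
    · rw [Finset.coe_insert]
      exact Set.insert_subset hz hT1
    · intro a ha b hb hab
      rcases Finset.mem_insert.1 ha with rfl | ha' <;> rcases Finset.mem_insert.1 hb with rfl | hb'
      · exact absurd rfl hab
      · exact hz' b hb'
      · rw [dist_comm]; exact hz' a ha'
      · exact hT2 a ha' b hb' hab
  have := le_csSup ⟨_, hbdd⟩ this
  rw [← hT3, Finset.card_insert_of_notMem hzT] at this
  lia

lemma IsGCB.exists_cover_aux (hσ : IsGCB σ) {P₀ r : ℝ} (hp : IsPacked X P₀ r) (hr : 0 < r)
    (k : ℕ) (x : X) : ∃ T : Finset X, T.card ≤ ⌊P₀⌋₊ ^ (k + 1) ∧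
      closedBall x ((k + 3) * r) ⊆ ⋃ y ∈ T, closedBall y (2 * r) := by
  classical
  induction k with
  | zero => simpa using hp.exists_cover hr x
  | succ k ih =>
    obtain ⟨T, hT, hcov⟩ := ih
    choose U hU hUcov using fun y => hp.exists_cover hr y
    refine ⟨T.biUnion U, ?_, fun z hz => ?_⟩
    · rw [pow_succ]
      exact (Finset.card_biUnion_le_card_mul T U _ fun y _ => hU y).trans
        (Nat.mul_le_mul_right _ hT)
    · obtain ⟨γ, hγ, h0, h1⟩ := hσ.exists_line x z
      rw [Metric.mem_closedBall, dist_comm] at hz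
      push_cast at hz
      obtain ⟨s, hs0, hs1, hs2, hs3⟩ : ∃ s : ℝ, 0 ≤ s ∧ s ≤ dist x z ∧ s ≤ (k + 3) * r ∧
          dist x z - s ≤ r := by
        refine ⟨max 0 (dist x z - r), le_max_left _ _, max_le dist_nonneg (by linarith),
          max_le (by positivity) (by linarith), ?_⟩
        linarith [le_max_right 0 (dist x z - r)]
      have hs : γ s ∈ closedBall x ((k + 3) * r) := by
        rw [Metric.mem_closedBall, dist_comm]
        have := hγ.dist_of_le hs0
        rw [h0, sub_zero] at this
        exact this.trans_le hs2
      obtain ⟨y, hy, hys⟩ := Set.mem_iUnion₂.1 (hcov hs)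
      have hz2 : z ∈ closedBall y (3 * r) := by
        rw [Metric.mem_closedBall] at hys ⊢
        have h2 := hγ.dist_of_le hs1
        rw [h1, dist_comm] at h2
        linarith [dist_triangle z (γ s) y]
      obtain ⟨w, hw, hzw⟩ := Set.mem_iUnion₂.1 (hUcov y hz2)
      exact Set.mem_iUnion₂.2 ⟨w, Finset.mem_biUnion.2 ⟨y, hy, hw⟩, hzw⟩

/-- Balls of a packed GCB-space have covering numbers bounded by the packing data. -/
lemma exists_cover_of_isPacked (P₀ r₀ : ℝ) (hr₀ : 0 < r₀) (ε R : ℝ) (hε : 0 < ε) :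
    ∃ M : ℕ, 0 < M ∧ ∀ (X : Type u) [MetricSpace X] (σ : X → X → ℝ → X), IsGCB σ →
      IsPacked X P₀ r₀ → ∀ x : X, ∃ T : Finset X, T.card ≤ M ∧
        closedBall x R ⊆ ⋃ y ∈ T, closedBall y ε := by
  set r := min r₀ (ε / 2) with hr
  have hr0 : 0 < r := lt_min hr₀ (by positivity)
  refine ⟨⌊P₀⌋₊ ^ (⌈R / r⌉₊ + 1) + 1, by positivity, ?_⟩
  intro X _ σ hσ hp x
  obtain ⟨T, hT, hcov⟩ := hσ.exists_cover_aux (hσ.isPacked_of_le hp hr0 (min_le_left _ _)) hr0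
    ⌈R / r⌉₊ x
  refine ⟨T, hT.trans (Nat.le_succ _), fun z hz => ?_⟩
  have h1 : R ≤ (⌈R / r⌉₊ + 3) * r := by
    have := Nat.le_ceil (R / r)
    rw [div_le_iff₀ hr0] at this
    linarith
  obtain ⟨y, hy, hzy⟩ := Set.mem_iUnion₂.1 (hcov (closedBall_subset_closedBall h1 hz))
  refine Set.mem_iUnion₂.2 ⟨y, hy, closedBall_subset_closedBall ?_ hzy⟩
  linarith [min_le_right r₀ (ε / 2)]

/-- Pigeonhole principle in balls of a packed GCB-space. -/
lemma exists_pigeonhole_of_isPacked (P₀ r₀ : ℝ) (hr₀ : 0 < r₀) (ε R : ℝ) (hε : 0 < ε) :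
    ∃ M : ℕ, 0 < M ∧ ∀ (X : Type u) [MetricSpace X] (σ : X → X → ℝ → X), IsGCB σ →
      IsPacked X P₀ r₀ → ∀ (x : X) (α : Type u) (A : Finset α) (f : α → X),
        (∀ a ∈ A, dist x (f a) ≤ R) → ∃ F ⊆ A, A.card ≤ M * F.card ∧
          ∀ a ∈ F, ∀ b ∈ F, dist (f a) (f b) ≤ ε := by
  classical
  obtain ⟨M, hM, h⟩ := exists_cover_of_isPacked P₀ r₀ hr₀ (ε / 2) R (by positivity)
  refine ⟨M, hM, fun X _ σ hσ hp x α A f hf => ?_⟩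
  obtain ⟨T, hT, hcov⟩ := h X σ hσ hp x
  rcases A.eq_empty_or_nonempty with rfl | hne
  · exact ⟨∅, subset_rfl, by simp, by simp⟩
  have hc : ∀ a ∈ A, ∃ y ∈ T, dist (f a) y ≤ ε / 2 := fun a ha => by
    have := hf a ha
    obtain ⟨y, hy, h1⟩ := Set.mem_iUnion₂.1 (hcov (by rwa [Metric.mem_closedBall, dist_comm] :
      f a ∈ closedBall x R))
    exact ⟨y, hy, h1⟩
  obtain ⟨a₀, ha₀⟩ := hne
  obtain ⟨y₀, hy₀, _⟩ := hc a₀ ha₀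
  set p : α → X := fun a => if ha : a ∈ A then (hc a ha).choose else y₀ with hpdef
  have hpa : ∀ a, ∀ ha : a ∈ A, p a ∈ T ∧ dist (f a) (p a) ≤ ε / 2 := fun a ha => by
    have := (hc a ha).choose_spec
    simp only [hpdef, dif_pos ha]
    exact this
  obtain ⟨y, hy, hmax⟩ := T.exists_max_image (fun y => (A.filter fun a => p a = y).card) ⟨y₀, hy₀⟩
  refine ⟨A.filter fun a => p a = y, Finset.filter_subset _ _, ?_, fun a ha b hb => ?_⟩
  · calc A.card = ∑ z ∈ T, (A.filter fun a => p a = z).card :=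
        Finset.card_eq_sum_card_fiberwise fun a ha => (hpa a ha).1
      _ ≤ ∑ z ∈ T, (A.filter fun a => p a = y).card := Finset.sum_le_sum fun z hz => hmax z hz
      _ = T.card * (A.filter fun a => p a = y).card := by rw [Finset.sum_const, smul_eq_mul]
      _ ≤ _ := Nat.mul_le_mul_right _ hT
  · obtain ⟨ha, hay⟩ := Finset.mem_filter.1 ha
    obtain ⟨hb, hby⟩ := Finset.mem_filter.1 hb
    have h1 := (hpa a ha).2
    have h2 := (hpa b hb).2
    rw [hay] at h1
    rw [hby] at h2
    linarith [dist_triangle_right (f a) (f b) y]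

lemma IsGCB.properSpace [CompleteSpace X] (hσ : IsGCB σ) {P₀ r₀ : ℝ} (hr₀ : 0 < r₀)
    (hp : IsPacked X P₀ r₀) : ProperSpace X := by
  refine ⟨fun x R => isCompact_iff_totallyBounded_isComplete.2 ⟨?_, isClosed_closedBall.isComplete⟩⟩
  refine Metric.totallyBounded_iff.2 fun ε hε => ?_
  obtain ⟨M, -, h⟩ := exists_cover_of_isPacked.{u} P₀ r₀ hr₀ (ε / 2) R (by positivity)
  obtain ⟨T, -, hT⟩ := h X σ hσ hp x
  refine ⟨T, T.finite_toSet, hT.trans ?_⟩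
  exact Set.iUnion₂_mono fun y _ => closedBall_subset_ball (by linarith)

/-- Ultralimits of lines through a bounded region are lines. -/
lemma IsGCB.exists_line_limit [ProperSpace X] (hσ : IsGCB σ) (𝒰 : Ultrafilter ℕ) {γ : ℕ → ℝ → X}
    (hγ : ∀ n, IsSigmaLine σ (γ n)) {o : X} {C : ℝ} (hC : ∀ n, dist o (γ n 0) ≤ C) :
    ∃ c, IsSigmaLine σ c ∧ ∀ t, Tendsto (fun n => γ n t) 𝒰 (nhds (c t)) := by
  have hlim : ∀ t, ∃ y, Tendsto (fun n => γ n t) 𝒰 (nhds y) := by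
    intro t
    have hmem : ∀ n, γ n t ∈ closedBall o (C + |t|) := fun n => by
      rw [Metric.mem_closedBall, dist_comm]
      have := (hγ n).dist_eq 0 t
      rw [zero_sub, abs_neg] at this
      linarith [dist_triangle o (γ n 0) (γ n t), hC n]
    obtain ⟨y, -, hy⟩ := (isCompact_closedBall o (C + |t|)).ultrafilter_le_nhds
      (𝒰.map fun n => γ n t) (by
        rw [Ultrafilter.coe_map]
        exact tendsto_principal.2 (Eventually.of_forall hmem))
    exact ⟨y, hy⟩
  choose c hc using hlim
  refine ⟨c, ⟨Isometry.of_dist_eq fun s t => ?_, fun s t hst l hl => ?_⟩, hc⟩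
  · refine tendsto_nhds_unique ((hc s).dist (hc t)) ?_
    simp only [(hγ _).1.dist_eq]
    exact tendsto_const_nhds
  · have h1 : Tendsto (fun n => γ n (s + l * (t - s))) 𝒰 (nhds (σ (c s) (c t) l)) := by
      rw [tendsto_iff_dist_tendsto_zero]
      have h2 : Tendsto (fun n => (1 - l) * dist (γ n s) (c s) + l * dist (γ n t) (c t)) 𝒰
          (nhds ((1 - l) * 0 + l * 0)) :=
        ((tendsto_iff_dist_tendsto_zero.1 (hc s)).const_mul _).add
          ((tendsto_iff_dist_tendsto_zero.1 (hc t)).const_mul _)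
      rw [mul_zero, mul_zero, add_zero] at h2
      refine squeeze_zero (fun _ => dist_nonneg) (fun n => ?_) h2
      rw [← (hγ n).2 s t hst l hl]
      exact hσ.dist_le _ _ _ _ hl
    exact tendsto_nhds_unique h1 (hc _)

end Bicombing

section Rays
open Metric Filter

universe u

variable {X : Type u} [MetricSpace X] {σ : X → X → ℝ → X} {δ : ℝ} {Γ : Subgroup (X ≃ᵢ X)}

/-- Two maps `c, c' : ℝ → X` are asymptotic if they stay at bounded distance in the future. -/
def Asymp (c c' : ℝ → X) : Prop := ∃ C, ∀ t, 0 ≤ t → dist (c t) (c' t) ≤ C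

lemma Asymp.refl (c : ℝ → X) : Asymp c c := ⟨0, fun _ _ => (dist_self _).le⟩

lemma Asymp.symm {c c' : ℝ → X} (h : Asymp c c') : Asymp c' c := by
  obtain ⟨C, hC⟩ := h
  exact ⟨C, fun t ht => by rw [dist_comm]; exact hC t ht⟩

lemma Asymp.trans {c c' c'' : ℝ → X} (h : Asymp c c') (h' : Asymp c' c'') : Asymp c c'' := by
  obtain ⟨C, hC⟩ := h
  obtain ⟨C', hC'⟩ := h'
  exact ⟨C + C', fun t ht => (dist_triangle _ (c' t) _).trans (add_le_add (hC t ht) (hC' t ht))⟩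

lemma Asymp.map {c c' : ℝ → X} (h : Asymp c c') (g : X ≃ᵢ X) :
    Asymp (fun t => g (c t)) (fun t => g (c' t)) := by
  obtain ⟨C, hC⟩ := h
  exact ⟨C, fun t ht => by rw [g.dist_eq]; exact hC t ht⟩

/-- The elements of `Γ` fixing the point at infinity of `c`. -/
def rayStab (Γ : Subgroup (X ≃ᵢ X)) (c : ℝ → X) : Subgroup (X ≃ᵢ X) where
  carrier := {g | g ∈ Γ ∧ Asymp c fun t => g (c t)}
  one_mem' := ⟨Γ.one_mem, Asymp.refl c⟩
  mul_mem' := fun {g h} hg hh => ⟨Γ.mul_mem hg.1 hh.1, hg.2.trans (hh.2.map g)⟩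
  inv_mem' := fun {g} hg => ⟨Γ.inv_mem hg.1, by
    have := hg.2.symm.map g⁻¹
    simpa using this⟩

lemma mem_rayStab {c : ℝ → X} {g : X ≃ᵢ X} :
    g ∈ rayStab Γ c ↔ g ∈ Γ ∧ Asymp c fun t => g (c t) := Iff.rfl

lemma rayStab_congr {c c' : ℝ → X} (h : Asymp c c') : rayStab Γ c = rayStab Γ c' := by
  ext g
  exact ⟨fun hg => ⟨hg.1, h.symm.trans (hg.2.trans (h.map g))⟩,
    fun hg => ⟨hg.1, h.trans (hg.2.trans (h.symm.map g))⟩⟩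

lemma mem_rayStab_map {c : ℝ → X} {g h : X ≃ᵢ X} (hg : g ∈ Γ) :
    g * h * g⁻¹ ∈ rayStab Γ (fun t => g (c t)) ↔ h ∈ rayStab Γ c := by
  have h1 : (g * h * g⁻¹ ∈ Γ) ↔ h ∈ Γ := by
    rw [Γ.mul_mem_cancel_right (Γ.inv_mem hg), Γ.mul_mem_cancel_left hg]
  simp only [mem_rayStab, h1, IsometryEquiv.mul_apply, IsometryEquiv.inv_apply_self]
  refine and_congr_right fun _ => ⟨fun h2 => ?_, fun h2 => h2.map g⟩
  simpa using h2.map g⁻¹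

/-- A torsion-free discrete group of `σ`-isometries of a `δ`-hyperbolic GCB-space. -/
structure IsHypAction (σ : X → X → ℝ → X) (δ : ℝ) (Γ : Subgroup (X ≃ᵢ X)) : Prop where
  gcb : IsGCB σ
  hyp : IsDeltaHyperbolic X δ
  pos : 0 < δ
  isSigma : ∀ g ∈ Γ, IsSigmaIsometry σ g
  discrete : IsDiscreteSubgroup Γ
  torsionFree : ∀ g ∈ Γ, g ≠ 1 → ¬ IsOfFinOrder g

namespace IsHypAction

lemma pow_ne_one (H : IsHypAction σ δ Γ) {g : X ≃ᵢ X} (hg : g ∈ Γ) (h1 : g ≠ 1) {k : ℤ}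
    (hk : k ≠ 0) : g ^ k ≠ 1 := fun h =>
  H.torsionFree g hg h1 (isOfFinOrder_iff_zpow_eq_one.2 ⟨k, hk, h⟩)

lemma exists_dist_pow_ge (H : IsHypAction σ δ Γ) {g : X ≃ᵢ X} (hg : g ∈ Γ) (h1 : g ≠ 1) (x : X)
    (R : ℝ) : ∃ m : ℕ, ∀ k : ℤ, (m : ℤ) ≤ |k| → R < dist x ((g ^ k) x) := by
  have hfin := H.discrete x R
  have hinj : Function.Injective fun k : ℤ => g ^ k := by
    intro k l hkl
    by_contra hne
    refine H.pow_ne_one hg h1 (sub_ne_zero.2 hne) ?_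
    rw [zpow_sub, mul_inv_eq_one]
    exact hkl
  have hfin2 : {k : ℤ | dist x ((g ^ k) x) ≤ R}.Finite :=
    (hfin.preimage hinj.injOn).subset fun k hk => ⟨Γ.zpow_mem hg k, hk⟩
  obtain ⟨m, hm⟩ := (hfin2.image fun k : ℤ => |k|).bddAbove
  refine ⟨m.toNat + 1, fun k hk => ?_⟩
  by_contra! hle
  have := hm ⟨k, hle, rfl⟩
  simp only at this
  have h2 := Int.self_le_toNat m
  push_cast at hk
  lia

/-- Every nontrivial element fixes a point at infinity, and does not move the points of a ray
from `o` to it more than `o`. This ray is a limit of segments from `o` to points of its orbit. -/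
lemma exists_fixed_ray [ProperSpace X] (H : IsHypAction σ δ Γ) {g : X ≃ᵢ X} (hg : g ∈ Γ)
    (h1 : g ≠ 1) (o : X) :
    ∃ c, IsSigmaLine σ c ∧ c 0 = o ∧ (∀ t, 0 ≤ t → dist (c t) (g (c t)) ≤ dist o (g o)) ∧
      ∀ t, 0 ≤ t → ∃ m : ℕ, dist (c t) ((g ^ (m : ℤ)) o) ≤ dist o ((g ^ (m : ℤ)) o) - t + 1 := by
  have hex : ∀ n : ℕ, ∃ γ, IsSigmaLine σ γ ∧ γ 0 = o ∧
      (∀ t : ℝ, 0 ≤ t → t ≤ n → dist (γ t) (g (γ t)) ≤ dist o (g o)) ∧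
      ∃ m : ℕ, ∀ t : ℝ, 0 ≤ t → t ≤ n →
        dist (γ t) ((g ^ (m : ℤ)) o) ≤ dist o ((g ^ (m : ℤ)) o) - t := by
    intro n
    obtain ⟨m, hm⟩ := H.exists_dist_pow_ge hg h1 o n
    have h2 := hm m (by simp)
    obtain ⟨γ, hγ, h0, hd⟩ := H.gcb.exists_line o ((g ^ (m : ℤ)) o)
    refine ⟨γ, hγ, h0, fun t ht0 htn => ?_, m, fun t ht0 htn => ?_⟩
    · refine hγ.dist_le_of_mem H.gcb (hγ.map (H.isSigma g hg)) (s := 0)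
        (r := dist o ((g ^ (m : ℤ)) o)) ?_ ?_ ht0 (htn.trans h2.le)
      · simp only [h0, le_refl]
      · simp only [hd]
        rw [← IsometryEquiv.mul_apply, ← zpow_one_add, add_comm, zpow_add_one,
          IsometryEquiv.mul_apply, IsometryEquiv.dist_eq]
    · have := hγ.dist_of_le (htn.trans h2.le)
      rw [hd] at this
      exact this.le
  choose γ hγ h0 hle m hm using hex
  obtain ⟨c, hc, hlim⟩ := H.gcb.exists_line_limit (hyperfilter ℕ) hγ (o := o) (C := 0)
    (fun n => by rw [h0, dist_self])
  have hev : ∀ t : ℝ, ∀ᶠ n : ℕ in hyperfilter ℕ, t ≤ n := fun t => by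
    have : ∀ᶠ n : ℕ in hyperfilter ℕ, ⌈t⌉₊ ≤ n :=
      Nat.hyperfilter_le_atTop (eventually_ge_atTop _)
    filter_upwards [this] with n hn using Nat.ceil_le.1 hn
  refine ⟨c, hc, ?_, fun t ht => ?_, fun t ht => ?_⟩
  · refine tendsto_nhds_unique (hlim 0) ?_
    simp only [h0]
    exact tendsto_const_nhds
  · refine le_of_tendsto ((hlim t).dist ((g.continuous.tendsto _).comp (hlim t))) ?_
    filter_upwards [hev t] with n hn using hle n t ht hn
  · obtain ⟨n, hn1, hn2⟩ :=
      ((hev t).and (Metric.tendsto_nhds.1 (hlim t) 1 one_pos)).exists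
    refine ⟨m n, ?_⟩
    linarith [hm n t ht hn1, dist_triangle_left (c t) ((g ^ (m n : ℤ)) o) (γ n t)]

end IsHypAction

/-- Two rays with unbounded Gromov products are asymptotic. -/
lemma IsDeltaHyperbolic.dist_le_of_gromovProd_ge (hyp : IsDeltaHyperbolic X δ) {c c' : ℝ → X}
    (hc : IsSigmaLine σ c) (hc' : IsSigmaLine σ c') {s t r : ℝ} (hr : 0 ≤ r)
    (hrs : r ≤ s) (hrt : r ≤ t) (h : r ≤ gromovProd (c s) (c' t) (c 0)) :
    dist (c r) (c' r) ≤ 3 * dist (c 0) (c' 0) + 4 * δ := by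
  have hδ := hyp.nonneg (c 0)
  have e1 := hc.dist_of_le hr
  have e2 := hc.dist_of_le hrs
  have e3 := hc.dist_of_le (hr.trans hrs)
  have e4 := hc'.dist_of_le hr
  have e5 := hc'.dist_of_le hrt
  have e6 := hc'.dist_of_le (hr.trans hrt)
  have t1 := dist_triangle (c' 0) (c 0) (c' r)
  have t2 := dist_triangle (c' 0) (c 0) (c' t)
  have t3 := dist_triangle (c 0) (c' 0) (c' r)
  have h1 := hyp.gromovProd_le (c r) (c s) (c' t) (c 0)
  have h2 := hyp.gromovProd_le (c r) (c' t) (c' r) (c 0)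
  simp only [gromovProd] at *
  rw [dist_comm (c r) (c 0), dist_comm (c s) (c 0), dist_comm (c' t) (c 0)] at *
  rw [dist_comm (c' r) (c 0), dist_comm (c' t) (c' r), dist_comm (c' 0) (c 0)] at *
  rcases h1 with h1 | h1 <;> rcases h2 with h2 | h2 <;>
    linarith [dist_nonneg (x := c 0) (y := c' 0)]

lemma IsDeltaHyperbolic.exists_gromovProd_le (hyp : IsDeltaHyperbolic X δ) {c c' : ℝ → X}
    (hc : IsSigmaLine σ c) (hc' : IsSigmaLine σ c') (h : ¬ Asymp c c') :
    ∃ B, ∀ s t, 0 ≤ s → 0 ≤ t → gromovProd (c s) (c' t) (c 0) ≤ B := by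
  by_contra! hB
  refine h ⟨3 * dist (c 0) (c' 0) + 4 * δ, fun r hr => ?_⟩
  obtain ⟨s, t, hs, ht, hst⟩ := hB (r + dist (c 0) (c' 0))
  have h1 := gromovProd_le_left (c s) (c' t) (c 0)
  have h2 := gromovProd_le_left (c' t) (c s) (c 0)
  rw [gromovProd_comm (c' t)] at h2
  rw [dist_comm, hc.dist_of_le hs] at h1
  have h3 := hc'.dist_of_le ht
  have h4 := dist_triangle (c' t) (c' 0) (c 0)
  rw [dist_comm (c' t) (c' 0), dist_comm (c' 0) (c 0)] at h4
  have h5 := dist_nonneg (x := c 0) (y := c' 0)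
  exact hyp.dist_le_of_gromovProd_ge hc hc' hr (s := s) (t := t) (by linarith) (by linarith)
    (by linarith)

/-- Two distinct points at infinity are joined by a line. -/
lemma exists_line_of_not_asymp [ProperSpace X] (hσ : IsGCB σ) (hyp : IsDeltaHyperbolic X δ)
    {c c' : ℝ → X} (hc : IsSigmaLine σ c) (hc' : IsSigmaLine σ c') (h : ¬ Asymp c c') :
    ∃ γ, IsSigmaLine σ γ ∧ Asymp γ c ∧ Asymp (fun t => γ (-t)) c' := by
  obtain ⟨B, hB⟩ := hyp.exists_gromovProd_le hc hc' h
  set A := B + 2 * δ with hA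
  set A' := A + dist (c 0) (c' 0) with hA'
  have hex : ∀ n : ℕ, ∃ γ, IsSigmaLine σ γ ∧ dist (c 0) (γ 0) ≤ A ∧
      (∀ t : ℝ, 0 ≤ t → t ≤ n → dist (γ t) (c t) ≤ A) ∧
      (∀ t : ℝ, 0 ≤ t → t ≤ n → dist (γ (-t)) (c' t) ≤ A') := by
    intro n
    obtain ⟨β, hβ, h0, h1⟩ := hσ.exists_line (c' n) (c n)
    set d := dist (c' n) (c n) with hd
    set b := gromovProd (c 0) (c n) (c' n) with hb
    have hb0 : 0 ≤ b := gromovProd_nonneg _ _ _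
    have hbd : b ≤ d := by
      rw [hb, gromovProd_comm, hd, dist_comm]; exact gromovProd_le_left _ _ _
    have hz1 := hβ.dist_of_le hb0
    have hz2 := hβ.dist_of_le hbd
    rw [h0] at hz1
    rw [h1] at hz2
    have hz : dist (c 0) (β b) ≤ A := by
      have := hyp.dist_le_of_gromovProd (u := c' n) (v := c n) (y := c 0) (z := β b)
        (by rw [hz1, hz2]; ring) (by rw [hz1, sub_zero])
      refine this.trans ?_
      rw [gromovProd_comm]
      linarith [hB n n (Nat.cast_nonneg n) (Nat.cast_nonneg n)]
    have hcn := hc.dist_of_le (Nat.cast_nonneg n)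
    have hcn' := hc'.dist_of_le (Nat.cast_nonneg n)
    have hγ := hβ.shift b
    refine ⟨fun t => β (t + b), hγ, by simpa using hz, ?_, ?_⟩
    · intro t ht0 htn
      refine hγ.dist_le_of_mem hσ hc (s := 0) (r := n) ?_ ?_ ht0 htn
      · rw [zero_add, dist_comm]; exact hz
      · rw [← h1, hβ.dist_eq, abs_le]
        constructor
        · linarith [dist_triangle_left (β b) (c n) (c 0), dist_comm (β b) (c n)]
        · linarith [dist_triangle (c 0) (β b) (c n)]
    · intro t ht0 htn
      refine (hγ.reverse hσ).dist_le_of_mem hσ hc' (s := 0) (r := n) ?_ ?_ ht0 htn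
      · rw [neg_zero, zero_add]
        linarith [dist_triangle_left (β b) (c' 0) (c 0)]
      · rw [← h0, hβ.dist_eq, sub_zero, abs_le]
        have h3 := dist_triangle_left (β b) (c' 0) (c 0)
        constructor
        · linarith [dist_triangle (c' 0) (β b) (c' n), dist_comm (β b) (c' n),
            dist_comm (c' 0) (β b)]
        · linarith [dist_triangle (c' n) (c' 0) (β b), dist_comm (c' n) (c' 0),
            dist_comm (c' 0) (β b)]
  choose γ hγ hγ0 hγp hγn using hex
  obtain ⟨β, hβ, hlim⟩ := hσ.exists_line_limit (hyperfilter ℕ) hγ hγ0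
  have hev : ∀ t : ℝ, ∀ᶠ n : ℕ in hyperfilter ℕ, ⌈t⌉₊ ≤ n := fun t =>
    Nat.hyperfilter_le_atTop (eventually_ge_atTop _)
  refine ⟨β, hβ, ⟨A, fun t ht => ?_⟩, ⟨A', fun t ht => ?_⟩⟩
  · refine le_of_tendsto ((hlim t).dist tendsto_const_nhds) ?_
    filter_upwards [hev t] with n hn
    exact hγp n t ht (Nat.ceil_le.1 hn)
  · refine le_of_tendsto ((hlim (-t)).dist tendsto_const_nhds) ?_
    filter_upwards [hev t] with n hn
    exact hγn n t ht (Nat.ceil_le.1 hn)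

end Rays

section RayStabilizers
open Metric Filter

universe u

variable {X : Type u} [MetricSpace X] {σ : X → X → ℝ → X} {δ : ℝ} {Γ : Subgroup (X ≃ᵢ X)}

lemma IsSigmaLine.dist_eq_of_bounded (hσ : IsGCB σ) {γ γ' : ℝ → X} (h : IsSigmaLine σ γ)
    (h' : IsSigmaLine σ γ') {C : ℝ} (hC : ∀ t, dist (γ t) (γ' t) ≤ C) (s t : ℝ) :
    dist (γ s) (γ' s) = dist (γ t) (γ' t) := by
  have key : ∀ s t : ℝ, s ≤ t → dist (γ s) (γ' s) = dist (γ t) (γ' t) := by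
    intro s t hst
    refine le_antisymm ?_ (h.antitone_dist hσ h' (fun t _ => hC t) hst)
    have := (h.reverse hσ).antitone_dist hσ (h'.reverse hσ) (fun t _ => hC (-t))
      (neg_le_neg hst)
    simpa using this
  rcases le_total s t with hst | hst
  · exact key s t hst
  · exact (key t s hst).symm

/-- Two lines which are close at both ends of a long interval are `4δ`-close in the middle. -/
lemma IsDeltaHyperbolic.exists_dist_le (hyp : IsDeltaHyperbolic X δ) (hδ : 0 < δ) {γ γ' : ℝ → X}
    (hγ : IsSigmaLine σ γ) (hγ' : IsSigmaLine σ γ') {a m b C : ℝ} (hC : 0 ≤ C)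
    (ha : dist (γ a) (γ' a) ≤ C) (hb : dist (γ b) (γ' b) ≤ C) (ham : C + 3 * δ < m - a)
    (hmb : C + 3 * δ < b - m) : ∃ s, a ≤ s ∧ s ≤ b ∧ dist (γ' m) (γ s) ≤ 4 * δ := by
  have e1' := hγ'.dist_of_le (show a ≤ m by linarith)
  have e2' := hγ'.dist_of_le (show m ≤ b by linarith)
  have e3 := hγ.dist_of_le (show a ≤ b by linarith)
  have e3' := hγ'.dist_of_le (show a ≤ b by linarith)
  have hgp : gromovProd (γ a) (γ b) (γ' m) ≤ 2 * δ := by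
    have t1 := dist_triangle_left (γ' m) (γ' b) (γ b)
    have t2 := dist_triangle_left (γ' m) (γ' a) (γ a)
    have h1 := hyp.gromovProd_le (γ' a) (γ a) (γ' b) (γ' m)
    have h2 := hyp.gromovProd_le (γ a) (γ b) (γ' b) (γ' m)
    simp only [gromovProd] at *
    rw [dist_comm (γ' b) (γ' m), dist_comm (γ' a) (γ a)] at *
    rw [dist_comm (γ' m)] at t2
    rcases h1 with h1 | h1
    · linarith
    · rcases h2 with h2 | h2 <;> linarith
  set r := gromovProd (γ' m) (γ b) (γ a) with hr
  have hr0 : 0 ≤ r := gromovProd_nonneg _ _ _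
  have hrb : r ≤ b - a := by
    rw [hr, gromovProd_comm]
    refine (gromovProd_le_left _ _ _).trans ?_
    rw [dist_comm, e3]
  have z1 := hγ.dist_of_le (show a ≤ a + r by linarith)
  have z2 := hγ.dist_of_le (show a + r ≤ b by linarith)
  have hnear := hyp.dist_le_of_gromovProd (u := γ a) (v := γ b) (y := γ' m)
    (z := γ (a + r)) (by rw [z1, z2, e3]; ring) (by rw [z1]; ring)
  exact ⟨a + r, by linarith, by linarith, by linarith⟩

namespace IsHypAction

/-- An element fixing both ends of a line translates it up to `4δ`. -/
lemma exists_translation (H : IsHypAction σ δ Γ) {γ : ℝ → X} (hγ : IsSigmaLine σ γ)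
    {g : X ≃ᵢ X} (h1 : g ∈ rayStab Γ γ) (h2 : g ∈ rayStab Γ fun t => γ (-t)) :
    ∃ τ, ∀ t, dist (g (γ t)) (γ (t + τ)) ≤ 4 * δ := by
  obtain ⟨hg, C₁, hC₁⟩ := h1
  obtain ⟨-, C₂, hC₂⟩ := h2
  set C := max C₁ C₂
  have hC : ∀ t, dist (γ t) (g (γ t)) ≤ C := by
    intro t
    rcases le_total 0 t with ht | ht
    · exact (hC₁ t ht).trans (le_max_left _ _)
    · have := hC₂ (-t) (by linarith)
      simp only [neg_neg] at this
      exact this.trans (le_max_right _ _)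
  have hC0 : 0 ≤ C := dist_nonneg.trans (hC 0)
  have hgl := hγ.map (H.isSigma g hg)
  obtain ⟨τ, -, -, hτ⟩ := H.hyp.exists_dist_le H.pos hγ hgl (m := 0) hC0 (hC (-(C + 3 * δ + 1)))
    (hC (C + 3 * δ + 1)) (by linarith) (by linarith)
  refine ⟨τ, fun t => ?_⟩
  have hbd : ∀ t, dist (g (γ t)) (γ (t + τ)) ≤ C + |τ| := by
    intro t
    have h3 := hγ.dist_eq t (t + τ)
    rw [sub_add_cancel_left, abs_neg] at h3
    linarith [dist_triangle_left (g (γ t)) (γ (t + τ)) (γ t), hC t]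
  rwa [hgl.dist_eq_of_bounded H.gcb (hγ.shift τ) hbd t 0, zero_add]

/-- The orbit of a nontrivial element fixing both ends of a line follows that line. -/
lemma exists_zpow_follows (H : IsHypAction σ δ Γ) {γ : ℝ → X} (hγ : IsSigmaLine σ γ)
    {w : X ≃ᵢ X} (hw : w ≠ 1) (h1 : w ∈ rayStab Γ γ) (h2 : w ∈ rayStab Γ fun t => γ (-t)) :
    ∃ k : ℤ, k ≠ 0 ∧ ∃ B, ∀ t, 0 ≤ t → ∃ n : ℤ, dist ((w ^ (k * n)) (γ 0)) (γ t) ≤ B ∧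
      dist ((w ^ (k * -n)) (γ 0)) (γ (-t)) ≤ B := by
  have hδ := H.pos
  choose τ hτ using fun n : ℤ => H.exists_translation hγ (zpow_mem h1 n) (zpow_mem h2 n)
  have hadd : ∀ m n : ℤ, |τ (m + n) - (τ m + τ n)| ≤ 12 * δ := by
    intro m n
    rw [← Real.dist_eq, ← hγ.1.dist_eq]
    have a1 := hτ (m + n) 0
    have a2 := hτ m (τ n)
    have a3 := hτ n 0
    rw [zpow_add, IsometryEquiv.mul_apply, zero_add] at a1
    rw [zero_add, ← (w ^ m).dist_eq] at a3
    rw [add_comm] at a2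
    linarith [dist_triangle_left (γ (τ (m + n))) (γ (τ m + τ n)) ((w ^ m) ((w ^ n) (γ 0))),
      dist_triangle ((w ^ m) ((w ^ n) (γ 0))) ((w ^ m) (γ (τ n))) (γ (τ m + τ n))]
  have hzero : |τ 0| ≤ 12 * δ := by
    have := hadd 0 0
    rwa [add_zero, sub_add_cancel_left, abs_neg] at this
  obtain ⟨k, hk0, hk⟩ : ∃ k : ℤ, k ≠ 0 ∧ 24 * δ < τ k := by
    obtain ⟨m, hm⟩ := H.exists_dist_pow_ge h1.1 hw (γ 0) (60 * δ)
    have a1 := hm (m + 1) (by rw [abs_of_nonneg (by positivity)]; lia)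
    have a2 := hτ (m + 1) 0
    have a3 := hγ.dist_eq 0 (0 + τ (m + 1))
    rw [show (0 : ℝ) - (0 + τ (m + 1)) = - τ (m + 1) by ring, abs_neg] at a3
    have a4 : 56 * δ < |τ (m + 1)| := by
      linarith [dist_triangle_right (γ 0) (((w ^ ((m : ℤ) + 1))) (γ 0)) (γ (0 + τ (m + 1)))]
    rcases lt_abs.1 a4 with a5 | a5
    · exact ⟨m + 1, by lia, by linarith⟩
    · refine ⟨-(m + 1), by lia, ?_⟩
      have a6 := hadd (m + 1) (-(m + 1))
      rw [add_neg_cancel] at a6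
      linarith [(abs_le.1 a6).2, (abs_le.1 hzero).1]
  have hstep : ∀ n : ℤ, τ (k * n) + 12 * δ ≤ τ (k * (n + 1)) ∧
      τ (k * (n + 1)) ≤ τ (k * n) + τ k + 12 * δ := by
    intro n
    have := abs_le.1 (hadd (k * n) k)
    rw [mul_add, mul_one]
    constructor <;> linarith [this.1, this.2]
  have hgrow : ∀ n : ℕ, n * (12 * δ) - 12 * δ ≤ τ (k * n) := by
    intro n
    induction n with
    | zero =>
      simp only [Nat.cast_zero, mul_zero]
      linarith [(abs_le.1 hzero).1]
    | succ n ih =>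
      push_cast
      linarith [(hstep n).1]
  refine ⟨k, hk0, τ k + 16 * δ, fun t ht => ?_⟩
  have hexn : ∃ n : ℕ, t ≤ τ (k * n) := by
    refine ⟨⌈t / (12 * δ)⌉₊ + 1, ?_⟩
    have h3 := hgrow (⌈t / (12 * δ)⌉₊ + 1)
    have h4 := Nat.le_ceil (t / (12 * δ))
    rw [div_le_iff₀ (by positivity)] at h4
    push_cast at h3 ⊢
    linarith
  have hspec := Nat.find_spec hexn
  have hclose : |τ (k * (Nat.find hexn : ℕ)) - t| ≤ τ k + 12 * δ := by
    rw [abs_of_nonneg (by linarith)]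
    rcases Nat.eq_zero_or_pos (Nat.find hexn) with h0 | h0
    · rw [h0]
      simp only [Nat.cast_zero, mul_zero]
      linarith [(abs_le.1 hzero).2]
    · have h3 := Nat.find_min hexn (Nat.sub_lt h0 one_pos)
      have h4 := (hstep ((Nat.find hexn - 1 : ℕ) : ℤ)).2
      rw [show ((Nat.find hexn - 1 : ℕ) : ℤ) + 1 = (Nat.find hexn : ℕ) by lia] at h4
      linarith
  set n : ℤ := ((Nat.find hexn : ℕ) : ℤ)
  refine ⟨n, ?_, ?_⟩
  · have h3 := hτ (k * n) 0
    rw [zero_add] at h3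
    have h4 := hγ.dist_eq (τ (k * n)) t
    linarith [dist_triangle ((w ^ (k * n)) (γ 0)) (γ (τ (k * n))) (γ t)]
  · have h3 := hτ (k * n) (-τ (k * n))
    rw [neg_add_cancel, ← (w ^ (k * -n)).dist_eq, ← IsometryEquiv.mul_apply, ← zpow_add, mul_neg,
      neg_add_cancel, zpow_zero, show (1 : X ≃ᵢ X) (γ (-τ (k * n))) = γ (-τ (k * n)) from rfl] at h3
    have h4 := hγ.dist_eq (-τ (k * n)) (-t)
    rw [show -τ (k * n) - -t = -(τ (k * n) - t) by ring, abs_neg] at h4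
    rw [mul_neg]
    linarith [dist_triangle_left ((w ^ (-(k * n))) (γ 0)) (γ (-t)) (γ (-τ (k * n)))]

lemma mem_rayStab_of_commute_of_line (H : IsHypAction σ δ Γ) {γ : ℝ → X} (hγ : IsSigmaLine σ γ)
    {w h : X ≃ᵢ X} (hw : w ≠ 1) (h1 : w ∈ rayStab Γ γ) (h2 : w ∈ rayStab Γ fun t => γ (-t))
    (hh : h ∈ Γ) (hcomm : Commute h w) :
    h ∈ rayStab Γ γ ∧ h ∈ rayStab Γ fun t => γ (-t) := by
  obtain ⟨k, -, B, hB⟩ := H.exists_zpow_follows hγ hw h1 h2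
  have key : ∀ n : ℤ, ∀ x, dist ((w ^ n) (γ 0)) x ≤ B →
      dist x (h x) ≤ 2 * B + dist (γ 0) (h (γ 0)) := by
    intro n x hx
    have h3 : dist ((w ^ n) (γ 0)) (h ((w ^ n) (γ 0))) = dist (γ 0) (h (γ 0)) := by
      rw [← IsometryEquiv.mul_apply h, (hcomm.zpow_right n).eq, IsometryEquiv.mul_apply,
        IsometryEquiv.dist_eq]
    have h4 := h.dist_eq ((w ^ n) (γ 0)) x
    linarith [dist_triangle4 x ((w ^ n) (γ 0)) (h ((w ^ n) (γ 0))) (h x), dist_comm x ((w ^ n) (γ 0))]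
  refine ⟨⟨hh, 2 * B + dist (γ 0) (h (γ 0)), fun t ht => ?_⟩,
    ⟨hh, 2 * B + dist (γ 0) (h (γ 0)), fun t ht => ?_⟩⟩
  · obtain ⟨n, h3, -⟩ := hB t ht
    exact key _ _ h3
  · obtain ⟨n, -, h3⟩ := hB t ht
    exact key _ _ h3

lemma exists_commute_of_line (H : IsHypAction σ δ Γ) {γ : ℝ → X} (hγ : IsSigmaLine σ γ)
    {w h : X ≃ᵢ X} (hw : w ≠ 1) (h1 : w ∈ rayStab Γ γ) (h2 : w ∈ rayStab Γ fun t => γ (-t))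
    (hh : h ∈ rayStab Γ γ) : ∃ k : ℤ, k ≠ 0 ∧ Commute h (w ^ k) := by
  obtain ⟨k, hk, B, hB⟩ := H.exists_zpow_follows hγ hw h1 h2
  obtain ⟨hhΓ, C, hC⟩ := hh
  choose n hn _ using fun i : ℕ => hB i (Nat.cast_nonneg i)
  have hinf : (Set.range n).Infinite := by
    intro hfin
    obtain ⟨R, hR⟩ := (hfin.image fun m => dist ((w ^ (k * m)) (γ 0)) (γ 0)).bddAbove
    obtain ⟨i, hi⟩ := exists_nat_gt (B + R)
    have h3 := hR ⟨n i, ⟨i, rfl⟩, rfl⟩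
    have h4 := hγ.dist_of_le (Nat.cast_nonneg i)
    simp only at h3
    linarith [hn i, dist_triangle_left (γ 0) (γ i) ((w ^ (k * n i)) (γ 0))]
  have hmaps : Set.MapsTo (fun m : ℤ => (w ^ (k * m))⁻¹ * h * w ^ (k * m)) (Set.range n)
      {g | g ∈ Γ ∧ dist (γ 0) (g (γ 0)) ≤ 2 * B + C} := by
    rintro _ ⟨i, rfl⟩
    have hwm := Γ.zpow_mem h1.1 (k * n i)
    refine ⟨Γ.mul_mem (Γ.mul_mem (Γ.inv_mem hwm) hhΓ) hwm, ?_⟩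
    rw [IsometryEquiv.mul_apply, IsometryEquiv.mul_apply, ← (w ^ (k * n i)).dist_eq,
      IsometryEquiv.apply_inv_self]
    have h3 := h.dist_eq ((w ^ (k * n i)) (γ 0)) (γ i)
    linarith [dist_triangle4 ((w ^ (k * n i)) (γ 0)) (γ i) (h (γ i)) (h ((w ^ (k * n i)) (γ 0))),
      hC i (Nat.cast_nonneg i), hn i, dist_comm (h ((w ^ (k * n i)) (γ 0))) (h (γ i))]
  obtain ⟨a, -, b, -, hab, heq⟩ :=
    hinf.exists_ne_map_eq_of_mapsTo hmaps (H.discrete (γ 0) (2 * B + C))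
  refine ⟨k * a - k * b, by rw [← mul_sub]; exact mul_ne_zero hk (sub_ne_zero.2 hab), ?_⟩
  have heq : (w ^ (k * a))⁻¹ * h * w ^ (k * a) = (w ^ (k * b))⁻¹ * h * w ^ (k * b) := heq
  rw [zpow_sub]
  calc h * (w ^ (k * a) * (w ^ (k * b))⁻¹)
      = w ^ (k * a) * ((w ^ (k * a))⁻¹ * h * w ^ (k * a)) * (w ^ (k * b))⁻¹ := by group
    _ = w ^ (k * a) * ((w ^ (k * b))⁻¹ * h * w ^ (k * b)) * (w ^ (k * b))⁻¹ := by rw [heq]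
    _ = _ := by group

section Pairs

variable [ProperSpace X] {c c' : ℝ → X} {w h : X ≃ᵢ X}

lemma exists_line_of_mem (H : IsHypAction σ δ Γ) (hc : IsSigmaLine σ c) (hc' : IsSigmaLine σ c')
    (hcc : ¬ Asymp c c') : ∃ γ, IsSigmaLine σ γ ∧ Asymp γ c ∧ Asymp (fun t => γ (-t)) c' ∧
      rayStab Γ γ = rayStab Γ c ∧ rayStab Γ (fun t => γ (-t)) = rayStab Γ c' := by
  obtain ⟨γ, hγ, h1, h2⟩ := exists_line_of_not_asymp H.gcb H.hyp hc hc' hcc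
  exact ⟨γ, hγ, h1, h2, rayStab_congr h1, rayStab_congr h2⟩

lemma mem_rayStab_of_commute (H : IsHypAction σ δ Γ) (hc : IsSigmaLine σ c)
    (hc' : IsSigmaLine σ c') (hcc : ¬ Asymp c c') (hw : w ≠ 1) (h1 : w ∈ rayStab Γ c)
    (h2 : w ∈ rayStab Γ c') (hh : h ∈ Γ) (hcomm : Commute h w) :
    h ∈ rayStab Γ c ∧ h ∈ rayStab Γ c' := by
  obtain ⟨γ, hγ, -, -, e1, e2⟩ := H.exists_line_of_mem hc hc' hcc
  rw [← e1] at h1 ⊢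
  rw [← e2] at h2 ⊢
  exact H.mem_rayStab_of_commute_of_line hγ hw h1 h2 hh hcomm

lemma exists_commute (H : IsHypAction σ δ Γ) (hc : IsSigmaLine σ c)
    (hc' : IsSigmaLine σ c') (hcc : ¬ Asymp c c') (hw : w ≠ 1) (h1 : w ∈ rayStab Γ c)
    (h2 : w ∈ rayStab Γ c') (hh : h ∈ rayStab Γ c) : ∃ k : ℤ, k ≠ 0 ∧ Commute h (w ^ k) := by
  obtain ⟨γ, hγ, -, -, e1, e2⟩ := H.exists_line_of_mem hc hc' hcc
  rw [← e1] at h1 hh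
  rw [← e2] at h2
  exact H.exists_commute_of_line hγ hw h1 h2 hh

lemma rayStab_eq (H : IsHypAction σ δ Γ) (hc : IsSigmaLine σ c)
    (hc' : IsSigmaLine σ c') (hcc : ¬ Asymp c c') (hw : w ≠ 1) (h1 : w ∈ rayStab Γ c)
    (h2 : w ∈ rayStab Γ c') : rayStab Γ c = rayStab Γ c' := by
  refine le_antisymm (fun h hh => ?_) fun h hh => ?_
  · obtain ⟨k, hk, hcomm⟩ := H.exists_commute hc hc' hcc hw h1 h2 hh
    exact (H.mem_rayStab_of_commute hc hc' hcc (H.pow_ne_one h1.1 hw hk) (zpow_mem h1 k)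
      (zpow_mem h2 k) hh.1 hcomm).2
  · have hcc' : ¬ Asymp c' c := fun h => hcc h.symm
    obtain ⟨k, hk, hcomm⟩ := H.exists_commute hc' hc hcc' hw h2 h1 hh
    exact (H.mem_rayStab_of_commute hc' hc hcc' (H.pow_ne_one h1.1 hw hk) (zpow_mem h2 k)
      (zpow_mem h1 k) hh.1 hcomm).2

/-- A nontrivial element fixes at most two points at infinity. -/
lemma not_fix_three (H : IsHypAction σ δ Γ) {c₁ c₂ c₃ : ℝ → X} (hc₁ : IsSigmaLine σ c₁)
    (hc₂ : IsSigmaLine σ c₂) (hc₃ : IsSigmaLine σ c₃) (h12 : ¬ Asymp c₁ c₂) (h13 : ¬ Asymp c₁ c₃)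
    (h23 : ¬ Asymp c₂ c₃) (hw : w ≠ 1) (h1 : w ∈ rayStab Γ c₁) (h2 : w ∈ rayStab Γ c₂)
    (h3 : w ∈ rayStab Γ c₃) : False := by
  obtain ⟨γ, hγ, -, ⟨A, hA⟩, e1, e2⟩ := H.exists_line_of_mem (Γ := Γ) hc₁ hc₂ h12
  obtain ⟨γ', hγ', ⟨A₁, hA₁⟩, ⟨A₃, hA₃⟩, e1', e3'⟩ := H.exists_line_of_mem (Γ := Γ) hc₁ hc₃ h13
  obtain ⟨k, -, B, hB⟩ := H.exists_zpow_follows hγ hw (e1 ▸ h1) (e2 ▸ h2)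
  obtain ⟨B₁, hB₁⟩ := H.hyp.exists_gromovProd_le hc₂ hc₁ (fun h => h12 h.symm)
  obtain ⟨B₃, hB₃⟩ := H.hyp.exists_gromovProd_le hc₂ hc₃ h23
  set E := A + B + dist (γ 0) (γ' 0) + 4 * δ
  have key : ∀ t s, 0 ≤ t → ∀ c : ℝ → X, ∀ r, dist (c₂ t) (c s) ≤ r →
      t - r ≤ gromovProd (c₂ t) (c s) (c₂ 0) := by
    intro t s ht c r hr
    have h4 := hc₂.dist_of_le ht
    have h5 := dist_triangle_right (c₂ 0) (c₂ t) (c s)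
    simp only [gromovProd]
    rw [dist_comm (c₂ t) (c₂ 0), dist_comm (c s) (c₂ 0)]
    linarith
  set t := max 0 (max (B₁ + E + A₁) (B₃ + E + A₃)) + 1 with ht
  have ht0 : 0 ≤ t := by
    have := le_max_left 0 (max (B₁ + E + A₁) (B₃ + E + A₃)); linarith
  have ht1 : B₁ + E + A₁ < t := by
    have := (le_max_left _ _).trans (le_max_right 0 (max (B₁ + E + A₁) (B₃ + E + A₃))); linarith
  have ht3 : B₃ + E + A₃ < t := by
    have := (le_max_right _ _).trans (le_max_right 0 (max (B₁ + E + A₁) (B₃ + E + A₃))); linarith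
  obtain ⟨n, -, hn⟩ := hB t ht0
  obtain ⟨τ, hτ⟩ := H.exists_translation hγ' (zpow_mem (e1' ▸ h1) (k * -n))
    (zpow_mem (e3' ▸ h3) (k * -n))
  have h4 := hτ 0
  rw [zero_add] at h4
  have h5 : dist (c₂ t) (γ' τ) ≤ E := by
    have h6 := (w ^ (k * -n)).dist_eq (γ 0) (γ' 0)
    have h7 := hA t ht0
    have h8 := dist_triangle_left (c₂ t) (γ' τ) (γ (-t))
    have h9 := dist_triangle_left (γ (-t)) (γ' τ) ((w ^ (k * -n)) (γ 0))
    linarith [dist_triangle ((w ^ (k * -n)) (γ 0)) ((w ^ (k * -n)) (γ' 0)) (γ' τ)]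
  rcases le_total 0 τ with hτ0 | hτ0
  · have h6 := key t τ ht0 c₁ (E + A₁)
      (by linarith [dist_triangle (c₂ t) (γ' τ) (c₁ τ), hA₁ τ hτ0])
    linarith [hB₁ t τ ht0 hτ0]
  · have h7 : dist (γ' (-(-τ))) (c₃ (-τ)) ≤ A₃ := hA₃ (-τ) (by linarith)
    rw [neg_neg] at h7
    have h6 := key t (-τ) ht0 c₃ (E + A₃)
      (by linarith [dist_triangle (c₂ t) (γ' τ) (c₃ (-τ))])
    linarith [hB₃ t (-τ) ht0 (by linarith)]

/-- Stabilizers of points at infinity are malnormal. -/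
lemma mem_rayStab_of_conj (H : IsHypAction σ δ Γ) (hc : IsSigmaLine σ c) {g : X ≃ᵢ X}
    (hg : g ∈ Γ) (hw : w ≠ 1) (h1 : w ∈ rayStab Γ c)
    (h2 : w ∈ rayStab Γ fun t => g (c t)) : g ∈ rayStab Γ c := by
  by_contra hgc
  have hcc : ¬ Asymp c fun t => g (c t) := fun h => hgc ⟨hg, h⟩
  have hcc2 : ¬ Asymp (fun t => g (c t)) fun t => g (g (c t)) := fun h => hcc (by
    simpa using h.map g⁻¹)
  have hgl := hc.map (H.isSigma g hg)
  have hggl := hgl.map (H.isSigma g hg)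
  have heq := H.rayStab_eq hc hgl hcc hw h1 h2
  have h3 : w ∈ rayStab Γ fun t => g (g (c t)) := by
    have h4 : g⁻¹ * w * g ∈ rayStab Γ c := by
      rw [← mem_rayStab_map hg]
      convert h2 using 1; group
    rw [heq, ← mem_rayStab_map hg] at h4
    convert h4 using 1; group
  have hg1 : g ≠ 1 := by
    rintro rfl
    exact hgc (one_mem _)
  have hg2 : g ^ (2 : ℤ) ∈ rayStab Γ c := by
    refine ⟨Γ.zpow_mem hg 2, ?_⟩
    by_contra h4
    refine H.not_fix_three hc hgl hggl hcc (fun h5 => h4 ?_) hcc2 hw h1 h2 h3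
    have h6 : (fun t => (g ^ (2 : ℤ)) (c t)) = fun t => g (g (c t)) := by
      ext t
      rw [zpow_two, IsometryEquiv.mul_apply]
    rwa [h6]
  exact hgc (H.mem_rayStab_of_commute hc hgl hcc (H.pow_ne_one hg hg1 two_ne_zero) hg2
    (heq ▸ hg2) hg ((Commute.refl g).zpow_right 2)).1

lemma mem_rayStab_of_zpow (H : IsHypAction σ δ Γ) (hc : IsSigmaLine σ c) {g : X ≃ᵢ X}
    (hg : g ∈ Γ) {k : ℤ} (hk : k ≠ 0) (h : g ^ k ∈ rayStab Γ c) : g ∈ rayStab Γ c := by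
  rcases eq_or_ne g 1 with rfl | hg1
  · exact one_mem _
  refine H.mem_rayStab_of_conj hc hg (H.pow_ne_one hg hg1 hk) h ?_
  rw [← mem_rayStab_map hg] at h
  convert h using 1
  rw [eq_mul_inv_iff_mul_eq, ← zpow_add_one, ← zpow_one_add, add_comm]

lemma exists_mem_rayStab (H : IsHypAction σ δ Γ) {g : X ≃ᵢ X} (hg : g ∈ Γ) (o : X) :
    ∃ c, IsSigmaLine σ c ∧ c 0 = o ∧ g ∈ rayStab Γ c := by
  rcases eq_or_ne g 1 with rfl | hg1
  · obtain ⟨c, hc, h0, -⟩ := H.gcb.exists_line o o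
    exact ⟨c, hc, h0, one_mem _⟩
  · obtain ⟨c, hc, h0, h, -⟩ := H.exists_fixed_ray hg hg1 o
    exact ⟨c, hc, h0, hg, _, h⟩

/-- Virtually nilpotent subgroups fix a point at infinity. -/
lemma exists_le_rayStab (H : IsHypAction σ δ Γ) {G : Subgroup (X ≃ᵢ X)} (hG : G ≤ Γ)
    (hvn : IsVirtuallyNilpotent G) (hx : ∃ x ∈ G, x ≠ 1) :
    ∃ c, IsSigmaLine σ c ∧ G ≤ rayStab Γ c := by
  obtain ⟨N, hN, hnil⟩ := hvn
  obtain ⟨x, hxG, hx1⟩ := hx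
  have hpow : ∀ y : G, ∃ k : ℤ, k ≠ 0 ∧ y ^ k ∈ N := by
    intro y
    obtain ⟨k, hk, -, hyk⟩ := Subgroup.exists_pow_mem_of_index_ne_zero hN.index_ne_zero y
    exact ⟨k, by lia, by simpa using hyk⟩
  have hNt : Nontrivial N := by
    obtain ⟨k, hk, hxk⟩ := hpow ⟨x, hxG⟩
    refine ⟨⟨⟨_, hxk⟩, 1, fun h => H.pow_ne_one (hG hxG) hx1 hk ?_⟩⟩
    have := congrArg (fun z : N => ((z : G) : X ≃ᵢ X)) h
    simpa using this
  have hZ : Nontrivial (Subgroup.center N) := by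
    rw [Subgroup.nontrivial_iff_ne_bot]
    exact Group.IsNilpotent.center_ne_bot N
  obtain ⟨z, hz1⟩ := exists_ne (1 : Subgroup.center N)
  set z' : X ≃ᵢ X := (((z : N) : G) : X ≃ᵢ X) with hz'
  have hz'1 : z' ≠ 1 := fun h => hz1 (by
    apply Subtype.ext; apply Subtype.ext; apply Subtype.ext; exact h)
  have hzΓ : z' ∈ Γ := hG ((z : N) : G).2
  obtain ⟨o⟩ : Nonempty X := by
    by_contra hX
    rw [not_nonempty_iff] at hX
    exact hx1 (IsometryEquiv.ext fun y => hX.elim y)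
  obtain ⟨c, hc, -, hzc⟩ := H.exists_mem_rayStab hzΓ o
  refine ⟨c, hc, fun h hh => ?_⟩
  obtain ⟨k, hk, hhk⟩ := hpow ⟨h, hh⟩
  have hhΓ : h ^ k ∈ Γ := Γ.zpow_mem (hG hh) k
  have hcomm : h ^ k * z' = z' * h ^ k := by
    have := congrArg (fun z : N => ((z : G) : X ≃ᵢ X)) (Subgroup.mem_center_iff.1 z.2 ⟨_, hhk⟩)
    simpa using this
  refine H.mem_rayStab_of_zpow hc (hG hh) hk (H.mem_rayStab_of_conj hc hhΓ hz'1 hzc ?_)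
  rw [← mem_rayStab_map hhΓ, hcomm, mul_inv_cancel_right] at hzc
  exact hzc

end Pairs

end IsHypAction

end RayStabilizers

section Parabolic
open Metric Filter
open scoped Classical Pointwise

universe u

variable {X : Type u} [MetricSpace X] {σ : X → X → ℝ → X} {δ : ℝ} {Γ : Subgroup (X ≃ᵢ X)}

/-- The elements of `Γ` displacing `x` at most `R`. -/
noncomputable def IsDiscreteSubgroup.near (hd : IsDiscreteSubgroup Γ) (x : X) (R : ℝ) :
    Finset (X ≃ᵢ X) := (hd x R).toFinset

lemma IsDiscreteSubgroup.mem_near (hd : IsDiscreteSubgroup Γ) {x : X} {R : ℝ} {g : X ≃ᵢ X} :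
    g ∈ hd.near x R ↔ g ∈ Γ ∧ dist x (g x) ≤ R := by
  simp [near]

lemma dist_mul_apply_le (g h : X ≃ᵢ X) (x : X) :
    dist x ((g * h) x) ≤ dist x (g x) + dist x (h x) := by
  have := dist_triangle x (g x) (g (h x))
  rwa [g.dist_eq, ← IsometryEquiv.mul_apply] at this

lemma dist_inv_apply (g : X ≃ᵢ X) (x : X) : dist x (g⁻¹ x) = dist x (g x) := by
  rw [← g.dist_eq, IsometryEquiv.apply_inv_self, dist_comm]

lemma dist_inv_mul_apply (g h : X ≃ᵢ X) (x : X) :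
    dist x ((g⁻¹ * h) x) = dist (g x) (h x) := by
  rw [← g.dist_eq, IsometryEquiv.mul_apply, IsometryEquiv.apply_inv_self]

lemma exists_pigeonhole_isometry (P₀ r₀ : ℝ) (hr₀ : 0 < r₀) (ε R : ℝ) (hε : 0 < ε) :
    ∃ M : ℕ, 0 < M ∧ ∀ (X : Type u) [MetricSpace X] (σ : X → X → ℝ → X), IsGCB σ →
      IsPacked X P₀ r₀ → ∀ (x : X) (A : Finset (X ≃ᵢ X)), (∀ a ∈ A, dist x (a x) ≤ R) →
        ∃ F ⊆ A, A.card ≤ M * F.card ∧ ∀ a ∈ F, ∀ b ∈ F, dist x ((a⁻¹ * b) x) ≤ ε := by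
  obtain ⟨M, hM, h⟩ := exists_pigeonhole_of_isPacked.{u} P₀ r₀ hr₀ ε R hε
  refine ⟨M, hM, fun X _ σ hσ hp x A hA => ?_⟩
  obtain ⟨F, hF, hcard, hF'⟩ := h X σ hσ hp x (X ≃ᵢ X) A (fun a => a x) hA
  exact ⟨F, hF, hcard, fun a ha b hb => (dist_inv_mul_apply a b x).trans_le (hF' a ha b hb)⟩

lemma exists_card_near_le (P₀ r₀ : ℝ) (hr₀ : 0 < r₀) (ε R : ℝ) (hε : 0 < ε) :
    ∃ M : ℕ, 0 < M ∧ ∀ (X : Type u) [MetricSpace X] (σ : X → X → ℝ → X), IsGCB σ →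
      IsPacked X P₀ r₀ → ∀ (Γ : Subgroup (X ≃ᵢ X)) (hd : IsDiscreteSubgroup Γ) (x : X),
        (hd.near x R).card ≤ M * (hd.near x ε).card := by
  obtain ⟨M, hM, h⟩ := exists_pigeonhole_isometry.{u} P₀ r₀ hr₀ ε R hε
  refine ⟨M, hM, fun X _ σ hσ hp Γ hd x => ?_⟩
  obtain ⟨F, hF, hcard, hF'⟩ := h X σ hσ hp x (hd.near x R) fun a ha => (hd.mem_near.1 ha).2
  refine hcard.trans (Nat.mul_le_mul_left _ ?_)
  rcases F.eq_empty_or_nonempty with rfl | ⟨a, ha⟩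
  · simp
  · rw [← Finset.card_image_of_injective F (mul_right_injective a⁻¹)]
    refine Finset.card_le_card fun y hy => ?_
    obtain ⟨b, hb, rfl⟩ := Finset.mem_image.1 hy
    exact hd.mem_near.2 ⟨Γ.mul_mem (Γ.inv_mem (hd.mem_near.1 (hF ha)).1)
      (hd.mem_near.1 (hF hb)).1, hF' a ha b hb⟩

namespace IsHypAction

/-- An element fixing a point at infinity eventually translates a ray towards it up to `4δ`. -/
lemma exists_ray_translation (H : IsHypAction σ δ Γ) {c : ℝ → X} (hc : IsSigmaLine σ c)
    {g : X ≃ᵢ X} (hg : g ∈ rayStab Γ c) {t₀ C : ℝ} (hC : dist (c t₀) (g (c t₀)) ≤ C)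
    {T : ℝ} (hT : t₀ + C + 3 * δ < T) :
    ∃ τ, ∀ t, T ≤ t → dist (g (c t)) (c (t + τ)) ≤ 4 * δ := by
  have hgl := hc.map (H.isSigma g hg.1)
  obtain ⟨A, hA⟩ := hg.2
  have hanti := hc.antitone_dist H.gcb hgl hA
  have hC0 : 0 ≤ C := dist_nonneg.trans hC
  obtain ⟨s, -, -, hs⟩ := H.hyp.exists_dist_le H.pos hc hgl (a := t₀) (m := T)
    (b := T + C + 3 * δ + 1) hC0 hC
    ((hanti (by linarith [H.pos])).trans hC) (by linarith) (by linarith)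
  refine ⟨s - T, fun t ht => ?_⟩
  have hbd : ∀ t, 0 ≤ t → dist (g (c t)) (c (t + (s - T))) ≤ A + |s - T| := by
    intro t ht
    have h3 := hc.dist_eq t (t + (s - T))
    rw [sub_add_cancel_left, abs_neg] at h3
    linarith [dist_triangle_left (g (c t)) (c (t + (s - T))) (c t), hA t ht]
  have h4 := hgl.antitone_dist H.gcb (hc.shift (s - T)) hbd ht
  refine h4.trans ?_
  simpa using hs

lemma isVirtuallyNilpotent_of_line (H : IsHypAction σ δ Γ) [ProperSpace X] {c c' : ℝ → X}
    (hc : IsSigmaLine σ c) (hc' : IsSigmaLine σ c') (hcc : ¬ Asymp c c') {w : X ≃ᵢ X}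
    (hw : w ≠ 1) (h1 : w ∈ rayStab Γ c) (h2 : w ∈ rayStab Γ c') (hΓ : Γ ≤ rayStab Γ c) :
    IsVirtuallyNilpotent Γ := by
  have heq := H.rayStab_eq hc hc' hcc hw h1 h2
  obtain ⟨γ, hγ, -, -, e1, e2⟩ := H.exists_line_of_mem (Γ := Γ) hc hc' hcc
  obtain ⟨k, -, B, hB⟩ := H.exists_zpow_follows hγ hw (e1 ▸ h1) (e2 ▸ h2)
  have hcov : ∀ g ∈ Γ, ∃ n : ℤ, w ^ n * g ∈ H.discrete.near (γ 0) (B + 4 * δ) := by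
    intro g hg
    obtain ⟨τ, hτ⟩ := H.exists_translation hγ (e1 ▸ hΓ hg) (e2 ▸ heq ▸ hΓ hg)
    have hτ0 := hτ 0
    rw [zero_add] at hτ0
    obtain ⟨n, hn⟩ : ∃ n : ℤ, dist ((w ^ n) (γ 0)) (γ τ) ≤ B := by
      rcases le_total 0 τ with h0 | h0
      · obtain ⟨n, hn, -⟩ := hB τ h0
        exact ⟨_, hn⟩
      · obtain ⟨n, -, hn⟩ := hB (-τ) (by linarith)
        rw [neg_neg] at hn
        exact ⟨_, hn⟩
    refine ⟨-n, H.discrete.mem_near.2 ⟨Γ.mul_mem (Γ.zpow_mem h1.1 _) hg, ?_⟩⟩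
    rw [zpow_neg, dist_inv_mul_apply]
    linarith [dist_triangle_right ((w ^ n) (γ 0)) (g (γ 0)) (γ τ)]
  set Z : Subgroup Γ := Subgroup.zpowers ⟨w, h1.1⟩
  have hfin : Finite (Γ ⧸ Z) := by
    have : Finite {f : Γ // (f : X ≃ᵢ X) ∈ H.discrete.near (γ 0) (B + 4 * δ)} :=
      ((H.discrete.near (γ 0) (B + 4 * δ)).finite_toSet.preimage
        Subtype.val_injective.injOn).to_subtype
    refine Finite.of_surjective (fun f : {f : Γ // (f : X ≃ᵢ X) ∈ H.discrete.near (γ 0)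
      (B + 4 * δ)} => ((f.1⁻¹ : Γ) : Γ ⧸ Z)) fun q => ?_
    obtain ⟨g, rfl⟩ := QuotientGroup.mk_surjective q
    obtain ⟨n, hn⟩ := hcov _ (Γ.inv_mem g.2)
    refine ⟨⟨⟨w, h1.1⟩ ^ n * g⁻¹, hn⟩, ?_⟩
    rw [QuotientGroup.eq, inv_inv, mul_assoc, inv_mul_cancel, mul_one]
    exact zpow_mem (Subgroup.mem_zpowers _) n
  have hfi : Z.FiniteIndex := Subgroup.finiteIndex_of_finite_quotient
  have hcomm : ∀ x y : Z, x * y = y * x := by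
    rintro ⟨_, i, rfl⟩ ⟨_, j, rfl⟩
    exact Subtype.ext (zpow_mul_comm _ i j)
  let _ : CommGroup Z := { (inferInstance : Group Z) with mul_comm := hcomm }
  exact ⟨Z, hfi, inferInstance⟩

/-- An element with a large translation towards a point at infinity fixes another one. -/
lemma exists_not_asymp (H : IsHypAction σ δ Γ) [ProperSpace X] {c : ℝ → X}
    (hc : IsSigmaLine σ c) {w : X ≃ᵢ X} (h1 : w ∈ Γ) {τ T : ℝ} (hτ : 32 * δ < τ)
    (h : ∀ t, T ≤ t → dist (w (c t)) (c (t - τ)) ≤ 4 * δ) :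
    ∃ c', IsSigmaLine σ c' ∧ ¬ Asymp c c' ∧ w ∈ rayStab Γ c' := by
  have hδ := H.pos
  set t₀ := T + 2 * τ with ht₀
  set o := c t₀ with ho
  have hw : w ≠ 1 := by
    rintro rfl
    have h3 := h T le_rfl
    have h4 := hc.dist_of_le (show T - τ ≤ T by linarith)
    rw [show (1 : X ≃ᵢ X) (c T) = c T from rfl, dist_comm] at h3
    linarith
  obtain ⟨c', hc', h0, hfix, happ⟩ := H.exists_fixed_ray h1 hw o
  refine ⟨c', hc', ?_, h1, _, hfix⟩
  rintro ⟨A, hA⟩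
  have hwo := h t₀ (by linarith)
  have hw2o : dist (w (w o)) (c (t₀ - 2 * τ)) ≤ 8 * δ := by
    have h3 := h (t₀ - τ) (by linarith)
    rw [show t₀ - τ - τ = t₀ - 2 * τ by ring] at h3
    have h4 := w.dist_eq (w o) (c (t₀ - τ))
    linarith [dist_triangle (w (w o)) (w (c (t₀ - τ))) (c (t₀ - 2 * τ))]
  have d1 := hc.dist_of_le (show t₀ - τ ≤ t₀ by linarith)
  have d2 := hc.dist_of_le (show t₀ - 2 * τ ≤ t₀ by linarith)
  have hlow : τ - 4 * δ ≤ dist o (w o) := by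
    linarith [dist_triangle_left (c (t₀ - τ)) o (w o), dist_comm o (w o)]
  have hup : dist o (w o) ≤ τ + 4 * δ := by
    linarith [dist_triangle_right o (w o) (c (t₀ - τ)), dist_comm o (c (t₀ - τ))]
  have hlow2 : 2 * τ - 8 * δ ≤ dist o (w (w o)) := by
    linarith [dist_triangle_left (c (t₀ - 2 * τ)) o (w (w o)), dist_comm o (w (w o))]
  have key : ∀ t, τ ≤ t → ∀ m : ℕ, gromovProd (c (t₀ + t)) ((w ^ (m : ℤ)) o) o ≤ 9 * δ := by
    intro t ht m
    set x : ℕ → X := fun n => match n with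
      | 0 => c (t₀ + t)
      | n + 1 => (w ^ (n : ℤ)) o with hx
    have hx1 : x 1 = o := by simp only [hx, Nat.cast_zero, zpow_zero]; rfl
    have hx2 : x 2 = w o := by simp only [hx, Nat.cast_one, zpow_one]
    have hxs : ∀ n, x (n + 2) = (w ^ (n : ℤ)) (w o) := by
      intro n
      simp only [hx]
      push_cast
      rw [zpow_add_one, IsometryEquiv.mul_apply]
    have hxs' : ∀ n, x (n + 3) = (w ^ (n : ℤ)) (w (w o)) := by
      intro n
      rw [hxs (n + 1)]
      push_cast
      rw [zpow_add_one, IsometryEquiv.mul_apply]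
    rcases Nat.eq_zero_or_pos m with rfl | hm
    · rw [Nat.cast_zero, zpow_zero]
      refine (gromovProd_comm _ _ _).trans_le ((gromovProd_le_left _ _ _).trans ?_)
      rw [show (1 : X ≃ᵢ X) o = o from rfl, dist_self]; linarith
    have hloc := H.hyp.local_to_global_rev (x := x) (D := 8 * δ) (L := τ - 4 * δ) (n := m + 1)
      (by linarith) hδ.le (by linarith) ?_ ?_ (i := 0) (k := m + 1) (by lia) le_rfl
    · rw [hx1] at hloc
      refine le_trans ?_ (hloc.trans (by linarith))
      exact le_rfl
    · intro i _
      rcases i with _ | n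
      · rw [zero_add, hx1]
        have := hc.dist_of_le (show t₀ ≤ t₀ + t by linarith)
        show _ ≤ dist (c (t₀ + t)) o
        rw [dist_comm]; linarith
      · rw [hxs n]
        show _ ≤ dist ((w ^ (n : ℤ)) o) _
        rwa [IsometryEquiv.dist_eq]
    · intro i _
      rcases i with _ | n
      · rw [zero_add, zero_add, hx1, hx2]
        show gromovProd (c (t₀ + t)) (w o) o ≤ _
        have e1 := hc.dist_of_le (show t₀ ≤ t₀ + t by linarith)
        have e2 := hc.dist_of_le (show t₀ - τ ≤ t₀ + t by linarith)
        simp only [gromovProd]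
        rw [dist_comm (c (t₀ + t)) o, dist_comm (w o) o]
        linarith [dist_triangle_left (c (t₀ - τ)) (c (t₀ + t)) (w o), dist_comm (c (t₀ + t)) (w o)]
      · rw [show n + 1 + 2 = n + 3 by ring, show n + 1 + 1 = n + 2 by ring, hxs', hxs]
        show gromovProd ((w ^ (n : ℤ)) o) _ _ ≤ _
        rw [gromovProd_map]
        simp only [gromovProd]
        rw [dist_comm (w (w o)) (w o), w.dist_eq]
        linarith
  set r := |t₀| + |A| + A + |τ| + 20 * δ + 2 with hr
  have hr1 : τ ≤ r := by
    have := le_abs_self τ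
    have := neg_abs_le A
    linarith [abs_nonneg t₀]
  obtain ⟨m, hm⟩ := happ (t₀ + r) (by linarith [neg_abs_le t₀, neg_abs_le A, abs_nonneg τ])
  have h3 := key r hr1 m
  have h4 := hA (t₀ + r) (by linarith [neg_abs_le t₀, neg_abs_le A, abs_nonneg τ])
  have h5 := hc.dist_of_le (show t₀ ≤ t₀ + r by linarith)
  simp only [gromovProd] at h3
  rw [dist_comm (c (t₀ + r)) o, dist_comm _ o] at h3
  rw [← ho] at h5
  linarith [dist_triangle (c (t₀ + r)) (c' (t₀ + r)) ((w ^ (m : ℤ)) o), abs_nonneg τ,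
    neg_abs_le A, neg_abs_le t₀, abs_nonneg t₀, abs_nonneg A]


/-- A finitely generated group fixing a point at infinity is virtually nilpotent. -/
theorem isVirtuallyNilpotent (H : IsHypAction σ δ Γ) [CompleteSpace X] {P₀ r₀ : ℝ} (hr₀ : 0 < r₀)
    (hp : IsPacked X P₀ r₀) [Group.FG Γ] {c : ℝ → X} (hc : IsSigmaLine σ c)
    (hΓ : Γ ≤ rayStab Γ c) : IsVirtuallyNilpotent Γ := by
  have hproper : ProperSpace X := H.gcb.properSpace hr₀ hp
  have hδ := H.pos
  by_cases hcase : ∃ w c', IsSigmaLine σ c' ∧ ¬ Asymp c c' ∧ w ≠ 1 ∧ w ∈ rayStab Γ c'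
  · obtain ⟨w, c', hc', hcc, hw, hwc⟩ := hcase
    exact H.isVirtuallyNilpotent_of_line hc hc' hcc hw (hΓ hwc.1) hwc hΓ
  push Not at hcase
  have hτ : ∀ g ∈ Γ, ∀ τ T, (∀ t, T ≤ t → dist (g (c t)) (c (t + τ)) ≤ 4 * δ) →
      |τ| ≤ 32 * δ := by
    intro g hg τ T hgT
    by_contra! hτ
    rcases lt_abs.1 hτ with h1 | h1
    · obtain ⟨c', hc', hcc, h2⟩ := H.exists_not_asymp hc (Γ.inv_mem hg) (T := T + τ) h1
        (fun t ht => by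
          have := hgT (t - τ) (by linarith)
          rw [sub_add_cancel] at this
          rwa [← g.dist_eq, IsometryEquiv.apply_inv_self, dist_comm])
      refine hcase _ c' hc' hcc (fun h => ?_) h2
      · have := hgT T le_rfl
        rw [inv_eq_one.1 h, show (1 : X ≃ᵢ X) (c T) = c T from rfl, hc.dist_eq,
          sub_add_cancel_left, abs_neg] at this
        linarith
    · obtain ⟨c', hc', hcc, h2⟩ := H.exists_not_asymp hc hg h1 (T := T)
        (fun t ht => by rw [sub_neg_eq_add]; exact hgT t ht)
      refine hcase _ c' hc' hcc (fun h => ?_) h2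
      · have := hgT T le_rfl
        rw [h, show (1 : X ≃ᵢ X) (c T) = c T from rfl, hc.dist_eq,
          sub_add_cancel_left, abs_neg] at this
        linarith
  have hanti : ∀ g ∈ Γ, Antitone fun t => dist (c t) (g (c t)) := fun g hg => by
    obtain ⟨A, hA⟩ := (hΓ hg).2
    exact hc.antitone_dist H.gcb (hc.map (H.isSigma g hg)) hA
  have hsmall : ∀ g ∈ Γ, ∀ t C, dist (c t) (g (c t)) ≤ C → ∀ T, t + C + 3 * δ < T →
      dist (c T) (g (c T)) ≤ 36 * δ := by
    intro g hg t C hC T hT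
    obtain ⟨τ, hgτ⟩ := H.exists_ray_translation hc (hΓ hg) hC hT
    have h1 := hτ g hg τ T hgτ
    have h2 := hgτ T le_rfl
    have h3 := hc.dist_eq T (T + τ)
    rw [sub_add_cancel_left, abs_neg] at h3
    linarith [dist_triangle_right (c T) (g (c T)) (c (T + τ))]
  set C₂ := 76 * δ with hC₂
  obtain ⟨M, hM, hcard⟩ := exists_card_near_le.{u} P₀ r₀ hr₀ (36 * δ) (36 * δ + 2 * C₂)
    (by positivity)
  set U : ℝ → Finset (X ≃ᵢ X) := fun t => H.discrete.near (c t) (36 * δ) with hU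
  have hUmul : ∀ t, ∀ g ∈ U t, ∀ h ∈ U t, g * h ∈ U (t + C₂) := by
    intro t g hg h hh
    have hg := H.discrete.mem_near.1 hg
    have hh := H.discrete.mem_near.1 hh
    refine H.discrete.mem_near.2 ⟨Γ.mul_mem hg.1 hh.1, ?_⟩
    refine hsmall _ (Γ.mul_mem hg.1 hh.1) t (72 * δ) ?_ _ (by linarith)
    linarith [dist_mul_apply_le g h (c t)]
  have hUcard : ∀ t, (U (t + C₂)).card ≤ M * (U t).card := by
    intro t
    refine le_trans (Finset.card_le_card fun g hg => ?_) (hcard X σ H.gcb hp Γ H.discrete (c t))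
    have hg := H.discrete.mem_near.1 hg
    refine H.discrete.mem_near.2 ⟨hg.1, ?_⟩
    have h1 := hc.dist_of_le (show t ≤ t + C₂ by linarith)
    have h2 := g.dist_eq (c t) (c (t + C₂))
    linarith [dist_triangle4 (c t) (c (t + C₂)) (g (c (t + C₂))) (g (c t)),
      dist_comm (g (c (t + C₂))) (g (c t))]
  obtain ⟨S, hS⟩ := exists_isSymmGen Γ
  have hex : ∀ s : Γ, ∃ t, (s : X ≃ᵢ X) ∈ U t := by
    intro s
    exact ⟨_, H.discrete.mem_near.2 ⟨s.2, hsmall s s.2 0 _ le_rfl _ (lt_add_one _)⟩⟩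
  choose f hf using hex
  have hmono : ∀ s t, s ≤ t → U s ⊆ U t := by
    intro s t hst g hg
    have hg := H.discrete.mem_near.1 hg
    exact H.discrete.mem_near.2 ⟨hg.1, (hanti g hg.1 hst).trans hg.2⟩
  obtain ⟨t₀, ht₀⟩ := (S.image f).bddAbove
  have hpow : ∀ k : ℕ, ∀ s ∈ S ^ 2 ^ k, (s : X ≃ᵢ X) ∈ U (t₀ + k * C₂) := by
    intro k
    induction k with
    | zero =>
      intro s hs
      rw [pow_zero, pow_one] at hs
      rw [Nat.cast_zero, zero_mul, add_zero]
      exact hmono _ _ (ht₀ (Finset.mem_coe.2 (Finset.mem_image_of_mem f hs))) (hf s)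
    | succ k ih =>
      intro s hs
      rw [pow_succ, mul_two, pow_add] at hs
      obtain ⟨a, ha, b, hb, rfl⟩ := Finset.mem_mul.1 hs
      have := hUmul _ _ (ih a ha) _ (ih b hb)
      rw [show t₀ + ((k + 1 : ℕ) : ℝ) * C₂ = t₀ + k * C₂ + C₂ by push_cast; ring]
      exact this
  have hcards : ∀ k : ℕ, (U (t₀ + k * C₂)).card ≤ M ^ k * (U t₀).card := by
    intro k
    induction k with
    | zero => simp
    | succ k ih =>
      rw [show t₀ + ((k + 1 : ℕ) : ℝ) * C₂ = t₀ + k * C₂ + C₂ by push_cast; ring]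
      calc _ ≤ M * (M ^ k * (U t₀).card) := (hUcard _).trans (Nat.mul_le_mul_left _ ih)
        _ = _ := by ring
  have hmain : ∀ k : ℕ, (S ^ 2 ^ k).card ≤ (U t₀).card * 2 ^ (M * k) := fun k => by
    calc (S ^ 2 ^ k).card = ((S ^ 2 ^ k).image (Subtype.val : Γ → X ≃ᵢ X)).card :=
          (Finset.card_image_of_injective _ Subtype.val_injective).symm
      _ ≤ (U (t₀ + k * C₂)).card := Finset.card_le_card fun g hg => by
          obtain ⟨s, hs, rfl⟩ := Finset.mem_image.1 hg
          exact hpow k s hs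
      _ ≤ M ^ k * (U t₀).card := hcards k
      _ ≤ (2 ^ M) ^ k * (U t₀).card := by
          gcongr
          exact Nat.lt_two_pow_self.le
      _ = (U t₀).card * 2 ^ (M * k) := by rw [← pow_mul, mul_comm]
  refine isVirtuallyNilpotent_of_growthLE M Γ 
    (GrowthLE.of_two_pow (s := (U t₀).card) (K := M) hS fun k => ?_)
  convert hmain k

end IsHypAction

end Parabolic

section Tripod
open Metric Filter

universe u

variable {X : Type u} [MetricSpace X] {σ : X → X → ℝ → X} {δ : ℝ} {o : X} {c : Fin 3 → ℝ → X}

/-- Three rays issuing from `o` in pairwise different directions. -/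
structure IsTripod (σ : X → X → ℝ → X) (δ : ℝ) (o : X) (c : Fin 3 → ℝ → X) : Prop where
  line : ∀ i, IsSigmaLine σ (c i)
  source : ∀ i, c i 0 = o
  prod : ∀ i j, i ≠ j → ∀ s t, 0 ≤ s → 0 ≤ t → gromovProd (c i s) (c j t) o ≤ 3 * δ

namespace IsTripod

lemma dist_eq (h : IsTripod σ δ o c) (i : Fin 3) {t : ℝ} (ht : 0 ≤ t) : dist o (c i t) = t := by
  rw [← h.source i, (h.line i).dist_of_le ht, sub_zero]

lemma not_asymp (h : IsTripod σ δ o c) {i j : Fin 3} (hij : i ≠ j) : ¬ Asymp (c i) (c j) := by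
  rintro ⟨C, hC⟩
  set t := |C| + |δ| * 3 + 1 with ht
  have ht0 : 0 ≤ t := by positivity
  have h1 := h.prod i j hij t t ht0 ht0
  have h2 := hC t ht0
  simp only [gromovProd] at h1
  rw [dist_comm _ o, dist_comm _ o, h.dist_eq i ht0, h.dist_eq j ht0] at h1
  linarith [le_abs_self C, le_abs_self δ, abs_nonneg C]

lemma dist_center_le (h : IsTripod σ δ o c) (hyp : IsDeltaHyperbolic X δ) {g : X ≃ᵢ X} {T C : ℝ}
    (hC : ∀ i, dist (c i T) (g (c i T)) ≤ C) (hT : C + 5 * δ < T) (hT0 : 0 ≤ T) :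
    dist o (g o) ≤ 13 * δ := by
  have hδ := hyp.nonneg o
  have key : ∀ i j, i ≠ j → dist (g o) (c i T) + dist (g o) (c j T) ≤ 2 * T + 10 * δ ∧
      dist o (g o) ≤ max (dist (g o) (c i T)) (dist (g o) (c j T)) - T + 8 * δ := by
    intro i j hij
    have hp := h.prod i j hij T T hT0 hT0
    have ei := h.dist_eq i hT0
    have ej := h.dist_eq j hT0
    have hi := hC i
    have hj := hC j
    have egi : dist (g (c i T)) (g o) = T := by rw [g.dist_eq, dist_comm, ei]
    have egj : dist (g (c j T)) (g o) = T := by rw [g.dist_eq, dist_comm, ej]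
    have hpi : gromovProd (g (c i T)) (g (c j T)) (g o) ≤ 3 * δ := by rwa [gromovProd_map]
    have hti : T - C ≤ gromovProd (c i T) (g (c i T)) (g o) := by
      simp only [gromovProd]
      linarith [dist_triangle_left (g o) (g (c i T)) (c i T), dist_comm (c i T) (g (c i T)),
        dist_comm (g o) (g (c i T)), dist_triangle_left (g (c i T)) (g o) (c i T)]
    have htj : T - C ≤ gromovProd (c j T) (g (c j T)) (g o) := by
      simp only [gromovProd]
      linarith [dist_comm (c j T) (g (c j T)), dist_triangle_left (g (c j T)) (g o) (c j T)]
    have h1 : gromovProd (c i T) (g (c j T)) (g o) ≤ 4 * δ := by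
      rcases hyp.gromovProd_le (g (c i T)) (c i T) (g (c j T)) (g o) with h1 | h1
      · rw [gromovProd_comm] at h1
        linarith
      · linarith
    have h2 : gromovProd (c i T) (c j T) (g o) ≤ 5 * δ := by
      rcases hyp.gromovProd_le (c i T) (c j T) (g (c j T)) (g o) with h2 | h2 <;> linarith
    simp only [gromovProd] at hp h2
    rw [dist_comm _ o, dist_comm _ o, ei, ej] at hp
    rw [dist_comm _ (g o), dist_comm _ (g o)] at h2
    refine ⟨by linarith [dist_triangle_left (c i T) (c j T) o], ?_⟩
    have := le_max_left (dist (g o) (c i T)) (dist (g o) (c j T))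
    have := le_max_right (dist (g o) (c i T)) (dist (g o) (c j T))
    rcases hyp.four o (g o) (c i T) (c j T) with h3 | h3 <;> linarith
  obtain ⟨h01, h01'⟩ := key 0 1 (by decide)
  obtain ⟨h02, h02'⟩ := key 0 2 (by decide)
  obtain ⟨h12, h12'⟩ := key 1 2 (by decide)
  rcases max_cases (dist (g o) (c 0 T)) (dist (g o) (c 1 T)) with ⟨e, -⟩ | ⟨e, -⟩ <;>
  rcases max_cases (dist (g o) (c 0 T)) (dist (g o) (c 2 T)) with ⟨e', -⟩ | ⟨e', -⟩ <;>
  rcases max_cases (dist (g o) (c 1 T)) (dist (g o) (c 2 T)) with ⟨e'', -⟩ | ⟨e'', -⟩ <;>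
  rw [e] at h01' <;> rw [e'] at h02' <;> rw [e''] at h12' <;> linarith

lemma dist_le (h : IsTripod σ δ o c) (hyp : IsDeltaHyperbolic X δ) {g : X ≃ᵢ X} {T T' C : ℝ}
    (hC : ∀ i, dist (c i T') (g (c i T')) ≤ C) (hT : C + 5 * δ < T') (hT0 : 0 ≤ T)
    (hTT : T + C ≤ T') (i : Fin 3) : dist (c i T) (g (c i T)) ≤ 17 * δ := by
  have hC0 : 0 ≤ C := dist_nonneg.trans (hC i)
  have hT' : 0 ≤ T' := by linarith
  have hδ := hyp.nonneg o
  have h1 := h.dist_center_le hyp hC hT hT'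
  have e1 := h.dist_eq i hT0
  have e2 := h.dist_eq i hT'
  have e3 := (h.line i).dist_of_le (show T ≤ T' by linarith)
  refine (hyp.dist_le_of_fellow e1 e3 (by linarith) (by rw [g.dist_eq, e1])
    (by rw [g.dist_eq, e3]) (by rw [g.dist_eq]; linarith) h1 (hC i) (by linarith)).trans ?_
  linarith

end IsTripod

/-- The Gromov product based at a nearest point projection. -/
lemma IsDeltaHyperbolic.gromovProd_le_of_forall_dist_le (hyp : IsDeltaHyperbolic X δ)
    {γ : ℝ → X} (hγ : IsSigmaLine σ γ) {r : X} {s : ℝ} (hs : ∀ u, dist r (γ s) ≤ dist r (γ u))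
    (t : ℝ) : gromovProd r (γ t) (γ s) ≤ 2 * δ := by
  have h0 := gromovProd_nonneg r (γ t) (γ s)
  have h1 : gromovProd r (γ t) (γ s) ≤ |s - t| := by
    rw [gromovProd_comm, ← hγ.dist_eq, dist_comm]
    exact gromovProd_le_left _ _ _
  set p := gromovProd r (γ t) (γ s) with hp
  have key : ∀ m : ℝ, dist (γ s) (γ m) = p → dist (γ s) (γ m) + dist (γ m) (γ t) = dist (γ s) (γ t) →
      p ≤ 2 * δ := by
    intro m hm hm'
    have h2 := hyp.dist_le_of_gromovProd (y := r) hm' hm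
    have h3 := gromovProd_add r (γ t) (γ s)
    have h4 := hs m
    linarith
  rcases le_total s t with hst | hst
  · rw [abs_sub_comm, abs_of_nonneg (by linarith)] at h1
    refine key (s + p) ?_ ?_
    · rw [hγ.dist_of_le (by linarith)]; ring
    · rw [hγ.dist_of_le (by linarith), hγ.dist_of_le (by linarith), hγ.dist_of_le hst]; ring
  · rw [abs_of_nonneg (by linarith)] at h1
    refine key (s - p) ?_ ?_
    · rw [dist_comm, hγ.dist_of_le (by linarith)]; ring
    · rw [dist_comm (γ s) (γ (s - p)), dist_comm _ (γ t), dist_comm _ (γ t), hγ.dist_of_le (by linarith),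
        hγ.dist_of_le (by linarith), hγ.dist_of_le hst]
      ring

lemma IsSigmaLine.exists_forall_dist_le {γ : ℝ → X} (hγ : IsSigmaLine σ γ) (r : X) :
    ∃ s, ∀ u, dist r (γ s) ≤ dist r (γ u) := by
  have hcont : Continuous fun u => dist r (γ u) := continuous_const.dist hγ.1.continuous
  refine hcont.exists_forall_le ?_
  have h1 : Tendsto (fun u : ℝ => |u| - dist r (γ 0)) (cocompact ℝ) atTop :=
    tendsto_atTop_add_const_right _ _ (tendsto_norm_cocompact_atTop (E := ℝ))
  refine tendsto_atTop_mono (fun u => ?_) h1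
  have := hγ.dist_eq u 0
  rw [sub_zero] at this
  linarith [dist_triangle_left (γ u) (γ 0) r]

/-- Away from the `4 * δ`-neighbourhood of a line there is a tripod with centre on the line. -/
lemma IsDeltaHyperbolic.exists_tripod (hyp : IsDeltaHyperbolic X δ) (hσ : IsGCB σ) {γ : ℝ → X}
    (hγ : IsSigmaLine σ γ) {r : X} {s : ℝ} (hs : ∀ u, dist r (γ s) ≤ dist r (γ u))
    (hr : 4 * δ < dist r (γ s)) : ∃ c, IsTripod σ δ (γ s) c := by
  have hδ := hyp.nonneg r
  obtain ⟨c₃, hc₃, h30, h31⟩ := hσ.exists_line (γ s) r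
  have h3 : ∀ t, 0 ≤ t → dist (γ s) (c₃ t) = t := fun t ht => by
    rw [← h30, hc₃.dist_of_le ht, sub_zero]
  have hbr : ∀ t u, 0 ≤ t → gromovProd (c₃ t) (γ u) (γ s) ≤ 3 * δ := by
    intro t u ht
    set t' := max t (dist (γ s) r) with ht'
    have h4 : t ≤ t' := le_max_left _ _
    have h5 : dist (γ s) r ≤ t' := le_max_right _ _
    have h6 : gromovProd (c₃ t) (γ u) (γ s) ≤ gromovProd (c₃ t') (γ u) (γ s) := by
      simp only [gromovProd]
      rw [dist_comm (c₃ t), dist_comm (c₃ t'), h3 t ht, h3 t' (ht.trans h4)]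
      linarith [dist_triangle_left (c₃ t') (γ u) (c₃ t), hc₃.dist_of_le h4]
    refine h6.trans ?_
    have h7 := hyp.gromovProd_le_of_forall_dist_le hγ hs u
    have h8 : gromovProd r (c₃ t') (γ s) = dist r (γ s) := by
      simp only [gromovProd]
      have := hc₃.dist_of_le h5
      rw [h31] at this
      rw [dist_comm (c₃ t'), h3 t' (ht.trans h4), this, dist_comm r]
      ring
    rcases hyp.gromovProd_le r (c₃ t') (γ u) (γ s) with h9 | h9 <;> linarith
  have hdir : ∀ t u : ℝ, 0 ≤ t → 0 ≤ u → gromovProd (γ (t + s)) (γ (-u + s)) (γ s) ≤ 3 * δ := by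
    intro t u ht hu
    simp only [gromovProd]
    rw [dist_comm (γ (t + s)) (γ s), hγ.dist_of_le (show s ≤ t + s by linarith),
      hγ.dist_of_le (show -u + s ≤ s by linarith), dist_comm,
      hγ.dist_of_le (show -u + s ≤ t + s by linarith)]
    linarith
  refine ⟨![fun t => γ (t + s), fun t => γ (-t + s), c₃], ?_, ?_, ?_⟩
  · intro i
    fin_cases i
    · exact hγ.shift s
    · exact (hγ.shift s).reverse hσ
    · exact hc₃
  · intro i
    fin_cases i
    · simp
    · simp
    · exact h30
  · intro i j hij t u ht hu
    fin_cases i <;> fin_cases j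
    · exact absurd rfl hij
    · exact hdir t u ht hu
    · exact (gromovProd_comm _ _ _).trans_le (hbr u _ hu)
    · exact (gromovProd_comm _ _ _).trans_le (hdir u t hu ht)
    · exact absurd rfl hij
    · exact (gromovProd_comm _ _ _).trans_le (hbr u _ hu)
    · exact hbr t _ ht
    · exact hbr t _ ht
    · exact absurd rfl hij

end Tripod

section MargulisTripod
open Metric Filter
open scoped Classical Pointwise

universe u

lemma Finset.exists_eq_of_antitone {α : Type u} {W : ℕ → Finset α} (hW : Antitone W) {a : α}
    (ha : ∀ i, a ∈ W i) (h : ∀ b, (∀ i, b ∈ W i) → b = a) : ∃ i, W i = {a} := by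
  have h1 : ∀ b, b ≠ a → ∃ i, b ∉ W i := fun b hb => by
    by_contra! h2
    exact hb (h b h2)
  choose! f hf using h1
  refine ⟨(W 0).sup f, ?_⟩
  ext b
  rw [Finset.mem_singleton]
  refine ⟨fun hb => ?_, fun hb => hb ▸ ha _⟩
  by_contra hba
  exact hf b hba (hW (Finset.le_sup (hW (Nat.zero_le _) hb)) hb)

lemma IsDiscreteSubgroup.card_le_of_pigeonhole {X : Type u} [MetricSpace X]
    {W W' : Finset (X ≃ᵢ X)} {M : ℕ}
    (h : ∃ F ⊆ W, W.card ≤ M * F.card ∧ ∀ a ∈ F, ∀ b ∈ F, a⁻¹ * b ∈ W') :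
    W.card ≤ M * W'.card := by
  obtain ⟨F, -, hcard, hF⟩ := h
  refine hcard.trans (Nat.mul_le_mul_left _ ?_)
  rcases F.eq_empty_or_nonempty with rfl | ⟨a, ha⟩
  · simp
  · exact Finset.card_le_card_of_injOn (fun b => a⁻¹ * b) (fun b hb => hF a ha b hb)
      fun x _ y _ h => mul_left_cancel h

lemma exists_pigeonhole_tripod (P₀ r₀ : ℝ) (hr₀ : 0 < r₀) (ε R : ℝ) (hε : 0 < ε) :
    ∃ M : ℕ, 0 < M ∧ ∀ (X : Type u) [MetricSpace X] (σ : X → X → ℝ → X), IsGCB σ →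
      IsPacked X P₀ r₀ → ∀ (p : Fin 3 → X) (A : Finset (X ≃ᵢ X)),
        (∀ a ∈ A, ∀ i, dist (p i) (a (p i)) ≤ R) →
        ∃ F ⊆ A, A.card ≤ M * F.card ∧
          ∀ a ∈ F, ∀ b ∈ F, ∀ i, dist (p i) ((a⁻¹ * b) (p i)) ≤ ε := by
  obtain ⟨M, hM, h⟩ := exists_pigeonhole_isometry.{u} P₀ r₀ hr₀ ε R hε
  refine ⟨M ^ 3, by positivity, fun X _ σ hσ hp p A hA => ?_⟩
  obtain ⟨F, hF, hc, h0⟩ := h X σ hσ hp (p 0) A fun a ha => hA a ha 0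
  obtain ⟨F', hF', hc', h1⟩ := h X σ hσ hp (p 1) F fun a ha => hA a (hF ha) 1
  obtain ⟨F'', hF'', hc'', h2⟩ := h X σ hσ hp (p 2) F' fun a ha => hA a (hF (hF' ha)) 2
  refine ⟨F'', hF''.trans (hF'.trans hF), ?_, fun a ha b hb i => ?_⟩
  · calc A.card ≤ M * (M * (M * F''.card)) :=
          hc.trans (Nat.mul_le_mul_left _ (hc'.trans (Nat.mul_le_mul_left _ hc'')))
      _ = M ^ 3 * F''.card := by ring
  · fin_cases i
    · exact h0 a (hF' (hF'' ha)) b (hF' (hF'' hb))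
    · exact h1 a (hF'' ha) b (hF'' hb)
    · exact h2 a ha b hb

lemma exists_margulis_tripod (P₀ r₀ δ : ℝ) (hr₀ : 0 < r₀) (hδ : 0 < δ) :
    ∃ n₁ : ℕ, ∀ (X : Type u) [MetricSpace X] [ProperSpace X] (σ : X → X → ℝ → X)
      (Γ : Subgroup (X ≃ᵢ X)), IsHypAction σ δ Γ → IsPacked X P₀ r₀ →
      ∀ (o : X) (c : Fin 3 → ℝ → X), IsTripod σ δ o c → ∀ F : Finset (X ≃ᵢ X), n₁ ≤ F.card →
        (∀ g ∈ F, g ∈ Γ ∧ ∀ i, dist (c i (74 * δ)) (g (c i (74 * δ))) ≤ 34 * δ) →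
        ∃ c', IsSigmaLine σ c' ∧ ∀ g ∈ Γ,
          (∀ i, dist (c i (74 * δ)) (g (c i (74 * δ))) ≤ 34 * δ) → g ∈ rayStab Γ c' := by
  obtain ⟨M, hM, hpig⟩ := exists_pigeonhole_tripod.{u} P₀ r₀ hr₀ (34 * δ) (102 * δ) (by positivity)
  obtain ⟨n₁, hn₁⟩ := exists_malnormal_of_chain.{u} M
  refine ⟨n₁, fun X _ _ σ Γ H hp o c hc F hF hFW => ?_⟩
  set T : ℕ → ℝ := fun i => 6 * δ + i * (34 * δ) with hT
  have hT0 : ∀ i, 0 ≤ T i := fun i => by positivity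
  have hTs : ∀ i, T (i + 1) = T i + 34 * δ := fun i => by simp only [hT]; push_cast; ring
  have hT6 : ∀ i, 6 * δ ≤ T i := fun i => by
    have : (0 : ℝ) ≤ i * (34 * δ) := by positivity
    linarith
  set W : ℕ → Finset (X ≃ᵢ X) := fun i =>
    (H.discrete.near (c 0 (T i)) (34 * δ)).filter fun g =>
      ∀ j, dist (c j (T i)) (g (c j (T i))) ≤ 34 * δ with hW
  have hmem : ∀ i g, g ∈ W i ↔ g ∈ Γ ∧ ∀ j, dist (c j (T i)) (g (c j (T i))) ≤ 34 * δ := by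
    intro i g
    simp only [hW, Finset.mem_filter, H.discrete.mem_near]
    exact ⟨fun h => ⟨h.1.1, h.2⟩, fun h => ⟨⟨h.1, h.2 0⟩, h.2⟩⟩
  have hhalf : ∀ i, ∀ g ∈ W (i + 1), ∀ j, dist (c j (T i)) (g (c j (T i))) ≤ 17 * δ :=
    fun i g hg j => hc.dist_le H.hyp ((hmem _ _).1 hg).2 (by linarith [hTs i, hT6 i]) (hT0 i)
      (hTs i).ge j
  have hone : ∀ i, 1 ∈ W i := fun i => (hmem _ _).2 ⟨Γ.one_mem, fun j => by
    rw [show (1 : X ≃ᵢ X) (c j (T i)) = c j (T i) from rfl, dist_self]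
    positivity⟩
  have hmul : ∀ i, W (i + 1) * W (i + 1) ⊆ W i := by
    intro i x hx
    obtain ⟨g, hg, h, hh, rfl⟩ := Finset.mem_mul.1 hx
    refine (hmem _ _).2 ⟨Γ.mul_mem ((hmem _ _).1 hg).1 ((hmem _ _).1 hh).1, fun j => ?_⟩
    have := dist_mul_apply_le g h (c j (T i))
    linarith [hhalf i g hg j, hhalf i h hh j]
  have hanti : Antitone W := antitone_nat_of_succ_le fun i g hg =>
    hmul i (by simpa using Finset.mul_mem_mul hg (hone (i + 1)))
  have hconj : ∀ (g : X ≃ᵢ X) (x : X ≃ᵢ X) (c' : ℝ → X), IsSigmaLine σ c' → g ∈ Γ →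
      g ∉ rayStab Γ c' → x ∈ rayStab Γ c' → g * x * g⁻¹ ∈ rayStab Γ c' → x = 1 := by
    intro g x c' hc' hg hgc hx hgx
    by_contra hx1
    refine hgc (H.mem_rayStab_of_conj hc' hg (w := g * x * g⁻¹) ?_ hgx ((mem_rayStab_map hg).2 hx))
    simpa using hx1
  obtain ⟨E, ⟨c', hc', rfl⟩, hE⟩ := hn₁ (X ≃ᵢ X) Γ H.torsionFree
    {E | ∃ c', IsSigmaLine σ c' ∧ rayStab Γ c' = E}
    (by
      rintro _ ⟨c', hc', rfl⟩ g hg hgc x hx hgx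
      exact hconj g x c' hc' hg hgc hx hgx)
    (by
      rintro S hS ⟨x, hx, hx1⟩ hvn
      obtain ⟨c', hc', hle⟩ := H.exists_le_rayStab ((Subgroup.closure_le _).2 hS) hvn
        ⟨x, Subgroup.subset_closure hx, hx1⟩
      exact ⟨_, ⟨c', hc', rfl⟩, fun s hs => hle (Subgroup.subset_closure hs)⟩)
    W (fun i g hg => ((hmem i g).1 hg).1) hone
    (fun i g hg => (hmem _ _).2 ⟨Γ.inv_mem ((hmem _ _).1 hg).1, fun j => by
      rw [dist_inv_apply]
      exact ((hmem _ _).1 hg).2 j⟩)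
    hmul
    (fun i => by
      obtain ⟨F, hFW, hcard, hF⟩ := hpig X σ H.gcb hp (fun j => c j (T (i + 1))) (W i)
        fun a ha j => by
          have h1 := (hc.line j).dist_of_le (show T i ≤ T (i + 1) by linarith [hTs i])
          have h2 := ((hmem _ _).1 ha).2 j
          have h3 := dist_triangle4 (c j (T (i + 1))) (c j (T i)) (a (c j (T i)))
            (a (c j (T (i + 1))))
          rw [a.dist_eq, dist_comm (c j (T (i + 1))) (c j (T i))] at h3
          linarith [hTs i]
      exact IsDiscreteSubgroup.card_le_of_pigeonhole ⟨F, hFW, hcard, fun a ha b hb =>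
        (hmem _ _).2 ⟨Γ.mul_mem (Γ.inv_mem ((hmem _ _).1 (hFW ha)).1) ((hmem _ _).1 (hFW hb)).1,
          hF a ha b hb⟩⟩)
    (by
      refine Finset.exists_eq_of_antitone hanti hone fun b hb => ?_
      by_contra hb1
      have hbs : ∀ j, b ∈ rayStab Γ (c j) := by
        refine fun j => ⟨((hmem _ _).1 (hb 0)).1, 34 * δ, fun t ht => ?_⟩
        obtain ⟨i, hi⟩ := exists_nat_gt (t / (34 * δ))
        rw [div_lt_iff₀ (by positivity)] at hi
        have h0 : dist (c j 0) (b (c j 0)) ≤ 34 * δ := by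
          rw [hc.source j]
          have := hc.dist_center_le H.hyp (T := T 1) ((hmem _ _).1 (hb 1)).2
            (by linarith [hTs 0, hT6 0]) (hT0 1)
          linarith
        exact (hc.line j).dist_le_of_mem H.gcb ((hc.line j).map (H.isSigma b ((hmem _ _).1 (hb 0)).1))
          h0 (((hmem _ _).1 (hb i)).2 j) ht (by simp only [hT]; linarith)
      exact H.not_fix_three (hc.line 0) (hc.line 1) (hc.line 2) (hc.not_asymp (by decide))
        (hc.not_asymp (by decide)) (hc.not_asymp (by decide)) hb1 (hbs 0) (hbs 1) (hbs 2))
    (hF.trans (Finset.card_le_card fun g hg => hanti (Nat.zero_le 2) ((hmem 2 g).2 (by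
      have := hFW g hg
      rwa [show T 2 = 74 * δ by simp only [hT]; push_cast; ring]))))
  refine ⟨c', hc', fun g hg hgT => hE ((hmem 2 g).2 ⟨hg, ?_⟩)⟩
  rwa [show T 2 = 74 * δ by simp only [hT]; push_cast; ring]

end MargulisTripod

section Margulis
open Metric Filter
open scoped Classical Pointwise

universe u

variable {X : Type u} [MetricSpace X] {σ : X → X → ℝ → X} {δ : ℝ} {Γ : Subgroup (X ≃ᵢ X)}

/-- If `X` stays near a line then every isometry group fixes one of its ends. -/
lemma IsHypAction.exists_le_rayStab_of_line (H : IsHypAction σ δ Γ) [ProperSpace X] {γ : ℝ → X}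
    (hγ : IsSigmaLine σ γ) (h : ∀ r, ∃ s, dist r (γ s) ≤ 4 * δ) :
    ∃ c, IsSigmaLine σ c ∧ Γ ≤ rayStab Γ c := by
  have hγ' := hγ.reverse H.gcb
  have hlim : ∀ c, IsSigmaLine σ c → Asymp c γ ∨ Asymp c fun t => γ (-t) := by
    intro c hc
    by_contra! hcon
    obtain ⟨B, hB⟩ := H.hyp.exists_gromovProd_le hc hγ hcon.1
    obtain ⟨B', hB'⟩ := H.hyp.exists_gromovProd_le hc hγ' hcon.2
    set s := |B| + |B'| + 4 * δ + 1
    have hδ := H.pos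
    have hs : 0 ≤ s := by positivity
    obtain ⟨u, hu⟩ := h (c s)
    have h1 : s - 4 * δ ≤ gromovProd (c s) (γ u) (c 0) := by
      have h2 := hc.dist_of_le hs
      simp only [gromovProd]
      rw [dist_comm (c s) (c 0), h2]
      linarith [dist_triangle_left (c 0) (c s) (γ u), dist_comm (c s) (c 0), dist_comm (γ u) (c s)]
    rcases le_total 0 u with h0 | h0
    · linarith [hB s u hs h0, le_abs_self B, abs_nonneg B']
    · have := hB' s (-u) hs (by linarith)
      rw [neg_neg] at this
      linarith [le_abs_self B', abs_nonneg B]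
  have hunion : ∀ g ∈ Γ, g ∈ rayStab Γ γ ∨ g ∈ rayStab Γ fun t => γ (-t) := by
    intro g hg
    obtain ⟨c, hc, -, hgc⟩ := H.exists_mem_rayStab hg (γ 0)
    rcases hlim c hc with h1 | h1
    · exact Or.inl (rayStab_congr (Γ := Γ) h1 ▸ hgc)
    · exact Or.inr (rayStab_congr (Γ := Γ) h1 ▸ hgc)
  by_contra! hcon
  obtain ⟨g, hg, hg'⟩ := SetLike.not_le_iff_exists.1 (hcon _ hγ)
  obtain ⟨h, hh, hh'⟩ := SetLike.not_le_iff_exists.1 (hcon _ hγ')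
  have hg2 := (hunion g hg).resolve_left hg'
  have hh2 := (hunion h hh).resolve_right hh'
  rcases hunion (g * h) (Γ.mul_mem hg hh) with h3 | h3
  · exact hg' ((Subgroup.mul_mem_cancel_right _ hh2).1 h3)
  · exact hh' ((Subgroup.mul_mem_cancel_left _ hg2).1 h3)

/-- Near `x` there is a tripod whose centre is almost preserved, up to a symmetry, by the
isometries moving `x` a bounded amount. -/
lemma IsDeltaHyperbolic.exists_tripod_of_line (hyp : IsDeltaHyperbolic X δ) (hσ : IsGCB σ)
    {γ : ℝ → X} (hγ : IsSigmaLine σ γ) (h : ∃ r, ∀ s, 4 * δ < dist r (γ s)) :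
    ∃ s c, IsTripod σ δ (γ s) c ∧ ∀ (g : X ≃ᵢ X) (R : ℝ), dist (γ 0) (g (γ 0)) ≤ R →
      dist (γ s) (g (γ s)) ≤ 2 * R + 8 * δ + 2 ∨
      dist (γ (-s)) (g (γ s)) ≤ 2 * R + 8 * δ + 2 := by
  set S : Set ℝ := {s | ∃ r, (∀ u, dist r (γ s) ≤ dist r (γ u)) ∧ 4 * δ < dist r (γ s)} with hS
  obtain ⟨r₀, hr₀⟩ := h
  have hδ := hyp.nonneg r₀
  obtain ⟨s₀, hs₀⟩ := hγ.exists_forall_dist_le r₀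
  have hne : ((fun s => |s|) '' S).Nonempty := ⟨_, s₀, ⟨r₀, hs₀, hr₀ s₀⟩, rfl⟩
  have hbdd : BddBelow ((fun s : ℝ => |s|) '' S) := ⟨0, by rintro _ ⟨s, -, rfl⟩; exact abs_nonneg _⟩
  obtain ⟨_, ⟨s, ⟨r, hr, hr4⟩, rfl⟩, hs⟩ := exists_lt_of_csInf_lt hne
    (lt_add_one (sInf ((fun s : ℝ => |s|) '' S)))
  have hmin : ∀ s' ∈ S, |s| ≤ |s'| + 1 := fun s' hs' => by
    have := csInf_le hbdd ⟨s', hs', rfl⟩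
    have hs : |s| < _ := hs
    have this : sInf ((fun s : ℝ => |s|) '' S) ≤ |s'| := this
    linarith
  obtain ⟨c, hc⟩ := hyp.exists_tripod hσ hγ hr hr4
  refine ⟨s, c, hc, fun g R hR => ?_⟩
  have hR0 : 0 ≤ R := dist_nonneg.trans hR
  obtain ⟨u, hu⟩ := hγ.exists_forall_dist_le (g (γ s))
  set q := g (γ s) with hq
  have e0 : dist (g (γ 0)) q = |s| := by
    rw [hq, g.dist_eq, hγ.dist_eq, zero_sub, abs_neg]
  have h1 : dist (γ 0) q ≤ |s| + R := by linarith [dist_triangle (γ 0) (g (γ 0)) q]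
  have h2 : |s| - R ≤ dist (γ 0) q := by
    linarith [dist_triangle_left (g (γ 0)) q (γ 0)]
  have eu : dist (γ 0) (γ u) = |u| := by rw [hγ.dist_eq, zero_sub, abs_neg]
  have h3 : dist q (γ u) + abs (|s| - |u|) ≤ 2 * R + 8 * δ + 2 := by
    by_cases huS : u ∈ S
    · have h4 := hmin u huS
      have h5 := hyp.gromovProd_le_of_forall_dist_le hγ hu 0
      simp only [gromovProd] at h5
      rw [eu, dist_comm q (γ 0)] at h5
      rcases abs_cases (|s| - |u|) with ⟨h6, -⟩ | ⟨h6, -⟩ <;> rw [h6] <;>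
        linarith [dist_nonneg (x := q) (y := γ u)]
    · have h4 : dist q (γ u) ≤ 4 * δ := by
        by_contra! h4
        exact huS ⟨q, hu, h4⟩
      have h5 := dist_triangle (γ 0) (γ u) q
      have h6 := dist_triangle_right (γ 0) (γ u) q
      rw [eu] at h5 h6
      rw [dist_comm (γ u) q] at h5 h6
      rcases abs_cases (|s| - |u|) with ⟨h7, -⟩ | ⟨h7, -⟩ <;> rw [h7] <;> linarith
  have h4 := dist_triangle_right (γ s) q (γ u)
  have h5 := dist_triangle_right (γ (-s)) q (γ u)
  rw [hγ.dist_eq] at h4 h5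
  rcases abs_cases s with ⟨h6, -⟩ | ⟨h6, -⟩ <;> rcases abs_cases u with ⟨h7, -⟩ | ⟨h7, -⟩ <;>
    rw [h6, h7] at h3
  · left; linarith
  · right
    rw [show -s - u = -(s - -u) by ring, abs_neg] at h5
    linarith
  · right
    linarith
  · left
    rw [show s - u = -(-s - -u) by ring, abs_neg] at h4
    linarith

/-- A uniform version of the Margulis lemma for torsion-free discrete groups. -/
theorem exists_margulis (P₀ r₀ δ : ℝ) (hr₀ : 0 < r₀) (hδ : 0 < δ) (R : ℝ) (hR : 0 < R) :
    ∃ n₀ : ℕ, ∀ (X : Type u) [MetricSpace X] [ProperSpace X] (σ : X → X → ℝ → X)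
      (Γ : Subgroup (X ≃ᵢ X)), IsHypAction σ δ Γ → IsPacked X P₀ r₀ →
      (∀ c, IsSigmaLine σ c → ¬ Γ ≤ rayStab Γ c) → ∀ (x : X) (A : Finset (X ≃ᵢ X)),
        n₀ < A.card → (∀ g ∈ A, g ∈ Γ ∧ dist x (g x) ≤ R) →
        ∃ c, IsSigmaLine σ c ∧ ∀ g ∈ Γ, dist x (g x) ≤ R → g ∈ rayStab Γ c := by
  obtain ⟨n₁, hn₁⟩ := exists_margulis_tripod.{u} P₀ r₀ δ hr₀ hδ
  set R₁ := 2 * R + 8 * δ + 2 with hR₁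
  obtain ⟨M, hM, hpig⟩ := exists_pigeonhole_of_isPacked.{u} P₀ r₀ hr₀ (34 * δ) (R₁ + 74 * δ)
    (by positivity)
  obtain ⟨K, hK, hcard⟩ := exists_card_near_le.{u} P₀ r₀ hr₀ R (5 * R) hR
  set M' := 2 * M ^ 3 with hM'
  refine ⟨max (M' * n₁) (K * M' ^ 2), fun X _ _ σ Γ H hp hne x A₀ hA₀ hA₀R => ?_⟩
  set A := H.discrete.near x R with hA
  have hAA : A₀ ⊆ A := fun g hg => H.discrete.mem_near.2 (hA₀R g hg)
  have hAcard : max (M' * n₁) (K * M' ^ 2) < A.card := hA₀.trans_le (Finset.card_le_card hAA)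
  obtain ⟨γ, hγ, hγ0, -⟩ := H.gcb.exists_line x x
  by_cases hcase : ∀ r, ∃ s, dist r (γ s) ≤ 4 * δ
  · obtain ⟨c, hc, hle⟩ := H.exists_le_rayStab_of_line hγ hcase
    exact absurd hle (hne c hc)
  push Not at hcase
  obtain ⟨s, c, hc, hcen⟩ := H.hyp.exists_tripod_of_line H.gcb hγ hcase
  have hsplit : ∃ (y : X) (A' : Finset (X ≃ᵢ X)), A' ⊆ A ∧ A.card ≤ 2 * A'.card ∧
      ∀ g ∈ A', dist y (g (γ s)) ≤ R₁ := by
    set A₁ := A.filter fun g => dist (γ s) (g (γ s)) ≤ R₁ with hA₁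
    set A₂ := A.filter fun g => dist (γ (-s)) (g (γ s)) ≤ R₁ with hA₂
    have hun : A ⊆ A₁ ∪ A₂ := fun g hg => by
      rw [Finset.mem_union, Finset.mem_filter, Finset.mem_filter]
      have h1 := (H.discrete.mem_near.1 hg).2
      rw [← hγ0] at h1
      rcases hcen g R h1 with h2 | h2
      · exact Or.inl ⟨hg, h2⟩
      · exact Or.inr ⟨hg, h2⟩
    have hc2 := (Finset.card_le_card hun).trans (Finset.card_union_le _ _)
    rcases le_total A₁.card A₂.card with h1 | h1
    · exact ⟨_, A₂, Finset.filter_subset _ _, by lia, fun g hg => (Finset.mem_filter.1 hg).2⟩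
    · exact ⟨_, A₁, Finset.filter_subset _ _, by lia, fun g hg => (Finset.mem_filter.1 hg).2⟩
  obtain ⟨y, A', hA'A, hA'card, hA'⟩ := hsplit
  have hdist : ∀ g ∈ A', ∀ i, dist y (g (c i (74 * δ))) ≤ R₁ + 74 * δ := fun g hg i => by
    have h1 := dist_triangle y (g (γ s)) (g (c i (74 * δ)))
    rw [g.dist_eq, hc.dist_eq i (by positivity)] at h1
    linarith [hA' g hg]
  obtain ⟨F₀, hF₀, hc₀, h₀⟩ := hpig X σ H.gcb hp y _ A' (fun g => g (c 0 (74 * δ)))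
    fun g hg => hdist g hg 0
  obtain ⟨F₁, hF₁, hc₁, h₁⟩ := hpig X σ H.gcb hp y _ F₀ (fun g => g (c 1 (74 * δ)))
    fun g hg => hdist g (hF₀ hg) 1
  obtain ⟨F₂, hF₂, hc₂, h₂⟩ := hpig X σ H.gcb hp y _ F₁ (fun g => g (c 2 (74 * δ)))
    fun g hg => hdist g (hF₀ (hF₁ hg)) 2
  have hcF : A.card ≤ M' * F₂.card := by
    calc A.card ≤ 2 * (M * (M * (M * F₂.card))) :=
          hA'card.trans (Nat.mul_le_mul_left _ (hc₀.trans (Nat.mul_le_mul_left _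
            (hc₁.trans (Nat.mul_le_mul_left _ hc₂)))))
      _ = M' * F₂.card := by rw [hM']; ring
  have hF₂A : ∀ g ∈ F₂, g ∈ A := fun g hg => hA'A (hF₀ (hF₁ (hF₂ hg)))
  obtain ⟨a, ha⟩ : F₂.Nonempty := by
    rw [Finset.nonempty_iff_ne_empty]
    rintro rfl
    simp only [Finset.card_empty, mul_zero] at hcF
    lia
  set F := F₂.image fun b => a⁻¹ * b with hF
  have hFcard : F.card = F₂.card := Finset.card_image_of_injective _ (mul_right_injective _)
  have hFR : ∀ g ∈ F, g ∈ Γ ∧ dist x (g x) ≤ 2 * R := by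
    intro g hg
    obtain ⟨b, hb, rfl⟩ := Finset.mem_image.1 hg
    have h1 := H.discrete.mem_near.1 (hF₂A a ha)
    have h2 := H.discrete.mem_near.1 (hF₂A b hb)
    refine ⟨Γ.mul_mem (Γ.inv_mem h1.1) h2.1, (dist_mul_apply_le _ _ _).trans ?_⟩
    rw [dist_inv_apply]
    linarith
  have hFW : ∀ g ∈ F, g ∈ Γ ∧ ∀ i, dist (c i (74 * δ)) (g (c i (74 * δ))) ≤ 34 * δ := by
    intro g hg
    refine ⟨(hFR g hg).1, fun i => ?_⟩
    obtain ⟨b, hb, rfl⟩ := Finset.mem_image.1 hg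
    rw [dist_inv_mul_apply]
    fin_cases i
    · exact h₀ a (hF₁ (hF₂ ha)) b (hF₁ (hF₂ hb))
    · exact h₁ a (hF₂ ha) b (hF₂ hb)
    · exact h₂ a ha b hb
  have hn₁F : n₁ ≤ F.card := by
    rw [hFcard]
    have h1 : M' * n₁ < M' * F₂.card := ((le_max_left _ _).trans_lt hAcard).trans_le hcF
    exact (lt_of_mul_lt_mul_left h1 (Nat.zero_le _)).le
  obtain ⟨c', hc', hE⟩ := hn₁ X σ Γ H hp _ c hc F hn₁F hFW
  refine ⟨c', hc', fun b hb hbR => ?_⟩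
  by_contra hbE
  have hmal : ∀ z ∈ rayStab Γ c', b * z * b⁻¹ ∈ rayStab Γ c' → z = 1 := by
    intro z hz hbz
    by_contra hz1
    exact hbE (H.mem_rayStab_of_conj hc' hb (w := b * z * b⁻¹) (by simpa using hz1) hbz
      ((mem_rayStab_map hb).2 hz))
  have hBB := card_mul_singleton_mul_of_malnormal hmal (B := F)
    fun g hg => hE g (hFW g hg).1 (hFW g hg).2
  have hsub : F * {b} * F ⊆ H.discrete.near x (5 * R) := by
    intro z hz
    obtain ⟨z', hz', f', hf', rfl⟩ := Finset.mem_mul.1 hz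
    obtain ⟨f, hf, b', hb', rfl⟩ := Finset.mem_mul.1 hz'
    rw [Finset.mem_singleton] at hb'
    subst hb'
    refine H.discrete.mem_near.2 ⟨Γ.mul_mem (Γ.mul_mem (hFR f hf).1 hb) (hFR f' hf').1, ?_⟩
    linarith [dist_mul_apply_le (f * b') f' x, dist_mul_apply_le f b' x, (hFR f hf).2,
      (hFR f' hf').2]
  have h3 : F.card ^ 2 ≤ K * A.card := by
    rw [← hBB]
    refine le_trans ?_ (hcard X σ H.gcb hp Γ H.discrete x)
    convert Finset.card_le_card hsub
  rw [hFcard] at h3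
  have h4 : A.card ^ 2 ≤ (K * M' ^ 2) * A.card := by
    calc A.card ^ 2 ≤ (M' * F₂.card) ^ 2 := by gcongr
      _ = M' ^ 2 * F₂.card ^ 2 := by ring
      _ ≤ M' ^ 2 * (K * A.card) := by gcongr
      _ = _ := by ring
  have h5 : K * M' ^ 2 < A.card := (le_max_right _ _).trans_lt hAcard
  rw [sq] at h4
  exact absurd (Nat.le_of_mul_le_mul_right h4 (by lia)) (by lia)

end Margulis

section Star
open Metric Filter

universe u

lemma exists_forall_le_add {ι : Type*} [Nonempty ι] (f : ι → ℝ) (hf : ∀ i, 0 ≤ f i) {ε : ℝ}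
    (hε : 0 < ε) : ∃ i, ∀ j, f i ≤ f j + ε := by
  have hbdd : BddBelow (Set.range f) := ⟨0, by rintro _ ⟨i, rfl⟩; exact hf i⟩
  obtain ⟨i, hi⟩ := exists_lt_of_ciInf_lt (lt_add_of_pos_right (⨅ i, f i) hε)
  exact ⟨i, fun j => hi.le.trans (by linarith [ciInf_le hbdd j])⟩

variable {X : Type u} [MetricSpace X] {σ : X → X → ℝ → X} {δ : ℝ}

lemma IsSigmaLine.exists_ray_from [ProperSpace X] (hσ : IsGCB σ) {c : ℝ → X}
    (hc : IsSigmaLine σ c) (y : X) : ∃ c', IsSigmaLine σ c' ∧ c' 0 = y ∧ Asymp c' c := by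
  choose γ hγ h0 h1 using fun n : ℕ => hσ.exists_line y (c n)
  obtain ⟨c', hc', hlim⟩ := hσ.exists_line_limit (hyperfilter ℕ) hγ (o := y) (C := 0)
    fun n => by rw [h0, dist_self]
  refine ⟨c', hc', ?_, dist y (c 0), fun t ht => ?_⟩
  · refine tendsto_nhds_unique (hlim 0) ?_
    simp only [h0]
    exact tendsto_const_nhds
  · refine le_of_tendsto ((hlim t).dist tendsto_const_nhds) ?_
    obtain ⟨N, hN⟩ := exists_nat_ge t
    have hev : ∀ᶠ n : ℕ in (hyperfilter ℕ : Filter ℕ), N ≤ n :=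
      (Nat.hyperfilter_le_atTop) (eventually_ge_atTop N)
    filter_upwards [hev] with n hn
    have hNn : (N : ℝ) ≤ n := by exact_mod_cast hn
    refine (hγ n).dist_le_of_mem hσ hc (by rw [h0]) ?_ ht (hN.trans hNn)
    have h2 : dist (γ n n) (c n) = |n - dist y (c n)| := by
      conv_lhs => rw [← h1 n]
      rw [(hγ n).dist_eq]
    have h3 := hc.dist_of_le (Nat.cast_nonneg (α := ℝ) n)
    rw [h2, abs_le]
    constructor <;> linarith [dist_triangle y (c 0) (c n), dist_triangle_left (c 0) (c n) y]

/-- A set containing, with each of its points, a ray issuing from this point and asymptotic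
to `ξ`. -/
def IsStar (σ : X → X → ℝ → X) (M : Set X) (ξ : ℝ → X) : Prop :=
  ∀ y ∈ M, ∃ c, IsSigmaLine σ c ∧ c 0 = y ∧ Asymp c ξ ∧ ∀ t, 0 ≤ t → c t ∈ M

lemma IsDeltaHyperbolic.gromovProd_le_of_isStar (hyp : IsDeltaHyperbolic X δ) {M : Set X}
    {ξ : ℝ → X} (hM : IsStar σ M ξ) {o y z : X} (hy : y ∈ M)
    (hoy : ∀ w ∈ M, dist o y ≤ dist o w + δ) (hz : z ∈ M) : gromovProd o z y ≤ 8 * δ := by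
  have hδ := hyp.nonneg o
  obtain ⟨c, hc, hc0, hcξ, hcM⟩ := hM y hy
  obtain ⟨c', hc', hc'0, hc'ξ, hc'M⟩ := hM z hz
  obtain ⟨C, hC⟩ := hcξ.trans hc'ξ.symm
  have hyc : ∀ t, 0 ≤ t → dist y (c t) = t := fun t ht => by
    rw [← hc0, hc.dist_of_le ht, sub_zero]
  have hzc : ∀ t, 0 ≤ t → dist z (c' t) = t := fun t ht => by
    rw [← hc'0, hc'.dist_of_le ht, sub_zero]
  have h1 : ∀ t, 0 ≤ t → gromovProd o (c t) y ≤ 3 * δ := by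
    intro t ht
    set p := gromovProd o (c t) y with hp
    have hp0 : 0 ≤ p := gromovProd_nonneg _ _ _
    have hpt : p ≤ t := by
      have := gromovProd_le_left (c t) o y
      rw [gromovProd_comm, dist_comm, hyc t ht] at this
      exact this
    have h2 := hyp.dist_le_of_gromovProd (u := y) (v := c t) (y := o) (z := c p)
      (by rw [hyc p hp0, hyc t ht, hc.dist_of_le hpt]; ring) (hyc p hp0)
    have h3 := hoy _ (hcM p hp0)
    have h4 : gromovProd y (c t) o = dist o y - p := by
      simp only [hp, gromovProd]
      rw [dist_comm y o, dist_comm (c t) o, dist_comm (c t) y]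
      ring
    linarith
  by_contra! hcon
  set t := |C| + dist y z + 20 * δ + 1 with ht
  have ht0 : 0 ≤ t := by positivity
  have h2 := h1 t ht0
  have h3 : gromovProd z (c t) y ≤ 4 * δ := by
    rcases hyp.gromovProd_le o z (c t) y with h | h <;> linarith
  have h4 : t - C ≤ gromovProd (c' t) (c t) y := by
    have := hC t ht0
    simp only [gromovProd]
    linarith [hyc t ht0, dist_comm y (c t), dist_comm (c t) (c' t),
      dist_triangle_left (c t) y (c' t), dist_comm y (c' t)]
  have h5 : gromovProd z (c' t) y ≤ 5 * δ := by
    rcases hyp.gromovProd_le z (c' t) (c t) y with h | h <;>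
      linarith [le_abs_self C, dist_nonneg (x := y) (y := z)]
  set p := gromovProd o (c' t) z with hp
  have hp0 : 0 ≤ p := gromovProd_nonneg _ _ _
  have hpt : p ≤ t := by
    have := gromovProd_le_left (c' t) o z
    rw [gromovProd_comm, dist_comm, hzc t ht0] at this
    exact this
  have h6 := hyp.dist_le_of_gromovProd (u := z) (v := c' t) (y := o) (z := c' p)
    (by rw [hzc p hp0, hzc t ht0, hc'.dist_of_le hpt]; ring) (hzc p hp0)
  have h7 := hoy _ (hc'M p hp0)
  simp only [gromovProd] at h5 h6 hcon
  linarith [dist_triangle o y (c' t), dist_comm o (c' t), dist_comm y (c' t), dist_comm o z,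
    dist_comm o y]

/-- Quasiconvex sets which are pairwise close have a common almost point. -/
lemma IsDeltaHyperbolic.exists_forall_dist_le_of_isStar [Nonempty X] (hδ : 0 < δ)
    (hyp : IsDeltaHyperbolic X δ) {m : ℕ} {M : ℕ → Set X} {ξ : ℕ → ℝ → X}
    (hM : ∀ i ≤ m, IsStar σ (M i) (ξ i)) {L : ℝ}
    (hL : ∀ i ≤ m, ∀ j ≤ m, ∃ y ∈ M i, ∃ z ∈ M j, dist y z ≤ L) :
    ∃ x, ∀ i ≤ m, ∃ w ∈ M i, dist x w ≤ 2 * L + 30 * δ := by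
  have hproj : ∀ x, ∀ i, ∃ y, i ≤ m → y ∈ M i ∧ ∀ w ∈ M i, dist x y ≤ dist x w + δ := by
    intro x i
    by_cases hi : i ≤ m
    · obtain ⟨y, hy, -⟩ := hL i hi i hi
      have : Nonempty (M i) := ⟨⟨y, hy⟩⟩
      obtain ⟨z, hz⟩ := exists_forall_le_add (fun w : M i => dist x w) (fun _ => dist_nonneg) hδ
      exact ⟨z, fun _ => ⟨z.2, fun w hw => hz ⟨w, hw⟩⟩⟩
    · exact ⟨x, fun h => absurd h hi⟩
  choose π hπ using hproj
  obtain ⟨o⟩ := ‹Nonempty X›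
  obtain ⟨i, hi, hmax⟩ := (Finset.range (m + 1)).exists_max_image (fun i => dist o (π o i))
    ⟨0, by simp⟩
  rw [Finset.mem_range, Nat.lt_succ_iff] at hi
  set x := π o i with hx
  refine ⟨x, fun j hj => ⟨π x j, (hπ x j hj).1, ?_⟩⟩
  obtain ⟨y, hy, z, hz, hyz⟩ := hL i hi j hj
  have hL0 : 0 ≤ L := dist_nonneg.trans hyz
  have hmaxj := hmax j (Finset.mem_range.2 (Nat.lt_succ_of_le hj))
  set y' := π o j with hy'
  have h1 := hyp.gromovProd_le_of_isStar (hM i hi) (hπ o i hi).1 (hπ o i hi).2 hy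
  obtain ⟨hw, hw'⟩ := hπ x j hj
  set w := π x j with hwdef
  have h2 := hyp.gromovProd_le_of_isStar (hM j hj) hw hw' (hπ o j hj).1
  have h3 := hyp.gromovProd_le_of_isStar (hM j hj) hw hw' hz
  have h4 : gromovProd o z x ≤ 8 * δ + L := by
    simp only [gromovProd] at h1 ⊢
    linarith [dist_triangle_left z x y, dist_triangle_right o y z, dist_comm x y, dist_comm x z]
  have h5 := hw' y' (hπ o j hj).1
  rcases hyp.gromovProd_le o y' z x with h6 | h6
  · simp only [gromovProd] at h4 h6
    linarith [dist_comm x o, dist_comm x y']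
  · simp only [gromovProd] at h2 h3 h4 h6
    linarith [dist_comm x y', dist_comm x z, dist_triangle_right y' z w]

/-- A ping-pong criterion at the midpoint between two almost invariant sets. -/
lemma IsDeltaHyperbolic.free_of_midpoint (hyp : IsDeltaHyperbolic X δ) (hδ : 0 < δ)
    {g h : X ≃ᵢ X} {o y z : X} {q R : ℝ} (ho : dist y o + dist o z = dist y z)
    (hg : ∀ k : ℤ, k ≠ 0 → gromovProd o ((g ^ k) y) y ≤ q)
    (hh : ∀ k : ℤ, k ≠ 0 → gromovProd o ((h ^ k) z) z ≤ q)
    (hgR : ∀ k : ℤ, k ≠ 0 → R ≤ dist o ((g ^ k) o))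
    (hhR : ∀ k : ℤ, k ≠ 0 → R ≤ dist o ((h ^ k) o))
    (hy : 2 * q + 4 * δ < dist o y) (hz : 2 * q + 4 * δ < dist o z) (hR : 2 * q + 8 * δ < R) :
    Function.Injective (FreeGroup.lift fun i : Bool => if i then g else h) := by
  have key : ∀ (g : X ≃ᵢ X) (y : X), (∀ k : ℤ, k ≠ 0 → gromovProd o ((g ^ k) y) y ≤ q) →
      (∀ k : ℤ, k ≠ 0 → R ≤ dist o ((g ^ k) o)) → 2 * q + 4 * δ < dist o y →
      ∀ k : ℤ, k ≠ 0 → 2 * δ < gromovProd y ((g ^ k) o) o := by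
    intro g y hg hgR hy k hk
    have h1 := hg k hk
    have h2 := hg (-k) (neg_ne_zero.2 hk)
    rw [← gromovProd_map (g ^ k), ← IsometryEquiv.mul_apply, ← zpow_add, add_neg_cancel,
      zpow_zero, show (1 : X ≃ᵢ X) y = y from rfl] at h2
    have h3 := hgR k hk
    have e1 : dist ((g ^ k) o) ((g ^ k) y) = dist o y := (g ^ k).dist_eq _ _
    simp only [gromovProd] at h1 h2 ⊢
    rw [e1] at h2
    rw [dist_comm ((g ^ k) y) y] at h1
    rw [dist_comm y o, dist_comm ((g ^ k) o) o]
    have h0 := dist_triangle y ((g ^ k) y) ((g ^ k) o)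
    rw [dist_comm ((g ^ k) y), e1] at h0
    rcases hyp.four o ((g ^ k) y) ((g ^ k) o) y with h4 | h4
    · linarith [dist_comm ((g ^ k) y) y, dist_comm ((g ^ k) o) y]
    · rw [dist_comm ((g ^ k) y) ((g ^ k) o), e1] at h4
      linarith [dist_comm ((g ^ k) o) y]
  have hq : 0 ≤ q := (gromovProd_nonneg _ _ _).trans (hg 1 one_ne_zero)
  refine hyp.free_of_gromovProd_le hδ (o := o) (D := 2 * δ) (fun k hk => ?_) (fun k hk => ?_)
    fun k l hk hl => ?_
  · linarith [hgR k hk]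
  · linarith [hhR k hk]
  · have h1 := key g y hg hgR hy k hk
    have h2 := key h z hh hhR hz l hl
    have h0 : gromovProd y z o = 0 := by
      simp only [gromovProd]
      linarith [dist_comm o z]
    have h3 : gromovProd ((g ^ k) o) z o ≤ δ := by
      rcases hyp.gromovProd_le y ((g ^ k) o) z o with h | h <;> linarith
    have h4 := hyp.gromovProd_le z ((h ^ l) o) ((g ^ k) o) o
    rw [gromovProd_comm z ((g ^ k) o), gromovProd_comm ((h ^ l) o)] at h4
    rcases h4 with h | h <;> linarith

end Star

section Orbits
open Metric Filter

universe u

variable {X : Type u} [MetricSpace X] {δ l : ℝ} {α : X ≃ᵢ X} {x : X}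

lemma gromovProd_sub_dist_le (x y o o' : X) :
    gromovProd x y o - dist o o' ≤ gromovProd x y o' := by
  simp only [gromovProd]
  linarith [dist_triangle x o' o, dist_triangle y o' o, dist_comm o o']

lemma gromovProd_self_right (x y : X) : gromovProd x y y = 0 := by
  simp [gromovProd]

/-- The orbit of `x` under `α` is a local quasi-geodesic of step `l`. -/
structure IsAxial (δ : ℝ) (α : X ≃ᵢ X) (x : X) (l : ℝ) : Prop where
  dist_eq : dist x (α x) = l
  prod_le : gromovProd x (α (α x)) (α x) ≤ δ
  large : 100 * δ ≤ l

namespace IsAxial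

lemma conj (h : IsAxial δ α x l) (g : X ≃ᵢ X) : IsAxial δ (g * α * g⁻¹) (g x) l := by
  have e : ∀ z, (g * α * g⁻¹) (g z) = g (α z) := fun z => by
    show g (α (g⁻¹ (g z))) = _
    rw [show g⁻¹ (g z) = z from g.symm_apply_apply z]
  refine ⟨?_, ?_, h.large⟩
  · rw [e, g.dist_eq, h.dist_eq]
  · rw [e, e, gromovProd_map]
    exact h.prod_le

lemma zpow_apply (h : IsAxial δ α x l) (k : ℤ) : IsAxial δ α ((α ^ k) x) l := by
  have h1 := h.conj (α ^ k)
  rwa [← zpow_add_one, ← zpow_neg, ← zpow_add, show k + 1 + -k = 1 by ring, zpow_one] at h1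

lemma inv (h : IsAxial δ α x l) : IsAxial δ α⁻¹ x l := by
  have e : ∀ z, α (α⁻¹ z) = z := fun z => α.apply_symm_apply z
  refine ⟨?_, ?_, h.large⟩
  · rw [← α.dist_eq, e, dist_comm, h.dist_eq]
  · rw [← gromovProd_map α, ← gromovProd_map α, e, e, gromovProd_comm]
    exact h.prod_le

variable (hδ : 0 < δ) (hyp : IsDeltaHyperbolic X δ) (h : IsAxial δ α x l)
include h

lemma dist_pow_le (n : ℕ) : dist x ((α ^ n) x) ≤ n * l := by
  induction n with
  | zero => simp
  | succ n ih =>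
    have h1 : dist ((α ^ n) x) ((α ^ (n + 1)) x) = l := by
      rw [pow_succ, IsometryEquiv.mul_apply, (α ^ n).dist_eq, h.dist_eq]
    push_cast
    linarith [dist_triangle x ((α ^ n) x) ((α ^ (n + 1)) x)]

include hδ hyp

lemma gromovProd_pow_le {i j k : ℕ} (hij : i ≤ j) (hjk : j ≤ k) :
    gromovProd ((α ^ i) x) ((α ^ k) x) ((α ^ j) x) ≤ 3 * δ := by
  obtain ⟨j, rfl⟩ := Nat.exists_eq_add_of_le hij
  obtain ⟨k, rfl⟩ := Nat.exists_eq_add_of_le (hij.trans hjk)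
  rw [pow_add, pow_add, IsometryEquiv.mul_apply, IsometryEquiv.mul_apply, gromovProd_map]
  rcases (show j ≤ k by omega).eq_or_lt with rfl | hlt
  · rw [gromovProd_self_right]
    positivity
  · have h1 := hyp.gromovProd_le_of_local (x := fun n => (α ^ n) x) (n := k) (D := δ) (L := l)
      hδ.le hδ.le (by linarith [h.large]) (fun i _ => ?_) (fun i _ => ?_) hlt le_rfl
    · simp only [pow_zero] at h1
      linarith [show gromovProd x ((α ^ k) x) ((α ^ j) x) ≤ δ + 2 * δ from h1]
    · rw [pow_succ, IsometryEquiv.mul_apply, (α ^ i).dist_eq, h.dist_eq]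
    · rw [pow_succ, pow_succ, mul_assoc, IsometryEquiv.mul_apply, IsometryEquiv.mul_apply,
        IsometryEquiv.mul_apply, gromovProd_map]
      exact h.prod_le

lemma le_dist_pow (n : ℕ) : n * (l - 4 * δ) ≤ dist x ((α ^ n) x) := by
  have h1 := hyp.dist_ge_of_local (x := fun n => (α ^ n) x) (n := n) (D := δ) (L := l)
      hδ.le hδ.le (by linarith [h.large]) (fun i _ => ?_) (fun i _ => ?_) n le_rfl
  · simp only [pow_zero] at h1
    have h2 : (n : ℝ) * (l - 2 * δ - 2 * δ) ≤ dist x ((α ^ n) x) := h1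
    linarith
  · rw [pow_succ, IsometryEquiv.mul_apply, (α ^ i).dist_eq, h.dist_eq]
  · rw [pow_succ, pow_succ, mul_assoc, IsometryEquiv.mul_apply, IsometryEquiv.mul_apply,
        IsometryEquiv.mul_apply, gromovProd_map]
    exact h.prod_le

lemma le_dist_pow_apply (n : ℕ) (z : X) : n * (l - 4 * δ) ≤ dist z ((α ^ n) z) := by
  have h1 : ∀ m : ℕ, dist z ((α ^ (n * m)) z) ≤ m * dist z ((α ^ n) z) := by
    intro m
    induction m with
    | zero => simp
    | succ m ih =>
      have e : dist ((α ^ (n * m)) z) ((α ^ (n * (m + 1))) z) = dist z ((α ^ n) z) := by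
        rw [mul_add, mul_one, pow_add, IsometryEquiv.mul_apply, (α ^ (n * m)).dist_eq]
      push_cast
      linarith [dist_triangle z ((α ^ (n * m)) z) ((α ^ (n * (m + 1))) z)]
  by_contra! hcon
  obtain ⟨m, hm⟩ := exists_nat_gt (2 * dist x z / (n * (l - 4 * δ) - dist z ((α ^ n) z)))
  rw [div_lt_iff₀ (by linarith)] at hm
  have h2 := h.le_dist_pow hδ hyp (n * m)
  have h3 : dist ((α ^ (n * m)) x) ((α ^ (n * m)) z) = dist x z := (α ^ (n * m)).dist_eq _ _
  push_cast at h2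
  have h4 := dist_triangle4 x z ((α ^ (n * m)) z) ((α ^ (n * m)) x)
  nlinarith [h1 m, dist_comm ((α ^ (n * m)) x) ((α ^ (n * m)) z)]

lemma le_dist_zpow_apply {k : ℤ} (hk : k ≠ 0) {N : ℕ} (z : X) :
    N * (l / 2) ≤ dist z (((α ^ N) ^ k) z) := by
  have key : ∀ (β : X ≃ᵢ X), IsAxial δ β x l → ∀ n : ℕ, N ≤ n →
      N * (l / 2) ≤ dist z ((β ^ n) z) := by
    intro β hβ n hn
    have h1 := hβ.le_dist_pow_apply hδ hyp n z
    have h2 : (N : ℝ) ≤ n := by exact_mod_cast hn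
    have h3 : l / 2 ≤ l - 4 * δ := by linarith [h.large]
    have h4 : 0 ≤ l := by linarith [h.large]
    calc (N : ℝ) * (l / 2) ≤ n * (l - 4 * δ) := by gcongr
      _ ≤ _ := h1
  obtain ⟨n, rfl | rfl⟩ := k.eq_nat_or_neg
  · rw [zpow_natCast, ← pow_mul]
    exact key α h _ (Nat.le_mul_of_pos_right _ (by omega))
  · rw [zpow_neg, zpow_natCast, ← pow_mul, ← inv_pow]
    exact key α⁻¹ h.inv _ (Nat.le_mul_of_pos_right _ (by omega))

lemma gromovProd_zpow_le_of_near {o : X} (ho : ∀ i : ℤ, dist o x ≤ dist o ((α ^ i) x) + δ)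
    (k : ℤ) : gromovProd o ((α ^ k) x) x ≤ 2 * l := by
  have key : ∀ (β : X ≃ᵢ X), IsAxial δ β x l → (∀ i : ℕ, dist o x ≤ dist o ((β ^ i) x) + δ) →
      ∀ k : ℕ, gromovProd o ((β ^ k) x) x ≤ 2 * l := by
    intro β hβ ho k
    set p := gromovProd o ((β ^ k) x) x with hp
    have hp0 : 0 ≤ p := gromovProd_nonneg _ _ _
    obtain ⟨j, hj, hpj, hjp⟩ : ∃ j ≤ k, dist x ((β ^ j) x) ≤ p ∧ p ≤ dist x ((β ^ j) x) + l := by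
      by_contra! hcon
      have h1 : ∀ j ≤ k, dist x ((β ^ j) x) ≤ p := by
        intro j
        induction j with
        | zero => intro _; simpa using hp0
        | succ j ih =>
          intro hj
          have h2 := hcon j (by omega) (ih (by omega))
          have h3 : dist ((β ^ j) x) ((β ^ (j + 1)) x) = l := by
            rw [pow_succ, IsometryEquiv.mul_apply, (β ^ j).dist_eq, hβ.dist_eq]
          linarith [dist_triangle x ((β ^ j) x) ((β ^ (j + 1)) x)]
      have h2 := hcon k le_rfl (h1 k le_rfl)
      have h3 := gromovProd_le_left ((β ^ k) x) o x
      rw [gromovProd_comm, dist_comm] at h3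
      linarith [h.large]
    have h1 := hβ.gromovProd_pow_le hδ hyp (Nat.zero_le j) hj
    rw [pow_zero, show (1 : X ≃ᵢ X) x = x from rfl] at h1
    have h2 := ho j
    simp only [gromovProd] at h1 hp
    rcases hyp.four o ((β ^ j) x) x ((β ^ k) x) with h3 | h3 <;>
      linarith [h.large, dist_comm ((β ^ j) x) ((β ^ k) x), dist_comm ((β ^ j) x) x,
        dist_comm ((β ^ k) x) x]
  obtain ⟨n, rfl | rfl⟩ := k.eq_nat_or_neg
  · rw [zpow_natCast]
    exact key α h (fun i => by simpa using ho i) n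
  · rw [zpow_neg, zpow_natCast, ← inv_pow]
    exact key α⁻¹ h.inv (fun i => by simpa using ho (-i)) n

end IsAxial

end Orbits

section Overlap
open Metric Filter

universe u

variable {X : Type u} [MetricSpace X] {σ : X → X → ℝ → X} {δ l : ℝ} {α β : X ≃ᵢ X} {x y : X}

lemma IsGCB.exists_point_on (hσ : IsGCB σ) {u v : X} {r : ℝ} (h0 : 0 ≤ r) (h1 : r ≤ dist u v) :
    ∃ t ∈ Set.Icc (0 : ℝ) 1, t * dist u v = r ∧ dist u (σ u v t) = r ∧
      dist u (σ u v t) + dist (σ u v t) v = dist u v := by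
  rcases eq_or_lt_of_le (dist_nonneg (x := u) (y := v)) with h | h
  · have hr : r = 0 := by linarith
    have huv : u = v := dist_eq_zero.1 h.symm
    refine ⟨0, by simp, ?_, ?_, ?_⟩ <;> simp [hσ.source, hr]
  · have ht : r / dist u v ∈ Set.Icc (0 : ℝ) 1 := ⟨by positivity, by rwa [div_le_one h]⟩
    have e1 := hσ.geodesic u v 0 (by simp) _ ht
    have e2 := hσ.geodesic u v _ ht 1 (by simp)
    rw [hσ.source, zero_sub, abs_neg, abs_of_nonneg ht.1, div_mul_cancel₀ _ h.ne'] at e1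
    rw [hσ.target, abs_of_nonpos (by linarith [ht.2])] at e2
    refine ⟨_, ht, div_mul_cancel₀ _ h.ne', e1, ?_⟩
    rw [e1, e2, neg_sub, sub_mul, one_mul, div_mul_cancel₀ _ h.ne']
    ring

namespace IsAxial

variable (hδ : 0 < δ) (hyp : IsDeltaHyperbolic X δ) (hβ : IsAxial δ β y l)
include hδ hyp hβ

/-- A point close to an orbit segment lies near a consecutive pair of orbit points. -/
lemma exists_gromovProd_le {Y : X} {m : ℕ} (hY : gromovProd y ((β ^ m) y) Y ≤ 5 * δ)
    (hm : 10 * δ < dist Y ((β ^ m) y)) :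
    ∃ j, j + 1 ≤ m ∧ gromovProd ((β ^ j) y) ((β ^ (j + 1)) y) Y ≤ 12 * δ := by
  classical
  have hex : ∃ j, dist y Y < dist y ((β ^ j) y) := ⟨m, by
    simp only [gromovProd] at hY
    linarith [dist_comm Y ((β ^ m) y)]⟩
  have hmin : ∀ j < Nat.find hex, dist y ((β ^ j) y) ≤ dist y Y := fun j hj =>
    not_lt.1 (Nat.find_min hex hj)
  have hle : Nat.find hex ≤ m := Nat.find_min' hex (by
    simp only [gromovProd] at hY
    linarith [dist_comm Y ((β ^ m) y)])
  have hlt := Nat.find_spec hex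
  obtain ⟨j, hj⟩ : ∃ j, Nat.find hex = j + 1 := Nat.exists_eq_succ_of_ne_zero fun h0 => by
    rw [h0, pow_zero, show (1 : X ≃ᵢ X) y = y from rfl, dist_self] at hlt
    exact absurd hlt (not_lt.2 dist_nonneg)
  rw [hj] at hmin hle hlt
  refine ⟨j, hle, ?_⟩
  have hjY := hmin j (Nat.lt_succ_self j)
  have h1 := hβ.gromovProd_pow_le hδ hyp (Nat.zero_le j) (show j ≤ m by omega)
  have h2 := hβ.gromovProd_pow_le hδ hyp (Nat.zero_le (j + 1)) hle
  rw [pow_zero, show (1 : X ≃ᵢ X) y = y from rfl] at h1 h2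
  have h5 := dist_triangle y ((β ^ j) y) ((β ^ (j + 1)) y)
  have h3 : dist Y ((β ^ j) y) ≤ dist y Y - dist y ((β ^ j) y) + 12 * δ := by
    simp only [gromovProd] at hY h1
    rcases hyp.four Y ((β ^ j) y) y ((β ^ m) y) with h | h <;>
      linarith [dist_comm Y y, dist_comm Y ((β ^ m) y), dist_comm ((β ^ j) y) y,
        dist_comm ((β ^ j) y) ((β ^ m) y)]
  have h4 : dist Y ((β ^ (j + 1)) y) ≤ dist y ((β ^ (j + 1)) y) - dist y Y + 12 * δ := by
    simp only [gromovProd] at hY h2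
    rcases hyp.four Y ((β ^ (j + 1)) y) y ((β ^ m) y) with h | h <;>
      linarith [dist_comm Y y, dist_comm Y ((β ^ m) y), dist_comm ((β ^ (j + 1)) y) y,
        dist_comm ((β ^ (j + 1)) y) ((β ^ m) y)]
  simp only [gromovProd]
  linarith [dist_comm Y ((β ^ (j + 1)) y), dist_comm Y ((β ^ j) y)]

/-- Along an orbit segment, `β ^ i` almost translates by the translation length. -/
lemma dist_pow_apply_le (hσ : IsGCB σ) (hβσ : IsSigmaIsometry σ (β : X ≃ᵢ X)) {Y : X} {m i : ℕ}
    (hY : gromovProd y ((β ^ m) y) Y ≤ 5 * δ) (hm : (i + 2) * l ≤ dist Y ((β ^ m) y)) :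
    dist Y ((β ^ i) Y) ≤ dist y ((β ^ i) y) + 28 * δ ∧
      dist ((β ^ i) Y) ((β ^ m) y) ≤ dist Y ((β ^ m) y) - dist y ((β ^ i) y) + 40 * δ := by
  have hl := hβ.large
  have hi0 : (0 : ℝ) ≤ i := Nat.cast_nonneg i
  obtain ⟨j, hjm, hj⟩ := hβ.exists_gromovProd_le hδ hyp hY (by nlinarith)
  set u := (β ^ j) y with hu
  set v := (β ^ (j + 1)) y with hv
  have huv : dist u v = l := by
    rw [hu, hv, pow_succ, IsometryEquiv.mul_apply, (β ^ j).dist_eq, hβ.dist_eq]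
  have hr : gromovProd Y v u ≤ dist u v := by
    have := gromovProd_le_left v Y u
    rwa [gromovProd_comm, dist_comm] at this
  obtain ⟨t, ht, htr, hup, hupv⟩ := hσ.exists_point_on (gromovProd_nonneg Y v u) hr
  set p := σ u v t with hp
  have hYp : dist Y p ≤ 14 * δ := by
    linarith [hyp.dist_le_of_gromovProd hupv hup]
  have hcomm : ∀ n, (β ^ i) ((β ^ n) y) = (β ^ (n + i)) y := fun n => by
    rw [← IsometryEquiv.mul_apply, ← pow_add, add_comm]
  have hsig : ∀ k : ℕ, (β ^ k) p = σ ((β ^ k) u) ((β ^ k) v) t := by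
    intro k
    induction k with
    | zero => rfl
    | succ k ih =>
      rw [pow_succ', IsometryEquiv.mul_apply, ih, hβσ _ _ _ ht]
      rfl
  have hpi : dist p ((β ^ i) p) ≤ dist y ((β ^ i) y) := by
    have e : ∀ n, dist ((β ^ n) y) ((β ^ i) ((β ^ n) y)) = dist y ((β ^ i) y) := fun n => by
      rw [hcomm, pow_add, IsometryEquiv.mul_apply, (β ^ n).dist_eq]
    have := hσ.dist_le u v ((β ^ i) u) ((β ^ i) v) ht
    rw [← hsig, hu, hv, e, e] at this
    linarith
  have hvm : dist v ((β ^ m) y) ≤ (m - (j + 1) : ℕ) * l := by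
    have := hβ.dist_pow_le (m - (j + 1))
    rwa [← (β ^ (j + 1)).dist_eq, ← IsometryEquiv.mul_apply, ← pow_add,
      Nat.add_sub_cancel' hjm] at this
  have hjim : j + 1 + i ≤ m := by
    have h1 : dist Y ((β ^ m) y) ≤ 14 * δ + l + (m - (j + 1) : ℕ) * l := by
      linarith [dist_triangle4 Y p v ((β ^ m) y), dist_nonneg (x := u) (y := p)]
    have h2 : (i : ℝ) < ((m - (j + 1) : ℕ) : ℝ) + 1 := by
      by_contra! hcon
      nlinarith
    have h3 : i < m - (j + 1) + 1 := by exact_mod_cast h2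
    omega
  have hdrop : ∀ n, n + i ≤ m → dist ((β ^ i) ((β ^ n) y)) ((β ^ m) y) ≤
      dist ((β ^ n) y) ((β ^ m) y) - dist y ((β ^ i) y) + 6 * δ := by
    intro n hn
    have h1 := hβ.gromovProd_pow_le hδ hyp (Nat.le_add_right n i) hn
    have h2 : dist ((β ^ n) y) ((β ^ (n + i)) y) = dist y ((β ^ i) y) := by
      rw [pow_add, IsometryEquiv.mul_apply, (β ^ n).dist_eq]
    rw [hcomm]
    simp only [gromovProd] at h1
    linarith [dist_comm ((β ^ m) y) ((β ^ (n + i)) y)]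
  have hdu := hdrop j (by omega)
  have hdv := hdrop (j + 1) hjim
  have hline := hβ.gromovProd_pow_le hδ hyp (Nat.le_succ j) hjm
  have hconst : σ ((β ^ m) y) ((β ^ m) y) t = (β ^ m) y := by
    have := hσ.geodesic ((β ^ m) y) ((β ^ m) y) t ht 0 (by simp)
    rw [hσ.source, dist_self, mul_zero] at this
    exact dist_eq_zero.1 this
  have hpm : dist ((β ^ i) p) ((β ^ m) y) ≤ dist p ((β ^ m) y) - dist y ((β ^ i) y) + 12 * δ := by
    have h1 := hσ.dist_le ((β ^ i) u) ((β ^ i) v) ((β ^ m) y) ((β ^ m) y) ht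
    rw [hconst, ← hsig] at h1
    have h2 : dist v ((β ^ m) y) ≤ dist u ((β ^ m) y) - dist u v + 6 * δ := by
      simp only [gromovProd] at hline
      linarith [dist_comm ((β ^ m) y) v]
    have h3 := dist_triangle u p ((β ^ m) y)
    have h4 : (1 - t) * dist ((β ^ i) u) ((β ^ m) y) ≤
        (1 - t) * (dist u ((β ^ m) y) - dist y ((β ^ i) y) + 6 * δ) :=
      mul_le_mul_of_nonneg_left hdu (by linarith [ht.2])
    have h5 : t * dist ((β ^ i) v) ((β ^ m) y) ≤
        t * (dist u ((β ^ m) y) - dist u v + 6 * δ - dist y ((β ^ i) y) + 6 * δ) :=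
      mul_le_mul_of_nonneg_left (hdv.trans (by linarith)) ht.1
    have h6 : t * δ ≤ δ := mul_le_of_le_one_left hδ.le ht.2
    rw [hup] at h3
    linarith
  have hiso : dist ((β ^ i) Y) ((β ^ i) p) = dist Y p := (β ^ i).dist_eq _ _
  constructor
  · linarith [dist_triangle4 Y p ((β ^ i) p) ((β ^ i) Y), dist_comm ((β ^ i) Y) ((β ^ i) p)]
  · linarith [dist_triangle ((β ^ i) Y) ((β ^ i) p) ((β ^ m) y),
      dist_triangle_left p ((β ^ m) y) Y]

/-- Two quasi-axes with the same translation lengths which fellow travel for a long time are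
translated in the same way along the common part. -/
lemma dist_le_of_overlap (hσ : IsGCB σ) (hβσ : IsSigmaIsometry σ (β : X ≃ᵢ X))
    (hα : IsAxial δ α x l) (hαβ : ∀ i : ℕ, dist x ((α ^ i) x) = dist y ((β ^ i) y))
    (hxy : dist x y ≤ 14 * l) {p n m : ℕ}
    (hp : (p + 30) * l ≤ gromovProd ((α ^ n) x) ((β ^ m) y) x) {k i : ℕ} (hk : 15 ≤ k)
    (hk' : k ≤ 16) (hi : i ≤ p) :
    dist ((α ^ (k + i)) x) ((β ^ i) ((α ^ k) x)) ≤ 110 * δ := by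
  have hl := hα.large
  have hl0 : 0 < l := by linarith
  have hkl : (15 : ℝ) ≤ k := by exact_mod_cast hk
  have hku : (k : ℝ) ≤ 16 := by exact_mod_cast hk'
  have hip : (i : ℝ) ≤ p := by exact_mod_cast hi
  have hil : i * l ≤ p * l := by gcongr
  have hpl : 0 ≤ p * l := by positivity
  have hkl' : k * l ≤ 16 * l := by gcongr
  have hnp : p + 30 ≤ n := by
    have h1 := (gromovProd_le_left ((α ^ n) x) ((β ^ m) y) x)
    rw [dist_comm] at h1
    have h2 := hp.trans (h1.trans (hα.dist_pow_le n))
    have h3 := le_of_mul_le_mul_right h2 hl0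
    exact_mod_cast h3
  set Y := (α ^ k) x with hYdef
  have hxY : dist x Y ≤ k * l := hα.dist_pow_le k
  have hxY' : 15 * (l - 4 * δ) ≤ dist x Y :=
    (mul_le_mul_of_nonneg_right hkl (by linarith)).trans (hα.le_dist_pow hδ hyp k)
  have hnm : (p + 14) * l ≤ gromovProd ((α ^ n) x) ((β ^ m) y) Y := by
    linarith [gromovProd_sub_dist_le ((α ^ n) x) ((β ^ m) y) x Y]
  have hxn := hα.gromovProd_pow_le hδ hyp (Nat.zero_le k) (show k ≤ n by omega)
  rw [pow_zero, show (1 : X ≃ᵢ X) x = x from rfl] at hxn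
  have hxm : gromovProd x ((β ^ m) y) Y ≤ 4 * δ := by
    rcases hyp.gromovProd_le x ((β ^ m) y) ((α ^ n) x) Y with h | h
    · linarith
    · rw [gromovProd_comm] at h
      linarith
  have hym : gromovProd y ((β ^ m) y) Y ≤ 5 * δ := by
    have h1 : 6 * δ < gromovProd y x Y := by
      simp only [gromovProd]
      linarith [dist_triangle x y Y, dist_comm x y]
    have h2 := hyp.gromovProd_le ((β ^ m) y) y x Y
    rw [gromovProd_comm _ y, gromovProd_comm _ x] at h2
    rcases h2 with h | h <;> linarith
  have hYm : (p + 14) * l ≤ dist Y ((β ^ m) y) := by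
    have h1 := gromovProd_le_left ((β ^ m) y) ((α ^ n) x) Y
    rw [gromovProd_comm, dist_comm] at h1
    exact hnm.trans h1
  obtain ⟨h1, h2⟩ := hβ.dist_pow_apply_le hδ hyp hσ hβσ (i := i) hym (by linarith)
  have hYi : dist Y ((α ^ (k + i)) x) = dist y ((β ^ i) y) := by
    rw [hYdef, pow_add, IsometryEquiv.mul_apply, (α ^ k).dist_eq, hαβ]
  have hli : dist y ((β ^ i) y) ≤ i * l := hβ.dist_pow_le i
  have h3 : dist y ((β ^ i) y) - 3 * δ ≤ gromovProd ((α ^ (k + i)) x) ((α ^ n) x) Y := by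
    have h4 := hα.gromovProd_pow_le hδ hyp (Nat.le_add_right k i) (show k + i ≤ n by omega)
    have h5 := gromovProd_add Y ((α ^ n) x) ((α ^ (k + i)) x)
    rw [← hYdef] at h4
    simp only [gromovProd] at h4 ⊢
    linarith [dist_comm Y ((α ^ n) x), dist_comm Y ((α ^ (k + i)) x),
      dist_comm ((α ^ n) x) ((α ^ (k + i)) x)]
  have h4 : dist y ((β ^ i) y) - 4 * δ ≤ gromovProd ((α ^ (k + i)) x) ((β ^ m) y) Y := by
    rcases hyp.gromovProd_le ((α ^ (k + i)) x) ((α ^ n) x) ((β ^ m) y) Y with h | h <;>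
      linarith
  have h5 : dist y ((β ^ i) y) - 40 * δ ≤ gromovProd ((β ^ m) y) ((β ^ i) Y) Y := by
    simp only [gromovProd]
    linarith [dist_triangle Y ((β ^ i) Y) ((β ^ m) y), dist_comm Y ((β ^ m) y),
      dist_comm ((β ^ i) Y) ((β ^ m) y), dist_comm Y ((β ^ i) Y)]
  have h6 : dist y ((β ^ i) y) - 41 * δ ≤ gromovProd ((α ^ (k + i)) x) ((β ^ i) Y) Y := by
    rcases hyp.gromovProd_le ((α ^ (k + i)) x) ((β ^ m) y) ((β ^ i) Y) Y with h | h <;>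
      linarith
  simp only [gromovProd] at h6
  linarith [dist_comm Y ((α ^ (k + i)) x), dist_comm Y ((β ^ i) Y)]

end IsAxial

end Overlap

section FreePairs
open Metric Filter

universe u

variable {X : Type u} [MetricSpace X] {σ : X → X → ℝ → X} {δ : ℝ} {Γ : Subgroup (X ≃ᵢ X)}

lemma mem_genMargulisDomain {g : X ≃ᵢ X} {R : ℝ} {y : X} :
    y ∈ genMargulisDomain g R ↔ ∃ k : ℤ, k ≠ 0 ∧ dist y ((g ^ k) y) ≤ R := by
  simp [genMargulisDomain, margulisDomain]

lemma zpow_mem_genMargulisDomain {g : X ≃ᵢ X} {R : ℝ} {y : X} (hy : y ∈ genMargulisDomain g R)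
    (j : ℤ) : (g ^ j) y ∈ genMargulisDomain g R := by
  obtain ⟨k, hk, h⟩ := mem_genMargulisDomain.1 hy
  refine mem_genMargulisDomain.2 ⟨k, hk, ?_⟩
  rwa [← IsometryEquiv.mul_apply, ← zpow_add, add_comm, zpow_add, IsometryEquiv.mul_apply,
    (g ^ j).dist_eq]

lemma apply_mem_genMargulisDomain {g h : X ≃ᵢ X} {R : ℝ} {y : X}
    (hy : y ∈ genMargulisDomain g R) : h y ∈ genMargulisDomain (h * g * h⁻¹) R := by
  obtain ⟨k, hk, hd⟩ := mem_genMargulisDomain.1 hy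
  refine mem_genMargulisDomain.2 ⟨k, hk, ?_⟩
  rwa [conj_zpow, ← IsometryEquiv.mul_apply, inv_mul_cancel_right, IsometryEquiv.mul_apply,
    h.dist_eq]

/-- A midpoint of two points. -/
lemma IsGCB.exists_midpoint (hσ : IsGCB σ) (y z : X) :
    ∃ o, dist o y = dist y z / 2 ∧ dist o z = dist y z / 2 := by
  have h1 := hσ.geodesic y z (1 / 2) (by norm_num) 0 (by norm_num)
  have h2 := hσ.geodesic y z (1 / 2) (by norm_num) 1 (by norm_num)
  rw [hσ.source] at h1
  rw [hσ.target] at h2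
  norm_num at h1 h2
  exact ⟨_, h1.trans (by ring), h2.trans (by ring)⟩

/-- At most `n₀` elements of `Γ` move a given point by at most `R`, unless these elements have a
common fixed point at infinity. -/
def IsMargulisBound (σ : X → X → ℝ → X) (Γ : Subgroup (X ≃ᵢ X)) (R : ℝ) (n₀ : ℕ) : Prop :=
  ∀ (x : X) (A : Finset (X ≃ᵢ X)), n₀ < A.card → (∀ g ∈ A, g ∈ Γ ∧ dist x (g x) ≤ R) →
    ∃ c, IsSigmaLine σ c ∧ ∀ g ∈ Γ, dist x (g x) ≤ R → g ∈ rayStab Γ c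

/-- Two elements of `Γ` without common fixed point at infinity. -/
structure IsIndependent (σ : X → X → ℝ → X) (Γ : Subgroup (X ≃ᵢ X)) (a b : X ≃ᵢ X) : Prop where
  left_mem : a ∈ Γ
  right_mem : b ∈ Γ
  notMem : ∀ c, IsSigmaLine σ c → a ∈ rayStab Γ c → b ∉ rayStab Γ c

variable [ProperSpace X] (H : IsHypAction σ δ Γ) {a b : X ≃ᵢ X} (hab : IsIndependent σ Γ a b)
include H hab

namespace IsIndependent

lemma left_ne_one (o : X) : a ≠ 1 := by
  rintro rfl
  obtain ⟨c, hc, -, hbc⟩ := H.exists_mem_rayStab hab.right_mem o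
  exact hab.notMem c hc (one_mem _) hbc

lemma conj_notMem (o : X) {c : ℝ → X} (hc : IsSigmaLine σ c) (h : a ∈ rayStab Γ c) :
    b * a * b⁻¹ ∉ rayStab Γ c := fun h' =>
  hab.notMem c hc h (H.mem_rayStab_of_conj hc hab.right_mem
    (fun h1 => hab.left_ne_one H o (conj_eq_one_iff.1 h1)) h' ((mem_rayStab_map hab.right_mem).2 h))

lemma zpow_ne_conj (o : X) {k l d : ℤ} (hk : k ≠ 0) (hd : d ≠ 0) :
    a ^ k ≠ b ^ d * a ^ l * (b ^ d)⁻¹ := by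
  intro h
  obtain ⟨c, hc, -, hac⟩ := H.exists_mem_rayStab hab.left_mem o
  have hbd := Γ.zpow_mem hab.right_mem d
  have h1 := (mem_rayStab_map hbd).2 (zpow_mem hac l)
  rw [← h] at h1
  exact hab.notMem c hc hac (H.mem_rayStab_of_zpow hc hab.right_mem hd
    (H.mem_rayStab_of_conj hc hbd (H.pow_ne_one hab.left_mem (hab.left_ne_one H o) hk)
      (zpow_mem hac k) h1))

end IsIndependent

omit hab

namespace IsHypAction

lemma isStar_genMargulisDomain {g : X ≃ᵢ X} {ξ : ℝ → X} (hξ : IsSigmaLine σ ξ)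
    (hg : g ∈ rayStab Γ ξ) (R : ℝ) : IsStar σ (genMargulisDomain g R) ξ := by
  intro y hy
  obtain ⟨k, hk, hd⟩ := mem_genMargulisDomain.1 hy
  obtain ⟨c, hc, hc0, hcξ⟩ := hξ.exists_ray_from H.gcb y
  have hgc : g ^ k ∈ rayStab Γ c := by
    rw [rayStab_congr hcξ]
    exact zpow_mem hg k
  obtain ⟨hgΓ, C, hC⟩ := hgc
  refine ⟨c, hc, hc0, hcξ, fun t ht => mem_genMargulisDomain.2 ⟨k, hk, ?_⟩⟩
  have := hc.antitone_dist H.gcb (hc.map (H.isSigma _ hgΓ)) hC ht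
  simp only [hc0] at this
  exact this.trans hd

/-- Elements with distant Margulis domains play ping-pong. -/
lemma free_of_far {g h : X ≃ᵢ X} (hg : g ∈ Γ) (hh : h ∈ Γ)
    (hgM : (genMargulisDomain g (100 * δ)).Nonempty)
    (hhM : (genMargulisDomain h (100 * δ)).Nonempty)
    (hfar : ∀ y ∈ genMargulisDomain g (100 * δ), ∀ z ∈ genMargulisDomain h (100 * δ),
      100 * δ < dist y z) {m n : ℕ} (hm : m ≠ 0) (hn : n ≠ 0) :
    Function.Injective (FreeGroup.lift fun i : Bool => if i then g ^ m else h ^ n) := by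
  have hδ := H.pos
  obtain ⟨y₀, hy₀⟩ := hgM
  obtain ⟨z₀, hz₀⟩ := hhM
  have : Nonempty (genMargulisDomain g (100 * δ) × genMargulisDomain h (100 * δ)) :=
    ⟨⟨⟨y₀, hy₀⟩, ⟨z₀, hz₀⟩⟩⟩
  obtain ⟨⟨⟨y, hy⟩, ⟨z, hz⟩⟩, hmin⟩ := exists_forall_le_add
    (fun p : genMargulisDomain g (100 * δ) × genMargulisDomain h (100 * δ) =>
      dist (p.1 : X) (p.2 : X)) (fun _ => dist_nonneg) hδ
  have hyz := hfar y hy z hz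
  obtain ⟨o, hoy, hoz⟩ := H.gcb.exists_midpoint y z
  have hminy : ∀ w ∈ genMargulisDomain g (100 * δ), dist o y ≤ dist o w + δ := fun w hw => by
    have h1 : dist y z ≤ dist w z + δ := hmin (⟨w, hw⟩, ⟨z, hz⟩)
    linarith [dist_triangle_left w z o]
  have hminz : ∀ w ∈ genMargulisDomain h (100 * δ), dist o z ≤ dist o w + δ := fun w hw => by
    have h1 : dist y z ≤ dist y w + δ := hmin (⟨y, hy⟩, ⟨w, hw⟩)
    linarith [dist_triangle_left y w o]
  obtain ⟨ξ, hξ, -, hgξ⟩ := H.exists_mem_rayStab hg o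
  obtain ⟨η, hη, -, hhη⟩ := H.exists_mem_rayStab hh o
  have key : ∀ (g : X ≃ᵢ X) (y : X) (m : ℕ), m ≠ 0 →
      (∀ w ∈ genMargulisDomain g (100 * δ), dist o y ≤ dist o w + δ) → 50 * δ < dist o y →
      ∀ k : ℤ, k ≠ 0 → 100 * δ ≤ dist o (((g ^ m) ^ k) o) := by
    intro g y m hm hmin hoy k hk
    by_contra! hcon
    have h1 := hmin o (mem_genMargulisDomain.2 ⟨m * k, by positivity, by
      rw [zpow_mul, zpow_natCast]; exact hcon.le⟩)
    rw [dist_self] at h1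
    linarith
  refine H.hyp.free_of_midpoint hδ (o := o) (y := y) (z := z) (q := 8 * δ) (R := 100 * δ)
    ?_ (fun k hk => ?_) (fun k hk => ?_) (key g y m hm hminy (by linarith))
    (key h z n hn hminz (by linarith)) ?_ ?_ ?_
  · rw [dist_comm y o]
    linarith
  · rw [← zpow_natCast, ← zpow_mul]
    exact H.hyp.gromovProd_le_of_isStar (H.isStar_genMargulisDomain hξ hgξ _) hy hminy
      (zpow_mem_genMargulisDomain hy _)
  · rw [← zpow_natCast, ← zpow_mul]
    exact H.hyp.gromovProd_le_of_isStar (H.isStar_genMargulisDomain hη hhη _) hz hminz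
      (zpow_mem_genMargulisDomain hz _)
  all_goals linarith

end IsHypAction

namespace IsIndependent

include hab

/-- Among boundedly many conjugates of `a` by powers of `b`, some has its Margulis domain far
from that of `a`. -/
lemma exists_far {n₀ : ℕ} (hn₀ : IsMargulisBound σ Γ (560 * δ) n₀)
    (hM : (genMargulisDomain a (100 * δ)).Nonempty) :
    ∃ p ≤ n₀ + 1, ∀ y ∈ genMargulisDomain a (100 * δ),
      ∀ z ∈ genMargulisDomain (b ^ p * a * (b ^ p)⁻¹) (100 * δ), 100 * δ < dist y z := by
  by_contra! hcon
  have hδ := H.pos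
  obtain ⟨o, ho⟩ := hM
  set f : ℕ → X ≃ᵢ X := fun i => b ^ i * a * (b ^ i)⁻¹ with hf
  have hfΓ : ∀ i, f i ∈ Γ := fun i => Γ.mul_mem (Γ.mul_mem (Γ.pow_mem hab.right_mem i)
    hab.left_mem) (Γ.inv_mem (Γ.pow_mem hab.right_mem i))
  have hfadd : ∀ i j, f (i + j) = b ^ i * f j * (b ^ i)⁻¹ := fun i j => by
    simp only [hf, pow_add, mul_inv_rev, mul_assoc]
  have hclose : ∀ i j, i ≤ j → j ≤ n₀ + 1 → ∃ y ∈ genMargulisDomain (f i) (100 * δ),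
      ∃ z ∈ genMargulisDomain (f j) (100 * δ), dist y z ≤ 100 * δ := by
    intro i j hij hj
    obtain ⟨p, rfl⟩ := Nat.exists_eq_add_of_le hij
    obtain ⟨y, hy, z, hz, hyz⟩ := hcon p (by omega)
    refine ⟨(b ^ i) y, apply_mem_genMargulisDomain hy, (b ^ i) z, ?_, ?_⟩
    · rw [hfadd]
      exact apply_mem_genMargulisDomain hz
    · rwa [(b ^ i).dist_eq]
  choose ξ hξ _ hfξ using fun i => H.exists_mem_rayStab (hfΓ i) o
  have : Nonempty X := ⟨o⟩
  obtain ⟨x, hx⟩ := H.hyp.exists_forall_dist_le_of_isStar hδ (m := n₀ + 1) (L := 100 * δ)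
    (fun i _ => H.isStar_genMargulisDomain (hξ i) (hfξ i) (100 * δ)) (fun i hi j hj => by
      rcases le_total i j with hij | hij
      · exact hclose i j hij hj
      · obtain ⟨y, hy, z, hz, hyz⟩ := hclose j i hij hi
        exact ⟨z, hz, y, hy, by rwa [dist_comm]⟩)
  have hx' : ∀ i, ∃ k : ℤ, i ≤ n₀ + 1 → k ≠ 0 ∧ dist x ((f i ^ k) x) ≤ 560 * δ := by
    intro i
    by_cases hi : i ≤ n₀ + 1
    · obtain ⟨w, hw, hxw⟩ := hx i hi
      obtain ⟨k, hk, hd⟩ := mem_genMargulisDomain.1 hw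
      refine ⟨k, fun _ => ⟨hk, ?_⟩⟩
      have h1 : dist ((f i ^ k) w) ((f i ^ k) x) = dist w x := (f i ^ k).dist_eq _ _
      linarith [dist_triangle4 x w ((f i ^ k) w) ((f i ^ k) x), dist_comm x w]
    · exact ⟨0, fun h => absurd h hi⟩
  choose k hk using hx'
  have hne : ∀ i j, i < j → j ≤ n₀ + 1 → f i ^ k i ≠ f j ^ k j := by
    intro i j hij hj h
    obtain ⟨d, rfl⟩ := Nat.exists_eq_add_of_lt hij
    refine hab.zpow_ne_conj H o (k := k i) (l := k (i + d + 1)) (d := (d + 1 : ℕ))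
      (hk i (by omega)).1 (by positivity) ?_
    rw [show i + d + 1 = i + (d + 1) by ring, hfadd] at h
    simp only [hf, conj_zpow] at h
    have h2 := mul_left_cancel (mul_right_cancel h)
    rw [h2, zpow_natCast]
    rfl
  have hinj : Set.InjOn (fun i => f i ^ k i) (Finset.range (n₀ + 2)) := by
    intro i hi j hj hij
    simp only [Finset.coe_range, Set.mem_Iio] at hi hj
    rcases lt_trichotomy i j with h | h | h
    · exact absurd hij (hne i j h (by omega))
    · exact h
    · exact absurd hij.symm (hne j i h (by omega))
  classical
  obtain ⟨c, hc, hall⟩ := hn₀ x ((Finset.range (n₀ + 2)).image fun i => f i ^ k i)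
    (by rw [Finset.card_image_of_injOn hinj, Finset.card_range]; omega) (by
      intro g hg
      obtain ⟨i, hi, rfl⟩ := Finset.mem_image.1 hg
      rw [Finset.mem_range] at hi
      exact ⟨Γ.zpow_mem (hfΓ i) _, (hk i (by omega)).2⟩)
  have hmem : ∀ i ≤ n₀ + 1, f i ∈ rayStab Γ c := fun i hi =>
    H.mem_rayStab_of_zpow hc (hfΓ i) (hk i hi).1
      (hall _ (Γ.zpow_mem (hfΓ i) _) (hk i hi).2)
  refine hab.conj_notMem H o hc ?_ ?_
  · simpa [hf] using hmem 0 (by omega)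
  · simpa [hf] using hmem 1 (by omega)

lemma exists_free_of_nonempty {n₀ : ℕ} (hn₀ : IsMargulisBound σ Γ (560 * δ) n₀)
    (hM : (genMargulisDomain a (100 * δ)).Nonempty) :
    ∃ p ≤ n₀ + 1, ∀ N : ℕ, N ≠ 0 → Function.Injective
      (FreeGroup.lift fun i : Bool => if i then a ^ N else b ^ p * a * (b ^ p)⁻¹) := by
  obtain ⟨p, hp, hfar⟩ := hab.exists_far H hn₀ hM
  refine ⟨p, hp, fun N hN => ?_⟩
  have hbp := Γ.pow_mem hab.right_mem p
  obtain ⟨y, hy⟩ := hM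
  have := H.free_of_far hab.left_mem (Γ.mul_mem (Γ.mul_mem hbp hab.left_mem) (Γ.inv_mem hbp))
    ⟨y, hy⟩ ⟨_, apply_mem_genMargulisDomain hy⟩ hfar hN one_ne_zero
  rwa [pow_one] at this

end IsIndependent

end FreePairs

section AxialPairs
open Metric Filter

universe u

variable {X : Type u} [MetricSpace X] {σ : X → X → ℝ → X} {δ l : ℝ} {Γ : Subgroup (X ≃ᵢ X)}
  {α β : X ≃ᵢ X} {x y : X}

/-- Distant axes give free subgroups. -/
lemma IsAxial.free_of_far (hσ : IsGCB σ) (hδ : 0 < δ) (hyp : IsDeltaHyperbolic X δ)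
    (hα : IsAxial δ α x l) (hβ : IsAxial δ β y l)
    (hx : ∀ i : ℤ, dist x y ≤ dist ((α ^ i) x) y + δ)
    (hy : ∀ i : ℤ, dist x y ≤ dist x ((β ^ i) y) + δ) (hxy : 14 * l < dist x y) {m n : ℕ}
    (hm : 14 ≤ m) (hn : 14 ≤ n) :
    Function.Injective (FreeGroup.lift fun i : Bool => if i then α ^ m else β ^ n) := by
  have hl := hα.large
  obtain ⟨o, hox, hoy⟩ := hσ.exists_midpoint x y
  have hx' : ∀ i : ℤ, dist o x ≤ dist o ((α ^ i) x) + δ := fun i => by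
    linarith [hx i, dist_triangle_left ((α ^ i) x) y o]
  have hy' : ∀ i : ℤ, dist o y ≤ dist o ((β ^ i) y) + δ := fun i => by
    linarith [hy i, dist_triangle_left x ((β ^ i) y) o]
  have key : ∀ k : ℕ, 14 ≤ k → 7 * l ≤ k * (l / 2) := fun k hk => by
    have : (14 : ℝ) ≤ k := by exact_mod_cast hk
    nlinarith
  refine hyp.free_of_midpoint hδ (o := o) (y := x) (z := y) (q := 2 * l) (R := 7 * l)
    ?_ (fun k _ => ?_) (fun k _ => ?_) (fun k hk => ?_) (fun k hk => ?_) ?_ ?_ ?_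
  · rw [dist_comm x o]
    linarith
  · rw [← zpow_natCast, ← zpow_mul]
    exact hα.gromovProd_zpow_le_of_near hδ hyp hx' _
  · rw [← zpow_natCast, ← zpow_mul]
    exact hβ.gromovProd_zpow_le_of_near hδ hyp hy' _
  · exact (key m hm).trans (hα.le_dist_zpow_apply hδ hyp hk o)
  · exact (key n hn).trans (hβ.le_dist_zpow_apply hδ hyp hk o)
  all_goals linarith

/-- Axes with a bounded overlap give free subgroups. -/
lemma IsAxial.free_of_gromovProd_le (hδ : 0 < δ) (hyp : IsDeltaHyperbolic X δ)
    (hα : IsAxial δ α x l) (hβ : IsAxial δ β y l) (hxy : dist x y ≤ 14 * l) {K : ℕ}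
    (hK : ∀ i j : ℤ, gromovProd ((α ^ i) x) ((β ^ j) y) x ≤ K * l) {m n : ℕ}
    (hm : 4 * K + 60 ≤ m) (hn : 4 * K + 60 ≤ n) :
    Function.Injective (FreeGroup.lift fun i : Bool => if i then α ^ m else β ^ n) := by
  have hl := hα.large
  have key : ∀ k : ℕ, 4 * K + 60 ≤ k → 2 * ((K + 14) * l) + 4 * δ ≤ k * (l / 2) := fun k hk => by
    have : (4 * K + 60 : ℝ) ≤ k := by exact_mod_cast hk
    nlinarith
  refine hyp.free_of_gromovProd_le hδ (o := x) (D := (K + 14) * l) (fun k hk => ?_)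
    (fun k hk => ?_) fun i j _ _ => ?_
  · exact (key m hm).trans (hα.le_dist_zpow_apply hδ hyp hk x)
  · exact (key n hn).trans (hβ.le_dist_zpow_apply hδ hyp hk x)
  · rw [← zpow_natCast, ← zpow_natCast, ← zpow_mul, ← zpow_mul]
    have h1 := hK (m * i) (n * j)
    have h2 : dist ((β ^ (n * j : ℤ)) x) ((β ^ (n * j : ℤ)) y) = dist x y :=
      (β ^ (n * j : ℤ)).dist_eq _ _
    simp only [gromovProd] at h1 ⊢
    linarith [dist_triangle ((β ^ (n * j : ℤ)) x) ((β ^ (n * j : ℤ)) y) x,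
      dist_triangle ((α ^ (m * i : ℤ)) x) ((β ^ (n * j : ℤ)) x) ((β ^ (n * j : ℤ)) y)]

/-- A point moved almost least lies on a quasi-axis. -/
lemma IsGCB.isAxial_of_min (hσ : IsGCB σ) {a : X ≃ᵢ X} (ha : IsSigmaIsometry σ a) {o : X}
    (ho : ∀ y, dist o (a o) ≤ dist y (a y) + δ) (hl : 100 * δ ≤ dist o (a o)) :
    IsAxial δ a o (dist o (a o)) := by
  refine ⟨rfl, ?_, hl⟩
  have ht : (1 / 2 : ℝ) ∈ Set.Icc (0 : ℝ) 1 := by norm_num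
  have h1 := ho (σ o (a o) (1 / 2))
  have h2 := hσ.dist_le o (a o) (a (a o)) (a o) ht
  rw [ha _ _ _ ht, hσ.reversible (a o) _ _ ht, show (1 : ℝ) - 1 / 2 = 1 / 2 by norm_num] at h1
  rw [dist_self] at h2
  simp only [gromovProd]
  rw [dist_comm (a (a o)) (a o), a.dist_eq]
  linarith

namespace IsIndependent

variable [ProperSpace X] (H : IsHypAction σ δ Γ) {a b : X ≃ᵢ X} (hab : IsIndependent σ Γ a b)
include H hab

/-- The quasi-axes of `a` and of its conjugate by `b` have a bounded overlap. -/
lemma gromovProd_lt_of_isAxial {n₀ : ℕ} (hn₀ : IsMargulisBound σ Γ (110 * δ) n₀) {e e' : ℤ}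
    (he : e ≠ 0) (he' : e' ≠ 0) (hα : IsAxial δ (a ^ e) x l)
    (hβ : IsAxial δ (b * a ^ e' * b⁻¹) y l)
    (hαβ : ∀ i : ℕ, dist x (((a ^ e) ^ i) x) = dist y (((b * a ^ e' * b⁻¹) ^ i) y))
    (hxy : dist x y ≤ 14 * l) (m n : ℕ) :
    gromovProd (((a ^ e) ^ n) x) (((b * a ^ e' * b⁻¹) ^ m) y) x ≤ (n₀ + 31 : ℕ) * l := by
  by_contra! hcon
  set α := a ^ e with hαdef
  set β := b * a ^ e' * b⁻¹ with hβdef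
  have hαΓ : α ∈ Γ := Γ.zpow_mem hab.left_mem e
  have hβΓ : β ∈ Γ := Γ.mul_mem (Γ.mul_mem hab.right_mem (Γ.zpow_mem hab.left_mem e'))
    (Γ.inv_mem hab.right_mem)
  have hne : ∀ d : ℕ, d ≠ 0 → α ^ d ≠ β ^ d := by
    intro d hd h
    refine hab.zpow_ne_conj H x (k := e * d) (l := e' * d) (d := 1)
      (mul_ne_zero he (by exact_mod_cast hd)) one_ne_zero ?_
    rw [zpow_mul, zpow_natCast, zpow_mul, zpow_natCast, zpow_one, ← conj_pow]
    exact h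
  set u : ℕ → X ≃ᵢ X := fun i => (α ^ i)⁻¹ * β ^ i with hu
  have huΓ : ∀ i, u i ∈ Γ := fun i =>
    Γ.mul_mem (Γ.inv_mem (Γ.pow_mem hαΓ i)) (Γ.pow_mem hβΓ i)
  have hmove : ∀ k i, 15 ≤ k → k ≤ 16 → i ≤ n₀ + 1 →
      dist ((α ^ k) x) (u i ((α ^ k) x)) ≤ 110 * δ := by
    intro k i hk hk' hi
    have h1 := hβ.dist_le_of_overlap H.pos H.hyp H.gcb (H.isSigma _ hβΓ) hα hαβ hxy
      (p := n₀ + 1) (n := n) (m := m) (k := k) (i := i) (by push_cast at hcon ⊢; linarith)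
      hk hk' hi
    rw [← (α ^ i).dist_eq, ← IsometryEquiv.mul_apply, ← pow_add, add_comm]
    simpa [hu] using h1
  have hinj : Function.Injective u := by
    have key : ∀ i j, i < j → u i ≠ u j := by
      intro i j hij h
      obtain ⟨d, rfl⟩ := Nat.exists_eq_add_of_lt hij
      refine hne (d + 1) (by omega) ?_
      simp only [hu] at h
      rw [add_assoc, add_comm i, pow_add α, pow_add β, mul_inv_rev, mul_assoc,
        mul_left_cancel_iff, ← mul_assoc] at h
      rw [eq_comm, mul_eq_right, inv_mul_eq_one] at h
      exact h
    intro i j hij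
    rcases lt_trichotomy i j with h | h | h
    · exact absurd hij (key i j h)
    · exact h
    · exact absurd hij.symm (key j i h)
  classical
  obtain ⟨c, hc, hall⟩ := hn₀ ((α ^ 16) x) ((Finset.range (n₀ + 2)).image u)
    (by rw [Finset.card_image_of_injective _ hinj, Finset.card_range]; omega) (by
      intro g hg
      obtain ⟨i, hi, rfl⟩ := Finset.mem_image.1 hg
      rw [Finset.mem_range] at hi
      exact ⟨huΓ i, hmove 16 i (by norm_num) le_rfl (by omega)⟩)
  have h1 : u 1 ∈ rayStab Γ c := hall _ (huΓ 1) (hmove 16 1 (by norm_num) le_rfl (by omega))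
  have h2 : α * u 1 * α⁻¹ ∈ rayStab Γ c := by
    refine hall _ (Γ.mul_mem (Γ.mul_mem hαΓ (huΓ 1)) (Γ.inv_mem hαΓ)) ?_
    have h3 := hmove 15 1 le_rfl (by norm_num) (by omega)
    have e1 : (α ^ 16) x = α ((α ^ 15) x) := rfl
    rw [e1, IsometryEquiv.mul_apply, IsometryEquiv.mul_apply, IsometryEquiv.inv_apply_self,
      α.dist_eq]
    exact h3
  have h3 : α * u 1 * α⁻¹ ≠ 1 := by
    rw [Ne, conj_eq_one_iff]
    intro h
    refine hne 1 one_ne_zero ?_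
    simpa [hu, inv_mul_eq_one] using h
  have hαc : α ∈ rayStab Γ c :=
    H.mem_rayStab_of_conj hc hαΓ h3 h2 ((mem_rayStab_map hαΓ).2 h1)
  have hβc : β ∈ rayStab Γ c := by
    have : β = α * u 1 := by simp [hu]
    rw [this]
    exact mul_mem hαc h1
  refine hab.conj_notMem H x hc (H.mem_rayStab_of_zpow hc hab.left_mem he hαc) ?_
  rw [hβdef, ← conj_zpow] at hβc
  exact H.mem_rayStab_of_zpow hc (Γ.mul_mem (Γ.mul_mem hab.right_mem hab.left_mem)
    (Γ.inv_mem hab.right_mem)) he' hβc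

lemma free_of_eq_empty [Nonempty X] {n₀ : ℕ} (hn₀ : IsMargulisBound σ Γ (110 * δ) n₀)
    (hM : genMargulisDomain a (100 * δ) = ∅) {m n : ℕ} (hm : 4 * n₀ + 184 ≤ m)
    (hn : 4 * n₀ + 184 ≤ n) : Function.Injective
      (FreeGroup.lift fun i : Bool => if i then a ^ m else b * a ^ n * b⁻¹) := by
  have hδ := H.pos
  obtain ⟨o, ho⟩ := exists_forall_le_add (fun y => dist y (a y)) (fun _ => dist_nonneg) hδ
  have hlarge : 100 * δ ≤ dist o (a o) := by
    by_contra! hcon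
    have : o ∈ genMargulisDomain a (100 * δ) :=
      mem_genMargulisDomain.2 ⟨1, one_ne_zero, by rw [zpow_one]; exact hcon.le⟩
    rw [hM] at this
    exact this
  have hax := H.gcb.isAxial_of_min (H.isSigma a hab.left_mem) ho hlarge
  set l := dist o (a o)
  obtain ⟨⟨i, j⟩, hij⟩ := exists_forall_le_add
    (fun p : ℤ × ℤ => dist ((a ^ p.1) o) (b ((a ^ p.2) o))) (fun _ => dist_nonneg) hδ
  set x := (a ^ i) o with hx
  set y := b ((a ^ j) o) with hy
  set a' := b * a * b⁻¹ with ha'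
  have hα : IsAxial δ a x l := hax.zpow_apply i
  have hβ : IsAxial δ a' y l := (hax.zpow_apply j).conj b
  have ha'y : ∀ k : ℤ, (a' ^ k) y = b ((a ^ (k + j)) o) := fun k => by
    rw [ha', conj_zpow, hy, ← IsometryEquiv.mul_apply, inv_mul_cancel_right,
      IsometryEquiv.mul_apply, ← IsometryEquiv.mul_apply (a ^ k), ← zpow_add]
  have hnearx : ∀ k : ℤ, dist x y ≤ dist ((a ^ k) x) y + δ := fun k => by
    have := hij (k + i, j)
    rwa [zpow_add] at this
  have hneary : ∀ k : ℤ, dist x y ≤ dist x ((a' ^ k) y) + δ := fun k => by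
    rw [ha'y]
    exact hij (i, k + j)
  rw [← conj_pow, ← ha']
  rcases lt_or_ge (14 * l) (dist x y) with hxy | hxy
  · exact hα.free_of_far H.gcb hδ H.hyp hβ hnearx hneary hxy (by omega) (by omega)
  · refine hα.free_of_gromovProd_le hδ H.hyp hβ hxy (K := n₀ + 31) (fun k k' => ?_)
      (by omega) (by omega)
    have hdx : ∀ r : ℤ, dist x ((a ^ r) x) = dist o ((a ^ r) o) := fun r => by
      rw [hx, ← IsometryEquiv.mul_apply, ← zpow_add, add_comm, zpow_add,
        IsometryEquiv.mul_apply, (a ^ i).dist_eq]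
    have hdy : ∀ r : ℤ, dist y ((a' ^ r) y) = dist o ((a ^ r) o) := fun r => by
      rw [ha'y, hy, b.dist_eq, add_comm, zpow_add, IsometryEquiv.mul_apply, (a ^ j).dist_eq]
    have hneg : ∀ r : ℤ, dist o ((a ^ (-r)) o) = dist o ((a ^ r) o) := fun r => by
      rw [zpow_neg, dist_inv_apply]
    have main : ∀ e e' : ℤ, (e = 1 ∨ e = -1) → (e' = 1 ∨ e' = -1) → ∀ k k' : ℕ,
        gromovProd ((a ^ (e * k)) x) ((a' ^ (e' * k')) y) x ≤ (n₀ + 31 : ℕ) * l := by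
      intro e e' he he' k k'
      have hαe : IsAxial δ (a ^ e) x l := by
        rcases he with rfl | rfl
        · simpa using hα
        · simpa using hα.inv
      have hβe : IsAxial δ (b * a ^ e' * b⁻¹) y l := by
        rw [← conj_zpow, ← ha']
        rcases he' with rfl | rfl
        · simpa using hβ
        · simpa using hβ.inv
      have h1 := hab.gromovProd_lt_of_isAxial H hn₀ (by omega) (by omega) hαe hβe
        (fun r => ?_) hxy k' k
      · rwa [← conj_zpow, ← ha', ← zpow_natCast, ← zpow_natCast, ← zpow_mul, ← zpow_mul] at h1
      · rw [← conj_zpow, ← ha', ← zpow_natCast, ← zpow_natCast, ← zpow_mul, ← zpow_mul, hdx,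
          hdy]
        rcases he with rfl | rfl <;> rcases he' with rfl | rfl <;> simp only [one_mul, neg_one_mul,
          hneg]
    obtain ⟨r, hr⟩ := k.eq_nat_or_neg
    obtain ⟨s, hs⟩ := k'.eq_nat_or_neg
    rcases hr with rfl | rfl <;> rcases hs with rfl | rfl
    · simpa using main 1 1 (by simp) (by simp) r s
    · simpa using main 1 (-1) (by simp) (by simp) r s
    · simpa using main (-1) 1 (by simp) (by simp) r s
    · simpa using main (-1) (-1) (by simp) (by simp) r s

end IsIndependent

end AxialPairs

section Words
open Metric Filter

lemma exists_list_conj_prod {G : Type*} [Group G] (a b : G) (p q : ℕ) :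
    ∃ L : List G, L.length = 2 * p + q ∧ (∀ u ∈ L, u ∈ ({a, a⁻¹, b, b⁻¹} : Set G)) ∧
      b ^ p * a ^ q * (b ^ p)⁻¹ = L.prod := by
  refine ⟨List.replicate p b ++ List.replicate q a ++ List.replicate p b⁻¹, ?_, ?_, ?_⟩
  · simp only [List.length_append, List.length_replicate]
    ring
  · intro u hu
    simp only [List.mem_append, List.mem_replicate] at hu
    rcases hu with (⟨-, rfl⟩ | ⟨-, rfl⟩) | ⟨-, rfl⟩ <;> simp
  · simp [mul_assoc]

universe u

variable {X : Type u} [MetricSpace X] {σ : X → X → ℝ → X}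

lemma isSigmaIsometry_of_mem_closure {S : Set (X ≃ᵢ X)} (hS : ∀ g ∈ S, IsSigmaIsometry σ g)
    {g : X ≃ᵢ X} (hg : g ∈ Subgroup.closure S) : IsSigmaIsometry σ g := by
  induction hg using Subgroup.closure_induction with
  | mem g hg => exact hS g hg
  | one => exact fun _ _ _ _ => rfl
  | mul g h _ _ ihg ihh =>
    intro x y t ht
    rw [IsometryEquiv.mul_apply, ihh x y t ht, ihg _ _ t ht]
    rfl
  | inv g _ ih =>
    intro x y t ht
    apply g.injective
    rw [ih _ _ t ht]
    simp only [IsometryEquiv.apply_inv_self]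

end Words

/-- **Theorem 1.1(ii)** (quantitative free subgroup theorem with specification). -/
theorem free_subgroup_with_specification
    (P₀ r₀ δ : ℝ) (hP₀ : 0 < P₀) (hr₀ : 0 < r₀) (hδ : 0 < δ) :
    ∃ N : ℕ, 0 < N ∧
      ∀ (X : Type*) [MetricSpace X] [CompleteSpace X] (σ : X → X → ℝ → X),
        IsGCB σ → IsDeltaHyperbolic X δ → IsPacked X P₀ r₀ →
        ∀ a b : X ≃ᵢ X, IsSigmaIsometry σ a → IsSigmaIsometry σ b →
          IsDiscreteSubgroup (Subgroup.closure ({a, b} : Set (X ≃ᵢ X))) →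
          IsNonElementary (Subgroup.closure ({a, b} : Set (X ≃ᵢ X))) →
          (∀ g ∈ Subgroup.closure ({a, b} : Set (X ≃ᵢ X)), g ≠ 1 → ¬ IsOfFinOrder g) →
          ∃ w : X ≃ᵢ X,
            (∃ L : List (X ≃ᵢ X), L.length ≤ N ∧
              (∀ u ∈ L, u ∈ ({a, a⁻¹, b, b⁻¹} : Set (X ≃ᵢ X))) ∧ w = L.prod) ∧
            Function.Injective
              ⇑(FreeGroup.lift fun i : Bool => if i then a ^ N else w) := by
  obtain ⟨n₁, hn₁⟩ := exists_margulis P₀ r₀ δ hr₀ hδ (560 * δ) (by positivity)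
  obtain ⟨n₂, hn₂⟩ := exists_margulis P₀ r₀ δ hr₀ hδ (110 * δ) (by positivity)
  refine ⟨2 * n₁ + 4 * n₂ + 200, by omega, ?_⟩
  intro X _ _ σ hσ hyp hp a b ha hb hdisc hne htf
  set Γ := Subgroup.closure ({a, b} : Set (X ≃ᵢ X)) with hΓ
  have haΓ : a ∈ Γ := Subgroup.subset_closure (by simp)
  have hbΓ : b ∈ Γ := Subgroup.subset_closure (by simp)
  have : ProperSpace X := hσ.properSpace hr₀ hp
  have H : IsHypAction σ δ Γ := ⟨hσ, hyp, hδ, fun g hg =>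
    isSigmaIsometry_of_mem_closure (by rintro g (rfl | rfl) <;> assumption) hg, hdisc, htf⟩
  have hnvn : ¬ IsVirtuallyNilpotent Γ := fun h => by
    obtain ⟨g, h', hg, hh', hgh⟩ := hne
    refine hgh (h.mono ((Subgroup.closure_le _).2 ?_))
    rintro _ (rfl | rfl) <;> assumption
  have hX : Nonempty X := by
    by_contra hX
    rw [not_nonempty_iff] at hX
    have : Subsingleton (X ≃ᵢ X) := ⟨fun g h => IsometryEquiv.ext fun x => isEmptyElim x⟩
    exact hnvn (IsVirtuallyNilpotent.of_finite Γ)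
  have hfg : Group.FG Γ :=
    (Group.fg_iff_subgroup_fg Γ).2 ((Subgroup.fg_iff Γ).2 ⟨{a, b}, rfl, Set.toFinite _⟩)
  have hfix : ∀ c, IsSigmaLine σ c → ¬ Γ ≤ rayStab Γ c := fun c hc hle =>
    hnvn (H.isVirtuallyNilpotent hr₀ hp hc hle)
  have hab : IsIndependent σ Γ a b := ⟨haΓ, hbΓ, fun c hc h1 h2 => hfix c hc
    ((Subgroup.closure_le _).2 (by rintro _ (rfl | rfl) <;> assumption))⟩
  have hb₁ : IsMargulisBound σ Γ (560 * δ) n₁ := hn₁ X σ Γ H hp hfix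
  have hb₂ : IsMargulisBound σ Γ (110 * δ) n₂ := hn₂ X σ Γ H hp hfix
  have main : ∃ p q : ℕ, 2 * p + q ≤ 2 * n₁ + 4 * n₂ + 200 ∧ Function.Injective
      (FreeGroup.lift fun i : Bool => if i then a ^ (2 * n₁ + 4 * n₂ + 200) else
        b ^ p * a ^ q * (b ^ p)⁻¹) := by
    rcases (genMargulisDomain a (100 * δ)).eq_empty_or_nonempty with hM | hM
    · refine ⟨1, 4 * n₂ + 184, by omega, ?_⟩
      rw [pow_one b]
      exact hab.free_of_eq_empty H hb₂ hM (by omega) le_rfl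
    · obtain ⟨p, hpn, hinj⟩ := hab.exists_free_of_nonempty H hb₁ hM
      refine ⟨p, 1, by omega, ?_⟩
      rw [pow_one a]
      exact hinj _ (by omega)
  obtain ⟨p, q, hpq, hinj⟩ := main
  obtain ⟨L, hL, hmem, hprod⟩ := exists_list_conj_prod a b p q
  exact ⟨_, ⟨L, hL.trans_le hpq, hmem, hprod⟩, hinj⟩
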